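/- Let k ≥ 4 be an integer and let G be a 2-connected graph on n vertices with minimum degree at least k. Then for every even integer ℓ, G contains an (ℓ mod k)-cycle, unless G is isomorphic to the complete graph K_{k+1} or to the complete bipartite graph K_{k,n-k}. -/

import Mathlib

open SimpleGraph

/-- `G` has a cycle of length `n`. -/
def HasCycleLen {V : Type*} (G : SimpleGraph V) (n : ℕ) : Prop :=
  ∃ (v : V) (c : G.Walk v v), c.IsCycle ∧ c.length = n

/-- `G` has a cycle whose length is congruent to `l` modulo `k`. -/
def HasCycleLenMod {V : Type*} (G : SimpleGraph V) (k : ℕ) (l : ℤ) : Prop :=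
  ∃ n : ℕ, HasCycleLen G n ∧ (n : ℤ) ≡ l [ZMOD (k : ℤ)]

/-- `G` is `t`-connected: it has at least `t+1` vertices and the deletion of any set
of at most `t-1` vertices leaves a connected graph. -/
def KConnected {V : Type*} [Fintype V] (G : SimpleGraph V) (t : ℕ) : Prop :=
  t + 1 ≤ Fintype.card V ∧
    ∀ S : Finset V, S.card ≤ t - 1 → (G.induce ((↑S : Set V)ᶜ)).Connected

set_option linter.unusedSectionVars false

section Basic

variable {V : Type*} [DecidableEq V] {G : SimpleGraph V}

/-- `PathIn G U a b n`: there is a path from `a` to `b` of length `n` inside `U`. -/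
inductive PathIn (G : SimpleGraph V) : Finset V → V → V → ℕ → Prop
  | nil {U : Finset V} {a : V} (ha : a ∈ U) : PathIn G U a a 0
  | cons {U : Finset V} {a c b : V} {n : ℕ} (ha : a ∈ U) (hac : G.Adj a c)
      (h : PathIn G (U.erase a) c b n) : PathIn G U a b (n + 1)

namespace PathIn

theorem mono {U W : Finset V} {a b : V} {n : ℕ} (h : PathIn G U a b n) (hUW : U ⊆ W) :
    PathIn G W a b n := by
  induction h generalizing W with
  | nil ha => exact .nil (hUW ha)
  | cons ha hac _ ih => exact .cons (hUW ha) hac (ih (Finset.erase_subset_erase _ hUW))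

theorem left_mem {U : Finset V} {a b : V} {n : ℕ} (h : PathIn G U a b n) : a ∈ U := by
  cases h <;> assumption

theorem join {U W : Finset V} {a b c d : V} {n m : ℕ} (h : PathIn G U a b n)
    (h' : PathIn G W c d m) (hd : Disjoint U W) (hbc : G.Adj b c) :
    PathIn G (U ∪ W) a d (n + m + 1) := by
  induction h with
  | @nil U a ha =>
    rw [Nat.zero_add]
    refine .cons (by grind) hbc (h'.mono ?_)
    intro x hx
    have := Finset.disjoint_left.1 hd
    grind
  | @cons U a e b n ha hac _ ih =>
    have := ih (hd.mono_left (Finset.erase_subset _ _)) hbc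
    have e1 : n + 1 + m + 1 = (n + m + 1) + 1 := by ring
    rw [e1]
    refine .cons (by grind) hac (this.mono ?_)
    intro x hx
    have := Finset.disjoint_left.1 hd
    grind

theorem cons' {U W : Finset V} {a b c : V} {n : ℕ} (h : PathIn G U c b n) (ha : a ∉ U)
    (hac : G.Adj a c) (hW : insert a U ⊆ W) : PathIn G W a b (n + 1) :=
  .cons (hW (by grind)) hac (h.mono (by grind))

theorem snoc {U W : Finset V} {a b c : V} {n : ℕ} (h : PathIn G U a b n) (hc : c ∉ U)
    (hbc : G.Adj b c) (hW : insert c U ⊆ W) : PathIn G W a c (n + 1) := by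
  have := h.join (PathIn.nil (G := G) (Finset.mem_singleton_self c)) (by simpa using hc) hbc
  exact this.mono (by grind)

theorem symm {U : Finset V} {a b : V} {n : ℕ} (h : PathIn G U a b n) : PathIn G U b a n := by
  induction h with
  | nil ha => exact .nil ha
  | @cons U a c b n ha hac _ ih =>
    exact ih.snoc (by simp) hac.symm (by grind)

theorem exists_walk {U : Finset V} {a b : V} {n : ℕ} (h : PathIn G U a b n) :
    ∃ p : G.Walk a b, p.IsPath ∧ p.length = n ∧ ∀ v ∈ p.support, v ∈ U := by
  induction h with
  | @nil U a ha => exact ⟨.nil, by simp, rfl, by simpa using ha⟩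
  | @cons U a c b n ha hac _ ih =>
    obtain ⟨p, hp, hl, hs⟩ := ih
    refine ⟨.cons hac p, ?_, by simp [hl], ?_⟩
    · rw [Walk.cons_isPath_iff]
      exact ⟨hp, fun h => by simpa using hs _ h⟩
    · intro v hv
      rw [Walk.support_cons, List.mem_cons] at hv
      rcases hv with rfl | hv
      · exact ha
      · exact Finset.mem_of_mem_erase (hs v hv)

theorem hasCycleLen {U : Finset V} {a b : V} {n : ℕ} (h : PathIn G U a b n) (hab : G.Adj b a)
    (hn : 2 ≤ n) : HasCycleLen G (n + 1) := by
  obtain ⟨p, hp, hl, -⟩ := h.exists_walk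
  refine ⟨b, .cons hab p, ?_, by simp [hl]⟩
  rw [Walk.cons_isCycle_iff]
  refine ⟨hp, fun he => ?_⟩
  have := hp.length_eq_one_of_mem_edges (Sym2.eq_swap ▸ he)
  omega

theorem hasCycleLen' {U W : Finset V} {a b c d : V} {n m : ℕ} (h : PathIn G U a b n)
    (h' : PathIn G W c d m) (hd : Disjoint U W) (hbc : G.Adj b c) (hda : G.Adj d a)
    (hn : 1 ≤ n + m) : HasCycleLen G (n + m + 2) :=
  (h.join h' hd hbc).hasCycleLen hda (by omega)

end PathIn

/-- The number of neighbours of `v` in `U`. -/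
def dg (G : SimpleGraph V) [DecidableRel G.Adj] (U : Finset V) (v : V) : ℕ :=
  (U.filter (G.Adj v)).card

/-- `D` is a subset of `U` closed under adjacency in `U`. -/
def ClosedIn (G : SimpleGraph V) (U D : Finset V) : Prop :=
  D ⊆ U ∧ ∀ a ∈ D, ∀ b ∈ U, G.Adj a b → b ∈ D

/-- `U` induces a connected subgraph. -/
def ConnOn (G : SimpleGraph V) (U : Finset V) : Prop :=
  U.Nonempty ∧ ∀ D, ClosedIn G U D → D.Nonempty → D = U

/-- `L` contains an arithmetic progression of `k` terms with difference one or two. -/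
def AP (L : ℕ → Prop) (k : ℕ) : Prop :=
  ∃ p d, (d = 1 ∨ d = 2) ∧ ∀ i < k, L (p + d * i)

/-- The lengths of paths from `X` to `Y` inside `U`. -/
def Len (G : SimpleGraph V) (U X Y : Finset V) (n : ℕ) : Prop :=
  ∃ a ∈ X, ∃ b ∈ Y, PathIn G U a b n

theorem Len.symm {U X Y : Finset V} {n : ℕ} (h : Len G U X Y n) : Len G U Y X n := by
  obtain ⟨a, ha, b, hb, h⟩ := h
  exact ⟨b, hb, a, ha, h.symm⟩

theorem AP.imp {L L' : ℕ → Prop} {k s : ℕ} (h : AP L k) (hL : ∀ n, L n → L' (n + s)) :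
    AP L' k := by
  obtain ⟨p, d, hd, h⟩ := h
  refine ⟨p + s, d, hd, fun i hi => ?_⟩
  have := hL _ (h i hi)
  rwa [show p + s + d * i = p + d * i + s by ring]

theorem AP.mono {L : ℕ → Prop} {k k' : ℕ} (h : AP L k) (hk : k' ≤ k) : AP L k' := by
  obtain ⟨p, d, hd, h⟩ := h
  exact ⟨p, d, hd, fun i hi => h i (by omega)⟩

theorem AP.symm {U X Y : Finset V} {k : ℕ} (h : AP (Len G U X Y) k) : AP (Len G U Y X) k :=
  h.imp (s := 0) fun _ h => h.symm

theorem AP.add {L L' M : ℕ → Prop} {a b s : ℕ} (h : AP L a) (h' : AP L' b) (ha : 1 ≤ a)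
    (hb : 1 ≤ b) (hM : ∀ m n, L m → L' n → M (m + n + s)) : AP M (a + b - 1) := by
  obtain ⟨p, d, hd, h⟩ := h
  obtain ⟨q, e, he, h'⟩ := h'
  have key : ∃ f, (f = 1 ∨ f = 2) ∧
      ∀ i < a + b - 1, ∃ x < a, ∃ y < b, d * x + e * y = f * i := by
    rcases Nat.lt_or_ge a 2 with ha' | ha'
    · exact ⟨e, he, fun i hi => ⟨0, by omega, i, by omega, by simp⟩⟩
    rcases Nat.lt_or_ge b 2 with hb' | hb'
    · exact ⟨d, hd, fun i hi => ⟨i, by omega, 0, by omega, by simp⟩⟩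
    refine ⟨min d e, by omega, fun i hi => ?_⟩
    rcases hd with rfl | rfl <;> rcases he with rfl | rfl
    · refine ⟨min i (a - 1), by omega, i - min i (a - 1), by omega, by simp⟩
    · by_cases h : i < 2 * b
      · exact ⟨i % 2, by omega, i / 2, by omega, by simp; omega⟩
      · exact ⟨i - 2 * (b - 1), by omega, b - 1, by omega, by simp; omega⟩
    · by_cases h : i < 2 * a
      · exact ⟨i / 2, by omega, i % 2, by omega, by simp; omega⟩
      · exact ⟨a - 1, by omega, i - 2 * (a - 1), by omega, by simp; omega⟩
    · refine ⟨min i (a - 1), by omega, i - min i (a - 1), by omega, by simp; omega⟩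
  obtain ⟨f, hf, key⟩ := key
  refine ⟨p + q + s, f, hf, fun i hi => ?_⟩
  obtain ⟨x, hx, y, hy, hxy⟩ := key i hi
  have := hM _ _ (h x hx) (h' y hy)
  rwa [show p + q + s + f * i = p + d * x + (q + e * y) + s by rw [← hxy]; ring]

theorem PathIn.extend {U : Finset V} {a b c : V} {n : ℕ} (h : PathIn G U a b n) (hc : c ∈ U)
    (hbc : G.Adj b c) : ∃ m, PathIn G U a c m := by
  induction h with
  | @nil U a ha =>
    by_cases hac : c = a
    · subst hac; exact ⟨0, .nil ha⟩
    · exact ⟨1, .cons ha hbc (.nil (by grind))⟩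
  | @cons U a e b n ha hae _ ih =>
    by_cases hac : c = a
    · subst hac; exact ⟨0, .nil ha⟩
    · obtain ⟨m, hm⟩ := ih (by grind) hbc
      exact ⟨m + 1, .cons ha hae hm⟩

theorem PathIn.escape {U : Finset V} {a b : V} {n : ℕ} (h : PathIn G U a b n) (K : Finset V) :
    (∃ k ∈ K, k ∈ U ∧ ∃ m, PathIn G (insert k (U \ K)) k b m) ∨
      (a ∉ K ∧ PathIn G (U \ K) a b n) := by
  induction h with
  | @nil U a ha =>
    by_cases hK : a ∈ K
    · exact .inl ⟨a, hK, ha, 0, .nil (by grind)⟩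
    · exact .inr ⟨hK, .nil (by grind)⟩
  | @cons U a e b n ha hae _ ih =>
    rcases ih with ⟨k, hk, hkU, m, hm⟩ | ⟨he, hp⟩
    · exact .inl ⟨k, hk, by grind, m, hm.mono (by grind)⟩
    · by_cases hK : a ∈ K
      · exact .inl ⟨a, hK, ha, n + 1, hp.cons' (by grind) hae (by grind)⟩
      · exact .inr ⟨hK, hp.cons' (by grind) hae (by grind)⟩

theorem ClosedIn.sdiff {U D : Finset V} (h : ClosedIn G U D) : ClosedIn G U (U \ D) := by
  refine ⟨Finset.sdiff_subset, fun a ha b hb hab => ?_⟩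
  have := h.2 b
  have := hab.symm
  grind

open Classical in
/-- The connected component of `v` in `U`. -/
noncomputable def compOf (G : SimpleGraph V) (U : Finset V) (v : V) : Finset V :=
  U.filter fun w => ∀ D, ClosedIn G U D → v ∈ D → w ∈ D

theorem mem_compOf_self {U : Finset V} {v : V} (h : v ∈ U) : v ∈ compOf G U v := by
  simp [compOf, h]

theorem compOf_min {U D : Finset V} {v : V} (h : ClosedIn G U D) (hv : v ∈ D) :
    compOf G U v ⊆ D := by
  intro w hw
  simp only [compOf, Finset.mem_filter] at hw
  exact hw.2 D h hv

theorem closedIn_compOf (U : Finset V) (v : V) : ClosedIn G U (compOf G U v) := by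
  refine ⟨by simp [compOf], fun a ha b hb hab => ?_⟩
  simp only [compOf, Finset.mem_filter] at ha ⊢
  exact ⟨hb, fun D hD hv => hD.2 a (ha.2 D hD hv) b hb hab⟩

theorem ClosedIn.trans {U D E : Finset V} (h : ClosedIn G U D) (h' : ClosedIn G D E) :
    ClosedIn G U E :=
  ⟨h'.1.trans h.1, fun a ha b hb hab => h'.2 a ha b (h.2 a (h'.1 ha) b hb hab) hab⟩

theorem connOn_compOf {U : Finset V} {v : V} (hv : v ∈ U) : ConnOn G (compOf G U v) := by
  refine ⟨⟨v, mem_compOf_self hv⟩, fun D hD hne => ?_⟩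
  have hc := closedIn_compOf (G := G) U v
  by_cases hvD : v ∈ D
  · exact (Finset.Subset.antisymm hD.1 (compOf_min (hc.trans hD) hvD))
  · have := compOf_min (hc.trans hD.sdiff) (Finset.mem_sdiff.2 ⟨mem_compOf_self hv, hvD⟩)
    obtain ⟨d, hd⟩ := hne
    have := this (hD.1 hd)
    grind

theorem exists_comp {U : Finset V} {v : V} (hv : v ∈ U) :
    ∃ C, ClosedIn G U C ∧ ConnOn G C ∧ v ∈ C :=
  ⟨_, closedIn_compOf U v, connOn_compOf hv, mem_compOf_self hv⟩

theorem ConnOn.exists_path {U : Finset V} (h : ConnOn G U) {a b : V} (ha : a ∈ U) (hb : b ∈ U) :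
    ∃ n, PathIn G U a b n := by
  classical
  have := h.2 (U.filter fun v => ∃ n, PathIn G U a v n) ⟨Finset.filter_subset _ _, ?_⟩
    ⟨a, by simpa [ha] using ⟨0, .nil ha⟩⟩
  · rw [← this] at hb
    exact (Finset.mem_filter.1 hb).2
  · intro c hc d hd hcd
    obtain ⟨hc, n, hn⟩ := Finset.mem_filter.1 hc
    exact Finset.mem_filter.2 ⟨hd, hn.extend hd hcd⟩

theorem ConnOn.escape {U K Y : Finset V} (h : ConnOn G U) (hK : ∃ k ∈ K, k ∈ U)
    (hY : ∃ y ∈ Y, y ∈ U) :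
    ∃ k ∈ K, k ∈ U ∧ ∃ y ∈ Y, ∃ n, PathIn G (insert k (U \ K)) k y n := by
  obtain ⟨k, hk, hkU⟩ := hK
  obtain ⟨y, hy, hyU⟩ := hY
  obtain ⟨n, hn⟩ := h.exists_path hkU hyU
  rcases hn.escape K with ⟨k, hk, hkU, m, hm⟩ | ⟨h, -⟩
  · exact ⟨k, hk, hkU, y, hy, m, hm⟩
  · exact absurd hk h

/-- A nonempty proper part of a connected set has an edge leaving it. -/
theorem ConnOn.exists_adj {U D : Finset V} (h : ConnOn G U) (hD : D ⊆ U) (hne : D.Nonempty)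
    (hU : ∃ v ∈ U, v ∉ D) : ∃ a ∈ D, ∃ b ∈ U, b ∉ D ∧ G.Adj a b := by
  by_contra! hc
  have := h.2 D ⟨hD, fun a ha b hb hab => by_contra fun hbD => hc a ha b hb hbD hab⟩ hne
  grind

/-- Deleting a part that is closed apart from one vertex keeps connectivity. -/
theorem ConnOn.sdiff {U D : Finset V} {c : V} (h : ConnOn G U) (hc : c ∈ U)
    (hD : ClosedIn G (U.erase c) D) : ConnOn G (U \ D) := by
  have hcD : c ∉ D := fun h => by simpa using hD.1 h
  refine ⟨⟨c, by grind⟩, fun E hE hne => ?_⟩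
  by_cases hcE : c ∈ E
  · have := h.2 (E ∪ D) ⟨?_, ?_⟩ ⟨c, by grind⟩
    · have := hE.1
      grind
    · have := hE.1; have := hD.1; grind
    · intro a ha b hb hab
      have := hE.2 a; have := hD.2 a
      grind
  · have := h.2 E ⟨?_, ?_⟩ hne
    · grind
    · have := hE.1; grind
    · intro a ha b hb hab
      have h1 := hE.2 a ha b
      have h2 := hD.2 b
      have h3 := hE.1 ha
      have := hab.symm
      grind

end Basic

section Main

variable {V : Type*} [Fintype V] [DecidableEq V] {G : SimpleGraph V} [DecidableRel G.Adj] {k : ℕ}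

/-- `G` has no triangle. -/
def TriFree (G : SimpleGraph V) : Prop :=
  ∀ a b c, G.Adj a b → G.Adj b c → ¬G.Adj a c

/-- Splitting a cycle whose length satisfies `P` by an ear gives another such cycle. -/
def SplitClosed (P : ℕ → Prop) : Prop :=
  ∀ g a l, a ≤ g → P g → P (l + a) ∨ P (l + (g - a))

section Degrees

/-- The vertices with a neighbour in `A`. -/
def nbs (G : SimpleGraph V) [DecidableRel G.Adj] (A : Finset V) : Finset V :=
  Finset.univ.filter fun v => ∃ a ∈ A, G.Adj a v

@[simp] theorem mem_nbs {A : Finset V} {v : V} : v ∈ nbs G A ↔ ∃ a ∈ A, G.Adj a v := by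
  simp [nbs]

theorem mem_nbs_singleton {a v : V} : v ∈ nbs G {a} ↔ G.Adj a v := by simp

theorem dg_mono {U W : Finset V} (h : U ⊆ W) (v : V) : dg G U v ≤ dg G W v :=
  Finset.card_le_card (Finset.filter_subset_filter _ h)

theorem dg_union_le (U W : Finset V) (v : V) : dg G (U ∪ W) v ≤ dg G U v + dg G W v := by
  unfold dg
  rw [Finset.filter_union]
  exact Finset.card_union_le _ _

theorem dg_le_card (U : Finset V) (v : V) : dg G U v ≤ U.card := Finset.card_filter_le _ _

theorem dg_le_add_sdiff (U E : Finset V) (v : V) :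
    dg G U v ≤ dg G E v + dg G (U \ E) v :=
  (dg_mono (by grind) v).trans (dg_union_le _ _ v)

theorem dg_eq_zero {U : Finset V} {v : V} (h : ∀ a ∈ U, ¬G.Adj v a) : dg G U v = 0 := by
  simpa [dg, Finset.filter_eq_empty_iff] using h

theorem dg_pos {U : Finset V} {v : V} : 0 < dg G U v ↔ ∃ a ∈ U, G.Adj v a := by
  simp [dg, Finset.card_pos, Finset.Nonempty]

theorem dg_le_one {U : Finset V} {v : V}
    (h : ∀ a ∈ U, ∀ b ∈ U, G.Adj v a → G.Adj v b → a = b) : dg G U v ≤ 1 := by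
  rw [dg, Finset.card_le_one]
  simp only [Finset.mem_filter]
  exact fun a ha b hb => h a ha.1 b hb.1 ha.2 hb.2

theorem dg_le_ite {U : Finset V} {v : V}
    (h : ∀ a ∈ U, ∀ b ∈ U, G.Adj v a → G.Adj v b → a = b) :
    dg G U v ≤ if v ∈ nbs G U then 1 else 0 := by
  split_ifs with hv
  · exact dg_le_one h
  · exact (dg_eq_zero fun a ha hva => hv (mem_nbs.2 ⟨a, ha, hva.symm⟩)).le

/-- The degree of `v` in `U` when the two terminals are joined to `X` and `Y`. -/
def dgp (G : SimpleGraph V) [DecidableRel G.Adj] (U X Y : Finset V) (v : V) : ℕ :=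
  dg G U v + (if v ∈ X then 1 else 0) + (if v ∈ Y then 1 else 0)

theorem dgp_comm (U X Y : Finset V) (v : V) : dgp G U X Y v = dgp G U Y X v := by
  unfold dgp; ring

theorem dg_le_of_closedIn {U D : Finset V} {c v : V} (h : ClosedIn G (U.erase c) D)
    (hv : v ∈ D) : dg G U v ≤ dg G D v + if v ∈ nbs G {c} then 1 else 0 := by
  have key : ∀ a ∈ U \ D, G.Adj v a → a = c := by
    intro a ha hva
    have := h.2 v hv a
    grind
  have h1 := dg_le_add_sdiff (G := G) U D v
  have h2 : dg G (U \ D) v ≤ if v ∈ nbs G {c} then 1 else 0 := by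
    split_ifs with hv'
    · exact dg_le_one fun a ha b hb h1 h2 => by rw [key a ha h1, key b hb h2]
    · refine (dg_eq_zero fun a ha hva => hv' ?_).le
      rw [mem_nbs_singleton, ← key a ha hva]
      exact hva.symm
  omega

theorem dg_le_sdiff {U D : Finset V} {c v : V} (h : ClosedIn G (U.erase c) D)
    (hv : v ∈ U) (hvD : v ∉ D) (hvc : v ≠ c) : dg G U v ≤ dg G (U \ D) v := by
  refine Finset.card_le_card fun a ha => ?_
  have h1 := h.2 a
  have := G.adj_comm v a
  grind

/-- Every part of `U` cut off by a vertex and avoiding `Z` meets `W`. -/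
def Good (G : SimpleGraph V) (U W Z : Finset V) : Prop :=
  ∀ c ∈ U, ∀ D, ClosedIn G (U.erase c) D → D.Nonempty → (∀ z ∈ Z, z ∉ D) → ∃ v ∈ D, v ∈ W

theorem Good.sub {U W Z E W' : Finset V} (h : Good G U W Z) (hE : E ⊆ U)
    (hW : ∀ v ∈ E, v ∈ W → v ∈ W') (hb : ∀ v ∈ E, ∀ w ∈ U, w ∉ E → G.Adj v w → v ∈ W') :
    Good G E W' Z := by
  intro c hc D hD hne hZ
  by_contra! hcon
  have hcl : ClosedIn G (U.erase c) D := by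
    refine ⟨fun x hx => by have := hD.1 hx; grind, fun a ha b hb' hab => ?_⟩
    have h1 := hD.2 a ha b
    have h2 := hD.1 ha
    have h3 := hb a (by grind) b (by grind)
    have h4 := hcon a ha
    grind
  obtain ⟨v, hv, hvW⟩ := h c (hE hc) D hcl hne hZ
  exact hcon v hv (hW v (by have := hD.1 hv; grind) hvW)

theorem Good.mono {U W W' Z Z' : Finset V} (h : Good G U W Z) (hW : W ⊆ W') (hZ : Z ⊆ Z') :
    Good G U W' Z' := by
  intro c hc D hD hne hz
  obtain ⟨v, hv, hvW⟩ := h c hc D hD hne fun z hz' => hz z (hZ hz')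
  exact ⟨v, hv, hW hvW⟩

/-- A part closed apart from `c` in a connected set contains a neighbour of `c`. -/
theorem ConnOn.exists_nbr {U D : Finset V} {c : V} (h : ConnOn G U) (hc : c ∈ U)
    (hD : ClosedIn G (U.erase c) D) (hne : D.Nonempty) : ∃ v ∈ D, G.Adj c v := by
  obtain ⟨a, ha, b, hb, hbD, hab⟩ := h.exists_adj (D := D) (fun x hx => by
    have := hD.1 hx; grind) hne ⟨c, hc, fun h => by simpa using hD.1 h⟩
  have := hD.2 a ha b
  have : b = c := by grind
  exact ⟨a, ha, this ▸ hab.symm⟩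

/-- If `W` meets the connected set `D` only in `w`, then `D = {w}`, provided cut-off parts of `D`
always meet `W`. -/
theorem Good.eq_singleton {D W : Finset V} {w : V} (h : Good G D W ∅) (hw : w ∈ D)
    (hW : ∀ v ∈ D, v ∈ W → v = w) : D = {w} := by
  by_contra hne
  obtain ⟨v, hv, hvW⟩ := h w hw (D.erase w) ⟨subset_rfl, fun a ha b hb _ => hb⟩ (by
    rw [Finset.nonempty_iff_ne_empty]
    intro h
    apply hne
    ext x
    have : x ∉ D.erase w := by simp [h]
    grind) (by simp)
  have := hW v
  grind

end Degrees

section TwoPaths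

/-- The hypotheses of the two-path lemma. -/
structure TwoSys (G : SimpleGraph V) [DecidableRel G.Adj] (U X Y : Finset V) (z : V) : Prop where
  conn : ConnOn G U
  hX : ∃ x ∈ X, x ∈ U
  hY : ∃ y ∈ Y, y ∈ U
  good : Good G U (X ∪ Y) {z}
  deg : ∀ v ∈ U, v ≠ z → 3 ≤ dgp G U X Y v
  two : ∃ a ∈ U, ∃ b ∈ U, a ≠ b ∧ a ∈ X ∪ Y ∧ b ∈ X ∪ Y

theorem TwoSys.symm {U X Y : Finset V} {z : V} (h : TwoSys G U X Y z) : TwoSys G U Y X z :=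
  ⟨h.conn, h.hY, h.hX, Finset.union_comm X Y ▸ h.good,
    fun v hv hz => dgp_comm (G := G) U X Y v ▸ h.deg v hv hz, Finset.union_comm X Y ▸ h.two⟩

theorem Len.tail {U D X Y : Finset V} {c y : V} {n m : ℕ} (h : Len G D X (nbs G {c}) n)
    (h' : PathIn G (U \ D) c y m) (hD : D ⊆ U) (hy : y ∈ Y) : Len G U X Y (n + (m + 1)) := by
  obtain ⟨a, ha, b, hb, h⟩ := h
  rw [mem_nbs_singleton (G := G)] at hb
  exact ⟨a, ha, y, hy, (h.join h' Finset.disjoint_sdiff hb.symm).mono (by grind)⟩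

theorem ClosedIn.two {U D X Y : Finset V} {c z : V} (hc : c ∈ U) (hD : ClosedIn G (U.erase c) D)
    (hDc : ConnOn G D) (hU : ConnOn G U) (hgood : Good G U (X ∪ Y) ∅)
    (hY : ∀ y ∈ D, y ∉ Y) (hz : D ≠ {z}) (hdeg : ∀ v ∈ U, v ≠ z → 3 ≤ dgp G U X Y v) :
    TwoSys G D X (nbs G {c}) z := by
  have hDU : D ⊆ U := hD.1.trans (Finset.erase_subset _ _)
  obtain ⟨x, hx, hxX⟩ := hgood c hc D hD hDc.1 (by simp)
  have hxY := hY x hx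
  obtain ⟨y, hy, hyc⟩ := hU.exists_nbr hc hD hDc.1
  have hG : Good G D (X ∪ nbs G {c}) ∅ := by
    refine hgood.sub hDU (fun v hv hvW => ?_) fun v hv w hw hwD hvw => ?_
    · have := hY v hv; grind
    · have := hD.2 v hv w
      have : w = c := by grind
      subst this
      exact Finset.mem_union_right _ (mem_nbs_singleton.2 hvw.symm)
  have hdeg' : ∀ v ∈ D, v ≠ z → 3 ≤ dgp G D X (nbs G {c}) v := by
    intro v hv hvz
    have h1 := hdeg v (hDU hv) hvz
    have h2 := dg_le_of_closedIn hD hv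
    have h3 := hY v hv
    simp only [dgp, h3, if_false] at h1 ⊢
    omega
  refine ⟨hDc, ⟨x, by grind, hx⟩, ⟨y, mem_nbs_singleton.2 hyc, hy⟩,
    hG.mono subset_rfl (by simp), hdeg', ?_⟩
  by_contra! hcon
  have hDx := hG.eq_singleton hx (fun v hv hvW => by
    by_contra hne
    exact (hcon v hv x hx hne hvW) (by grind))
  have h1 := hdeg' x hx (by rintro rfl; exact hz hDx)
  have : dg G D x = 0 := dg_eq_zero (by simp [hDx])
  unfold dgp at h1
  split_ifs at h1 <;> omega

/-- All two-rooted systems on fewer vertices have two admissible lengths. -/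
def TwoIH (G : SimpleGraph V) [DecidableRel G.Adj] (n : ℕ) : Prop :=
  ∀ U X Y z, U.card < n → TwoSys G U X Y z → AP (Len G U X Y) 2

variable {U X Y : Finset V} {z : V}

theorem TwoSys.part (h : TwoSys G U X Y z) (hgood : Good G U (X ∪ Y) ∅) (ih : TwoIH G U.card)
    {c : V} {D : Finset V} (hc : c ∈ U) (hD : ClosedIn G (U.erase c) D)
    (hDc : ConnOn G D) (hY : ∀ y ∈ D, y ∉ Y) (hz : D ≠ {z}) : AP (Len G U X Y) 2 := by
  have hDU : D ⊆ U := hD.1.trans (Finset.erase_subset _ _)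
  have hs := hD.two hc hDc h.conn hgood hY hz h.deg
  obtain ⟨y, hy, hyU⟩ := h.hY
  have hcD : c ∉ D := fun h => by simpa using hD.1 h
  obtain ⟨m, hm⟩ := (h.conn.sdiff hc hD).exists_path (a := c) (b := y)
    (by grind) (by have := hY y; grind)
  refine (ih D _ _ _ (Finset.card_lt_card ⟨hDU, fun h => hcD (h hc)⟩) hs).imp fun n hn =>
    hn.tail hm hDU hy

theorem TwoSys.pendant (h : TwoSys G U X Y z) (hgood : Good G U (X ∪ Y) ∅) (ih : TwoIH G U.card)
    {c : V} (hc : c ∈ U) (hD : ClosedIn G (U.erase c) {z}) (hzY : z ∉ Y) :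
    AP (Len G U X Y) 2 := by
  have hz : z ∈ U.erase c := hD.1 (by simp)
  have hzU : z ∈ U := by grind
  have hzc : G.Adj c z := by
    obtain ⟨v, hv, hcv⟩ := h.conn.exists_nbr hc hD (by simp)
    simp at hv; exact hv ▸ hcv
  have honly : ∀ w ∈ U, G.Adj z w → w = c := by
    intro w hw hzw
    have := hD.2 z (by simp) w
    have := hzw.ne'
    grind
  have hUz : U \ {z} = U.erase z := by grind
  have hconn : ConnOn G (U.erase z) := hUz ▸ h.conn.sdiff hc hD
  have hzX : z ∈ X := by
    obtain ⟨v, hv, hvW⟩ := hgood c hc {z} hD (by simp) (by simp)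
    grind
  have hdg : ∀ v ∈ U.erase z, v ≠ c → dg G U v ≤ dg G (U.erase z) v := by
    intro v hv hvc
    rw [← hUz]
    exact dg_le_sdiff hD (by grind) (by grind) hvc
  have hlift : ∀ c' ∈ U.erase z, ∀ D', ClosedIn G ((U.erase z).erase c') D' → c ∉ D' →
      ClosedIn G (U.erase c') D' := by
    intro c' _ D' hD' hcD'
    refine ⟨fun x hx => by have := hD'.1 hx; grind, fun a ha b hb hab => ?_⟩
    have h1 := hD'.2 a ha b
    have h2 := honly a (by have := hD'.1 ha; grind)
    have := hab.symm
    grind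
  have hgd : ∀ W, (∀ v ∈ U.erase z, v ∈ X ∪ Y → v ∈ W) → Good G (U.erase z) W {c} := by
    intro W hW c' hc' D' hD' hne hcD'
    obtain ⟨v, hv, hvW⟩ := hgood c' (by grind) D' (hlift c' hc' D' hD' (by simpa using hcD')) hne
      (by simp)
    exact ⟨v, hv, hW v (by have := hD'.1 hv; grind) hvW⟩
  obtain ⟨y, hy, hyU⟩ := h.hY
  have hcard : (U.erase z).card < U.card := Finset.card_erase_lt_of_mem hzU
  -- if `c` is the only terminal apart from `z`, then `U = {z, c}`
  have hsmall : (∀ v ∈ U.erase z, v ∈ X ∪ Y → v = c) → U.erase z = {c} := by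
    intro hall
    by_contra hne
    have hcl : ClosedIn G ((U.erase z).erase c) ((U.erase z).erase c) :=
      ⟨subset_rfl, fun a _ b hb _ => hb⟩
    obtain ⟨v, hv, hvW⟩ := hgood c hc _ (hlift c (by grind) _ hcl (by simp)) (by
      by_contra hemp
      rw [Finset.not_nonempty_iff_eq_empty] at hemp
      apply hne
      ext x
      have : x ∉ (U.erase z).erase c := by simp [hemp]
      grind) (by simp)
    have := hall v
    grind
  by_cases hX : ∃ x ∈ X, x ∈ U ∧ x ≠ z
  · obtain ⟨x, hxX, hxU, hxz⟩ := hX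
    by_cases htwo : ∃ a ∈ U.erase z, ∃ b ∈ U.erase z, a ≠ b ∧ a ∈ X ∪ Y ∧ b ∈ X ∪ Y
    · have hs : TwoSys G (U.erase z) X Y c := by
        refine ⟨hconn, ⟨x, hxX, by grind⟩, ⟨y, hy, by grind⟩, hgd _ fun v _ hv => hv, ?_, htwo⟩
        intro v hv hvc
        have h1 := h.deg v (by grind) (by grind)
        have h2 := hdg v hv hvc
        unfold dgp at *
        omega
      refine (ih _ _ _ _ hcard hs).imp (s := 0) fun n ⟨a, ha, b, hb, hn⟩ => ?_
      exact ⟨a, ha, b, hb, hn.mono (Finset.erase_subset _ _)⟩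
    · push Not at htwo
      have hall : ∀ v ∈ U.erase z, v ∈ X ∪ Y → v = x := by
        intro v hv hvW
        by_contra hne
        exact htwo v hv x (by grind) hne hvW (by grind)
      have hxy : x = y := (hall y (by grind) (by grind)).symm
      subst hxy
      by_cases hxc : x = c
      · subst hxc
        have hUe := hsmall hall
        refine ⟨0, 1, by simp, fun i hi => ?_⟩
        interval_cases i
        · exact ⟨x, hxX, x, hy, .nil hxU⟩
        · exact ⟨z, hzX, x, hy, .cons hzU hzc.symm (.nil (by grind))⟩
      · refine h.part hgood ih hxU (closedIn_compOf (U.erase x) c)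
          (connOn_compOf (by grind)) (fun w hw hwY => ?_) fun heq => ?_
        · have h1 := (closedIn_compOf (G := G) (U.erase x) c).1 hw
          have := hall w
          have : w ≠ z := by rintro rfl; exact hzY hwY
          grind
        · have h1 : c ∈ compOf G (U.erase x) c := mem_compOf_self (by grind)
          rw [heq] at h1
          grind
  · push Not at hX
    have hyc : ∃ y ∈ Y, y ∈ U.erase z ∧ y ≠ c := by
      by_contra! hcon
      have hUe := hsmall (fun v hv hvW => by
        have := hX v; have := hcon v; grind)
      have h1 := h.deg c hc hzc.ne
      have h2 : dg G U c ≤ 1 := by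
        refine dg_le_one fun a ha b hb hca hcb => ?_
        have := hca.ne'; have := hcb.ne'
        have : ∀ v ∈ U, v ≠ z → v = c := fun v hv hvz => by
          have : v ∈ U.erase z := by grind
          rw [hUe] at this
          simpa using this
        grind
      have h3 : c ∉ X := fun h => hzc.ne (hX c h hc)
      simp only [dgp, h3, if_false] at h1
      split_ifs at h1 <;> omega
    obtain ⟨y', hy', hy'U, hy'c⟩ := hyc
    have hs : TwoSys G (U.erase z) {c} Y c := by
      refine ⟨hconn, ⟨c, by simp, by grind⟩, ⟨y, hy, by grind⟩, ?_, ?_, ?_⟩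
      · refine hgd _ fun v hv hvW => ?_
        have := hX v
        grind
      · intro v hv hvc
        have h1 := h.deg v (by grind) (by grind)
        have h2 := hdg v hv hvc
        have h3 : v ∉ X := by have := hX v; grind
        simp only [dgp, h3, if_false] at h1
        unfold dgp
        omega
      · exact ⟨c, by grind, y', hy'U, Ne.symm hy'c, by grind, by grind⟩
    refine (ih _ _ _ _ hcard hs).imp (s := 1) fun n ⟨a, ha, b, hb, hn⟩ => ?_
    simp only [Finset.mem_singleton] at ha
    subst ha
    exact ⟨z, hzX, b, hb, hn.cons' (by simp) hzc.symm (by grind)⟩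

theorem TwoSys.part' (h : TwoSys G U X Y z) (hgood : Good G U (X ∪ Y) ∅) (ih : TwoIH G U.card)
    {c : V} {D : Finset V} (hc : c ∈ U) (hD : ClosedIn G (U.erase c) D)
    (hDc : ConnOn G D) (hY : ∀ y ∈ D, y ∉ Y) : AP (Len G U X Y) 2 := by
  by_cases hz : D = {z}
  · subst hz
    exact h.pendant hgood ih hc hD (hY z (by simp))
  · exact h.part hgood ih hc hD hDc hY hz

/-- A vertex with two neighbours in `X` (or two adjacent members of `X`) gives two lengths. -/
theorem AP.two_of_adj (hU : ConnOn G U) (hY : ∃ y ∈ Y, y ∈ U) {a b : V} (ha : a ∈ X) (hb : b ∈ X)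
    (haU : a ∈ U) (hbU : b ∈ U) (hab : G.Adj a b) : AP (Len G U X Y) 2 := by
  obtain ⟨k, hk, hkU, y, hy, n, hn⟩ := hU.escape (K := {a, b}) ⟨a, by simp, haU⟩ hY
  have hex : ∃ k' ∈ X, k' ∈ U ∧ G.Adj k' k ∧ k' ∈ ({a, b} : Finset V) := by
    simp only [Finset.mem_insert, Finset.mem_singleton] at hk
    rcases hk with rfl | rfl
    · exact ⟨b, hb, hbU, hab.symm, by simp⟩
    · exact ⟨a, ha, haU, hab, by simp⟩
  obtain ⟨k', hk'X, hk'U, hk', hk'K⟩ := hex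
  have hkX : k ∈ X := by grind
  refine ⟨n, 1, by simp, fun i hi => ?_⟩
  interval_cases i
  · exact ⟨k, hkX, y, hy, hn.mono (by grind)⟩
  · have := hk'.ne
    exact ⟨k', hk'X, y, hy, hn.cons' (by grind) hk' (by grind)⟩

theorem AP.two_of_common
    (h2 : ∀ c ∈ U, ∀ D, ClosedIn G (U.erase c) D → ConnOn G D → ∃ y ∈ Y, y ∈ D)
    {a b v : V} (ha : a ∈ X) (hb : b ∈ X) (haU : a ∈ U) (hbU : b ∈ U) (hvU : v ∈ U) (hab : a ≠ b)
    (hva : G.Adj v a) (hvb : G.Adj v b) : AP (Len G U X Y) 2 := by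
  have hav := hva.ne'
  obtain ⟨C, hC, hCc, haC⟩ := exists_comp (G := G) (U := U.erase v) (v := a) (by grind)
  obtain ⟨k, hk, hkC, y, hy, n, hn⟩ := hCc.escape (K := {a, b}) ⟨a, by simp, haC⟩ (h2 v hvU C hC hCc)
  have hex : ∃ k' ∈ X, k' ∈ U ∧ G.Adj k' v ∧ k' ∈ ({a, b} : Finset V) ∧ k' ≠ k := by
    simp only [Finset.mem_insert, Finset.mem_singleton] at hk
    rcases hk with rfl | rfl
    · exact ⟨b, hb, hbU, hvb.symm, by simp, hab.symm⟩
    · exact ⟨a, ha, haU, hva.symm, by simp, hab⟩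
  obtain ⟨k', hk'X, hk'U, hk', hk'K, hk'k⟩ := hex
  have hkX : k ∈ X := by grind
  have hvk : G.Adj v k := by grind
  have hCU := hC.1
  refine ⟨n, 2, by simp, fun i hi => ?_⟩
  interval_cases i
  · exact ⟨k, hkX, y, hy, hn.mono (by grind)⟩
  · have := hk'.ne
    have h1 := hn.cons' (a := v) (W := insert v (insert k (C \ {a, b}))) (by grind) hvk (by grind)
    exact ⟨k', hk'X, y, hy, h1.cons' (by grind) hk' (by grind)⟩

theorem TwoSys.step (h : TwoSys G U X Y z) (hgood : Good G U (X ∪ Y) ∅) (ih : TwoIH G U.card)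
    (hXs : ∀ a ∈ U, ∀ b ∈ U, ∀ v ∈ U, a ∈ X → b ∈ X → G.Adj v a → G.Adj v b → a = b)
    {y : V} (hy : y ∈ Y) (hyU : y ∈ U) (hyX : y ∉ X) (hyz : y ≠ z) : AP (Len G U X Y) 2 := by
  obtain ⟨C, hC, hCc, hyC⟩ := exists_comp (G := G) (U := U \ X) (v := y) (by grind)
  have hCU : C ⊆ U := hC.1.trans Finset.sdiff_subset
  obtain ⟨x, hx, hxU⟩ := h.hX
  have hCX : ∀ v ∈ C, v ∉ X := fun v hv => by have := hC.1 hv; grind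
  have hout : ∀ v ∈ C, ∀ w ∈ U, w ∉ C → G.Adj v w → w ∈ X := by
    intro v hv w hw hwC hvw
    have := hC.2 v hv w
    grind
  have hG : Good G C (nbs G (X ∩ U) ∪ Y) ∅ := by
    refine hgood.sub hCU (fun v hv hvW => ?_) fun v hv w hw hwC hvw => ?_
    · have := hCX v hv; grind
    · exact Finset.mem_union_left _ (mem_nbs.2 ⟨w, by have := hout v hv w hw hwC hvw; grind,
        hvw.symm⟩)
  have hdeg : ∀ v ∈ C, v ≠ z → 3 ≤ dgp G C (nbs G (X ∩ U)) Y v := by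
    intro v hv hvz
    have h1 := h.deg v (hCU hv) hvz
    have h2 : dg G U v ≤ dg G C v + dg G (X ∩ U) v := by
      refine le_trans (Finset.card_le_card fun w hw => ?_) (dg_union_le C (X ∩ U) v)
      have := hout v hv w
      grind
    have h3 : dg G (X ∩ U) v ≤ if v ∈ nbs G (X ∩ U) then 1 else 0 :=
      dg_le_ite fun a ha b hb => hXs a (by grind) b (by grind) v (hCU hv) (by grind) (by grind)
    have h4 := hCX v hv
    simp only [dgp, h4, if_false] at h1
    unfold dgp
    omega
  have hs : TwoSys G C (nbs G (X ∩ U)) Y z := by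
    refine ⟨hCc, ?_, ⟨y, hy, hyC⟩, hG.mono subset_rfl (by simp), hdeg, ?_⟩
    · obtain ⟨a, ha, b, hb, hbC, hab⟩ := h.conn.exists_adj hCU ⟨y, hyC⟩
        ⟨x, hxU, fun h => hCX x h hx⟩
      exact ⟨a, mem_nbs.2 ⟨b, by have := hout a ha b hb hbC hab; grind, hab.symm⟩, ha⟩
    · by_contra! hcon
      have hDx := hG.eq_singleton hyC (fun v hv hvW => by
        by_contra hne
        exact (hcon v hv y hyC hne hvW) (by grind))
      have h1 := hdeg y hyC hyz
      have : dg G C y = 0 := dg_eq_zero (by simp [hDx])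
      unfold dgp at h1
      split_ifs at h1 <;> omega
  refine (ih C _ _ _ (Finset.card_lt_card ⟨hCU, fun h => hCX x (h hxU) hx⟩) hs).imp (s := 1)
    fun n ⟨a, ha, b, hb, hn⟩ => ?_
  obtain ⟨x', hx', hadj⟩ := mem_nbs.1 ha
  exact ⟨x', by grind, b, hb, hn.cons' (by have := hCX x'; grind) hadj (by grind)⟩

theorem TwoSys.ap : ∀ {U X Y : Finset V} {z : V}, TwoSys G U X Y z → AP (Len G U X Y) 2 := by
  intro U
  induction hn : U.card using Nat.strong_induction_on generalizing U with
  | _ n IH =>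
  subst hn
  intro X Y z h
  have ih : TwoIH G U.card :=
    fun U' X' Y' z' hlt h' => IH _ hlt rfl h'
  by_cases hgood : Good G U (X ∪ Y) ∅
  swap
  · -- trim a part containing `z`
    unfold Good at hgood
    push Not at hgood
    obtain ⟨c, hc, D, hD, hne, -, hW⟩ := hgood
    have hzD : z ∈ D := by
      by_contra hzD
      obtain ⟨v, hv, hvW⟩ := h.good c hc D hD hne (by simpa using hzD)
      exact hW v hv hvW
    have hDU : D ⊆ U := hD.1.trans (Finset.erase_subset _ _)
    have hs : TwoSys G (U \ D) X Y c := by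
      obtain ⟨x, hx, hxU⟩ := h.hX
      obtain ⟨y, hy, hyU⟩ := h.hY
      obtain ⟨a, ha, b, hb, hab, haW, hbW⟩ := h.two
      refine ⟨h.conn.sdiff hc hD, ⟨x, hx, ?_⟩, ⟨y, hy, ?_⟩, ?_, ?_, ⟨a, ?_, b, ?_, hab, haW, hbW⟩⟩
      · have := hW x; grind
      · have := hW y; grind
      · intro c' hc' D' hD' hne' hcD'
        have hcD' : c ∉ D' := by simpa using hcD'
        refine h.good c' (by grind) D' ⟨fun x hx => ?_, fun u hu w hw huw => ?_⟩ hne' ?_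
        · have := hD'.1 hx; grind
        · have h1 := hD'.2 u hu w
          have h2 := hD.2 w
          have h3 := hD'.1 hu
          have := huw.symm
          grind
        · simp only [Finset.mem_singleton, forall_eq]
          intro hzD'
          have := hD'.1 hzD'
          grind
      · intro v hv hvc
        have h1 := h.deg v (by grind) (by grind)
        have h2 := dg_le_sdiff hD (v := v) (by grind) (by grind) hvc
        unfold dgp at *
        omega
      · have := hW a; grind
      · have := hW b; grind
    refine (ih _ _ _ _ (Finset.card_lt_card ⟨by grind, fun h => ?_⟩) hs).imp (s := 0)
      fun n ⟨a, ha, b, hb, hn⟩ => ⟨a, ha, b, hb, hn.mono Finset.sdiff_subset⟩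
    have := h (hDU hzD)
    grind
  have hgood' : Good G U (Y ∪ X) ∅ := Finset.union_comm X Y ▸ hgood
  by_cases h2Y : ∀ c ∈ U, ∀ D, ClosedIn G (U.erase c) D → ConnOn G D → ∃ y ∈ Y, y ∈ D
  swap
  · push Not at h2Y
    obtain ⟨c, hc, D, hD, hDc, hY⟩ := h2Y
    exact h.part' hgood ih hc hD hDc fun y hy hyY => hY y hyY hy
  by_cases h2X : ∀ c ∈ U, ∀ D, ClosedIn G (U.erase c) D → ConnOn G D → ∃ x ∈ X, x ∈ D
  swap
  · push Not at h2X
    obtain ⟨c, hc, D, hD, hDc, hX⟩ := h2X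
    exact (h.symm.part' hgood' ih hc hD hDc fun y hy hyX => hX y hyX hy).symm
  by_contra hno
  have hXs : ∀ a ∈ U, ∀ b ∈ U, ∀ v ∈ U, a ∈ X → b ∈ X → G.Adj v a → G.Adj v b → a = b := by
    intro a ha b hb v hv haX hbX hva hvb
    by_contra hab
    exact hno (AP.two_of_common h2Y haX hbX ha hb hv hab hva hvb)
  have hYs : ∀ a ∈ U, ∀ b ∈ U, ∀ v ∈ U, a ∈ Y → b ∈ Y → G.Adj v a → G.Adj v b → a = b := by
    intro a ha b hb v hv haX hbX hva hvb
    by_contra hab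
    exact hno (AP.two_of_common h2X haX hbX ha hb hv hab hva hvb).symm
  have hXa : ∀ a ∈ U, ∀ b ∈ U, a ∈ X → b ∈ X → ¬G.Adj a b := fun a ha b hb haX hbX hab =>
    hno (AP.two_of_adj h.conn h.hY haX hbX ha hb hab)
  have hYa : ∀ a ∈ U, ∀ b ∈ U, a ∈ Y → b ∈ Y → ¬G.Adj a b := fun a ha b hb haX hbX hab =>
    hno (AP.two_of_adj h.conn h.hX haX hbX ha hb hab).symm
  have hYX : ∀ y ∈ U, y ∈ Y → y ≠ z → y ∈ X := fun y hyU hy hyz => by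
    by_contra hyX
    exact hno (h.step hgood ih hXs hy hyU hyX hyz)
  have hXY : ∀ y ∈ U, y ∈ X → y ≠ z → y ∈ Y := fun y hyU hy hyz => by
    by_contra hyX
    exact hno (h.symm.step hgood' ih hYs hy hyU hyX hyz).symm
  obtain ⟨t, htU, htX, htY, htz⟩ : ∃ t ∈ U, t ∈ X ∧ t ∈ Y ∧ t ≠ z := by
    obtain ⟨a, ha, b, hb, hab, haW, hbW⟩ := h.two
    by_cases haz : a = z
    · have h1 := hYX b hb; have h2 := hXY b hb; exact ⟨b, hb, by grind⟩
    · have h1 := hYX a ha; have h2 := hXY a ha; exact ⟨a, ha, by grind⟩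
  set A := (X ∪ Y) ∩ U with hA
  have huniq : ∀ v ∈ U, ∀ a ∈ A, ∀ b ∈ A, G.Adj v a → G.Adj v b → a = b := by
    intro v hv a ha b hb hva hvb
    have h1 := hXs a (by grind) b (by grind) v hv
    have h2 := hYs a (by grind) b (by grind) v hv
    have h3 := hXY a (by grind)
    have h4 := hYX a (by grind)
    have h5 := hXY b (by grind)
    have h6 := hYX b (by grind)
    by_contra hab
    grind
  obtain ⟨u, huU, htu⟩ : ∃ u ∈ U, G.Adj t u := by
    rw [← dg_pos]
    have := h.deg t htU htz
    simp only [dgp, htX, htY, if_true] at this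
    omega
  have huA : u ∉ A := by
    intro huA
    have h1 := hXa t htU u huU htX
    have h2 := hYa t htU u huU htY
    grind
  obtain ⟨E, hE, hEc, huE⟩ := exists_comp (G := G) (U := U \ A) (v := u) (by grind)
  have hEU : E ⊆ U := hE.1.trans Finset.sdiff_subset
  have hEA : ∀ v ∈ E, v ∉ A := fun v hv => by have := hE.1 hv; grind
  have hout : ∀ v ∈ E, ∀ w ∈ U, w ∉ E → G.Adj v w → w ∈ A := by
    intro v hv w hw hwC hvw
    have := hE.2 v hv w
    grind
  obtain ⟨w, hwE, a, haA, hat, hwa⟩ : ∃ w ∈ E, ∃ a ∈ A, a ≠ t ∧ G.Adj w a := by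
    by_contra! hcon
    have hcl : ClosedIn G (U.erase t) E := by
      refine ⟨fun x hx => ?_, fun x hx y hy hxy => ?_⟩
      · have := hE.1 hx
        grind
      · have h1 := hout x hx y
        have h2 := hcon x hx y
        grind
    obtain ⟨v, hv, hvW⟩ := hgood t htU E hcl hEc.1 (by simp)
    have := hEA v hv
    grind
  have hutE : u ∈ nbs G {t} := mem_nbs_singleton.2 htu
  have hs : TwoSys G E (nbs G {t}) (nbs G (A.erase t)) z := by
    refine ⟨hEc, ⟨u, hutE, huE⟩, ⟨w, mem_nbs.2 ⟨a, by grind, hwa.symm⟩, hwE⟩, ?_, ?_,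
      ⟨u, huE, w, hwE, ?_, by grind, ?_⟩⟩
    · refine (hgood.sub hEU (fun v hv hvW => ?_) fun v hv w hw hwE hvw => ?_).mono subset_rfl
        (by simp)
      · have := hEA v hv; grind
      · have h1 := hout v hv w hw hwE hvw
        rw [Finset.mem_union]
        by_cases hwt : w = t
        · left; subst hwt; exact mem_nbs_singleton.2 hvw.symm
        · right; exact mem_nbs.2 ⟨w, by grind, hvw.symm⟩
    · intro v hv hvz
      have h1 := h.deg v (hEU hv) hvz
      have h2 : dg G U v ≤ dg G E v + dg G A v := by
        refine le_trans (Finset.card_le_card fun w hw => ?_) (dg_union_le E A v)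
        have := hout v hv w
        grind
      have h3 : dg G A v ≤ 1 := dg_le_one (huniq v (hEU hv))
      have h4 : 0 < dg G A v → v ∈ nbs G {t} ∨ v ∈ nbs G (A.erase t) := by
        rw [dg_pos]
        rintro ⟨w, hw, hvw⟩
        by_cases hwt : w = t
        · left; subst hwt; exact mem_nbs_singleton.2 hvw.symm
        · right; exact mem_nbs.2 ⟨w, by grind, hvw.symm⟩
      have h5 : v ∉ X ∧ v ∉ Y := by have := hEA v hv; have := hEU hv; grind
      simp only [dgp, h5.1, h5.2, if_false] at h1
      unfold dgp
      split_ifs <;> grind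
    · rintro rfl
      exact hat (huniq u huU a haA t (by grind) hwa htu.symm)
    · exact Finset.mem_union_right _ (mem_nbs.2 ⟨a, by grind, hwa.symm⟩)
  refine hno ((ih E _ _ _ (Finset.card_lt_card ⟨hEU, fun h => hEA t (h htU) (by grind)⟩) hs).imp
    (s := 2) fun n ⟨p, hp, q, hq, hn⟩ => ?_)
  rw [mem_nbs_singleton] at hp
  obtain ⟨b, hb, hbq⟩ := mem_nbs.1 hq
  have h1 : PathIn G (insert t E) t q (n + 1) :=
    hn.cons' (by have := hEA t; grind) hp subset_rfl
  have h2 : PathIn G U t b (n + 2) :=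
    h1.snoc (by have := hEA b; grind) hbq.symm
      (Finset.insert_subset (Finset.mem_inter.1 (Finset.mem_of_mem_erase hb)).2
        (Finset.insert_subset htU hEU))
  rcases Finset.mem_union.1 (Finset.mem_inter.1 (Finset.mem_of_mem_erase hb)).1 with hbX | hbY
  · exact ⟨b, hbX, t, htY, h2.symm⟩
  · exact ⟨t, htX, b, hbY, h2⟩

end TwoPaths

section Patterns

theorem AP.inner {U E H A X Y : Finset V} {a N s e : ℕ} (he : e = 1 ∨ e = 2) (hN : 1 ≤ N)
    (ha : 1 ≤ a) (h : AP (Len G E (nbs G A) Y) a) (hd : Disjoint H E) (hE : E ⊆ U) (hH : H ⊆ U)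
    (hin : ∀ κ ∈ A, ∀ j < N, ∃ x ∈ X, PathIn G H x κ (s + e * j)) :
    AP (Len G U X Y) (N + a - 1) := by
  refine AP.add (L := fun m => ∃ j < N, m = s + e * j) (s := 1) ⟨s, e, he, fun i hi => ⟨i, hi, rfl⟩⟩
    h hN ha ?_
  rintro _ n ⟨j, hj, rfl⟩ ⟨v, hv, y, hy, hp⟩
  obtain ⟨κ, hκ, hκv⟩ := mem_nbs.1 hv
  obtain ⟨x, hx, hq⟩ := hin κ hκ j hj
  exact ⟨x, hx, y, hy, (hq.join hp hd hκv).mono (Finset.union_subset hH hE)⟩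

theorem clique_path {K : Finset V} {κ : V} {j : ℕ}
    (hK : ∀ a ∈ K, ∀ b ∈ K, a ≠ b → G.Adj a b) (hκ : κ ∈ K) (hj : j < K.card) :
    ∃ x ∈ K, PathIn G K x κ j := by
  induction j generalizing K κ with
  | zero => exact ⟨κ, hκ, .nil hκ⟩
  | succ j ih =>
    have hc := Finset.card_erase_of_mem hκ
    obtain ⟨x', hx'⟩ : (K.erase κ).Nonempty := by
      rw [← Finset.card_pos]; omega
    obtain ⟨x, hx, hp⟩ := ih (K := K.erase κ) (κ := x')
      (fun a ha b hb => hK a (by grind) b (by grind)) hx' (by omega)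
    exact ⟨x, by grind, hp.snoc (by simp) (hK x' (by grind) κ hκ (by grind)) (by grind)⟩

theorem bip_path {S T : Finset V} {κ : V} {j : ℕ} (hd : ∀ s ∈ S, s ∉ T)
    (hST : ∀ s ∈ S, ∀ t ∈ T, G.Adj s t) (hκ : κ ∈ T) (hj : j < T.card) (hj' : j ≤ S.card) :
    ∃ x ∈ T, PathIn G (S ∪ T) x κ (2 * j) := by
  induction j generalizing S T κ with
  | zero => exact ⟨κ, hκ, .nil (by grind)⟩
  | succ j ih =>
    obtain ⟨s, hs⟩ : S.Nonempty := by rw [← Finset.card_pos]; omega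
    have hc := Finset.card_erase_of_mem hκ
    have hc' := Finset.card_erase_of_mem hs
    obtain ⟨t, ht⟩ : (T.erase κ).Nonempty := by rw [← Finset.card_pos]; omega
    obtain ⟨x, hx, hp⟩ := ih (S := S.erase s) (T := T.erase κ) (κ := t) (by grind)
      (fun a ha b hb => hST a (by grind) b (by grind)) ht (by omega) (by omega)
    have hsT := hd s hs
    have h1 := hp.snoc (c := s) (W := S ∪ T.erase κ) (by grind) (hST s hs t (by grind)).symm
      (by grind)
    have := hd κ
    exact ⟨x, by grind, h1.snoc (c := κ) (by grind) (hST s hs κ hκ) (by grind)⟩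

theorem bip_path_odd {S T : Finset V} {κ : V} {j : ℕ} (hd : ∀ s ∈ S, s ∉ T)
    (hST : ∀ s ∈ S, ∀ t ∈ T, G.Adj s t) (hκ : κ ∈ S) (hj : j < T.card) (hj' : j < S.card) :
    ∃ x ∈ T, PathIn G (S ∪ T) x κ (2 * j + 1) := by
  have hc' := Finset.card_erase_of_mem hκ
  obtain ⟨t, ht⟩ : T.Nonempty := by rw [← Finset.card_pos]; omega
  obtain ⟨x, hx, hp⟩ := bip_path (S := S.erase κ) (T := T) (κ := t) (j := j) (by grind)
      (fun a ha b hb => hST a (by grind) b (by grind)) ht (by omega) (by omega)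
  have := hd κ hκ
  exact ⟨x, hx, hp.snoc (by grind) (hST κ hκ t ht).symm (by grind)⟩

theorem dg_le_of_closedIn_sdiff {U H E : Finset V} {v : V} (h : ClosedIn G (U \ H) E)
    (hv : v ∈ E) : dg G U v ≤ dg G E v + dg G H v := by
  refine le_trans (Finset.card_le_card fun w hw => ?_) (dg_union_le E H v)
  have := h.2 v hv w
  grind

theorem dg_le_of_closedIn_erase {U H E D : Finset V} {d v : V} (h : ClosedIn G (U \ H) E)
    (hD : ClosedIn G (E.erase d) D) (hv : v ∈ D) :
    dg G U v ≤ dg G D v + (if v ∈ nbs G {d} then 1 else 0) + dg G H v := by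
  have h1 := dg_le_of_closedIn_sdiff h (v := v) (by have := hD.1 hv; grind)
  have h2 := dg_le_of_closedIn hD hv
  omega

end Patterns

section Rooted

/-- A rooted system asking for `k` admissible path lengths. -/
structure KSys (G : SimpleGraph V) [DecidableRel G.Adj] (U X Y : Finset V) (k : ℕ) : Prop where
  conn : ConnOn G U
  hX : ∃ x ∈ X, x ∈ U
  hY : ∃ y ∈ Y, y ∈ U
  good : Good G U (X ∪ Y) ∅
  deg : 2 ≤ k → ∀ v ∈ U, k + 1 ≤ dgp G U X Y v

/-- All rooted systems on fewer vertices have their admissible lengths. -/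
def KIH (G : SimpleGraph V) [DecidableRel G.Adj] (n : ℕ) : Prop :=
  ∀ U X Y k, U.card < n → KSys G U X Y k → AP (Len G U X Y) k

theorem KSys.symm {U X Y : Finset V} {k : ℕ} (h : KSys G U X Y k) : KSys G U Y X k :=
  ⟨h.conn, h.hY, h.hX, Finset.union_comm X Y ▸ h.good,
    fun hk v hv => dgp_comm (G := G) U X Y v ▸ h.deg hk v hv⟩

variable {U X Y : Finset V}

theorem KSys.zero_lt (h : KSys G U X Y k) (hk : k ≤ 1) : AP (Len G U X Y) k := by
  obtain ⟨x, hx, hxU⟩ := h.hX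
  obtain ⟨y, hy, hyU⟩ := h.hY
  obtain ⟨n, hn⟩ := h.conn.exists_path hxU hyU
  exact ⟨n, 1, by simp, fun i hi => ⟨x, hx, y, hy, by rwa [show n + 1 * i = n by omega]⟩⟩

theorem KSys.two (h : KSys G U X Y 2) : AP (Len G U X Y) 2 := by
  obtain ⟨x, hx, hxU⟩ := h.hX
  refine TwoSys.ap (z := x) ⟨h.conn, h.hX, h.hY, h.good.mono subset_rfl (by simp),
    fun v hv _ => h.deg le_rfl v hv, ?_⟩
  by_contra! hcon
  have hUx := h.good.eq_singleton hxU (fun v hv hvW => by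
    by_contra hne
    exact (hcon v hv x hxU hne hvW) (by grind))
  have h1 := h.deg le_rfl x hxU
  have : dg G U x = 0 := dg_eq_zero (by simp [hUx])
  unfold dgp at h1
  split_ifs at h1 <;> omega

/-- A cut-off part avoiding `Y` can be used instead of `U`. -/
theorem KSys.part (h : KSys G U X Y k) (ih : KIH G U.card) {c : V} {D : Finset V} (hc : c ∈ U)
    (hD : ClosedIn G (U.erase c) D) (hDc : ConnOn G D) (hY : ∀ y ∈ D, y ∉ Y) :
    AP (Len G U X Y) k := by
  have hDU : D ⊆ U := hD.1.trans (Finset.erase_subset _ _)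
  have hcD : c ∉ D := fun h => by simpa using hD.1 h
  obtain ⟨x, hx, hxX⟩ := h.good c hc D hD hDc.1 (by simp)
  have hxY := hY x hx
  obtain ⟨w, hw, hwc⟩ := h.conn.exists_nbr hc hD hDc.1
  have hs : KSys G D X (nbs G {c}) k := by
    refine ⟨hDc, ⟨x, by grind, hx⟩, ⟨w, mem_nbs_singleton.2 hwc, hw⟩, ?_, ?_⟩
    · refine h.good.sub hDU (fun v hv hvW => ?_) fun v hv w hw hwD hvw => ?_
      · have := hY v hv; grind
      · have := hD.2 v hv w
        have : w = c := by grind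
        subst this
        exact Finset.mem_union_right _ (mem_nbs_singleton.2 hvw.symm)
    · intro hk v hv
      have h1 := h.deg hk v (hDU hv)
      have h2 := dg_le_of_closedIn hD hv
      have h3 := hY v hv
      simp only [dgp, h3, if_false] at h1 ⊢
      omega
  obtain ⟨y, hy, hyU⟩ := h.hY
  obtain ⟨m, hm⟩ := (h.conn.sdiff hc hD).exists_path (a := c) (b := y)
    (by grind) (by have := hY y; grind)
  exact (ih D _ _ _ (Finset.card_lt_card ⟨hDU, fun h => hcD (h hc)⟩) hs).imp fun n hn =>
    hn.tail hm hDU hy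

theorem exists_two_comps (hne : U.Nonempty) (hU : ¬ConnOn G U) :
    ∃ M N, ClosedIn G U M ∧ ConnOn G M ∧ ClosedIn G U N ∧ ConnOn G N ∧ Disjoint M N := by
  obtain ⟨u, hu⟩ := hne
  have hM := closedIn_compOf (G := G) U u
  have hne : ∃ w ∈ U, w ∉ compOf G U u := by
    by_contra! hcon
    exact hU ((Finset.Subset.antisymm hM.1 hcon) ▸ connOn_compOf hu)
  obtain ⟨w, hw, hwM⟩ := hne
  refine ⟨_, _, hM, connOn_compOf hu, closedIn_compOf U w, connOn_compOf hw, ?_⟩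
  exact (Finset.disjoint_sdiff).mono_right (compOf_min hM.sdiff (Finset.mem_sdiff.2 ⟨hw, hwM⟩))

theorem KSys.cut (h : KSys G U X Y k) (hk : 3 ≤ k) (ih : KIH G U.card) (hX : Good G U X ∅)
    (hY : Good G U Y ∅) {c : V} (hc : c ∈ U) (hcon : ¬ConnOn G (U.erase c)) :
    AP (Len G U X Y) k := by
  have hne : (U.erase c).Nonempty := by
    by_contra hemp
    rw [Finset.not_nonempty_iff_eq_empty] at hemp
    have h1 := h.deg (by omega) c hc
    have : dg G U c = 0 := dg_eq_zero fun a ha hca => by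
      have : a ∉ U.erase c := by simp [hemp]
      have := hca.ne'
      grind
    unfold dgp at h1
    split_ifs at h1 <;> omega
  obtain ⟨M, N, hM, hMc, hN, hNc, hMN⟩ := exists_two_comps hne hcon
  have key : ∀ X Y : Finset V, ∀ D, Good G U X ∅ → (∀ v ∈ U, k + 1 ≤ dgp G U X Y v) →
      ClosedIn G (U.erase c) D → ConnOn G D → KSys G D X (nbs G {c}) (k - 1) := by
    intro X Y D hX hdeg hD hDc
    have hDU : D ⊆ U := hD.1.trans (Finset.erase_subset _ _)
    obtain ⟨x, hx, hxX⟩ := hX c hc D hD hDc.1 (by simp)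
    obtain ⟨w, hw, hwc⟩ := h.conn.exists_nbr hc hD hDc.1
    refine ⟨hDc, ⟨x, hxX, hx⟩, ⟨w, mem_nbs_singleton.2 hwc, hw⟩, ?_, ?_⟩
    · refine hX.sub hDU (fun v hv hvW => Finset.mem_union_left _ hvW) fun v hv w hw hwD hvw => ?_
      have := hD.2 v hv w
      have : w = c := by grind
      subst this
      exact Finset.mem_union_right _ (mem_nbs_singleton.2 hvw.symm)
    · intro _ v hv
      have h1 := hdeg v (hDU hv)
      have h2 := dg_le_of_closedIn hD hv
      unfold dgp at h1 ⊢
      split_ifs at * <;> omega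
  have hlt : ∀ D, ClosedIn G (U.erase c) D → D.card < U.card := fun D hD =>
    (Finset.card_le_card hD.1).trans_lt (Finset.card_erase_lt_of_mem hc)
  have h1 := ih _ _ _ _ (hlt M hM) (key X Y M hX (h.deg (by omega)) hM hMc)
  have h2 := (ih _ _ _ _ (hlt N hN) (key Y X N hY (h.symm.deg (by omega)) hN hNc)).symm
  refine AP.mono (k := k - 1 + (k - 1) - 1) ?_ (by omega)
  refine h1.add h2 (by omega) (by omega) (s := 2) fun m n hm hn => ?_
  obtain ⟨a, ha, b, hb, hp⟩ := hm
  obtain ⟨a', ha', b', hb', hp'⟩ := hn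
  rw [mem_nbs_singleton] at hb ha'
  have hcM : c ∉ M := fun h => by simpa using hM.1 h
  have hcN : c ∉ N := fun h => by simpa using hN.1 h
  have e1 := hp.snoc hcM hb.symm subset_rfl
  have e2 := e1.join hp' (by simp [hcN, hMN]) ha'
  refine ⟨a, ha, b', hb', ?_⟩
  rw [show m + n + 2 = m + 1 + n + 1 by ring]
  refine e2.mono (Finset.union_subset (Finset.insert_subset hc ?_) ?_)
  · exact hM.1.trans (Finset.erase_subset _ _)
  · exact hN.1.trans (Finset.erase_subset _ _)

end Rooted

section Cores

variable {U X Y H : Finset V}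

theorem ConnOn.exists_nbs {C : Finset V} (hU : ConnOn G U) (hC : ClosedIn G (U \ H) C)
    (hne : C.Nonempty) (hH : ∃ h ∈ H, h ∈ U) : ∃ v ∈ C, v ∈ nbs G H := by
  obtain ⟨h, hh, hhU⟩ := hH
  obtain ⟨a, ha, b, hb, hbC, hab⟩ := hU.exists_adj (D := C)
    (hC.1.trans Finset.sdiff_subset) hne ⟨h, hhU, fun hc => by have := hC.1 hc; grind⟩
  have := hC.2 a ha b
  exact ⟨a, ha, mem_nbs.2 ⟨b, by grind, hab.symm⟩⟩

theorem KSys.of_comp {C A : Finset V} {k' : ℕ} (hC : ClosedIn G (U \ H) C) (hCc : ConnOn G C)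
    (hA : ∃ a ∈ nbs G A, a ∈ C) (hY : ∃ y ∈ Y, y ∈ C) (hg : Good G C (nbs G A ∪ Y) ∅)
    (hdeg : 2 ≤ k' → ∀ v ∈ C, k + 1 ≤ dgp G U X Y v ∧
      dg G H v + (if v ∈ X then 1 else 0) + k' ≤ k + (if v ∈ nbs G A then 1 else 0)) :
    KSys G C (nbs G A) Y k' := by
  refine ⟨hCc, hA, hY, hg, fun hk v hv => ?_⟩
  obtain ⟨h1, h2⟩ := hdeg hk v hv
  have h3 := dg_le_of_closedIn_sdiff hC hv
  unfold dgp at *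
  omega

theorem KSys.of_part {C D A : Finset V} {d : V} {k' : ℕ} (hC : ClosedIn G (U \ H) C)
    (hCc : ConnOn G C) (hd : d ∈ C) (hD : ClosedIn G (C.erase d) D) (hDc : ConnOn G D)
    (hA : ∃ a ∈ nbs G A, a ∈ D) (hY : ∀ v ∈ D, v ∉ Y)
    (hg : Good G D (nbs G A ∪ nbs G {d}) ∅)
    (hdeg : 2 ≤ k' → ∀ v ∈ D, k + 1 ≤ dgp G U X Y v ∧
      dg G H v + (if v ∈ X then 1 else 0) + k' ≤ k + (if v ∈ nbs G A then 1 else 0)) :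
    KSys G D (nbs G A) (nbs G {d}) k' := by
  obtain ⟨w, hw, hwd⟩ := hCc.exists_nbr hd hD hDc.1
  refine ⟨hDc, hA, ⟨w, mem_nbs_singleton.2 hwd, hw⟩, hg, fun hk v hv => ?_⟩
  obtain ⟨h1, h2⟩ := hdeg hk v hv
  have h3 := dg_le_of_closedIn_erase hC hD hv
  have h4 := hY v hv
  simp only [dgp, h4, if_false] at *
  omega

theorem clique_core {K : Finset V} (ih : KIH G U.card) (hU : ConnOn G U)
    (hg : Good G U (Y ∪ K) ∅) (hKU : K ⊆ U) (hKX : K ⊆ X) (hne : K.Nonempty)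
    (hK : ∀ a ∈ K, ∀ b ∈ K, a ≠ b → G.Adj a b)
    (hdeg : ∀ v ∈ U, v ∉ K → k + 1 ≤ dgp G U X Y v ∧
      dg G K v + (if v ∈ X then 1 else 0) + 1 ≤ K.card + (if v ∈ nbs G K then 1 else 0))
    (hy : ∃ y ∈ Y, y ∈ U ∧ y ∉ K) : AP (Len G U X Y) k := by
  obtain ⟨y, hy, hyU, hyK⟩ := hy
  obtain ⟨C, hC, hCc, hyC⟩ := exists_comp (G := G) (U := U \ K) (v := y) (by grind)
  have hCU : C ⊆ U := hC.1.trans Finset.sdiff_subset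
  have hCK : Disjoint K C := (Finset.disjoint_sdiff).mono_right hC.1
  obtain ⟨κ, hκ⟩ := hne
  have hCκ : κ ∉ C := Finset.disjoint_left.1 hCK hκ
  obtain ⟨a, haC, ha⟩ := hU.exists_nbs hC hCc.1 ⟨κ, hκ, hKU hκ⟩
  have hpos := Finset.card_pos.2 ⟨κ, hκ⟩
  have hs : KSys G C (nbs G K) Y (max (k + 1 - K.card) 1) := by
    refine KSys.of_comp (X := X) (k := k) hC hCc ⟨a, ha, haC⟩ ⟨y, hy, hyC⟩ ?_ ?_
    · refine hg.sub hCU (fun v hv hvW => ?_) fun v hv w hw hwD hvw => ?_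
      · have := Finset.disjoint_right.1 hCK hv; grind
      · have := hC.2 v hv w
        exact Finset.mem_union_left _ (mem_nbs.2 ⟨w, by grind, hvw.symm⟩)
    · intro hk v hv
      obtain ⟨h1, h2⟩ := hdeg v (hCU hv) (Finset.disjoint_right.1 hCK hv)
      exact ⟨h1, by omega⟩
  have := ih C _ _ _ (Finset.card_lt_card ⟨hCU, fun h => hCκ (h (hKU hκ))⟩) hs
  refine (AP.inner (N := K.card) (s := 0) (e := 1) (X := X) (H := K) (.inl rfl) hpos (by omega)
    this hCK hCU hKU fun κ hκ j hj => ?_).mono (by omega)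
  obtain ⟨x, hx, hp⟩ := clique_path hK hκ hj
  exact ⟨x, hKX hx, by simpa using hp⟩

/-- Among the cliques of `W`, one to which no vertex of `W` can be added. -/
theorem exists_max_clique {W K₀ : Finset V} (h₀ : K₀ ⊆ W)
    (hc : ∀ a ∈ K₀, ∀ b ∈ K₀, a ≠ b → G.Adj a b) :
    ∃ K, K ⊆ W ∧ (∀ a ∈ K, ∀ b ∈ K, a ≠ b → G.Adj a b) ∧ K₀.card ≤ K.card ∧
      ∀ v ∈ W, v ∉ K → dg G K v + 1 ≤ K.card := by
  classical
  let F := W.powerset.filter fun K => ∀ a ∈ K, ∀ b ∈ K, a ≠ b → G.Adj a b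
  obtain ⟨K, hK, hmax⟩ := F.exists_max_image Finset.card ⟨K₀, by simp [F, h₀]; exact hc⟩
  simp only [F, Finset.mem_filter, Finset.mem_powerset] at hK hmax
  refine ⟨K, hK.1, hK.2, hmax K₀ ⟨h₀, hc⟩, fun v hv hvK => ?_⟩
  by_contra! hcon
  have hle : dg G K v = K.card := le_antisymm (dg_le_card K v) (by omega)
  have hall : ∀ a ∈ K, G.Adj v a := by
    unfold dg at hle
    rwa [Finset.card_filter_eq_iff] at hle
  have := hmax (insert v K) ⟨Finset.insert_subset hv hK.1, fun a ha b hb hab => by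
    have h1 := hall b
    have h2 := fun ha => (hall a ha).symm
    have h3 := hK.2 a
    grind⟩
  rw [Finset.card_insert_of_notMem hvK] at this
  omega

end Cores

section Bip

variable {U X Y : Finset V}

/-- A rooted system with a complete bipartite piece at `X`. -/
structure BipSys (G : SimpleGraph V) [DecidableRel G.Adj] (U X Y S T : Finset V) (k : ℕ) :
    Prop where
  conn : ConnOn G U
  good : Good G U Y ∅
  hS : S ⊆ U
  hT : T ⊆ U
  hTX : T ⊆ X
  disj : ∀ s ∈ S, s ∉ T
  adj : ∀ s ∈ S, ∀ t ∈ T, G.Adj s t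
  card : S.card + 1 ≤ T.card
  deg : ∀ v ∈ U, v ∉ S → v ∉ T → k + 1 ≤ dgp G U X Y v ∧
    dg G S v + dg G T v + (if v ∈ X then 1 else 0) ≤ S.card + (if v ∈ nbs G T then 1 else 0) ∧
    dg G S v + (if v ∈ X then 1 else 0) ≤ S.card

theorem BipSys.odd_part {S T C D : Finset V} {y d : V} (h : BipSys G U X Y S T k)
    (ih : KIH G U.card) (hC : ClosedIn G (U \ (S ∪ T)) C) (hCc : ConnOn G C) (hy : y ∈ Y)
    (hyC : y ∈ C) (hd : d ∈ C) (hD : ClosedIn G (C.erase d) D) (hDc : ConnOn G D)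
    (hDT : ∀ v ∈ D, v ∉ nbs G T) (hDY : ∀ v ∈ D, v ∉ Y) (hX : S.card = 1 → ∀ v ∈ D, v ∉ X) :
    AP (Len G U X Y) k := by
  have hCU : C ⊆ U := hC.1.trans Finset.sdiff_subset
  have hCH : Disjoint (S ∪ T) C := (Finset.disjoint_sdiff).mono_right hC.1
  have hDC : D ⊆ C := hD.1.trans (Finset.erase_subset _ _)
  have hdD : d ∉ D := fun h => by simpa using hD.1 h
  have key : ∀ v ∈ D, ∀ w ∈ U, w ∉ D → G.Adj v w → w = d ∨ w ∈ S := by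
    intro v hv w hw hwD hvw
    have h1 := hC.2 v (hDC hv) w
    have h2 := hD.2 v hv w
    have h3 : w ∉ T := fun hwT => hDT v hv (mem_nbs.2 ⟨w, hwT, hvw.symm⟩)
    grind
  obtain ⟨a, haD, ha⟩ : ∃ a ∈ D, a ∈ nbs G S := by
    by_contra! hcon
    obtain ⟨v, hv, hvY⟩ := h.good d (hCU hd) D ⟨fun x hx => by grind, fun a ha b hb hab => by
      by_contra hbD
      rcases key a ha b (by grind) hbD hab with rfl | hbS
      · simp at hb
      · exact hcon a ha (mem_nbs.2 ⟨b, hbS, hab.symm⟩)⟩ hDc.1 (by simp)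
    exact hDY v hv hvY
  obtain ⟨b, hbS, hab⟩ := mem_nbs.1 ha
  have hpos := Finset.card_pos.2 ⟨b, hbS⟩
  have hs : KSys G D (nbs G S) (nbs G {d}) (max (k + 1 - S.card) 1) := by
    refine KSys.of_part (X := X) (k := k) (Y := Y) hC hCc hd hD hDc ⟨a, ha, haD⟩ hDY ?_ ?_
    · refine Good.sub (h.good) (hDC.trans hCU) (fun v hv hvW => absurd hvW (hDY v hv)) ?_
      intro v hv w hw hwD hvw
      rcases key v hv w hw hwD hvw with rfl | hwS
      · exact Finset.mem_union_right _ (mem_nbs_singleton.2 hvw.symm)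
      · exact Finset.mem_union_left _ (mem_nbs.2 ⟨w, hwS, hvw.symm⟩)
    · intro hk v hv
      have hvH := Finset.disjoint_right.1 hCH (hDC hv)
      obtain ⟨h1, h2, h3⟩ := h.deg v (hCU (hDC hv)) (by grind) (by grind)
      have h4 := dg_union_le (G := G) S T v
      have h5 := hDT v hv
      have h6 : dg G T v = 0 := dg_eq_zero fun t ht hvt => h5 (mem_nbs.2 ⟨t, ht, hvt.symm⟩)
      have h7 := fun h => hX h v hv
      have h8 : v ∉ nbs G S → dg G S v = 0 := fun h => dg_eq_zero fun t ht hvt =>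
        h (mem_nbs.2 ⟨t, ht, hvt.symm⟩)
      refine ⟨h1, ?_⟩
      by_cases hvS : v ∈ nbs G S
      · simp only [hvS, if_true]
        omega
      · have := h8 hvS
        simp only [hvS, if_false]
        by_cases hc : S.card = 1
        · simp only [h7 hc, if_false]; omega
        · split_ifs <;> omega
  have h1 := ih D _ _ _ (Finset.card_lt_card ⟨hDC.trans hCU, fun h => hdD (h (hCU hd))⟩) hs
  have h2 : AP (Len G (U \ (C \ D)) X (nbs G {d})) k := by
    refine (AP.inner (N := S.card) (s := 1) (e := 2) (X := X) (H := S ∪ T) (.inr rfl) hpos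
      (by omega) h1 (hCH.mono_right hDC) (by grind) ?_ fun κ hκ j hj => ?_).mono (by omega)
    · intro x hx
      have h1 := Finset.disjoint_left.1 hCH hx
      have h2 := h.hS
      have h3 := h.hT
      grind
    · obtain ⟨x, hx, hp⟩ := bip_path_odd h.disj h.adj hκ (by have := h.card; omega) hj
      exact ⟨x, h.hTX hx, by rwa [show 1 + 2 * j = 2 * j + 1 by ring]⟩
  obtain ⟨m, hm⟩ := (hCc.sdiff hd hD).exists_path (a := d) (b := y)
    (by grind) (by have := hDY y; grind)
  refine h2.imp (s := m + 1) fun n hn => Len.tail hn (hm.mono fun x hx => ?_) (by grind) hy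
  have := hCU
  grind

theorem BipSys.odd_comp {S T C : Finset V} {y : V} (h : BipSys G U X Y S T k)
    (ih : KIH G U.card) (hC : ClosedIn G (U \ (S ∪ T)) C) (hCc : ConnOn G C) (hy : y ∈ Y)
    (hyC : y ∈ C) (hDT : ∀ v ∈ C, v ∉ nbs G T) (hX : S.card = 1 → ∀ v ∈ C, v ∉ X) :
    AP (Len G U X Y) k := by
  have hCU : C ⊆ U := hC.1.trans Finset.sdiff_subset
  have hCH : Disjoint (S ∪ T) C := (Finset.disjoint_sdiff).mono_right hC.1
  obtain ⟨t, ht⟩ : T.Nonempty := by have := h.card; rw [← Finset.card_pos]; omega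
  have htC : t ∉ C := fun h => by have := Finset.disjoint_right.1 hCH h; grind
  have key : ∀ v ∈ C, ∀ w ∈ U, w ∉ C → G.Adj v w → w ∈ S := by
    intro v hv w hw hwD hvw
    have h1 := hC.2 v hv w
    have h3 : w ∉ T := fun hwT => hDT v hv (mem_nbs.2 ⟨w, hwT, hvw.symm⟩)
    grind
  obtain ⟨a, haC, b, hb, hbC, hab⟩ := h.conn.exists_adj hCU hCc.1 ⟨t, h.hT ht, htC⟩
  have hbS := key a haC b hb hbC hab
  have ha : a ∈ nbs G S := mem_nbs.2 ⟨b, hbS, hab.symm⟩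
  have hpos := Finset.card_pos.2 ⟨b, hbS⟩
  have hs : KSys G C (nbs G S) Y (max (k + 1 - S.card) 1) := by
    refine KSys.of_comp (X := X) (k := k) (Y := Y) hC hCc ⟨a, ha, haC⟩ ⟨y, hy, hyC⟩ ?_ ?_
    · refine Good.sub (h.good) hCU (fun v hv hvW => Finset.mem_union_right _ hvW) ?_
      intro v hv w hw hwD hvw
      exact Finset.mem_union_left _ (mem_nbs.2 ⟨w, key v hv w hw hwD hvw, hvw.symm⟩)
    · intro hk v hv
      have hvH := Finset.disjoint_right.1 hCH hv
      obtain ⟨h1, h2, h3⟩ := h.deg v (hCU hv) (by grind) (by grind)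
      have h4 := dg_union_le (G := G) S T v
      have h5 := hDT v hv
      have h6 : dg G T v = 0 := dg_eq_zero fun t ht hvt => h5 (mem_nbs.2 ⟨t, ht, hvt.symm⟩)
      have h7 := fun h => hX h v hv
      have h8 : v ∉ nbs G S → dg G S v = 0 := fun h => dg_eq_zero fun t ht hvt =>
        h (mem_nbs.2 ⟨t, ht, hvt.symm⟩)
      refine ⟨h1, ?_⟩
      by_cases hvS : v ∈ nbs G S
      · simp only [hvS, if_true]
        omega
      · have := h8 hvS
        simp only [hvS, if_false]
        by_cases hc : S.card = 1
        · simp only [h7 hc, if_false]; omega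
        · split_ifs <;> omega
  have h1 := ih C _ _ _ (Finset.card_lt_card ⟨hCU, fun h' => htC (h' (h.hT ht))⟩) hs
  refine (AP.inner (N := S.card) (s := 1) (e := 2) (X := X) (H := S ∪ T) (.inr rfl) hpos
      (by omega) h1 hCH hCU (Finset.union_subset h.hS h.hT) fun κ hκ j hj => ?_).mono (by omega)
  obtain ⟨x, hx, hp⟩ := bip_path_odd h.disj h.adj hκ (by have := h.card; omega) hj
  exact ⟨x, h.hTX hx, by rwa [show 1 + 2 * j = 2 * j + 1 by ring]⟩

theorem BipSys.even {S T C : Finset V} {y : V} (h : BipSys G U X Y S T k)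
    (ih : KIH G U.card) (hC : ClosedIn G (U \ (S ∪ T)) C) (hCc : ConnOn G C) (hy : y ∈ Y)
    (hyC : y ∈ C) (hT : ∃ a ∈ nbs G T, a ∈ C) (hg : Good G C (nbs G T ∪ Y) ∅) :
    AP (Len G U X Y) k := by
  have hCU : C ⊆ U := hC.1.trans Finset.sdiff_subset
  have hCH : Disjoint (S ∪ T) C := (Finset.disjoint_sdiff).mono_right hC.1
  obtain ⟨t, ht⟩ : T.Nonempty := by have := h.card; rw [← Finset.card_pos]; omega
  have htC : t ∉ C := fun h => by have := Finset.disjoint_right.1 hCH h; grind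
  have hs : KSys G C (nbs G T) Y (max (k - S.card) 1) := by
    refine KSys.of_comp (X := X) (k := k) (Y := Y) hC hCc hT ⟨y, hy, hyC⟩ hg ?_
    intro hk v hv
    have hvH := Finset.disjoint_right.1 hCH hv
    obtain ⟨h1, h2, h3⟩ := h.deg v (hCU hv) (by grind) (by grind)
    have h4 := dg_union_le (G := G) S T v
    exact ⟨h1, by omega⟩
  have h1 := ih C _ _ _ (Finset.card_lt_card ⟨hCU, fun h' => htC (h' (h.hT ht))⟩) hs
  refine (AP.inner (N := S.card + 1) (s := 0) (e := 2) (X := X) (H := S ∪ T) (.inr rfl) (by omega)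
      (by omega) h1 hCH hCU (Finset.union_subset h.hS h.hT) fun κ hκ j hj => ?_).mono (by omega)
  obtain ⟨x, hx, hp⟩ := bip_path (j := j) h.disj h.adj hκ (by have := h.card; omega) (by omega)
  exact ⟨x, h.hTX hx, by simpa using hp⟩

/-- A part `D` of `U` whose only neighbours outside are `b` and `d`. -/
theorem two_sided {D : Finset V} {b d : V} (hk : 3 ≤ k) (ih : KIH G U.card)
    (hU : ∀ c ∈ U, ConnOn G (U.erase c)) (hgY : Good G U Y ∅)
    (hdeg : ∀ v ∈ U, k + 1 ≤ dgp G U X Y v)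
    (hY2 : ∃ y₁ ∈ Y, ∃ y₂ ∈ Y, y₁ ∈ U ∧ y₂ ∈ U ∧ y₁ ≠ y₂)
    (hDU : D ⊆ U) (hb : b ∈ U) (hd : d ∈ U) (hbd : b ≠ d) (hbD : b ∉ D) (hdD : d ∉ D)
    (hDc : ConnOn G D) (hout : ∀ v ∈ D, ∀ w ∈ U, w ∉ D → G.Adj v w → w = b ∨ w = d)
    (hw : ∃ w ∈ U, w ∉ D ∧ w ≠ b ∧ w ≠ d)
    (hDY : ∀ v ∈ D, v ∉ Y) (hDX : ∃ x ∈ X, x ∈ D) (hg : Good G D (X ∪ nbs G {d}) ∅) :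
    AP (Len G U X Y) k := by
  have hDcl : ClosedIn G ((U.erase d).erase b) D := by
    refine ⟨fun x hx => by grind, fun a ha c hc hac => ?_⟩
    by_contra hcD
    have := hout a ha c
    grind
  obtain ⟨w, hwU, hwD, hwb, hwd⟩ := hw
  -- the part `D` with the roots `X` and `d`
  have hs : KSys G D X (nbs G {d}) (k - 1) := by
    refine ⟨hDc, hDX, ?_, hg, fun _ v hv => ?_⟩
    · obtain ⟨a, ha, c, hc, hcD, hac⟩ := (hU b hb).exists_adj (D := D) (fun x hx => by grind) hDc.1
        ⟨d, by grind, hdD⟩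
      have : c = d := by have := hout a ha c; grind
      exact ⟨a, mem_nbs_singleton.2 (this ▸ hac.symm), ha⟩
    · have h1 := hdeg v (hDU hv)
      have h2 : dg G U v ≤ dg G D v + (if v ∈ nbs G {d} then 1 else 0) + 1 := by
        have h3 := dg_le_add_sdiff (G := G) U D v
        have h4 : dg G (U \ D) v ≤ dg G {d} v + dg G {b} v := by
          refine le_trans (Finset.card_le_card fun x hx => ?_) (dg_union_le {d} {b} v)
          have := hout v hv x
          grind
        have h5 := dg_le_card (G := G) {b} v
        have h6 := dg_le_ite (G := G) (U := {d}) (v := v) (by grind)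
        simp only [Finset.card_singleton] at h5
        omega
      have h3 := hDY v hv
      simp only [dgp, h3, if_false] at *
      omega
  have h1 := ih D _ _ _ (Finset.card_lt_card ⟨hDU, fun h => hdD (h hd)⟩) hs
  -- the rest, with the roots `d` and `Y`
  let W := (U.erase d) \ D
  have hWU : W ⊆ U := fun x hx => by grind
  have hWc : ConnOn G W := (hU d hd).sdiff (by grind) hDcl
  obtain ⟨e, heW, hde⟩ : ∃ e ∈ W, G.Adj d e := by
    obtain ⟨a, ha, c, hc, hcD, hac⟩ := (hU b hb).exists_adj (D := insert d D)
      (fun x hx => by grind) ⟨d, by simp⟩ ⟨w, by grind, by grind⟩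
    have := hout a
    have : a = d := by grind
    exact ⟨c, by grind, this ▸ hac⟩
  obtain ⟨y₀, hy₀Y, hy₀W⟩ : ∃ y ∈ Y, y ∈ W := by
    obtain ⟨y₁, h1, y₂, h2, h3, h4, h5⟩ := hY2
    have := hDY y₁
    have := hDY y₂
    by_cases y₁ = d
    · exact ⟨y₂, h2, by grind⟩
    · exact ⟨y₁, h1, by grind⟩
  have hlen : ∀ m, Len G D X (nbs G {d}) m → ∃ x ∈ X, PathIn G (insert d D) x d (m + 1) := by
    rintro m ⟨x, hx, v, hv, hp⟩
    exact ⟨x, hx, hp.snoc hdD (mem_nbs_singleton.1 hv).symm subset_rfl⟩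
  have hdis : Disjoint (insert d D) W := by
    rw [Finset.disjoint_left]; grind
  have hsub : insert d D ∪ W ⊆ U := by
    intro x hx; grind
  by_cases htwo : ∃ a ∈ W, ∃ c ∈ W, a ≠ c ∧ a ∈ nbs G {d} ∪ Y ∧ c ∈ nbs G {d} ∪ Y
  · have h2 : AP (Len G W (nbs G {d}) Y) 2 := by
      refine TwoSys.ap (z := b) ⟨hWc, ⟨e, mem_nbs_singleton.2 hde, heW⟩, ⟨y₀, hy₀Y, hy₀W⟩,
        ?_, ?_, htwo⟩
      · intro c hc E hE hne hbE
        by_contra! hcon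
        have hcl : ClosedIn G (U.erase c) E := by
          refine ⟨fun x hx => by have := hE.1 hx; grind, fun x hx z hz hxz => ?_⟩
          have h1 := hE.2 x hx z
          have h2 := hE.1 hx
          have h3 := hcon x hx
          have h4 := hbE b (by simp)
          have h5 : z ≠ d := by
            rintro rfl
            exact h3 (Finset.mem_union_left _ (mem_nbs_singleton.2 hxz.symm))
          have h6 : z ∉ D := fun hzD => by
            have := hout z hzD x
            have := hxz.symm
            grind
          grind
        obtain ⟨v, hv, hvY⟩ := hgY c (hWU hc) E hcl hne (by simp)
        exact hcon v hv (Finset.mem_union_right _ hvY)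
      · intro v hv hvb
        have h1 := hdeg v (hWU hv)
        have h2 : dg G U v ≤ dg G W v + (if v ∈ nbs G {d} then 1 else 0) := by
          have h6 := dg_le_ite (G := G) (U := {d}) (v := v) (by grind)
          refine le_trans (le_trans (Finset.card_le_card fun x hx => ?_)
            (dg_union_le W {d} v)) (Nat.add_le_add_left h6 _)
          simp only [Finset.mem_filter] at hx ⊢
          have : x ∉ D := fun hxD => by
            have := hout x hxD v
            have := hx.2.symm
            grind
          grind
        unfold dgp at *
        split_ifs at * <;> omega
    refine AP.mono (k := k - 1 + 2 - 1) (h1.add h2 (by omega) (by omega) (s := 2) ?_) (by omega)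
    rintro m n hm ⟨v, hv, y, hy, hp⟩
    obtain ⟨x, hx, hq⟩ := hlen m hm
    refine ⟨x, hx, y, hy, ?_⟩
    rw [show m + n + 2 = m + 1 + n + 1 by ring]
    exact (hq.join hp hdis (mem_nbs_singleton.1 hv)).mono hsub
  · have hey : y₀ = e := by
      by_contra hne
      exact htwo ⟨y₀, hy₀W, e, heW, hne, by grind, Finset.mem_union_left _
        (mem_nbs_singleton.2 hde)⟩
    have hdY : d ∈ Y := by
      obtain ⟨y₁, h1, y₂, h2, h3, h4, h5⟩ := hY2
      by_contra hdY
      have := hDY y₁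
      have := hDY y₂
      exact htwo ⟨y₁, by grind, y₂, by grind, h5, by grind, by grind⟩
    refine AP.mono (k := k - 1 + 2 - 1) (h1.add (L' := fun n => n = 0 ∨ n = 1)
      ⟨0, 1, by simp, by omega⟩ (by omega) (by omega) (s := 1) ?_) (by omega)
    rintro m n hm (rfl | rfl)
    · obtain ⟨x, hx, hq⟩ := hlen m hm
      exact ⟨x, hx, d, hdY, hq.mono (by grind)⟩
    · obtain ⟨x, hx, hq⟩ := hlen m hm
      exact ⟨x, hx, e, hey ▸ hy₀Y, hq.snoc (by grind) hde (by grind)⟩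

theorem BipSys.ap {S T : Finset V} (h : BipSys G U X Y S T k) (ih : KIH G U.card)
    (hy : ∃ y ∈ Y, y ∈ U ∧ y ∉ S ∧ y ∉ T)
    (hex : S.card = 1 → (∃ v ∈ U, v ∉ S ∧ v ∉ T ∧ v ∈ X) → 3 ≤ k ∧
      (∀ c ∈ U, ConnOn G (U.erase c)) ∧ (∀ v ∈ U, k + 1 ≤ dgp G U X Y v) ∧
      ∃ y₁ ∈ Y, ∃ y₂ ∈ Y, y₁ ∈ U ∧ y₂ ∈ U ∧ y₁ ≠ y₂) :
    AP (Len G U X Y) k := by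
  obtain ⟨y, hy, hyU, hyS, hyT⟩ := hy
  obtain ⟨C, hC, hCc, hyC⟩ := exists_comp (G := G) (U := U \ (S ∪ T)) (v := y) (by grind)
  have hCU : C ⊆ U := hC.1.trans Finset.sdiff_subset
  have hCH : Disjoint (S ∪ T) C := (Finset.disjoint_sdiff).mono_right hC.1
  have hCS : ∀ v ∈ C, v ∉ S ∧ v ∉ T := fun v hv => by
    have := Finset.disjoint_right.1 hCH hv; grind
  obtain ⟨t, ht⟩ : T.Nonempty := by have := h.card; rw [← Finset.card_pos]; omega
  have htC : t ∉ C := fun h => (hCS t h).2 ht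
  by_cases hT : ∃ a ∈ nbs G T, a ∈ C
  swap
  · push Not at hT
    refine h.odd_comp ih hC hCc hy hyC (fun v hv hvT => hT v hvT hv) fun hc v hv hvX => ?_
    obtain ⟨-, hU, -⟩ := hex hc ⟨v, hCU hv, (hCS v hv).1, (hCS v hv).2, hvX⟩
    obtain ⟨b, rfl⟩ := Finset.card_eq_one.1 hc
    have hbU : b ∈ U := h.hS (by simp)
    have hbT := h.disj b (by simp)
    obtain ⟨a, ha, c, hc, hcD, hac⟩ := (hU b hbU).exists_adj (D := C) (fun x hx => by
      have := hCS x hx; grind) hCc.1 ⟨t, by have := h.hT ht; grind, htC⟩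
    have h1 := hC.2 a ha c
    exact hT a (mem_nbs.2 ⟨c, by grind, hac.symm⟩) ha
  by_cases hg : Good G C (nbs G T ∪ Y) ∅
  · exact h.even ih hC hCc hy hyC hT hg
  have hbad : ∃ d ∈ C, ∃ D, ClosedIn G (C.erase d) D ∧ ConnOn G D ∧
      ∀ v ∈ D, v ∉ nbs G T ∧ v ∉ Y := by
    unfold Good at hg
    push Not at hg
    obtain ⟨d, hd, D, hD, ⟨v, hv⟩, -, hDW⟩ := hg
    obtain ⟨D', hD', hDc', -⟩ := exists_comp (G := G) hv
    exact ⟨d, hd, D', hD.trans hD', hDc', fun v hv => by have := hDW v (hD'.1 hv); grind⟩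
  by_cases hgood : ∃ d ∈ C, ∃ D, ClosedIn G (C.erase d) D ∧ ConnOn G D ∧
      (∀ v ∈ D, v ∉ nbs G T ∧ v ∉ Y) ∧ (S.card = 1 → ∀ v ∈ D, v ∉ X)
  · obtain ⟨d, hd, D, hD, hDc, hDW, hDX⟩ := hgood
    exact h.odd_part ih hC hCc hy hyC hd hD hDc (fun v hv => (hDW v hv).1)
      (fun v hv => (hDW v hv).2) hDX
  push Not at hgood
  obtain ⟨d, hd, D, hD, hDc, hDW⟩ := hbad
  obtain ⟨hc, x, hxD, hxX⟩ := hgood d hd D hD hDc hDW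
  have hDC : D ⊆ C := hD.1.trans (Finset.erase_subset _ _)
  have hdD : d ∉ D := fun h => by simpa using hD.1 h
  obtain ⟨hk, hU, hdeg, hY2⟩ := hex hc ⟨x, hCU (hDC hxD), (hCS x (hDC hxD)).1,
    (hCS x (hDC hxD)).2, hxX⟩
  obtain ⟨b, rfl⟩ := Finset.card_eq_one.1 hc
  have hbC : b ∉ C := fun hb => (hCS b hb).1 (by simp)
  have hbT := h.disj b (by simp)
  refine two_sided (b := b) hk ih hU h.good hdeg hY2 (hDC.trans hCU) (h.hS (by simp)) (hCU hd)
    (by grind) (by grind) hdD hDc ?_ ⟨t, h.hT ht, by grind, by grind, by grind⟩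
    (fun v hv => (hDW v hv).2) ⟨x, hxX, hxD⟩ ?_
  · intro v hv w hw hwD hvw
    have h1 := hC.2 v (hDC hv) w
    have h2 := hD.2 v hv w
    have h3 : w ∉ T := fun hwT => (hDW v hv).1 (mem_nbs.2 ⟨w, hwT, hvw.symm⟩)
    grind
  · intro e he E hE hne _
    by_contra! hcon
    obtain ⟨v, hv⟩ := hne
    obtain ⟨E', hE', hEc', -⟩ := exists_comp (G := G) hv
    have hE'D : E' ⊆ D := fun x hx => by have := hE.1 (hE'.1 hx); grind
    have hcl : ClosedIn G (C.erase e) E' := by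
      refine ⟨fun x hx => by have := hE.1 (hE'.1 hx); grind, fun a ha c hc hac => ?_⟩
      have h1 := hD.2 a (hE'D ha) c
      have h2 := hE.2 a (hE'.1 ha) c
      have h3 := hE'.2 a ha c
      have h4 := hcon a (hE'.1 ha)
      have h5 : c ≠ d := by
        rintro rfl
        exact h4 (Finset.mem_union_right _ (mem_nbs_singleton.2 hac.symm))
      grind
    obtain ⟨-, z, hz, hzX⟩ := hgood e (hDC he) E' hcl hEc' fun v hv => hDW v (hE'D hv)
    exact hcon z (hE'.1 hz) (Finset.mem_union_left _ hzX)

end Bip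

section RootedPaths

variable {U X Y : Finset V}

theorem dg_eq_card {K : Finset V} {v : V} : dg G K v = K.card ↔ ∀ a ∈ K, G.Adj v a := by
  unfold dg
  rw [Finset.card_filter_eq_iff]

theorem dg_eq_zero_of_notMem {K : Finset V} {v : V} (h : v ∉ nbs G K) : dg G K v = 0 :=
  dg_eq_zero fun a ha hva => h (mem_nbs.2 ⟨a, ha, hva.symm⟩)

/-- A rooted system without cutvertices. -/
structure BlockSys (G : SimpleGraph V) [DecidableRel G.Adj] (U X Y : Finset V) (k : ℕ) :
    Prop where
  sys : KSys G U X Y k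
  hk : 3 ≤ k
  goodX : Good G U X ∅
  goodY : Good G U Y ∅
  block : ∀ c ∈ U, ConnOn G (U.erase c)

theorem BlockSys.symm (h : BlockSys G U X Y k) : BlockSys G U Y X k :=
  ⟨h.sys.symm, h.hk, h.goodY, h.goodX, h.block⟩

theorem BlockSys.deg (h : BlockSys G U X Y k) : ∀ v ∈ U, k + 1 ≤ dgp G U X Y v :=
  h.sys.deg (by have := h.hk; omega)

theorem BlockSys.two_mem (h : BlockSys G U X Y k) :
    ∃ y₁ ∈ Y, ∃ y₂ ∈ Y, y₁ ∈ U ∧ y₂ ∈ U ∧ y₁ ≠ y₂ := by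
  obtain ⟨y, hy, hyU⟩ := h.sys.hY
  by_contra! hcon
  have := h.goodY.eq_singleton hyU fun v hv hvY => hcon v hvY y hy hv hyU
  have h1 := h.deg y hyU
  have h2 : dg G U y = 0 := dg_eq_zero (by simp [this])
  have := h.hk
  unfold dgp at h1
  split_ifs at h1 <;> omega

theorem BlockSys.good_erase (h : BlockSys G U X Y k) {t : V} (ht : t ∈ U) :
    Good G (U.erase t) (nbs G {t}) ∅ := by
  intro c hc D hD hne _
  by_contra! hcon
  have hcl : ClosedIn G (U.erase c) D := by
    refine ⟨fun x hx => by have := hD.1 hx; grind, fun a ha b hb hab => ?_⟩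
    have h1 := hD.2 a ha b
    have h2 := hcon a ha
    have : b ≠ t := by rintro rfl; exact h2 (mem_nbs_singleton.2 hab.symm)
    grind
  have h1 := (h.block c (by grind)).2 D hcl hne
  have := hD.1 (show t ∈ D by grind)
  grind

theorem Len.of_erase {X' : Finset V} {t : V} {n : ℕ} (h : Len G (U.erase t) X' (nbs G {t}) n)
    (ht : t ∈ U) (hX : X' ⊆ X) (hY : t ∈ Y) : Len G U X Y (n + 1) := by
  obtain ⟨x, hx, v, hv, hp⟩ := h
  exact ⟨x, hX hx, t, hY, hp.snoc (by simp) (mem_nbs_singleton.1 hv).symm (by grind)⟩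

theorem BlockSys.of_adj (h : BlockSys G U X Y k) (ih : KIH G U.card) {x x' : V} (hx : x ∈ X)
    (hxU : x ∈ U) (hx' : x' ∈ X) (hxU' : x' ∈ U) (hxx : G.Adj x x') :
    AP (Len G U X Y) k ∨ ∃ K, K ⊆ X ∩ U ∧ (∀ a ∈ K, ∀ b ∈ K, a ≠ b → G.Adj a b) ∧
      ∀ y ∈ Y, y ∈ U → y ∈ K := by
  obtain ⟨K, hKW, hK, hc, hmax⟩ := exists_max_clique (G := G) (W := X ∩ U) (K₀ := {x, x'})
    (by grind) (by have := hxx.symm; grind)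
  rw [Finset.card_pair hxx.ne] at hc
  by_cases hy : ∃ y ∈ Y, y ∈ U ∧ y ∉ K
  swap
  · push Not at hy
    exact .inr ⟨K, hKW, hK, hy⟩
  refine .inl (clique_core ih h.sys.conn (h.goodY.mono (by simp) (by simp)) (by grind) (by grind)
    (Finset.card_pos.1 (by omega)) hK (fun v hv hvK => ⟨h.deg v hv, ?_⟩) hy)
  have h1 := dg_le_card (G := G) K v
  have h2 := dg_eq_zero_of_notMem (G := G) (K := K) (v := v)
  by_cases hvX : v ∈ X
  · have := hmax v (by grind) hvK
    split_ifs <;> grind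
  · split_ifs <;> grind

theorem clique_two_path {B : Finset V} {t t' κ : V} {j : ℕ}
    (hB : ∀ a ∈ B, ∀ b ∈ B, a ≠ b → G.Adj a b) (hc : 2 ≤ B.card) (ht : t ∉ B) (ht' : t' ∉ B)
    (htt : t ≠ t') (hadj : ∀ b ∈ B, G.Adj t b ∧ G.Adj t' b) (hκ : κ ∈ B) (hj : j < B.card + 1) :
    PathIn G (B ∪ {t, t'}) t κ (1 + 1 * j) := by
  rcases Nat.lt_succ_iff_lt_or_eq.1 hj with hj | rfl
  · obtain ⟨x, hx, hp⟩ := clique_path hB hκ hj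
    have h1 := hp.cons' (W := B ∪ {t, t'}) ht (hadj x hx).1 (by grind)
    rwa [show 1 + 1 * j = j + 1 by ring]
  · have hcκ := Finset.card_erase_of_mem hκ
    obtain ⟨b, hb⟩ : (B.erase κ).Nonempty := by rw [← Finset.card_pos]; omega
    have hb' : b ∈ B := Finset.mem_of_mem_erase hb
    have hcb := Finset.card_erase_of_mem hb'
    obtain ⟨x, hx, hp⟩ := clique_path (K := B.erase b) (κ := κ) (j := B.card - 2)
      (fun a ha c hc => hB a (by grind) c (by grind)) (by grind) (by omega)
    have h1 := hp.cons' (a := t') (W := insert t' (B.erase b)) (by grind)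
      (hadj x (by grind)).2 subset_rfl
    have h2 := h1.cons' (a := b) (W := insert t' B) (by grind) (hadj b hb').2.symm
      (by grind)
    have h3 := h2.cons' (a := t) (W := B ∪ {t, t'}) (by grind) (hadj b hb').1 (by grind)
    rwa [show B.card - 2 + 1 + 1 + 1 = 1 + 1 * B.card by omega] at h3

theorem clique_two_path' {B : Finset V} {t t' : V} {j : ℕ}
    (hB : ∀ a ∈ B, ∀ b ∈ B, a ≠ b → G.Adj a b) (ht : t ∉ B) (ht' : t' ∉ B)
    (htt : t ≠ t') (hadj : ∀ b ∈ B, G.Adj t b ∧ G.Adj t' b) (hj : j < B.card) :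
    PathIn G (B ∪ {t, t'}) t t' (2 + 1 * j) := by
  obtain ⟨κ, hκ⟩ := Finset.card_pos.1 (show 0 < B.card by omega)
  obtain ⟨x, hx, hp⟩ := clique_path hB hκ hj
  have h1 := hp.cons' (a := t) (W := insert t B) ht (hadj x hx).1 subset_rfl
  have h2 := h1.snoc (c := t') (W := B ∪ {t, t'}) (by grind) (hadj κ hκ).2.symm (by grind)
  rwa [show j + 1 + 1 = 2 + 1 * j by ring] at h2

theorem BlockSys.of_common (h : BlockSys G U X Y k) (ih : KIH G U.card)
    (hXi : ∀ a ∈ X, ∀ b ∈ X, a ∈ U → b ∈ U → ¬G.Adj a b) {t₁ t₂ b₁ b₂ : V}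
    (ht₁ : t₁ ∈ X)
    (ht₁U : t₁ ∈ U) (ht₂ : t₂ ∈ X) (ht₂U : t₂ ∈ U) (htt : t₁ ≠ t₂) (hb₁ : b₁ ∈ U) (hb₂ : b₂ ∈ U)
    (h11 : G.Adj t₁ b₁) (h12 : G.Adj t₁ b₂) (h21 : G.Adj t₂ b₁) (h22 : G.Adj t₂ b₂)
    (hbb : G.Adj b₁ b₂) :
    AP (Len G U X Y) k ∨ ∃ B : Finset V, (∀ a ∈ B, ∀ b ∈ B, a ≠ b → G.Adj a b) ∧
      (∀ b ∈ B, G.Adj t₁ b ∧ G.Adj t₂ b) ∧ ∀ y ∈ Y, y ∈ U → y ∈ B ∨ y = t₁ ∨ y = t₂ := by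
  obtain ⟨B, hBW, hB, hc, hmax⟩ := exists_max_clique (G := G)
    (W := U.filter fun v => G.Adj t₁ v ∧ G.Adj t₂ v) (K₀ := {b₁, b₂})
    (by grind) (by have := hbb.symm; grind)
  rw [Finset.card_pair hbb.ne] at hc
  have hBt : ∀ b ∈ B, b ∈ U ∧ G.Adj t₁ b ∧ G.Adj t₂ b := fun b hb => by
    have := hBW hb; grind
  have ht₁B : t₁ ∉ B := fun h => (hBt t₁ h).2.1.ne rfl
  have ht₂B : t₂ ∉ B := fun h => (hBt t₂ h).2.2.ne rfl
  by_cases hy : ∃ y ∈ Y, y ∈ U ∧ ¬(y ∈ B ∨ y = t₁ ∨ y = t₂)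
  swap
  · push Not at hy
    exact .inr ⟨B, hB, fun b hb => (hBt b hb).2, hy⟩
  left
  obtain ⟨y, hy, hyU, hyH⟩ := hy
  let H := B ∪ {t₁, t₂}
  have hHU : H ⊆ U := fun x hx => by have := hBt x; grind
  obtain ⟨C, hC, hCc, hyC⟩ := exists_comp (G := G) (U := U \ H) (v := y) (by grind)
  have hCU : C ⊆ U := hC.1.trans Finset.sdiff_subset
  have hCH : Disjoint H C := (Finset.disjoint_sdiff).mono_right hC.1
  have hCB : ∀ v ∈ C, v ∉ B ∧ v ≠ t₁ ∧ v ≠ t₂ := fun v hv => by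
    have := Finset.disjoint_right.1 hCH hv; grind
  have htC : t₁ ∉ C := fun h => (hCB _ h).2.1 rfl
  have hlt : ∀ D ⊆ C, D.card < U.card := fun D hD =>
    Finset.card_lt_card ⟨hD.trans hCU, fun h => htC (hD (h ht₁U))⟩
  have hτ : ∀ v ∈ C, dg G H v ≤ dg G B v + dg G {t₁, t₂} v ∧ dg G {t₁, t₂} v ≤ 2 ∧
      (v ∈ X → dg G {t₁, t₂} v = 0) ∧ (dg G {t₁, t₂} v = 2 → dg G B v + 1 ≤ B.card) := by
    intro v hv
    have hcard : ({t₁, t₂} : Finset V).card = 2 := Finset.card_pair htt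
    refine ⟨dg_union_le _ _ v, hcard ▸ dg_le_card _ v, fun hvX => dg_eq_zero fun a ha => ?_,
      fun hτ => ?_⟩
    · have h1 := hXi v hvX t₁ ht₁ (hCU hv) ht₁U
      have h2 := hXi v hvX t₂ ht₂ (hCU hv) ht₂U
      grind
    · rw [← hcard, dg_eq_card] at hτ
      have h1 := (hτ t₁ (by simp)).symm
      have h2 := (hτ t₂ (by simp)).symm
      exact hmax v (by have := hCU hv; grind) (hCB v hv).1
  -- a part whose neighbours in `H` are only `t₁` and `t₂`
  have fin : ∀ D ⊆ C, ∀ Z, KSys G D (nbs G {t₁, t₂}) Z (max (k + 1 - B.card) 1) →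
      AP (Len G (H ∪ D) X Z) k := by
    intro D hD Z hs
    have h1 := ih D _ _ _ (hlt D hD) hs
    refine (AP.inner (N := B.card) (s := 2) (e := 1) (X := X) (H := H) (.inl rfl) (by omega)
      (by omega) h1 (hCH.mono_right hD) (by grind) (by grind) fun κ hκ j hj => ?_).mono (by omega)
    have h1 := clique_two_path' hB ht₁B ht₂B htt (fun b hb => (hBt b hb).2) hj
    have h2 := clique_two_path' hB ht₂B ht₁B htt.symm (fun b hb => (hBt b hb).2.symm) hj
    rw [Finset.pair_comm] at h2
    rcases Finset.mem_insert.1 hκ with rfl | hκ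
    · exact ⟨t₂, ht₂, h2⟩
    · rw [Finset.mem_singleton] at hκ
      subst hκ
      exact ⟨t₁, ht₁, h1⟩
  have hloss : 2 ≤ max (k + 1 - B.card) 1 → ∀ v ∈ C, v ∉ nbs G B → k + 1 ≤ dgp G U X Y v ∧
      dg G H v + (if v ∈ X then 1 else 0) + max (k + 1 - B.card) 1 ≤
        k + (if v ∈ nbs G {t₁, t₂} then 1 else 0) := by
    intro hk v hv hvB
    obtain ⟨h1, h2, h3, h4⟩ := hτ v hv
    have h5 := dg_eq_zero_of_notMem hvB
    have h6 := dg_eq_zero_of_notMem (G := G) (K := {t₁, t₂}) (v := v)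
    refine ⟨h.deg v (hCU hv), ?_⟩
    by_cases hvX : v ∈ X
    · have := h3 hvX
      simp only [hvX, if_true]
      omega
    · by_cases hvt : v ∈ nbs G {t₁, t₂}
      · simp only [hvX, hvt, if_true, if_false]
        omega
      · have := h6 hvt
        simp only [hvX, hvt, if_false]
        omega
  by_cases hCB' : ∃ a ∈ nbs G B, a ∈ C
  swap
  · push Not at hCB'
    have key : ∀ v ∈ C, ∀ w ∈ U, w ∉ C → G.Adj v w → w = t₁ ∨ w = t₂ := by
      intro v hv w hw hwC hvw
      have h1 := hC.2 v hv w
      have h3 : w ∉ B := fun hwT => hCB' v (mem_nbs.2 ⟨w, hwT, hvw.symm⟩) hv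
      grind
    obtain ⟨a, haC, b, hb, hbC, hab⟩ := h.sys.conn.exists_adj hCU hCc.1 ⟨t₁, ht₁U, htC⟩
    have hab' := key a haC b hb hbC hab
    refine (fin C subset_rfl Y (KSys.of_comp (X := X) (k := k) (Y := Y) hC hCc
      ⟨a, mem_nbs.2 ⟨b, by grind, hab.symm⟩, haC⟩ ⟨y, hy, hyC⟩ ?_
      fun hk v hv => hloss hk v hv fun h => hCB' v h hv)).imp (s := 0) ?_
    · refine Good.sub (h.goodY) hCU (fun v hv hvW => Finset.mem_union_right _ hvW) ?_
      intro v hv w hw hwD hvw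
      exact Finset.mem_union_left _ (mem_nbs.2 ⟨w, by grind, hvw.symm⟩)
    · rintro n ⟨x, hx, y, hy, hp⟩
      exact ⟨x, hx, y, hy, hp.mono (by grind)⟩
  by_cases hg : Good G C (nbs G B ∪ Y) ∅
  · have hs : KSys G C (nbs G B) Y (max (k - B.card) 1) := by
      refine KSys.of_comp (X := X) (k := k) (Y := Y) hC hCc hCB' ⟨y, hy, hyC⟩ hg ?_
      intro hk v hv
      obtain ⟨h1, h2, h3, h4⟩ := hτ v hv
      have h5 := dg_eq_zero_of_notMem (G := G) (K := B) (v := v)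
      have h6 := dg_le_card (G := G) B v
      refine ⟨h.deg v (hCU hv), ?_⟩
      by_cases hvX : v ∈ X
      · have := h3 hvX
        by_cases hvB : v ∈ nbs G B
        · simp only [hvX, hvB, if_true]
          omega
        · have := h5 hvB
          simp only [hvX, hvB, if_true, if_false]
          omega
      · by_cases hvB : v ∈ nbs G B
        · simp only [hvX, hvB, if_true, if_false]
          omega
        · have := h5 hvB
          simp only [hvX, hvB, if_false]
          omega
    refine (AP.inner (N := B.card + 1) (s := 1) (e := 1) (X := X) (H := H) (.inl rfl) (by omega)
      (by omega) (ih C _ _ _ (hlt C subset_rfl) hs) hCH hCU hHU fun κ hκ j hj =>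
      ⟨t₁, ht₁, clique_two_path hB hc ht₁B ht₂B htt (fun b hb => (hBt b hb).2) hκ hj⟩).mono (by omega)
  · unfold Good at hg
    push Not at hg
    obtain ⟨d, hd, D₀, hD₀, ⟨v, hv⟩, -, hDW₀⟩ := hg
    obtain ⟨D, hD', hDc, -⟩ := exists_comp (G := G) hv
    have hD := hD₀.trans hD'
    have hDW : ∀ v ∈ D, v ∉ nbs G B ∧ v ∉ Y := fun v hv => by
      have := hDW₀ v (hD'.1 hv); grind
    have hDC : D ⊆ C := hD.1.trans (Finset.erase_subset _ _)
    have hdD : d ∉ D := fun h => by simpa using hD.1 h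
    have key : ∀ v ∈ D, ∀ w ∈ U, w ∉ D → G.Adj v w → w = d ∨ w = t₁ ∨ w = t₂ := by
      intro v hv w hw hwD hvw
      have h1 := hC.2 v (hDC hv) w
      have h2 := hD.2 v hv w
      have h3 : w ∉ B := fun hwT => (hDW v hv).1 (mem_nbs.2 ⟨w, hwT, hvw.symm⟩)
      grind
    obtain ⟨a, haD, ha⟩ : ∃ a ∈ D, a ∈ nbs G {t₁, t₂} := by
      by_contra! hcon
      have hcl : ClosedIn G (U.erase d) D := by
        refine ⟨fun x hx => by grind, fun a ha b hb hab => ?_⟩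
        by_contra hbD
        have h1 := key a ha b (by grind) hbD hab
        refine hcon a ha (mem_nbs.2 ⟨b, by grind, hab.symm⟩)
      obtain ⟨v, hv, hvY⟩ := h.goodY d (hCU hd) D hcl hDc.1 (by simp)
      exact (hDW v hv).2 hvY
    have h2 := fin D hDC (nbs G {d}) (KSys.of_part (X := X) (k := k) (Y := Y) hC hCc hd hD hDc
      ⟨a, ha, haD⟩ (fun v hv => (hDW v hv).2) (by
        refine Good.sub (h.goodY) (hDC.trans hCU) (fun v hv hvW => absurd hvW (hDW v hv).2) ?_
        intro v hv w hw hwD hvw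
        rcases key v hv w hw hwD hvw with rfl | hwS
        · exact Finset.mem_union_right _ (mem_nbs_singleton.2 hvw.symm)
        · exact Finset.mem_union_left _ (mem_nbs.2 ⟨w, by grind, hvw.symm⟩))
      fun hk v hv => hloss hk v (hDC hv) (hDW v hv).1)
    obtain ⟨m, hm⟩ := (hCc.sdiff hd hD).exists_path (a := d) (b := y)
      (by grind) (by have := fun h => (hDW y h).2; grind)
    refine h2.imp (s := m + 1) fun n hn => Len.tail hn (hm.mono fun x hx => ?_) (by grind) hy
    have := fun h : x ∈ C => Finset.disjoint_right.1 hCH h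
    grind

/-- Both roots attach to the same clique. -/
theorem BlockSys.of_clique (h : BlockSys G U X Y k) (ih : KIH G U.card) {K : Finset V}
    (hK : ∀ a ∈ K, ∀ b ∈ K, a ≠ b → G.Adj a b) (hX : X ∩ U = K) (hY : Y ∩ U = K) :
    AP (Len G U X Y) k := by
  obtain ⟨u, hu, u', hu', huU, huU', huu⟩ := h.two_mem
  have hmX : ∀ v, v ∈ K ↔ v ∈ X ∧ v ∈ U := fun v => by rw [← hX, Finset.mem_inter]
  have hmY : ∀ v, v ∈ K ↔ v ∈ Y ∧ v ∈ U := fun v => by rw [← hY, Finset.mem_inter]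
  have huK : u ∈ K := (hmY u).2 ⟨hu, huU⟩
  have huK' : u' ∈ K := (hmY u').2 ⟨hu', huU'⟩
  have hKU : K ⊆ U := fun v hv => ((hmX v).1 hv).2
  have hce := Finset.card_erase_of_mem huK
  by_cases hy : ∃ y ∈ U, y ∉ K ∧ G.Adj u y
  · obtain ⟨y, hyU, hyK, huy⟩ := hy
    have hce' := Finset.card_erase_of_mem huU
    have hlt : (U.erase u).card < U.card := Finset.card_erase_lt_of_mem huU
    refine (clique_core (U := U.erase u) (X := K.erase u) (Y := nbs G {u}) (K := K.erase u)
      (fun U' X' Y' k' hc => ih U' X' Y' k' (by omega)) (h.block u huU)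
      ((h.good_erase huU).mono (by simp) (by simp)) (Finset.erase_subset_erase _ hKU) subset_rfl
      ⟨u', by grind⟩ (fun a ha b hb => hK a (by grind) b (by grind)) ?_
      ⟨y, mem_nbs_singleton.2 huy, by grind, by grind⟩).imp (s := 1) fun n hn =>
      hn.of_erase huU (fun x hx => ((hmX x).1 (by grind)).1) ((hmY u).1 huK).1
    intro v hv hvK
    have hvU : v ∈ U := by grind
    have hvX : v ∉ X := fun h => by have := hmX v; grind
    have hvY : v ∉ Y := fun h => by have := hmY v; grind
    have h1 := h.deg v hvU
    have h2 := dg_le_of_closedIn (G := G) (U := U) (D := U.erase u) (c := u)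
      ⟨subset_rfl, fun a ha b hb _ => hb⟩ hv
    have h3 := dg_le_card (G := G) (K.erase u) v
    have h4 := dg_eq_zero_of_notMem (G := G) (K := K.erase u) (v := v)
    have h5 : 0 < (K.erase u).card := Finset.card_pos.2 ⟨u', by grind⟩
    simp only [dgp, hvX, hvY, hvK, if_false] at *
    refine ⟨by omega, ?_⟩
    split_ifs with hn
    · omega
    · have := h4 hn; omega
  · push Not at hy
    have h1 : dg G U u ≤ (K.erase u).card := by
      refine Finset.card_le_card fun x hx => ?_
      have := hy x
      have : G.Adj u x → u ≠ x := fun h => h.ne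
      grind
    have h2 := h.deg u huU
    have h3 : 0 < K.card := Finset.card_pos.2 ⟨u, huK⟩
    have h5 := Finset.card_erase_of_mem huK
    have h4 : dgp G U X Y u ≤ dg G U u + 2 := by unfold dgp; split_ifs <;> omega
    refine ⟨0, 1, .inl rfl, fun i hi => ?_⟩
    obtain ⟨x, hx, hp⟩ := clique_path hK huK (j := i) (by omega)
    exact ⟨x, ((hmX x).1 hx).1, u, hu, by simpa using hp.mono hKU⟩

/-- Both roots attach to the same side of a complete bipartite subgraph. -/
theorem BlockSys.of_bip (h : BlockSys G U X Y k) (ih : KIH G U.card) {S T : Finset V} {t : V}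
    (hX : X ∩ U = T) (hY : Y ∩ U = T) (hi : ∀ a ∈ T, ∀ b ∈ T, ¬G.Adj a b) (ht : t ∈ T)
    (hS : S ⊆ U) (hST : ∀ s ∈ S, ∀ t ∈ T, G.Adj s t) (hc : S.card + 2 ≤ T.card)
    (hb : ∀ v ∈ U, v ∉ S → v ∉ T → dg G (T.erase t) v ≤ S.card + 1 ∧
      (2 ≤ dg G (T.erase t) v → dg G S v = 0)) : AP (Len G U X Y) k := by
  have hmX : ∀ v, v ∈ T ↔ v ∈ X ∧ v ∈ U := fun v => by rw [← hX, Finset.mem_inter]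
  have hmY : ∀ v, v ∈ T ↔ v ∈ Y ∧ v ∈ U := fun v => by rw [← hY, Finset.mem_inter]
  have hTU : T ⊆ U := fun v hv => ((hmX v).1 hv).2
  have htU := hTU ht
  have hdis : ∀ s ∈ S, s ∉ T := fun s hs hsT => (hST s hs s hsT).ne rfl
  have hce := Finset.card_erase_of_mem ht
  by_cases hy : ∃ y ∈ U, y ∉ S ∧ G.Adj t y
  · obtain ⟨y, hyU, hyS, hty⟩ := hy
    have hyT : y ∉ T := fun hyT => hi t ht y hyT hty
    have hlt : (U.erase t).card < U.card := Finset.card_erase_lt_of_mem htU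
    have hs : BipSys G (U.erase t) (T.erase t) (nbs G {t}) S (T.erase t) k := by
      refine ⟨h.block t htU, h.good_erase htU, fun x hx => ?_, Finset.erase_subset_erase _ hTU,
        subset_rfl, fun s hs => ?_, fun s hs t ht => hST s hs t (by grind), by omega, ?_⟩
      · have := hdis x hx; have := hS hx; grind
      · have := hdis s hs; grind
      · intro v hv hvS hvT
        have hvU : v ∈ U := by grind
        have hvT' : v ∉ T := by grind
        have hvX : v ∉ X := fun h => hvT' ((hmX v).2 ⟨h, hvU⟩)
        have hvY : v ∉ Y := fun h => hvT' ((hmY v).2 ⟨h, hvU⟩)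
        have h1 := h.deg v hvU
        have h2 := dg_le_of_closedIn (G := G) (U := U) (D := U.erase t) (c := t)
          ⟨subset_rfl, fun a ha b hb _ => hb⟩ hv
        have h3 := dg_le_card (G := G) S v
        have h4 := dg_eq_zero_of_notMem (G := G) (K := T.erase t) (v := v)
        obtain ⟨h5, h6⟩ := hb v hvU hvS hvT'
        simp only [dgp, hvX, hvY, hvT, if_false] at *
        refine ⟨by omega, ?_, by omega⟩
        split_ifs with hn
        · omega
        · have := h4 hn; omega
    refine (hs.ap (fun U' X' Y' k' hc => ih U' X' Y' k' (by omega))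
      ⟨y, mem_nbs_singleton.2 hty, by have := hty.ne; grind, hyS, by grind⟩ ?_).imp (s := 1)
      fun n hn => hn.of_erase htU (fun x hx => ((hmX x).1 (by grind)).1) ((hmY t).1 ht).1
    rintro - ⟨v, -, -, hv, hv'⟩
    exact absurd hv' hv
  · push Not at hy
    have h1 : dg G U t ≤ S.card := by
      refine Finset.card_le_card fun x hx => ?_
      have := hy x
      grind
    have h2 := h.deg t htU
    have h4 : dgp G U X Y t ≤ dg G U t + 2 := by unfold dgp; split_ifs <;> omega
    refine ⟨0, 2, .inr rfl, fun i hi => ?_⟩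
    obtain ⟨x, hx, hp⟩ := bip_path hdis hST ht (j := i) (by omega) (by omega)
    exact ⟨x, ((hmX x).1 hx).1, t, ((hmY t).1 ht).1,
      by simpa using hp.mono (Finset.union_subset hS hTU)⟩

theorem BlockSys.of_indep (h : BlockSys G U X Y k) (ih : KIH G U.card)
    (hXi : ∀ a ∈ X, ∀ b ∈ X, a ∈ U → b ∈ U → ¬G.Adj a b)
    (hcn : ∀ t₁ ∈ X, ∀ t₂ ∈ X, t₁ ∈ U → t₂ ∈ U → t₁ ≠ t₂ → ∀ b₁ ∈ U, ∀ b₂ ∈ U, G.Adj t₁ b₁ →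
      G.Adj t₁ b₂ → G.Adj t₂ b₁ → G.Adj t₂ b₂ → ¬G.Adj b₁ b₂) :
    AP (Len G U X Y) k ∨ ∃ S T : Finset V, S ⊆ U ∧ T ⊆ X ∩ U ∧ S.card + 1 ≤ T.card ∧
      (∀ s ∈ S, ∀ t ∈ T, G.Adj s t) ∧
      (∀ v ∈ U, v ∉ S → v ∉ T → v ∉ X → dg G T v ≤ S.card + 1 ∧ (2 ≤ dg G T v → dg G S v = 0)) ∧
      ∀ y ∈ Y, y ∈ U → y ∈ S ∨ y ∈ T := by
  classical
  let T : Finset V → Finset V := fun S => (X ∩ U).filter fun x => ∀ s ∈ S, G.Adj s x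
  have hT : ∀ S v, v ∈ T S ↔ v ∈ X ∧ v ∈ U ∧ ∀ s ∈ S, G.Adj s v := fun S v => by
    simp [T, and_assoc]
  obtain ⟨x, hx, hxU⟩ := h.sys.hX
  obtain ⟨S, hS, hmax⟩ := (U.powerset.filter fun S => S.card + 1 ≤ (T S).card).exists_max_image
    Finset.card ⟨∅, by
      simp only [Finset.mem_filter, Finset.mem_powerset, Finset.empty_subset, true_and,
        Finset.card_empty]
      exact Finset.card_pos.2 ⟨x, (hT _ _).2 ⟨hx, hxU, by simp⟩⟩⟩
  simp only [Finset.mem_filter, Finset.mem_powerset] at hS hmax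
  obtain ⟨hSU, hc⟩ := hS
  have hST : ∀ s ∈ S, ∀ t ∈ T S, G.Adj s t := fun s hs t ht => ((hT S t).1 ht).2.2 s hs
  have hTX : T S ⊆ X ∩ U := Finset.filter_subset _ _
  have hbd : ∀ v ∈ U, v ∉ S → v ∉ T S → v ∉ X →
      dg G (T S) v ≤ S.card + 1 ∧ (2 ≤ dg G (T S) v → dg G S v = 0) := by
    intro v hv hvS hvT hvX
    constructor
    · by_contra! hcon
      have h1 := hmax (insert v S) ⟨Finset.insert_subset hv hSU, by
        rw [Finset.card_insert_of_notMem hvS]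
        refine le_trans hcon (Finset.card_le_card fun x hx => ?_)
        rw [Finset.mem_filter, hT] at hx
        rw [hT]
        grind⟩
      rw [Finset.card_insert_of_notMem hvS] at h1
      omega
    · intro h2
      obtain ⟨t₁, h1, t₂, h2, hne⟩ := Finset.one_lt_card.1 h2
      rw [Finset.mem_filter] at h1 h2
      obtain ⟨h3, h4, h5⟩ := (hT _ _).1 h1.1
      obtain ⟨h6, h7, h8⟩ := (hT _ _).1 h2.1
      exact dg_eq_zero fun s hs hvs => hcn t₁ h3 t₂ h6 h4 h7 hne v hv s (hSU hs) h1.2.symm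
        (h5 s hs).symm h2.2.symm (h8 s hs).symm hvs
  by_cases hy : ∃ y ∈ Y, y ∈ U ∧ y ∉ S ∧ y ∉ T S
  swap
  · push Not at hy
    exact .inr ⟨S, T S, hSU, hTX, hc, hST, hbd, fun y hyY hyU => by have := hy y hyY hyU; tauto⟩
  refine .inl (BipSys.ap (S := S) (T := T S) ⟨h.sys.conn, h.goodY, hSU,
    hTX.trans Finset.inter_subset_right, hTX.trans Finset.inter_subset_left,
    fun s hs hsT => (hST s hs s hsT).ne rfl, hST, hc, fun v hv hvS hvT => ⟨h.deg v hv, ?_⟩⟩ ih hy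
    fun _ _ => ⟨h.hk, h.block, h.deg, h.two_mem⟩)
  by_cases hvX : v ∈ X
  · have h1 : dg G (T S) v = 0 := dg_eq_zero fun t ht => by
      have := (hT _ _).1 ht
      exact hXi v hvX t this.1 hv this.2.1
    have h2 : dg G S v ≠ S.card := fun h2 => by
      rw [dg_eq_card] at h2
      exact hvT ((hT _ _).2 ⟨hvX, hv, fun s hs => (h2 s hs).symm⟩)
    have h3 := dg_le_card (G := G) S v
    simp only [hvX, if_true]
    omega
  · obtain ⟨h1, h2⟩ := hbd v hv hvS hvT hvX
    have h3 := dg_le_card (G := G) S v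
    have h4 := dg_eq_zero_of_notMem (G := G) (K := T S) (v := v)
    simp only [hvX, if_false]
    split_ifs with hn
    · omega
    · have := h4 hn; omega

theorem BlockSys.ap (h : BlockSys G U X Y k) (ih : KIH G U.card) : AP (Len G U X Y) k := by
  by_contra hno
  have hno' : ¬AP (Len G U Y X) k := fun h => hno h.symm
  -- adjacent vertices in `X`
  have hadj : ∀ X Y, BlockSys G U X Y k → ¬AP (Len G U X Y) k →
      ∀ a ∈ X, ∀ b ∈ X, a ∈ U → b ∈ U → ¬G.Adj a b := by
    intro X Y h hno a ha b hb haU hbU hab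
    have hno' : ¬AP (Len G U Y X) k := fun h => hno h.symm
    obtain ⟨K, hKX, hK, hYK⟩ := (h.of_adj ih ha haU hb hbU hab).resolve_left hno
    obtain ⟨y₁, h1, y₂, h2, h3, h4, h5⟩ := h.two_mem
    obtain ⟨K', hKY, hK', hXK⟩ := (h.symm.of_adj ih h1 h3 h2 h4 (hK _ (hYK _ h1 h3) _
      (hYK _ h2 h4) h5)).resolve_left hno'
    refine hno (h.of_clique ih hK ?_ ?_)
    · ext v; have := hXK v; have := hYK v; have := @hKX v; have := @hKY v; grind
    · ext v; have := hXK v; have := hYK v; have := @hKX v; have := @hKY v; grind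
  have hXi := hadj X Y h hno
  have hYi := hadj Y X h.symm hno'
  have hcom : ∀ X Y, BlockSys G U X Y k → ¬AP (Len G U X Y) k →
      (∀ a ∈ X, ∀ b ∈ X, a ∈ U → b ∈ U → ¬G.Adj a b) →
      (∀ a ∈ Y, ∀ b ∈ Y, a ∈ U → b ∈ U → ¬G.Adj a b) →
      ∀ t₁ ∈ X, ∀ t₂ ∈ X, t₁ ∈ U → t₂ ∈ U → t₁ ≠ t₂ → ∀ b₁ ∈ U, ∀ b₂ ∈ U, G.Adj t₁ b₁ →
      G.Adj t₁ b₂ → G.Adj t₂ b₁ → G.Adj t₂ b₂ → ¬G.Adj b₁ b₂ := by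
    intro X Y h hno hXi hYi t₁ ht₁ t₂ ht₂ ht₁U ht₂U htt b₁ hb₁ b₂ hb₂ h11 h12 h21 h22 hbb
    have hno' : ¬AP (Len G U Y X) k := fun h => hno h.symm
    have key : ∀ Y, (∃ y₁ ∈ Y, ∃ y₂ ∈ Y, y₁ ∈ U ∧ y₂ ∈ U ∧ y₁ ≠ y₂) →
        (∀ a ∈ Y, ∀ b ∈ Y, a ∈ U → b ∈ U → ¬G.Adj a b) → ∀ B : Finset V,
        (∀ a ∈ B, ∀ b ∈ B, a ≠ b → G.Adj a b) → (∀ b ∈ B, G.Adj t₁ b ∧ G.Adj t₂ b) →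
        (∀ y ∈ Y, y ∈ U → y ∈ B ∨ y = t₁ ∨ y = t₂) → Y ∩ U = {t₁, t₂} := by
      rintro Y ⟨y₁, h1, y₂, h2, h3, h4, h5⟩ hYi B hB hBt hYB
      have hYt : ∀ y ∈ Y, y ∈ U → y = t₁ ∨ y = t₂ := by
        intro y hy hyU
        refine (hYB y hy hyU).resolve_left fun hyB => ?_
        obtain ⟨z, hz, hzU, hyz⟩ : ∃ z ∈ Y, z ∈ U ∧ z ≠ y := by
          by_cases y = y₁
          · exact ⟨y₂, h2, h4, by grind⟩
          · exact ⟨y₁, h1, h3, by grind⟩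
        have ha := hBt y hyB
        have hn := hYi z hz y hy hzU hyU
        rcases hYB z hz hzU with hzB | rfl | rfl
        · exact hn (hB z hzB y hyB hyz)
        · exact hn ha.1
        · exact hn ha.2
      have h6 := hYt y₁ h1 h3
      have h7 := hYt y₂ h2 h4
      ext v
      have := hYt v
      grind
    obtain ⟨B, hB, hBt, hYB⟩ := (h.of_common ih hXi ht₁ ht₁U ht₂ ht₂U htt hb₁ hb₂ h11 h12 h21 h22
      hbb).resolve_left hno
    have hY := key Y h.two_mem hYi B hB hBt hYB
    have hm : ∀ v, v ∈ Y ∧ v ∈ U ↔ v = t₁ ∨ v = t₂ := fun v => by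
      rw [← Finset.mem_inter, hY]; simp
    obtain ⟨B, hB, hBt, hXB⟩ := (h.symm.of_common ih hYi ((hm t₁).2 (by simp)).1 ht₁U
      ((hm t₂).2 (by simp)).1 ht₂U htt hb₁ hb₂ h11 h12 h21 h22 hbb).resolve_left hno'
    have hX := key X h.symm.two_mem hXi B hB hBt hXB
    refine hno (h.of_bip ih (S := ∅) (t := t₁) hX hY ?_ (by simp) (by simp) (by simp)
      (by simp [Finset.card_pair htt]) fun v hv _ hvT => ?_)
    · intro a ha b hb
      exact hXi a (by grind) b (by grind) (by grind) (by grind)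
    · have h1 := dg_le_card (G := G) (({t₁, t₂} : Finset V).erase t₁) v
      rw [Finset.card_erase_of_mem (by simp), Finset.card_pair htt] at h1
      simp only [Finset.card_empty]
      omega
  have hXc := hcom X Y h hno hXi hYi
  have hYc := hcom Y X h.symm hno' hYi hXi
  obtain ⟨S, T, hSU, hTX, hc, hST, hbd, hYH⟩ := (h.of_indep ih hXi hXc).resolve_left hno
  obtain ⟨S', T', hSU', hTY, hc', hST', -, hXH⟩ := (h.symm.of_indep ih hYi hYc).resolve_left hno'
  have side : ∀ Y S T : Finset V, (∀ a ∈ Y, ∀ b ∈ Y, a ∈ U → b ∈ U → ¬G.Adj a b) →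
      (∀ s ∈ S, ∀ t ∈ T, G.Adj s t) → (∀ y ∈ Y, y ∈ U → y ∈ S ∨ y ∈ T) →
      Y ∩ U ⊆ S ∨ Y ∩ U ⊆ T := by
    intro Y S T hYi hST hYH
    by_contra! hcon
    obtain ⟨hS, hT⟩ := hcon
    obtain ⟨a, ha, haS⟩ := Finset.not_subset.1 hS
    obtain ⟨b, hb, hbT⟩ := Finset.not_subset.1 hT
    have h1 := hYH a
    have h2 := hYH b
    have := hST b
    have := hYi b
    grind
  have hTc := Finset.card_le_card hTX
  have hTc' := Finset.card_le_card hTY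
  rcases side Y S T hYi hST hYH with h1 | h1 <;> rcases side X S' T' hXi hST' hXH with h2 | h2
  · have := Finset.card_le_card h1
    have := Finset.card_le_card h2
    omega
  · have := Finset.card_le_card h1
    have := Finset.card_le_card h2
    omega
  · have := Finset.card_le_card h1
    have := Finset.card_le_card h2
    omega
  have hX : X ∩ U = T := (h2.trans (hTY.trans h1)).antisymm hTX
  have hY : Y ∩ U = T := h1.antisymm (hTX.trans (h2.trans hTY))
  obtain ⟨y₁, h3, y₂, h4, h5, h6, h7⟩ := h.two_mem
  have hT2 : 1 < T.card := Finset.one_lt_card.2 ⟨y₁, h1 (by grind), y₂, h1 (by grind), h7⟩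
  obtain ⟨S₁, hS₁, hcS₁⟩ := Finset.exists_subset_card_eq (s := S) (n := min S.card (T.card - 2))
    (by omega)
  have ht : y₁ ∈ T := h1 (by grind)
  refine hno (h.of_bip ih (S := S₁) (t := y₁) hX hY ?_ ht (hS₁.trans hSU)
    (fun s hs t ht => hST s (hS₁ hs) t ht) (by omega) fun v hv hvS hvT => ?_)
  · intro a ha b hb
    have h8 := hTX ha
    have h9 := hTX hb
    exact hXi a (by grind) b (by grind) (by grind) (by grind)
  have hce := Finset.card_erase_of_mem ht
  have h8 := dg_mono (G := G) (Finset.erase_subset y₁ T) v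
  have h9 := dg_le_card (G := G) (T.erase y₁) v
  have h10 := dg_mono (G := G) hS₁ v
  have hvX : v ∉ X := fun hvX => hvT (by rw [← hX]; grind)
  by_cases hvS' : v ∈ S
  · have hne : S₁.card ≠ S.card := fun hne => hvS (Finset.eq_of_subset_of_card_le hS₁ hne.ge ▸ hvS')
    refine ⟨by omega, fun _ => dg_eq_zero fun s hs => ?_⟩
    obtain ⟨t₂, ht₂, htt⟩ : ∃ t ∈ T, t ≠ y₁ := ⟨y₂, h1 (by grind), h7.symm⟩
    have h11 := hTX ht
    have h12 := hTX ht₂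
    exact hXc y₁ (by grind) t₂ (by grind) h5 (by grind) htt.symm v hv s (hSU (hS₁ hs))
      (hST v hvS' _ ht).symm (hST s (hS₁ hs) _ ht).symm (hST v hvS' _ ht₂).symm
      (hST s (hS₁ hs) _ ht₂).symm
  · obtain ⟨h11, h12⟩ := hbd v hv hvS' hvT hvX
    exact ⟨by omega, fun h => by have := h12 (by omega); omega⟩

/-- A rooted system of degree excess `k` contains `k` admissible path lengths. -/
theorem KSys.ap (h : KSys G U X Y k) : AP (Len G U X Y) k := by
  induction hn : U.card using Nat.strong_induction_on generalizing U X Y k with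
  | _ n ihn =>
  have ih : KIH G U.card := fun U' X' Y' k' hc hs => ihn U'.card (hn ▸ hc) hs rfl
  clear ihn
  rcases Nat.lt_or_ge k 2 with hk | hk
  · exact h.zero_lt (by omega)
  rcases Nat.eq_or_lt_of_le hk with rfl | hk
  · exact h.two
  by_cases hX : Good G U X ∅
  swap
  · unfold Good at hX
    push Not at hX
    obtain ⟨c, hc, D, hD, ⟨v, hv⟩, -, hDX⟩ := hX
    obtain ⟨D', hD', hDc', -⟩ := exists_comp (G := G) hv
    exact (h.symm.part ih hc (hD.trans hD') hDc' fun v hv => hDX v (hD'.1 hv)).symm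
  by_cases hY : Good G U Y ∅
  swap
  · unfold Good at hY
    push Not at hY
    obtain ⟨c, hc, D, hD, ⟨v, hv⟩, -, hDX⟩ := hY
    obtain ⟨D', hD', hDc', -⟩ := exists_comp (G := G) hv
    exact h.part ih hc (hD.trans hD') hDc' fun v hv => hDX v (hD'.1 hv)
  by_cases hb : ∀ c ∈ U, ConnOn G (U.erase c)
  · exact BlockSys.ap ⟨h, hk, hX, hY, hb⟩ ih
  · push Not at hb
    obtain ⟨c, hc, hcon⟩ := hb
    exact h.cut hk ih hX hY hc hcon

end RootedPaths

section Target

/-- Cycles of every even residue modulo `k`. -/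
def EvenRes (G : SimpleGraph V) (k : ℕ) : Prop := ∀ l : ℤ, Even l → HasCycleLenMod G k l

/-- `L` contains `k` consecutive integers. -/
def Consec (L : ℕ → Prop) (k : ℕ) : Prop := ∃ p, ∀ i < k, L (p + i)

theorem Consec.evenRes {k : ℕ} (hk : 0 < k) (h : Consec (HasCycleLen G) k) : EvenRes G k := by
  obtain ⟨p, h⟩ := h
  intro l _
  have hk' : (k : ℤ) ≠ 0 := by positivity
  have h0 := Int.emod_nonneg (l - p) hk'
  have h1 := Int.emod_lt_of_pos (l - p) (by positivity : (0 : ℤ) < k)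
  refine ⟨_, h ((l - p) % k).toNat (by omega), ?_⟩
  push_cast
  rw [Int.toNat_of_nonneg h0]
  have := (Int.mod_modEq (l - p) k).add_left (p : ℤ)
  simpa using this

theorem evenRes_of_even {k m p : ℕ} (hk : 0 < k) (he : Even k) (hm : k ≤ 2 * m) (hp : Even p)
    (h : ∀ i < m, HasCycleLen G (p + 2 * i)) : EvenRes G k := by
  intro l hl
  have hk' : (k : ℤ) ≠ 0 := by positivity
  have h0 := Int.emod_nonneg (l - p) hk'
  have h1 := Int.emod_lt_of_pos (l - p) (by positivity : (0 : ℤ) < k)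
  have h2 : Even ((l - p) % k) := by
    have e := Int.emod_add_mul_ediv (l - p) k
    have : Even ((l - p) % k + k * ((l - p) / k)) := by
      rw [e]; exact hl.sub (by exact_mod_cast hp)
    exact (Int.even_add.1 this).2 (Even.mul_right (by exact_mod_cast he) _)
  obtain ⟨r, hr⟩ := h2
  refine ⟨_, h r.toNat (by omega), ?_⟩
  have hr' : ((2 * r.toNat : ℕ) : ℤ) = (l - p) % k := by omega
  push_cast at hr' ⊢
  rw [hr']
  have := (Int.mod_modEq (l - p) k).add_left (p : ℤ)
  simpa using this

theorem AP.evenRes {k : ℕ} (ho : Odd k) (h : AP (HasCycleLen G) k) : EvenRes G k := by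
  obtain ⟨p, d, hd | hd, h⟩ := h
  · exact Consec.evenRes ho.pos ⟨p, fun i hi => by simpa [hd] using h i hi⟩
  · subst hd
    obtain ⟨m, hm⟩ := ho
    intro l _
    have hk' : (k : ℤ) ≠ 0 := by omega
    have h0 := Int.emod_nonneg ((l - p) * (m + 1)) hk'
    have h1 := Int.emod_lt_of_pos ((l - p) * (m + 1)) (by omega : (0 : ℤ) < k)
    refine ⟨_, h ((l - p) * (m + 1) % k).toNat (by omega), ?_⟩
    push_cast
    rw [Int.toNat_of_nonneg h0]
    have h3 := ((Int.mod_modEq ((l - p) * (m + 1)) k).mul_left 2).add_left (p : ℤ)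
    refine h3.trans (Int.ModEq.symm ?_)
    rw [Int.modEq_iff_dvd]
    exact ⟨l - p, by subst hm; push_cast; ring⟩

theorem Consec.mono {L : ℕ → Prop} {a b : ℕ} (h : Consec L a) (hb : b ≤ a) : Consec L b := by
  obtain ⟨p, h⟩ := h
  exact ⟨p, fun i hi => h i (by omega)⟩

/-- The sum of consecutive integers and an admissible progression is consecutive. -/
theorem Consec.add {L L' M : ℕ → Prop} {a b s : ℕ} (h : Consec L a) (h' : AP L' b) (ha : 2 ≤ a)
    (hb : 1 ≤ b) (hM : ∀ m n, L m → L' n → M (m + n + s)) : Consec M (a + b - 1) := by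
  obtain ⟨p, h⟩ := h
  obtain ⟨q, e, he, h'⟩ := h'
  refine ⟨p + q + s, fun i hi => ?_⟩
  obtain ⟨x, hx, y, hy, hxy⟩ : ∃ x < a, ∃ y < b, x + e * y = i := by
    rcases he with rfl | rfl
    · rcases Nat.lt_or_ge i a with hia | hia
      · exact ⟨i, hia, 0, by omega, by omega⟩
      · exact ⟨a - 1, by omega, i - (a - 1), by omega, by omega⟩
    · rcases Nat.lt_or_ge (i / 2) b with hia | hia
      · exact ⟨i % 2, by omega, i / 2, hia, by omega⟩
      · exact ⟨i - 2 * (b - 1), by omega, b - 1, by omega, by omega⟩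
  have := hM _ _ (h x hx) (h' y hy)
  rwa [show p + q + s + i = p + x + (q + e * y) + s by omega]

/-- A 2-connected graph of minimum degree at least `k`. -/
structure Base (G : SimpleGraph V) [DecidableRel G.Adj] (k : ℕ) : Prop where
  hk : 4 ≤ k
  deg : ∀ v, k ≤ dg G Finset.univ v
  conn : ConnOn G Finset.univ
  conn_erase : ∀ c, ConnOn G (Finset.univ.erase c)

/-- A 3-connected graph of minimum degree at least `k`. -/
structure Base3 (G : SimpleGraph V) [DecidableRel G.Adj] (k : ℕ) : Prop extends Base G k where
  conn_erase₂ : ∀ c d, ConnOn G ((Finset.univ.erase c).erase d)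

theorem Base.card (h : Base G k) : k + 1 ≤ Fintype.card V := by
  obtain ⟨⟨v, -⟩, -⟩ := h.conn
  have h1 := h.deg v
  have h2 := dg_mono (G := G) (U := Finset.univ.filter (G.Adj v)) (W := Finset.univ.erase v)
    (fun x hx => by have : G.Adj v x → v ≠ x := fun h => h.ne; grind) v
  have h3 : dg G Finset.univ v = dg G (Finset.univ.filter (G.Adj v)) v := by
    unfold dg; congr 1; ext; simp
  have h4 := dg_le_card (G := G) (Finset.univ.erase v) v
  rw [Finset.card_erase_of_mem (Finset.mem_univ _), Finset.card_univ] at h4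
  have := h.hk
  omega

theorem Base.good (h : Base G k) {U W : Finset V} (hU : ∃ v, v ∉ U)
    (hb : ∀ v ∈ U, ∀ w, w ∉ U → G.Adj v w → v ∈ W) : Good G U W ∅ := by
  intro c hc D hD hne _
  by_contra! hW
  obtain ⟨u, hu⟩ := hU
  have := (h.conn_erase c).2 D ⟨fun x hx => by have := hD.1 hx; grind, fun a ha b hb' hab => ?_⟩ hne
  · have h1 : u ∈ D := by rw [this]; grind
    have := hD.1 h1
    grind
  · have h1 := hD.1 ha
    by_cases hbU : b ∈ U
    · exact hD.2 a ha b (by grind) hab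
    · exact absurd (hb a (by grind) b hbU hab) (hW a ha)

theorem Base3.good (h : Base3 G k) {U W : Finset V} (q : V) (hU : ∃ v, v ∉ U ∧ v ≠ q)
    (hq : q ∉ U) (hb : ∀ v ∈ U, ∀ w, w ∉ U → w ≠ q → G.Adj v w → v ∈ W) : Good G U W ∅ := by
  intro c hc D hD hne _
  by_contra! hW
  obtain ⟨u, hu, huq⟩ := hU
  have := (h.conn_erase₂ c q).2 D
    ⟨fun x hx => by have := hD.1 hx; grind, fun a ha b hb' hab => ?_⟩ hne
  · have h1 : u ∈ D := by rw [this]; grind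
    have := hD.1 h1
    grind
  · have h1 := hD.1 ha
    by_cases hbU : b ∈ U
    · exact hD.2 a ha b (by grind) hab
    · exact absurd (hb a (by grind) b hbU (by grind) hab) (hW a ha)

/-- Cycles from two cut vertices and rooted paths on both sides. -/
theorem Len.cycle_cut {U W : Finset V} {p q : V} {m n : ℕ} (h : Len G U (nbs G {p}) (nbs G {q}) n)
    (h' : Len G W (nbs G {p}) (nbs G {q}) m) (hd : Disjoint U W) (hpq : p ≠ q) (hpU : p ∉ U)
    (hqU : q ∉ U) (hpW : p ∉ W) (hqW : q ∉ W) : HasCycleLen G (n + m + 4) := by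
  obtain ⟨x, hx, y, hy, hp⟩ := h
  obtain ⟨x', hx', y', hy', hp'⟩ := h'
  rw [mem_nbs_singleton] at hx hy hx' hy'
  have h1 := (hp'.cons' (W := insert p W) hpW hx' (by grind)).snoc
    (W := insert q (insert p W)) (by grind) hy'.symm (by grind)
  have := hp.hasCycleLen' h1.symm ?_ hy.symm hx (by omega)
  · convert this using 1
    omega
  · rw [Finset.disjoint_left] at hd ⊢
    grind

end Target

section TwoCut

/-- The exact vertex set of a path. -/
theorem PathIn.exact {U : Finset V} {a b : V} {n : ℕ} (h : PathIn G U a b n) :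
    ∃ S ⊆ U, a ∈ S ∧ b ∈ S ∧ PathIn G S a b n ∧
      ∀ x ∈ S, ∃ i j, i + j = n ∧ PathIn G S a x i ∧ PathIn G S x b j := by
  induction h with
  | @nil U a ha =>
    refine ⟨{a}, by simpa using ha, by simp, by simp, .nil (by simp), fun x hx => ?_⟩
    obtain rfl := Finset.mem_singleton.1 hx
    exact ⟨0, 0, rfl, .nil hx, .nil hx⟩
  | @cons U a c b n ha hac _ ih =>
    obtain ⟨S, hS, hcS, hbS, hp, hx⟩ := ih
    have haS : a ∉ S := fun h => by simpa using hS h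
    have hp' := hp.cons' (W := insert a S) haS hac subset_rfl
    refine ⟨insert a S, Finset.insert_subset ha (hS.trans (Finset.erase_subset _ _)), by grind,
      by grind, hp', fun x hxS => ?_⟩
    rcases Finset.mem_insert.1 hxS with rfl | hxS
    · exact ⟨0, n + 1, by omega, .nil (by simp), hp'⟩
    · obtain ⟨i, j, hij, h1, h2⟩ := hx x hxS
      exact ⟨i + 1, j, by omega, h1.cons' haS hac subset_rfl, h2.mono (by grind)⟩

/-- A path in a connected set can be reached from any set meeting it. -/
theorem ConnOn.spider {M Y : Finset V} (h : ConnOn G M) {a b : V} {n : ℕ} (hp : PathIn G M a b n)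
    (hY : ∃ y ∈ Y, y ∈ M) : ∃ y ∈ Y, ∃ m i j, i + j = n ∧ PathIn G M y a (m + i) ∧
      PathIn G M y b (m + j) := by
  obtain ⟨S, hS, haS, hbS, -, hx⟩ := hp.exact
  obtain ⟨x, hxS, -, y, hy, m, hm⟩ := h.escape (K := S) ⟨a, haS, hS haS⟩ hY
  obtain ⟨i, j, hij, h1, h2⟩ := hx x hxS
  refine ⟨y, hy, m, i, j, hij, ?_⟩
  cases hm with
  | nil => exact ⟨by simpa using h1.symm.mono hS, by simpa using h2.mono hS⟩
  | @cons _ _ c _ m hxm hxc h =>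
    have hd : Disjoint ((insert x (M \ S)).erase x) S := by
      rw [Finset.disjoint_left]; grind
    have hM : (insert x (M \ S)).erase x ∪ S ⊆ M := Finset.union_subset (by grind) hS
    have e1 := (h.symm.join h1.symm hd hxc.symm).mono hM
    have e2 := (h.symm.join h2 hd hxc.symm).mono hM
    exact ⟨by convert e1 using 1; omega, by convert e2 using 1; omega⟩

/-- A component of the graph minus two vertices, with something left over. -/
structure Frag (G : SimpleGraph V) (p q : V) (M : Finset V) : Prop where
  ne : p ≠ q
  hp : p ∉ M
  hq : q ∉ M
  conn : ConnOn G M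
  closed : ClosedIn G ((Finset.univ.erase p).erase q) M
  rest : ∃ r, r ∉ M ∧ r ≠ p ∧ r ≠ q

theorem Frag.symm {p q : V} {M : Finset V} (h : Frag G p q M) : Frag G q p M :=
  ⟨h.ne.symm, h.hq, h.hp, h.conn, Finset.erase_right_comm (a := p) (b := q) ▸ h.closed, by
    obtain ⟨r, hr⟩ := h.rest; exact ⟨r, by tauto⟩⟩

theorem Frag.exists_nbr {p q : V} {M : Finset V} (h : Frag G p q M) (hb : Base G k) :
    ∃ v ∈ M, G.Adj p v := by
  refine ((hb.conn_erase q)).exists_nbr (by have := h.ne; grind) ?_ h.conn.1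
  rw [Finset.erase_right_comm]
  exact h.closed

theorem Frag.deg {p q v : V} {M : Finset V} (h : Frag G p q M) (hb : Base G k) (hv : v ∈ M) :
    k ≤ dg G M v + (if v ∈ nbs G {p} then 1 else 0) + if v ∈ nbs G {q} then 1 else 0 := by
  have h1 := hb.deg v
  have h2 := dg_le_of_closedIn (G := G) h.closed hv
  have h3 := dg_le_of_closedIn (G := G) (U := Finset.univ) (D := Finset.univ.erase p) (c := p)
    (v := v) ⟨subset_rfl, fun a ha b hb _ => hb⟩ (by have := h.hp; grind)
  omega

theorem Frag.sys {p q : V} {M : Finset V} (h : Frag G p q M) (hb : Base G k) :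
    KSys G M (nbs G {p}) (nbs G {q}) (k - 1) where
  conn := h.conn
  hX := by obtain ⟨v, hv, ha⟩ := h.exists_nbr hb; exact ⟨v, by simpa using ha, hv⟩
  hY := by obtain ⟨v, hv, ha⟩ := h.symm.exists_nbr hb; exact ⟨v, by simpa using ha, hv⟩
  good := hb.good ⟨p, h.hp⟩ fun v hv w hw hvw => by
    have := h.closed.2 v hv w
    have := hvw.symm
    simp only [Finset.mem_union, mem_nbs_singleton]
    grind
  deg _ v hv := by
    have := h.deg hb hv
    have := hb.hk
    unfold dgp
    omega

theorem Frag.sub_sys {p q v : V} {M W : Finset V} (h : Frag G p q M) (hb : Base G k)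
    (hmin : ∀ p' q' M', Frag G p' q' M' → M.card ≤ M'.card) (hv : v ∈ M)
    (hW : ClosedIn G (M.erase v) W) (hc : ConnOn G W) :
    KSys G W (nbs G {p}) (nbs G {v}) (k - 2) where
  conn := hc
  hY := by
    obtain ⟨w, hw, ha⟩ := h.conn.exists_nbr hv hW hc.1
    exact ⟨w, by simpa using ha, hw⟩
  hX := by
    by_contra! hcon
    have hWM : W ⊂ M := ⟨fun x hx => by have := hW.1 hx; grind, fun hs => by
      have := hW.1 (hs hv); grind⟩
    have hf : Frag G v q W := ⟨fun hvq => h.hq (hvq ▸ hv), fun hs => by have := hW.1 hs; grind,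
      fun hs => h.hq (hWM.1 hs), hc, ⟨fun x hx => by have := hW.1 hx; have := h.hq; grind,
        fun a ha b hb' hab => by
          have h1 := hcon a
          have h2 := hab.symm
          have h3 := hWM.1 ha
          have h4 := h.closed.2 a h3 b
          refine hW.2 a ha b ?_ hab
          rw [mem_nbs_singleton] at h1
          grind⟩, ⟨p, fun hs => h.hp (hWM.1 hs), fun hs => h.hp (hs ▸ hv), h.ne⟩⟩
    exact absurd (hmin _ _ _ hf) (not_le.2 (Finset.card_lt_card hWM))
  good := by
    intro c hc' D hD hne _
    by_contra! hcon
    obtain ⟨u, hu⟩ := hne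
    obtain ⟨D', hD', hcD', huD'⟩ := exists_comp hu
    have hDW : D' ⊆ W := fun x hx => by have := hD.1 (hD'.1 hx); grind
    have hWM : W ⊆ M := fun x hx => by have := hW.1 hx; grind
    have hss : D' ⊂ M := ⟨hDW.trans hWM, fun hs => by have := hW.1 (hDW (hs hv)); grind⟩
    have hf : Frag G c q D' := ⟨fun hs => h.hq (hs ▸ hWM hc'), fun hs => by
        have := hD.1 (hD'.1 hs); grind, fun hs => h.hq (hss.1 hs), hcD',
      ⟨fun x hx => by have := hD.1 (hD'.1 hx); have := h.hq; have := hss.1 hx; grind,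
        fun a ha b hb' hab => by
          have h1 := hcon a (hD'.1 ha)
          have h2 := hab.symm
          have h3 := hss.1 ha
          have h4 := h.closed.2 a h3 b
          have h5 := hW.2 a (hDW ha) b
          refine hD'.2 a ha b (hD.2 a (hD'.1 ha) b ?_ hab) hab
          simp only [Finset.mem_union, mem_nbs_singleton] at h1
          grind⟩, ⟨p, fun hs => h.hp (hss.1 hs), fun hs => h.hp (hs ▸ hWM hc'), h.ne⟩⟩
    exact absurd (hmin _ _ _ hf) (not_le.2 (Finset.card_lt_card hss))
  deg _ w hw := by
    have h1 := h.deg hb (Finset.mem_of_mem_erase (hW.1 hw))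
    have h2 := dg_le_of_closedIn (G := G) hW hw
    have := hb.hk
    unfold dgp
    split_ifs at * <;> omega

theorem Base.two_cut (h : Base G k) {c d : V}
    (hn : ¬ConnOn G ((Finset.univ.erase c).erase d)) : EvenRes G k := by
  have hk := h.hk
  have hcard := h.card
  have hf : ∃ n p q M, Frag G p q M ∧ M.card = n := by
    have hcd : c ≠ d := by
      rintro rfl
      exact hn (by simpa using h.conn_erase c)
    have hne : ((Finset.univ.erase c).erase d).Nonempty := by
      rw [← Finset.card_pos, Finset.card_erase_of_mem (by grind),
        Finset.card_erase_of_mem (by grind), Finset.card_univ]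
      omega
    obtain ⟨M, N, hM, hMc, hN, hNc, hd⟩ := exists_two_comps hne hn
    obtain ⟨r, hr⟩ := hNc.1
    have := Finset.disjoint_left.1 hd
    exact ⟨_, c, d, M, ⟨hcd, fun hs => by have := hM.1 hs; grind,
      fun hs => by have := hM.1 hs; grind, hMc, hM, r, fun hs => this hs hr,
      by have := hN.1 hr; grind, by have := hN.1 hr; grind⟩, rfl⟩
  classical
  obtain ⟨p, q, M, hM, hMn⟩ := Nat.find_spec hf
  have hmin : ∀ p' q' M', Frag G p' q' M' → M.card ≤ M'.card := fun p' q' M' h' =>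
    hMn ▸ Nat.find_min' hf ⟨p', q', M', h', rfl⟩
  obtain ⟨r, hr, hrp, hrq⟩ := hM.rest
  obtain ⟨N, hN, hNc, hrN⟩ := exists_comp (G := G) (U := (Finset.univ.erase p).erase q) (v := r)
    (by grind)
  have hd : Disjoint M N := by
    rw [Finset.disjoint_left]
    by_contra! hcon
    obtain ⟨x, hxM, hxN⟩ := hcon
    have := hNc.2 (N ∩ M) ⟨Finset.inter_subset_left, fun a ha b hb hab => by
      have := hM.closed.2 a (by grind) b (hN.1 hb) hab
      grind⟩ ⟨x, by grind⟩
    grind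
  have hNf : Frag G p q N := by
    obtain ⟨x, hx⟩ := hM.conn.1
    have := Finset.disjoint_left.1 hd hx
    have h1 := hM.hp
    have h2 := hM.hq
    exact ⟨hM.ne, fun hs => by have := hN.1 hs; grind, fun hs => by have := hN.1 hs; grind, hNc, hN,
      x, this, by grind, by grind⟩
  have hcut : ∀ m n, Len G M (nbs G {p}) (nbs G {q}) m → Len G N (nbs G {p}) (nbs G {q}) n →
      HasCycleLen G (m + n + 4) := fun m n h1 h2 =>
    h1.cycle_cut h2 hd hM.ne hM.hp hM.hq hNf.hp hNf.hq
  have hcut' : ∀ m n, Len G N (nbs G {p}) (nbs G {q}) m → Len G M (nbs G {p}) (nbs G {q}) n →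
      HasCycleLen G (m + n + 4) := fun m n h1 h2 => by
    have := hcut _ _ h2 h1
    rwa [show m + n + 4 = n + m + 4 by omega]
  have hA := (hM.sys h).ap
  have hB := (hNf.sys h).ap
  rcases Nat.even_or_odd k with he | ho
  swap
  · exact ((hA.add hB (by omega) (by omega) hcut).mono (by omega)).evenRes ho
  obtain ⟨a, d, hd1 | hd2, hA'⟩ := id hA
  · have : Consec (Len G M (nbs G {p}) (nbs G {q})) (k - 1) :=
      ⟨a, fun i hi => by simpa [hd1] using hA' i hi⟩
    exact ((this.add hB (by omega) (by omega) hcut).mono (by omega)).evenRes (by omega)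
  obtain ⟨b, e, he1 | he2, hB'⟩ := id hB
  · have : Consec (Len G N (nbs G {p}) (nbs G {q})) (k - 1) :=
      ⟨b, fun i hi => by simpa [he1] using hB' i hi⟩
    exact ((this.add hA (by omega) (by omega) hcut').mono (by omega)).evenRes (by omega)
  subst hd2 he2
  have fin : ∀ m, Even (m + b) → Len G M (nbs G {p}) (nbs G {q}) m → EvenRes G k := by
    intro m hm hl
    refine evenRes_of_even (m := k - 1) (p := m + b + 4) (by omega) he (by omega)
      (hm.add (by decide)) fun i hi => ?_
    have := hcut _ _ hl (hB' i hi)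
    rwa [show m + b + 4 + 2 * i = m + (b + 2 * i) + 4 by omega]
  obtain ⟨v, hv, hpv⟩ := hM.exists_nbr h
  obtain ⟨w, hw⟩ : (M.erase v).Nonempty := by
    have h1 := hM.deg h hv
    have : 0 < dg G M v := by split_ifs at h1 <;> omega
    obtain ⟨w, hw, hvw⟩ := dg_pos.1 this
    exact ⟨w, by have := hvw.ne; grind⟩
  obtain ⟨W, hW, hWc, -⟩ := exists_comp (G := G) hw
  have key : ∀ n, Len G W (nbs G {p}) (nbs G {v}) n → ∃ u ∈ M, G.Adj p u ∧
      PathIn G M u v (n + 1) := by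
    rintro n ⟨u, hu, x, hx, hp⟩
    rw [mem_nbs_singleton] at hu hx
    exact ⟨u, by have := hW.1 hp.left_mem; grind, hu,
      hp.snoc (fun hs => by have := hW.1 hs; grind) hx.symm
        (Finset.insert_subset hv fun x hx => by have := hW.1 hx; grind)⟩
  have odd : ∀ n, Even n → Len G W (nbs G {p}) (nbs G {v}) n → EvenRes G k := by
    intro n hn hl
    obtain ⟨u, hu, hpu, hpath⟩ := key n hl
    obtain ⟨y, hy, hqy⟩ := hM.symm.exists_nbr h
    obtain ⟨y, hy, m, i, j, hij, h1, h2⟩ := hM.conn.spider hpath (Y := nbs G {q})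
      ⟨y, by simpa using hqy, hy⟩
    by_cases hpar : Even (m + i + b)
    · exact fin _ hpar ⟨u, by simpa using hpu, y, hy, h1.symm⟩
    · refine fin (m + j) ?_ ⟨v, by simpa using hpv, y, hy, h2.symm⟩
      rw [Nat.even_iff] at *
      omega
  obtain ⟨a', d', hd', hW'⟩ := (hM.sub_sys h hmin hv hW hWc).ap
  rcases Nat.even_or_odd a' with ha | ha
  · exact odd a' ha (by simpa using hW' 0 (by omega))
  · rcases hd' with rfl | rfl
    · exact odd _ (ha.add_odd odd_one) (by simpa using hW' 1 (by omega))
    · refine evenRes_of_even (m := k - 2) (p := a' + 3) (by omega) he (by omega)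
        (ha.add_odd (by decide)) fun i hi => ?_
      obtain ⟨u, hu, hpu, hpath⟩ := key _ (hW' i hi)
      have := (hpath.snoc (c := p) (W := insert p M) hM.hp hpv.symm subset_rfl).hasCycleLen hpu
        (by omega)
      rwa [show a' + 3 + 2 * i = a' + 2 * i + 1 + 1 + 1 by omega]

end TwoCut

section Triangle

/-- A component outside `H` as a rooted system. -/
theorem Base.ear_sys (h : Base G k) {H E A B : Finset V} {k' : ℕ}
    (hE : ClosedIn G (Finset.univ \ H) E) (hc : ConnOn G E)
    (hg : Good G E (nbs G A ∪ nbs G B) ∅) (hA : ∃ v ∈ nbs G A, v ∈ E) (hB : ∃ v ∈ nbs G B, v ∈ E)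
    (hdeg : 2 ≤ k' → ∀ v ∈ E, k' + 1 + dg G H v ≤
      k + (if v ∈ nbs G A then 1 else 0) + if v ∈ nbs G B then 1 else 0) :
    KSys G E (nbs G A) (nbs G B) k' where
  conn := hc
  hX := hA
  hY := hB
  good := hg
  deg hk' v hv := by
    have h1 := hdeg hk' v hv
    have h2 := h.deg v
    have h3 := dg_le_of_closedIn_sdiff (G := G) hE hv
    unfold dgp
    omega

theorem Len.ear {E H A B : Finset V} {n m : ℕ} (h : Len G E (nbs G A) (nbs G B) n)
    (hd : Disjoint H E) (hin : ∀ a ∈ A, ∀ b ∈ B, PathIn G H a b m) (hm : 1 ≤ m) :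
    HasCycleLen G (m + n + 2) := by
  obtain ⟨x, hx, y, hy, hp⟩ := h
  obtain ⟨a, ha, hax⟩ := mem_nbs.1 hx
  obtain ⟨b, hb, hby⟩ := mem_nbs.1 hy
  exact (hin a ha b hb).hasCycleLen' hp.symm hd hby hax.symm (by omega)

theorem KSys.ear_consec {E H A B : Finset V} {k' N s : ℕ}
    (h : KSys G E (nbs G A) (nbs G B) k') (hd : Disjoint H E) (hk' : 1 ≤ k') (hN : 2 ≤ N)
    (hs : 1 ≤ s) (hin : ∀ a ∈ A, ∀ b ∈ B, ∀ j < N, PathIn G H a b (s + j)) :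
    Consec (HasCycleLen G) (N + k' - 1) :=
  Consec.add (L := fun m => ∃ j < N, m = s + j) (s := 2) ⟨s, fun i hi => ⟨i, hi, rfl⟩⟩ h.ap hN hk' <| by
    rintro _ n ⟨j, hj, rfl⟩ hn
    exact hn.ear hd (fun a ha b hb => hin a ha b hb j hj) (by omega)

theorem KSys.ear_ap {E H A B : Finset V} {k' N s e : ℕ} (he : e = 1 ∨ e = 2)
    (h : KSys G E (nbs G A) (nbs G B) k') (hd : Disjoint H E) (hk' : 1 ≤ k') (hN : 1 ≤ N)
    (hs : 1 ≤ s) (hin : ∀ a ∈ A, ∀ b ∈ B, ∀ j < N, PathIn G H a b (s + e * j)) :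
    AP (HasCycleLen G) (N + k' - 1) :=
  AP.add (L := fun m => ∃ j < N, m = s + e * j) (s := 2) ⟨s, e, he, fun i hi => ⟨i, hi, rfl⟩⟩
    h.ap hN hk' <| by
    rintro _ n ⟨j, hj, rfl⟩ hn
    exact hn.ear hd (fun a ha b hb => hin a ha b hb j hj) (by omega)

theorem clique_path_between {K : Finset V} {a b : V} {j : ℕ}
    (hK : ∀ a ∈ K, ∀ b ∈ K, a ≠ b → G.Adj a b) (ha : a ∈ K) (hb : b ∈ K) (hab : a ≠ b)
    (hj : j + 1 < K.card) : PathIn G K a b (1 + j) := by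
  have hc := Finset.card_erase_of_mem ha
  obtain ⟨x, hx, hp⟩ := clique_path (G := G) (K := K.erase a) (κ := b) (j := j)
    (fun x hx y hy => hK x (by grind) y (by grind)) (by grind) (by omega)
  have := hp.cons' (a := a) (W := K) (by simp) (hK a ha x (by grind) (by grind)) (by grind)
  rwa [Nat.add_comm]

theorem closedIn_disjoint {H E : Finset V} (h : ClosedIn G (Finset.univ \ H) E) :
    Disjoint H E := by
  rw [Finset.disjoint_left]
  intro a ha hE
  have := h.1 hE
  grind

theorem exists_maximum_clique {a b c : V} (hab : G.Adj a b) (hbc : G.Adj b c)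
    (hac : G.Adj a c) : ∃ K : Finset V, (∀ a ∈ K, ∀ b ∈ K, a ≠ b → G.Adj a b) ∧ 3 ≤ K.card ∧
      ∀ K' : Finset V, (∀ a ∈ K', ∀ b ∈ K', a ≠ b → G.Adj a b) → K'.card ≤ K.card := by
  classical
  obtain ⟨K, hK, hmax⟩ := Finset.exists_max_image
    ((Finset.univ : Finset (Finset V)).filter fun K => ∀ a ∈ K, ∀ b ∈ K, a ≠ b → G.Adj a b)
    Finset.card ⟨∅, by simp⟩
  simp only [Finset.mem_filter, Finset.mem_univ, true_and] at hK hmax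
  refine ⟨K, hK, ?_, hmax⟩
  have := hmax {a, b, c} (by
    have := hab.symm; have := hbc.symm; have := hac.symm
    simp only [Finset.mem_insert, Finset.mem_singleton]
    rintro x (rfl | rfl | rfl) y (rfl | rfl | rfl) hxy <;> first | assumption | exact absurd rfl hxy)
  rwa [Finset.card_eq_three.2 ⟨a, b, c, hab.ne, hac.ne, hbc.ne, rfl⟩] at this

theorem complete_iso (hc : Fintype.card V = k + 1) (hK : ∀ a b, a ≠ b → G.Adj a b) :
    Nonempty (G ≃g (⊤ : SimpleGraph (Fin (k + 1)))) := by
  refine ⟨⟨Fintype.equivFinOfCardEq hc, fun {a b} => ?_⟩⟩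
  simp only [top_adj, ne_eq, EmbeddingLike.apply_eq_iff_eq]
  exact ⟨hK a b, fun h => h.ne⟩

theorem dg_insert {K : Finset V} {u : V} (hu : u ∉ K) (v : V) :
    dg G (insert u K) v = dg G K v + if G.Adj v u then 1 else 0 := by
  unfold dg
  rw [Finset.filter_insert]
  split_ifs
  · rw [Finset.card_insert_of_notMem (by simp [hu])]
  · rfl

theorem dg_erase {K : Finset V} {u : V} (hu : u ∈ K) (v : V) :
    dg G K v = dg G (K.erase u) v + if G.Adj v u then 1 else 0 := by
  rw [← dg_insert (by simp), Finset.insert_erase hu]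

/-- A component outside a vertex set is attached to at least two of its vertices. -/
theorem Base.exists_attached (h : Base G k) {H E : Finset V} {u : V}
    (hE : ClosedIn G (Finset.univ \ H) E) (hc : E.Nonempty) (hu : u ∈ H) (hH : ∃ w ∈ H, w ≠ u) :
    ∃ v ∈ nbs G (H.erase u), v ∈ E := by
  by_contra! hcon
  obtain ⟨w, hw, hwu⟩ := hH
  have := (h.conn_erase u).2 E ⟨fun x hx => by have := hE.1 hx; grind, fun a ha b hb hab => ?_⟩ hc
  · have hwE : w ∈ E := by rw [this]; grind
    have := hE.1 hwE
    grind
  · have h1 := hE.2 a ha b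
    have h2 := hcon a
    simp only [mem_nbs] at h2
    have := hab.symm
    grind

theorem Base3.exists_attached₂ (h : Base3 G k) {H E : Finset V} {u q : V}
    (hE : ClosedIn G (Finset.univ \ H) E) (hc : E.Nonempty) (hu : u ∈ H) (hq : q ∈ H)
    (hH : ∃ w ∈ H, w ≠ u ∧ w ≠ q) : ∃ v ∈ nbs G ((H.erase u).erase q), v ∈ E := by
  by_contra! hcon
  obtain ⟨w, hw, hwu, hwq⟩ := hH
  have := (h.conn_erase₂ u q).2 E
    ⟨fun x hx => by have := hE.1 hx; grind, fun a ha b hb hab => ?_⟩ hc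
  · have hwE : w ∈ E := by rw [this]; grind
    have := hE.1 hwE
    grind
  · have h1 := hE.2 a ha b
    have h2 := hcon a
    simp only [mem_nbs] at h2
    have := hab.symm
    grind

theorem Base3.triangle (h : Base3 G k) {a b c : V} (hab : G.Adj a b) (hbc : G.Adj b c)
    (hac : G.Adj a c) : EvenRes G k ∨ Nonempty (G ≃g (⊤ : SimpleGraph (Fin (k + 1)))) := by
  have hk := h.hk
  obtain ⟨K, hK, hK3, hmax⟩ := exists_maximum_clique hab hbc hac
  have hbound : ∀ v, v ∉ K → dg G K v + 1 ≤ K.card := by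
    intro v hv
    by_contra! hcon
    have h1 := dg_eq_card.1 (le_antisymm (dg_le_card (G := G) K v) (by omega))
    have := hmax (insert v K) (by
      intro x hx y hy hxy
      have h2 := h1 x
      have h3 := h1 y
      have h4 := hK x
      have := fun h : G.Adj v x => h.symm
      grind)
    rw [Finset.card_insert_of_notMem hv] at this
    omega
  rcases Nat.lt_or_ge (k + 1) K.card with hbig | hbig
  · left
    refine Consec.evenRes (by omega) ⟨3, fun i hi => ?_⟩
    obtain ⟨x, hx, y, hy, hxy⟩ := Finset.one_lt_card.1 (show 1 < K.card by omega)
    have := (clique_path_between hK hx hy hxy (j := i + 1) (by omega)).hasCycleLen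
      (hK y hy x hx hxy.symm) (by omega)
    rwa [show 3 + i = 1 + (i + 1) + 1 by omega]
  by_cases hall : ∀ v, v ∈ K
  · have hKu : K = Finset.univ := by ext; simp [hall]
    have hcard := h.card
    right
    refine complete_iso ?_ fun a b hab => hK a (hall a) b (hall b) hab
    rw [hKu, Finset.card_univ] at hbig
    omega
  left
  push Not at hall
  by_cases hcase : K.card ≤ k ∧ ∃ u ∈ K, ∃ v₀, v₀ ∉ K ∧ ∀ a ∈ K.erase u, G.Adj v₀ a
  · obtain ⟨hKk, u, hu, v₀, hv₀, hadj⟩ := hcase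
    have huv : ¬G.Adj v₀ u := fun hvu => by
      have h1 := hbound v₀ hv₀
      rw [dg_eq_card.2 (fun a ha => by have := hadj a; grind)] at h1
      omega
    have hce := Finset.card_erase_of_mem hu
    obtain ⟨w, hw, hwH⟩ : ∃ w, G.Adj u w ∧ w ∉ insert v₀ K := by
      by_contra! hcon
      have h1 := h.deg u
      have h2 : dg G Finset.univ u ≤ (K.erase u).card := Finset.card_le_card fun x hx => by
        have := hcon x
        have := fun h : G.Adj u x => h.ne
        have := fun h : G.Adj u v₀ => huv h.symm
        grind
      omega
    obtain ⟨E, hE, hEc, hwE⟩ := exists_comp (G := G) (U := Finset.univ \ insert v₀ K) (v := w)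
      (by grind)
    have hd := closedIn_disjoint hE
    have hd' := Finset.disjoint_left.1 hd
    obtain ⟨x, hx, hxE⟩ := h.exists_attached₂ hE hEc.1 (u := u) (q := v₀) (by grind) (by grind) (by
      obtain ⟨y, hy⟩ := Finset.card_pos.1 (show 0 < (K.erase u).card by omega)
      exact ⟨y, by grind⟩)
    have hsys : KSys G E (nbs G {u}) (nbs G (K.erase u)) (k + 1 - K.card) := by
      refine h.ear_sys hE hEc (h.good v₀ ⟨u, fun hs => hd' (by grind) hs, by grind⟩
        (fun hs => hd' (by grind) hs) ?_) ⟨w, by simpa using hw, hwE⟩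
        ⟨x, by convert hx using 2; grind, hxE⟩ ?_
      · intro v hv y hy hyv hvy
        have h1 := hE.2 v hv y
        have : y ∈ K := by grind
        simp only [Finset.mem_union, mem_nbs]
        have := hvy.symm
        grind
      · intro _ v hv
        have hvK : v ∉ K := fun hs => hd' (by grind) hv
        have h1 := hbound v hvK
        have h2 := dg_insert (G := G) hv₀ v
        have h3 := dg_erase (G := G) hu v
        have h4 := dg_eq_zero_of_notMem (G := G) (K := K.erase u) (v := v)
        have h5 := dg_le_card (G := G) (K.erase u) v
        by_cases h6 : G.Adj v v₀ ∧ ¬G.Adj v u ∧ dg G (K.erase u) v = (K.erase u).card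
        · exfalso
          obtain ⟨h6, h7, h8⟩ := h6
          rw [dg_eq_card] at h8
          have := hmax (insert v (insert v₀ (K.erase u))) (by
            intro x hx y hy hxy
            have := hadj x
            have := hadj y
            have := h8 x
            have := h8 y
            have := hK x
            have := fun h : G.Adj v x => h.symm
            have := fun h : G.Adj v₀ x => h.symm
            grind)
          rw [Finset.card_insert_of_notMem (by have := h6.ne; grind),
            Finset.card_insert_of_notMem (by grind)] at this
          omega
        · simp only [mem_nbs_singleton, G.adj_comm u v]
          by_cases hB : v ∈ nbs G (K.erase u)
          · simp only [hB, if_true]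
            by_cases hv0 : G.Adj v v₀ <;> by_cases hvu : G.Adj v u <;>
              simp only [hv0, hvu, if_true, if_false, not_true, not_false_eq_true, true_and] at * <;>
              omega
          · rw [h4 hB] at h3
            split_ifs at * <;> omega
    refine ((hsys.ear_consec (N := K.card) (s := 1) (H := insert v₀ K) hd (by omega) (by omega)
      le_rfl ?_).mono (by omega)).evenRes (by omega)
    intro a ha b hb j hj
    obtain rfl := Finset.mem_singleton.1 ha
    have := clique_two_path (G := G) (B := K.erase a) (t := a) (t' := v₀) (κ := b) (j := j)
      (fun x hx y hy => hK x (by grind) y (by grind)) (by omega) (by grind) (by grind) (by grind)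
      (fun y hy => ⟨hK a hu y (by grind) (by grind), hadj y hy⟩) hb (by omega)
    rw [one_mul] at this
    exact this.mono (by grind)
  · push Not at hcase
    obtain ⟨w, hw⟩ := hall
    obtain ⟨E, hE, hEc, hwE⟩ := exists_comp (G := G) (U := Finset.univ \ K) (v := w) (by grind)
    have hd := closedIn_disjoint hE
    have hd' := Finset.disjoint_left.1 hd
    obtain ⟨u₀, hu₀⟩ := Finset.card_pos.1 (show 0 < K.card by omega)
    have hex : ∀ u ∈ K, ∃ w ∈ K, w ≠ u := fun u hu => by
      have hce := Finset.card_erase_of_mem hu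
      obtain ⟨y, hy⟩ := Finset.card_pos.1 (show 0 < (K.erase u).card by omega)
      exact ⟨y, by grind⟩
    obtain ⟨x, hx, hxE⟩ := h.exists_attached hE hEc.1 hu₀ (hex _ hu₀)
    obtain ⟨u, hu, hux⟩ := mem_nbs.1 hx
    replace hu := Finset.mem_of_mem_erase hu
    obtain ⟨y, hy, hyE⟩ := h.exists_attached hE hEc.1 hu (hex _ hu)
    have hce := Finset.card_erase_of_mem hu
    have hsys : KSys G E (nbs G {u}) (nbs G (K.erase u)) (k + 2 - K.card) := by
      refine h.ear_sys hE hEc (h.toBase.good ⟨u, fun hs => hd' hu hs⟩ ?_)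
        ⟨x, by simpa using hux, hxE⟩ ⟨y, hy, hyE⟩ ?_
      · intro v hv y hy hvy
        have h1 := hE.2 v hv y
        simp only [Finset.mem_union, mem_nbs]
        have := hvy.symm
        grind
      · intro hk2 v hv
        have hvK : v ∉ K := fun hs => hd' hs hv
        have h1 := hbound v hvK
        have h4 := dg_eq_zero_of_notMem (G := G) (K := K.erase u) (v := v)
        have h5 := dg_le_card (G := G) (K.erase u) v
        have h3 := dg_erase (G := G) hu v
        have h6 : dg G (K.erase u) v ≠ (K.erase u).card := by
          obtain ⟨a, ha, hva⟩ := hcase (by omega) u hu v hvK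
          rw [ne_eq, dg_eq_card]
          exact fun hs => hva (hs a ha)
        simp only [mem_nbs_singleton, G.adj_comm u v]
        by_cases hB : v ∈ nbs G (K.erase u)
        · simp only [hB, if_true]
          omega
        · rw [h4 hB] at h3
          omega
    refine ((hsys.ear_consec (N := K.card - 1) (s := 1) (H := K) hd (by omega) (by omega)
      le_rfl ?_).mono (by omega)).evenRes (by omega)
    intro a ha b hb j hj
    obtain rfl := Finset.mem_singleton.1 ha
    exact clique_path_between hK hu (by grind) (by grind) (by omega)

end Triangle

section Bipartite

theorem Base3.bipartite (h : Base3 G k) (he : Even k) (hb : ∀ n, HasCycleLen G n → Even n) :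
    EvenRes G k := by
  have hk := h.hk
  obtain ⟨⟨x, -⟩, -⟩ := h.conn
  have hx := h.deg x
  obtain ⟨y, -, hxy⟩ := dg_pos.1 (show 0 < dg G Finset.univ x by omega)
  have hcon := h.conn_erase₂ x y
  have hd1 : ∀ v, dg G {x, y} v = (if G.Adj v y then 1 else 0) + if G.Adj v x then 1 else 0 := by
    intro v
    rw [dg_insert (by simpa using hxy.ne), ← insert_empty_eq, dg_insert (by simp)]
    simp [dg]
  have hxyd := hxy.ne
  have hsys : KSys G ((Finset.univ.erase x).erase y) (nbs G {x}) (nbs G {y}) (k - 1) := by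
    refine h.ear_sys (H := {x, y}) ⟨fun v hv => by grind, fun a ha b hb _ => by grind⟩ hcon
      (h.toBase.good ⟨x, by simp⟩ ?_) ?_ ?_ ?_
    · intro v hv w hw hvw
      have := hvw.symm
      simp only [Finset.mem_union, mem_nbs_singleton]
      grind
    · by_contra! hno
      have : dg G Finset.univ x ≤ ({y} : Finset V).card := Finset.card_le_card fun v hv => by
        have := hno v
        have := fun h : G.Adj x v => h.ne
        simp only [mem_nbs_singleton] at *
        grind
      rw [Finset.card_singleton] at this
      omega
    · by_contra! hno
      have : dg G Finset.univ y ≤ ({x} : Finset V).card := Finset.card_le_card fun v hv => by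
        have := hno v
        have := fun h : G.Adj y v => h.ne
        simp only [mem_nbs_singleton] at *
        grind
      have := h.deg y
      rw [Finset.card_singleton] at *
      omega
    · intro _ v _
      rw [hd1]
      simp only [mem_nbs_singleton, G.adj_comm x v, G.adj_comm y v]
      omega
  obtain ⟨p, d, hd, hp⟩ := hsys.ap
  have hcyc : ∀ i < k - 1, HasCycleLen G (p + 3 + d * i) := by
    intro i hi
    obtain ⟨a, ha, b, hb, hab⟩ := hp i hi
    rw [mem_nbs_singleton] at ha hb
    have := (hab.snoc (c := y) (W := Finset.univ.erase x) (by simp) hb.symm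
      (by grind)).snoc (c := x) (W := Finset.univ) (by simp) hxy.symm (by grind)
    have := this.hasCycleLen ha (by omega)
    rwa [show p + 3 + d * i = p + d * i + 1 + 1 + 1 by omega]
  have h0 := hb _ (hcyc 0 (by omega))
  have h1 := hb _ (hcyc 1 (by omega))
  rcases hd with rfl | rfl
  · rw [Nat.even_iff] at h0 h1
    omega
  · exact evenRes_of_even (m := k - 1) (by omega) he (by omega) (by simpa using h0) hcyc

end Bipartite

section MaxBip

/-- A path in a complete bipartite subgraph between its two sides. -/
theorem bip_cross {S T : Finset V} {x t : V} {j : ℕ} (hd : ∀ s ∈ S, s ∉ T)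
    (hST : ∀ s ∈ S, ∀ t ∈ T, G.Adj s t) (hx : x ∈ S) (ht : t ∈ T) (hj : j < S.card)
    (hj' : j < T.card) : PathIn G (S ∪ T) x t (1 + 2 * j) := by
  have hc := Finset.card_erase_of_mem hx
  obtain ⟨y, hy, hp⟩ := bip_path (G := G) (S := S.erase x) (T := T) (κ := t) (j := j) (by grind)
    (fun a ha b hb => hST a (by grind) b hb) ht hj' (by omega)
  have hxT := hd x hx
  have := hp.cons' (a := x) (W := S ∪ T) (by grind) (hST x hx y hy) (by grind)
  rwa [Nat.add_comm]

/-- A path in a complete bipartite subgraph between two vertices of one side. -/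
theorem bip_same {S T : Finset V} {t t' : V} {j : ℕ} (hd : ∀ s ∈ S, s ∉ T)
    (hST : ∀ s ∈ S, ∀ t ∈ T, G.Adj s t) (ht : t ∈ T) (ht' : t' ∈ T) (htt : t ≠ t')
    (hj : j < S.card) (hj' : j + 1 < T.card) : PathIn G (S ∪ T) t t' (2 + 2 * j) := by
  have hc := Finset.card_erase_of_mem ht
  obtain ⟨x, hx⟩ := Finset.card_pos.1 (show 0 < S.card by omega)
  have hp := bip_cross (G := G) (S := S) (T := T.erase t) (x := x) (t := t') (j := j)
    (fun s hs => by have := hd s hs; grind) (fun a ha b hb => hST a ha b (by grind)) hx (by grind)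
    hj (by omega)
  have htS : t ∉ S := fun hs => hd t hs ht
  have := hp.cons' (a := t) (W := S ∪ T) (by grind) (hST x hx t ht).symm (by grind)
  rwa [show 2 + 2 * j = 1 + 2 * j + 1 by omega]

theorem dg_two {U : Finset V} {v : V} (h : 2 ≤ dg G U v) (a : V) :
    ∃ b ∈ U, b ≠ a ∧ G.Adj v b := by
  obtain ⟨b, hb, hba⟩ := Finset.exists_mem_ne (s := U.filter (G.Adj v)) h a
  exact ⟨b, by grind, hba, by grind⟩

theorem bip_cross_extra {S T : Finset V} {x t v₀ : V} {j : ℕ} (hd : ∀ s ∈ S, s ∉ T)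
    (hST : ∀ s ∈ S, ∀ t ∈ T, G.Adj s t) (hx : x ∈ S) (ht : t ∈ T) (hv : v₀ ∉ S ∪ T)
    (hj : j < S.card + 1) (hS : 2 ≤ S.card) (hT : S.card + 1 ≤ T.card) (h2 : 2 ≤ dg G T v₀) :
    PathIn G (insert v₀ (S ∪ T)) x t (1 + 2 * j) := by
  rcases Nat.lt_succ_iff_lt_or_eq.1 hj with hj | rfl
  · exact (bip_cross hd hST hx ht hj (by omega)).mono (Finset.subset_insert _ _)
  obtain ⟨τ, hτ, hτt, hvτ⟩ := dg_two h2 t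
  by_cases hvt : G.Adj v₀ t
  · have hc := Finset.card_erase_of_mem ht
    have hp := bip_cross (G := G) (S := S) (T := T.erase t) (x := x) (t := τ) (j := S.card - 1)
      (fun s hs => by have := hd s hs; grind) (fun a ha b hb => hST a ha b (by grind)) hx (by grind)
      (by omega) (by omega)
    have hts : t ∉ S := fun hs => hd t hs ht
    have := (hp.snoc (c := v₀) (W := insert v₀ (S ∪ T.erase t)) (by grind) hvτ.symm
      subset_rfl).snoc (c := t) (W := insert v₀ (S ∪ T)) (by grind) hvt (by grind)
    convert this using 1
    omega
  · obtain ⟨τ', hτ', hττ, hvτ'⟩ := dg_two h2 τ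
    have hc := Finset.card_erase_of_mem hx
    have hc' := Finset.card_erase_of_mem hτ
    have hp := bip_same (G := G) (S := S.erase x) (T := T.erase τ) (t := τ') (t' := t)
      (j := S.card - 2) (fun s hs => by have := hd s; grind)
      (fun a ha b hb => hST a (by grind) b (by grind)) (by grind) (by grind) (by grind)
      (by omega) (by omega)
    have hxT := hd x hx
    have hτS : τ ∉ S := fun hs => hd τ hs hτ
    have h1 := hp.cons' (a := v₀) (W := insert v₀ (S.erase x ∪ T.erase τ)) (by grind) hvτ'
      subset_rfl
    have h2 := h1.cons' (a := τ) (W := insert v₀ (S.erase x ∪ T)) (by grind) hvτ.symm (by grind)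
    have h3 := h2.cons' (a := x) (W := insert v₀ (S ∪ T)) (by grind) (hST x hx τ hτ) (by grind)
    convert h3 using 1
    omega

theorem bip_same_extra {S T : Finset V} {t₁ t v₀ : V} {j : ℕ} (hd : ∀ s ∈ S, s ∉ T)
    (hST : ∀ s ∈ S, ∀ t ∈ T, G.Adj s t) (ht₁ : t₁ ∈ T) (ht : t ∈ T) (htt : t₁ ≠ t)
    (hv : v₀ ∉ S ∪ T) (hvt₁ : ¬G.Adj v₀ t₁)
    (hj : j < S.card + 1) (hS : 2 ≤ S.card) (hT : S.card + 2 ≤ T.card) (h2 : 2 ≤ dg G T v₀) :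
    PathIn G (insert v₀ (S ∪ T)) t₁ t (2 + 2 * j) := by
  rcases Nat.lt_succ_iff_lt_or_eq.1 hj with hj | rfl
  · exact (bip_same hd hST ht₁ ht htt hj (by omega)).mono (Finset.subset_insert _ _)
  have h3 := dg_erase (G := G) ht₁ v₀
  rw [if_neg hvt₁] at h3
  obtain ⟨x, hx⟩ := Finset.card_pos.1 (show 0 < S.card by omega)
  have hc := Finset.card_erase_of_mem ht₁
  have ht₁S : t₁ ∉ S := fun hs => hd t₁ hs ht₁
  have hp := bip_cross_extra (G := G) (S := S) (T := T.erase t₁) (x := x) (t := t) (v₀ := v₀)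
    (j := S.card) (fun s hs => by have := hd s hs; grind)
    (fun a ha b hb => hST a ha b (by grind)) hx (by grind) (by grind) (by omega) hS (by omega)
    (by omega)
  have := hp.cons' (a := t₁) (W := insert v₀ (S ∪ T)) (by grind) (hST x hx t₁ ht₁).symm (by grind)
  convert this using 1
  omega

/-- A complete bipartite subgraph whose smaller side, and then whose larger side, is maximum. -/
structure MaxBip (G : SimpleGraph V) [DecidableRel G.Adj] (S T : Finset V) : Prop where
  adj : ∀ s ∈ S, ∀ t ∈ T, G.Adj s t
  two : 2 ≤ S.card
  le : S.card ≤ T.card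
  degT : ∀ v, v ∉ S → dg G T v ≤ S.card
  big : ∀ v, v ∉ S → dg G T v = S.card → S.card + 1 ≤ T.card
  degS : ∀ v, v ∉ T → dg G S v + 1 ≤ S.card
  tri : TriFree G

theorem MaxBip.disj {S T : Finset V} (h : MaxBip G S T) : ∀ s ∈ S, s ∉ T :=
  fun s hs ht => (h.adj s hs s ht).ne rfl

theorem exists_maxBip (htri : TriFree G)
    {S₀ T₀ : Finset V} (h₀ : ∀ s ∈ S₀, ∀ t ∈ T₀, G.Adj s t) (hS₀ : 2 ≤ S₀.card)
    (hT₀ : 2 ≤ T₀.card) : ∃ S T, MaxBip G S T := by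
  classical
  let n := Fintype.card V
  have hn : ∀ A : Finset V, A.card < n + 1 := fun A => Nat.lt_succ_of_le (Finset.card_le_univ A)
  have hex : ∃ p ∈ (Finset.univ : Finset (Finset V × Finset V)).filter
      (fun p => (∀ s ∈ p.1, ∀ t ∈ p.2, G.Adj s t) ∧ 2 ≤ p.1.card ∧ p.1.card ≤ p.2.card), True := by
    rcases le_total S₀.card T₀.card with hle | hle
    · exact ⟨(S₀, T₀), by simp only [Finset.mem_filter, Finset.mem_univ, true_and]; exact ⟨h₀, hS₀, hle⟩, trivial⟩
    · exact ⟨(T₀, S₀), by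
        simp only [Finset.mem_filter, Finset.mem_univ, true_and]
        exact ⟨fun s hs t ht => (h₀ t ht s hs).symm, hT₀, hle⟩, trivial⟩
  obtain ⟨p, hp, -⟩ := hex
  obtain ⟨⟨S, T⟩, hST, hmax⟩ := Finset.exists_max_image _
    (fun p : Finset V × Finset V => p.1.card * (n + 1) + p.2.card) ⟨p, hp⟩
  simp only [Finset.mem_filter, Finset.mem_univ, true_and, Prod.forall] at hST hmax
  obtain ⟨hadj, h2, hle⟩ := hST
  have hlex : ∀ A B : Finset V, (∀ s ∈ A, ∀ t ∈ B, G.Adj s t) → A.card ≤ B.card →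
      A.card ≤ S.card ∧ (A.card = S.card → B.card ≤ T.card) := by
    intro A B hAB hc
    have hT := hn T
    refine ⟨?_, fun he => ?_⟩
    · by_contra! hlt
      have := hmax A B ⟨hAB, by omega, hc⟩
      nlinarith
    · have := hmax A B ⟨hAB, by omega, hc⟩
      rw [he] at this
      omega
  refine ⟨S, T, hadj, h2, hle, fun v hv => ?_, fun v hv he => ?_, fun v hv => ?_, htri⟩
  · by_contra! hcon
    have := (hlex (insert v S) (T.filter (G.Adj v)) (by
      intro s hs t ht
      have := hadj s
      grind) (by
        rw [Finset.card_insert_of_notMem hv]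
        exact hcon)).1
    rw [Finset.card_insert_of_notMem hv] at this
    omega
  · by_contra! hcon
    have hTS : T.card = S.card := by omega
    have hall := dg_eq_card.1 (he.trans hTS.symm)
    have := (hlex T (insert v S) (by
      intro t ht s hs
      have := hadj s
      have := hall t ht
      have := fun h : G.Adj v t => h.symm
      have := fun h : G.Adj s t => h.symm
      grind) (by rw [Finset.card_insert_of_notMem hv]; omega)).2 hTS
    rw [Finset.card_insert_of_notMem hv] at this
    omega
  · by_contra! hcon
    have hall := dg_eq_card.1 (le_antisymm (dg_le_card (G := G) S v) (by omega))
    have := (hlex S (insert v T) (by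
      intro s hs t ht
      have := hadj s hs
      have := (hall s hs).symm
      grind) (by rw [Finset.card_insert_of_notMem hv]; omega)).2 rfl
    rw [Finset.card_insert_of_notMem hv] at this
    omega

end MaxBip

section EarLemma

theorem exists_modEq_of_odd (ho : Odd k) (p l : ℤ) :
    ∃ j : ℕ, j < k ∧ p + 2 * j ≡ l [ZMOD (k : ℤ)] := by
  obtain ⟨m, hm⟩ := ho
  have hk' : (k : ℤ) ≠ 0 := by omega
  have h0 := Int.emod_nonneg ((l - p) * (m + 1)) hk'
  have h1 := Int.emod_lt_of_pos ((l - p) * (m + 1)) (by omega : (0 : ℤ) < k)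
  refine ⟨((l - p) * (m + 1) % k).toNat, by omega, ?_⟩
  rw [Int.toNat_of_nonneg h0]
  refine (((Int.mod_modEq ((l - p) * (m + 1)) k).mul_left 2).add_left p).trans
    (Int.ModEq.symm ?_)
  rw [Int.modEq_iff_dvd]
  exact ⟨l - p, by subst hm; push_cast; ring⟩

theorem evenRes_of_two {p d : ℕ} (ho : Odd k) (hd : 0 < d) (hdk : d < k)
    (hp : ∀ j, j + 1 < k → HasCycleLen G (p + 2 * j))
    (hq : ∀ j, j + 1 < k → HasCycleLen G (p + d + 2 * j)) : EvenRes G k := by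
  intro l _
  obtain ⟨i, hi, hil⟩ := exists_modEq_of_odd ho p l
  obtain ⟨j, hj, hjl⟩ := exists_modEq_of_odd ho (p + d : ℕ) l
  by_cases hi' : i + 1 < k
  · exact ⟨_, hp i hi', by push_cast; exact hil⟩
  by_cases hj' : j + 1 < k
  · exact ⟨_, hq j hj', by push_cast at hjl ⊢; exact hjl⟩
  obtain rfl : i = j := by omega
  have := (hil.trans hjl.symm).dvd
  push_cast at this
  rw [show (p + d + 2 * i - (p + 2 * i) : ℤ) = d by ring] at this
  have := Int.le_of_dvd (by omega) this
  omega

/-- A path in `E` whose ends are attached to distinct vertices of `P`. -/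
def IsEar (G : SimpleGraph V) (P E : Finset V) (n : ℕ) : Prop :=
  ∃ t ∈ P, ∃ t' ∈ P, t ≠ t' ∧ ∃ x y, G.Adj t x ∧ G.Adj t' y ∧ PathIn G E x y n

theorem IsEar.hasCycleLen {P Q E : Finset V} {n j : ℕ} (h : IsEar G P E n)
    (hd : Disjoint (P ∪ Q) E) (hPQ : ∀ s ∈ Q, ∀ t ∈ P, G.Adj s t) (hj : j + 1 < P.card)
    (hj' : j < Q.card) : HasCycleLen G (n + 4 + 2 * j) := by
  obtain ⟨t, ht, t', ht', htt, x, y, hx, hy, hp⟩ := h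
  have h1 := bip_same (fun s hs ht => (hPQ s hs s ht).ne rfl) hPQ ht ht' htt hj' hj
  rw [Finset.union_comm] at h1
  have := h1.hasCycleLen' hp.symm hd hy hx.symm (by omega)
  convert this using 1
  omega

theorem AP.evenRes_ears {P Q E : Finset V} (ho : Odd k) (hk : 4 ≤ k) (h : AP (IsEar G P E) 2)
    (hd : Disjoint (P ∪ Q) E) (hPQ : ∀ s ∈ Q, ∀ t ∈ P, G.Adj s t) (hP : P.card = k)
    (hQ : k ≤ Q.card + 1) : EvenRes G k := by
  obtain ⟨p, d, hd', h⟩ := h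
  refine evenRes_of_two (p := p + 4) (d := d) ho (by omega) (by omega) (fun j hj => ?_)
    (fun j hj => ?_)
  · have := (h 0 (by omega)).hasCycleLen hd hPQ (j := j) (by omega) (by omega)
    simpa using this
  · have := (h 1 (by omega)).hasCycleLen hd hPQ (j := j) (by omega) (by omega)
    convert this using 1
    ring

/-- A component attached to one side, of size `k`, of a complete bipartite subgraph. -/
theorem Base.ear_lemma (h : Base G k) (ho : Odd k) {P Q E : Finset V}
    (hPQ : ∀ s ∈ Q, ∀ t ∈ P, G.Adj s t) (hP : P.card = k) (hQ : k ≤ Q.card + 1)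
    (hE : ClosedIn G (Finset.univ \ (P ∪ Q)) E) (hEc : ConnOn G E)
    (hEQ : ∀ v ∈ E, dg G Q v = 0) (hEP : ∀ v ∈ E, dg G P v + 1 ≤ k) : EvenRes G k := by
  have hk := h.hk
  have hd := closedIn_disjoint hE
  have hd' := Finset.disjoint_left.1 hd
  have hnQ : ∀ v ∈ E, ∀ s ∈ Q, ¬G.Adj v s := by
    intro v hv s hs hvs
    have := dg_pos.2 ⟨s, hs, hvs⟩
    have := hEQ v hv
    omega
  have hPw : ∀ u, ∃ w ∈ P, w ≠ u := fun u => Finset.exists_mem_ne (by omega) u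
  have hdP : ∀ v ∈ E, 0 < dg G P v → ∃ t ∈ P, G.Adj v t := fun v hv h0 => dg_pos.1 h0
  by_cases hbig : ∃ b ∈ E, dg G P b + 1 = k
  swap
  · obtain ⟨u₀, hu₀, -⟩ := hPw hEc.1.choose
    obtain ⟨x, hx, hxE⟩ := h.exists_attached hE hEc.1 (u := u₀) (by grind)
      (by obtain ⟨w, hw, hwu⟩ := hPw u₀; exact ⟨w, by grind, hwu⟩)
    obtain ⟨t, ht, htx⟩ := mem_nbs.1 hx
    have htP : t ∈ P := by
      have := hnQ x hxE t
      have := htx.symm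
      grind
    obtain ⟨y, hy, hyE⟩ := h.exists_attached hE hEc.1 (u := t) (by grind)
      (by obtain ⟨w, hw, hwu⟩ := hPw t; exact ⟨w, by grind, hwu⟩)
    have hsys : KSys G E (nbs G {t}) (nbs G (P.erase t)) 2 := by
      refine h.ear_sys hE hEc (h.good ⟨t, fun hs => hd' (by grind) hs⟩ ?_)
        ⟨x, by simpa using htx, hxE⟩ ⟨y, ?_, hyE⟩ ?_
      · intro v hv y hy hvy
        have h1 := hE.2 v hv y
        have h2 := hnQ v hv y
        simp only [Finset.mem_union, mem_nbs]
        have := hvy.symm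
        grind
      · rw [mem_nbs] at hy ⊢
        obtain ⟨a, ha, hay⟩ := hy
        have := hnQ y hyE a
        have := hay.symm
        exact ⟨a, by grind, hay⟩
      · intro _ v hv
        have h1 := dg_union_le (G := G) P Q v
        have h2 := hEQ v hv
        have h3 := hEP v hv
        have h4 : dg G P v + 1 ≠ k := fun hs => hbig ⟨v, hv, hs⟩
        have h5 := dg_erase (G := G) htP v
        have h6 := dg_eq_zero_of_notMem (G := G) (K := P.erase t) (v := v)
        simp only [mem_nbs_singleton, G.adj_comm t v]
        by_cases h7 : v ∈ nbs G (P.erase t) <;> by_cases h8 : G.Adj v t <;>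
          simp only [h7, h8, if_true, if_false, not_true, not_false_eq_true, forall_const] at * <;>
          omega
    refine AP.evenRes_ears ho hk ?_ hd hPQ hP hQ
    refine hsys.ap.imp (s := 0) ?_
    rintro n ⟨x, hx, y, hy, hp⟩
    rw [mem_nbs_singleton] at hx
    obtain ⟨t', ht', hy⟩ := mem_nbs.1 hy
    exact ⟨t, htP, t', by grind, by grind, x, y, hx, hy, hp⟩
  obtain ⟨b, hbE, hb⟩ := hbig
  have hear0 : ∀ j, j + 1 < k → HasCycleLen G (4 + 2 * j) := by
    intro j hj
    obtain ⟨t, ht, hbt⟩ := dg_pos.1 (show 0 < dg G P b by omega)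
    obtain ⟨t', ht', htt, hbt'⟩ := dg_two (show 2 ≤ dg G P b by omega) t
    have : IsEar G P E 0 := ⟨t, ht, t', ht', htt.symm, b, b, hbt.symm, hbt'.symm, .nil hbE⟩
    simpa using this.hasCycleLen hd hPQ (j := j) (by omega) (by omega)
  have hfin : ∀ n, 0 < n → n < k → IsEar G P E n → EvenRes G k := by
    intro n hn hnk he
    refine evenRes_of_two (p := 4) (d := n) ho hn hnk hear0 fun j hj => ?_
    rw [Nat.add_comm 4 n]
    exact he.hasCycleLen hd hPQ (by omega) (by omega)
  by_cases hear1 : ∃ b ∈ E, ∃ w ∈ E, dg G P b + 1 = k ∧ G.Adj b w ∧ 0 < dg G P w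
  · obtain ⟨b, hb, w, hw, hbk, hbw, hw0⟩ := hear1
    obtain ⟨t, ht, hwt⟩ := dg_pos.1 hw0
    obtain ⟨t', ht', htt, hbt⟩ := dg_two (show 2 ≤ dg G P b by omega) t
    exact hfin 1 (by omega) (by omega) ⟨t', ht', t, ht, htt, b, w, hbt.symm, hwt.symm,
      .cons' (.nil (Finset.mem_singleton_self w)) (by simpa using hbw.ne) hbw (by grind)⟩
  push Not at hear1
  by_cases hear2 : ∃ b ∈ E, ∃ b' ∈ E, ∃ w ∈ E, dg G P b + 1 = k ∧ dg G P b' + 1 = k ∧ b ≠ b' ∧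
      G.Adj w b ∧ G.Adj w b'
  · obtain ⟨b, hb, b', hb', w, hw, hbk, hbk', hbb, hwb, hwb'⟩ := hear2
    obtain ⟨t, ht, hwt⟩ := dg_pos.1 (show 0 < dg G P b by omega)
    obtain ⟨t', ht', htt, hbt⟩ := dg_two (show 2 ≤ dg G P b' by omega) t
    refine hfin 2 (by omega) (by omega) ⟨t, ht, t', ht', htt.symm, b, b', hwt.symm, hbt.symm, ?_⟩
    have h1 : PathIn G {w, b'} w b' 1 := .cons' (.nil (Finset.mem_singleton_self b'))
      (by simpa using hwb'.ne) hwb' (by grind)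
    exact h1.cons' (by have := hwb.ne; grind) hwb.symm (by grind)
  push Not at hear2
  let B := E.filter fun v => dg G P v + 1 = k
  have hB : ∀ v, v ∈ B ↔ v ∈ E ∧ dg G P v + 1 = k := by simp [B]
  have hdB : ∀ v ∈ E, dg G B v ≤ 1 := by
    intro v hv
    by_contra! hcon
    obtain ⟨b, hb, hvb⟩ := dg_pos.1 (show 0 < dg G B v by omega)
    obtain ⟨b', hb', hbb, hvb'⟩ := dg_two (show 2 ≤ dg G B v by omega) b
    rw [hB] at hb hb'
    exact hear2 b hb.1 b' hb'.1 v hv hb.2 hb'.2 hbb.symm hvb hvb'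
  have hdB' : ∀ v ∈ E, 0 < dg G B v → dg G P v = 0 := by
    intro v hv hv0
    obtain ⟨b, hb, hvb⟩ := dg_pos.1 hv0
    rw [hB] at hb
    have := hear1 b hb.1 v hv hb.2 hvb.symm
    omega
  obtain ⟨w, hwE, hbw⟩ : ∃ w ∈ E, G.Adj b w := by
    by_contra! hcon
    have h1 := h.deg b
    have h2 := dg_le_of_closedIn_sdiff (G := G) hE hbE
    have h3 := dg_union_le (G := G) P Q b
    have h4 := hEQ b hbE
    have h5 : dg G E b = 0 := by
      by_contra h0
      obtain ⟨w, hw, hbw⟩ := dg_pos.1 (Nat.pos_of_ne_zero h0)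
      exact hcon w hw hbw
    omega
  have hbB : b ∈ B := (hB b).2 ⟨hbE, hb⟩
  have hwB : w ∉ B := by
    intro hs
    have := hear1 b hbE w hwE hb hbw
    have := (hB w).1 hs
    omega
  obtain ⟨W, hW, hWc, hwW⟩ := exists_comp (G := G) (U := E \ B) (v := w) (by grind)
  have hWE : ∀ v ∈ W, v ∈ E ∧ v ∉ B := fun v hv => by have := hW.1 hv; grind
  have hBE : B ⊆ E := Finset.filter_subset _ _
  have hWcl : ClosedIn G (Finset.univ \ (P ∪ Q ∪ B)) W := by
    refine ⟨fun v hv => ?_, fun a ha c hc hac => ?_⟩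
    · have := hWE v hv
      have := hE.1 this.1
      grind
    · have h1 := hE.2 a (hWE a ha).1 c (by grind) hac
      exact hW.2 a ha c (by grind) hac
  have hPB : ∀ v ∈ W, dg G P v + 3 ≤ k + if v ∈ nbs G P then 1 else 0 := by
    intro v hv
    have h1 := hEP v (hWE v hv).1
    have h2 := hWE v hv
    have h2' : dg G P v + 1 ≠ k := fun hs => h2.2 ((hB v).2 ⟨h2.1, hs⟩)
    have h3 := dg_eq_zero_of_notMem (G := G) (K := P) (v := v)
    split_ifs with h4
    · omega
    · rw [h3 h4]
      omega
  by_cases hatt : ∃ v ∈ nbs G P, v ∈ W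
  · have hsys : KSys G W (nbs G B) (nbs G P) 2 := by
      refine h.ear_sys hWcl hWc (h.good ⟨b, fun hs => (hWE b hs).2 hbB⟩ ?_)
        ⟨w, mem_nbs.2 ⟨b, hbB, hbw⟩, hwW⟩ hatt ?_
      · intro v hv y hy hvy
        have h1 := hWcl.2 v hv y
        have h2 := hnQ v (hWE v hv).1 y
        simp only [Finset.mem_union, mem_nbs]
        have := hvy.symm
        grind
      · intro _ v hv
        have h1 := dg_union_le (G := G) (P ∪ Q) B v
        have h2 := dg_union_le (G := G) P Q v
        have h3 := hEQ v (hWE v hv).1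
        have h4 := hPB v hv
        have h5 := hdB v (hWE v hv).1
        have h6 := hdB' v (hWE v hv).1
        have h7 := dg_eq_zero_of_notMem (G := G) (K := B) (v := v)
        by_cases h8 : v ∈ nbs G B <;> simp only [h8, if_true, if_false, not_true,
          not_false_eq_true, forall_const] at * <;> omega
    refine AP.evenRes_ears ho hk (hsys.ap.imp (s := 1) ?_) hd hPQ hP hQ
    rintro n ⟨x, hx, y, hy, hp⟩
    obtain ⟨β, hβ, hβx⟩ := mem_nbs.1 hx
    obtain ⟨t', ht', hy⟩ := mem_nbs.1 hy
    have hβ' := (hB β).1 hβ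
    obtain ⟨t, ht, htt, hbt⟩ := dg_two (show 2 ≤ dg G P β by omega) t'
    exact ⟨t, ht, t', ht', htt, β, y, hbt.symm, hy,
      hp.cons' (fun hs => (hWE _ hs).2 hβ) hβx (by grind)⟩
  · push Not at hatt
    have hPW : ∀ v ∈ W, dg G P v = 0 := fun v hv =>
      dg_eq_zero_of_notMem fun hs => hatt v hs hv
    have hnP : ∀ v ∈ W, ∀ t ∈ P, ¬G.Adj v t := fun v hv t ht hvt =>
      hatt v (mem_nbs.2 ⟨t, ht, hvt.symm⟩) hv
    obtain ⟨y, hy, hyW⟩ := h.exists_attached hWcl hWc.1 (u := b) (by grind)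
      (by obtain ⟨t, ht, htb⟩ := hPw b; exact ⟨t, by grind, htb⟩)
    have hsys : KSys G W (nbs G {b}) (nbs G (B.erase b)) 2 := by
      refine h.ear_sys hWcl hWc (h.good ⟨b, fun hs => (hWE b hs).2 hbB⟩ ?_)
        ⟨w, by simpa using hbw, hwW⟩ ⟨y, ?_, hyW⟩ ?_
      · intro v hv y hy hvy
        have h1 := hWcl.2 v hv y
        have h2 := hnQ v (hWE v hv).1 y
        have h3 := hnP v hv y
        simp only [Finset.mem_union, mem_nbs]
        have := hvy.symm
        grind
      · rw [mem_nbs] at hy ⊢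
        obtain ⟨a, ha, hay⟩ := hy
        have h2 := hnQ y (hWE y hyW).1 a
        have h3 := hnP y hyW a
        have := hay.symm
        exact ⟨a, by grind, hay⟩
      · intro _ v hv
        have h1 := dg_union_le (G := G) (P ∪ Q) B v
        have h2 := dg_union_le (G := G) P Q v
        have h3 := hEQ v (hWE v hv).1
        have h4 := hPW v hv
        have h5 := hdB v (hWE v hv).1
        omega
    refine AP.evenRes_ears ho hk (hsys.ap.imp (s := 2) ?_) hd hPQ hP hQ
    rintro n ⟨x, hx, y, hy, hp⟩
    rw [mem_nbs_singleton] at hx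
    obtain ⟨β, hβ, hy⟩ := mem_nbs.1 hy
    have hβ' := (hB β).1 (by grind)
    obtain ⟨t, ht, hbt⟩ := dg_pos.1 (show 0 < dg G P b by omega)
    obtain ⟨t', ht', htt, hbt'⟩ := dg_two (show 2 ≤ dg G P β by omega) t
    refine ⟨t, ht, t', ht', htt.symm, b, β, hbt.symm, hbt'.symm, ?_⟩
    have h1 := hp.cons' (W := insert b W) (fun hs => (hWE _ hs).2 hbB) hx subset_rfl
    have hβW : β ∉ W := fun hs => (hWE β hs).2 (Finset.mem_of_mem_erase hβ)
    exact h1.snoc (by grind) hy.symm (Finset.insert_subset (by grind) (Finset.insert_subset hbE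
      fun v hv => (hWE v hv).1))

end EarLemma

section BipEars

variable {S T E : Finset V}

theorem MaxBip.dg_zero (h : MaxBip G S T) {v : V} (hv : 0 < dg G T v) : dg G S v = 0 := by
  by_contra h0
  obtain ⟨s, hs, hvs⟩ := dg_pos.1 (Nat.pos_of_ne_zero h0)
  obtain ⟨t, ht, hvt⟩ := dg_pos.1 hv
  exact h.tri v s t hvs (h.adj s hs t ht) hvt

theorem MaxBip.dg_S (h : MaxBip G S T) {v : V} (hv : v ∈ S) : dg G S v = 0 := by
  by_contra h0
  obtain ⟨s, hs, hvs⟩ := dg_pos.1 (Nat.pos_of_ne_zero h0)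
  obtain ⟨t, ht⟩ := Finset.card_pos.1 (show 0 < T.card by have := h.two; have := h.le; omega)
  exact h.tri v s t hvs (h.adj s hs t ht) (h.adj v hv t ht)

theorem MaxBip.dg_T (h : MaxBip G S T) {v : V} (hv : v ∈ T) : dg G T v = 0 := by
  by_contra h0
  obtain ⟨t, ht, hvt⟩ := dg_pos.1 (Nat.pos_of_ne_zero h0)
  obtain ⟨s, hs⟩ := Finset.card_pos.1 (show 0 < S.card by have := h.two; omega)
  exact h.tri v t s hvt (h.adj s hs t ht).symm (h.adj s hs v hv).symm

theorem MaxBip.two_sided (hB : MaxBip G S T) (h : Base3 G k) (hs : S.card ≤ k)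
    (hnb : ∀ u v, u ∉ S → v ∉ S → dg G T u = S.card → dg G T v = S.card → ¬G.Adj u v)
    (hE : ClosedIn G (Finset.univ \ (S ∪ T)) E) (hEc : ConnOn G E)
    (hES : ∃ v ∈ nbs G S, v ∈ E) (hET : ∃ v ∈ nbs G T, v ∈ E) : AP (HasCycleLen G) k := by
  have hd := closedIn_disjoint hE
  have hd' := Finset.disjoint_left.1 hd
  have h2 := hB.two
  have hle := hB.le
  have hvS : ∀ v ∈ E, v ∉ S := fun v hv hs => hd' (by grind) hv
  have hvT : ∀ v ∈ E, v ∉ T := fun v hv hs => hd' (by grind) hv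
  obtain ⟨x₀, hx₀⟩ := Finset.card_pos.1 (show 0 < S.card by omega)
  by_cases hbig : ∃ v₀ ∈ E, dg G T v₀ = S.card
  swap
  · have hsys : KSys G E (nbs G S) (nbs G T) (k - S.card + 1) := by
      refine h.toBase.ear_sys hE hEc (h.toBase.good ⟨x₀, fun hs => hd' (by grind) hs⟩ ?_)
        hES hET ?_
      · intro v hv y hy hvy
        have h1 := hE.2 v hv y
        simp only [Finset.mem_union, mem_nbs]
        have := hvy.symm
        grind
      · intro _ v hv
        have h1 := dg_union_le (G := G) S T v
        have h3 := hB.degS v (hvT v hv)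
        have h4 := hB.degT v (hvS v hv)
        have h5 := dg_eq_zero_of_notMem (G := G) (K := S) (v := v)
        have h6 := dg_eq_zero_of_notMem (G := G) (K := T) (v := v)
        have h7 := hB.dg_zero (v := v)
        have h8 : dg G T v ≠ S.card := fun hs => hbig ⟨v, hv, hs⟩
        by_cases h9 : v ∈ nbs G S <;> by_cases h10 : v ∈ nbs G T <;>
          simp only [h9, h10, if_true, if_false, not_true, not_false_eq_true, forall_const] at * <;>
          omega
    refine (hsys.ear_ap (e := 2) (N := S.card) (s := 1) (by omega) hd (by omega) (by omega) le_rfl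
      fun x hx t ht j hj => bip_cross hB.disj hB.adj hx ht hj (by omega)).mono (by omega)
  obtain ⟨v₀, hv₀, hv₀T⟩ := hbig
  have hTc := hB.big v₀ (hvS v₀ hv₀) hv₀T
  have hv₀H : v₀ ∉ S ∪ T := by have := hvS v₀ hv₀; have := hvT v₀ hv₀; grind
  have hv₀S := hB.dg_zero (v := v₀) (by omega)
  obtain ⟨w, hwS, hw⟩ := hES
  have hwv : w ≠ v₀ := by
    rintro rfl
    obtain ⟨s, hs, hsw⟩ := mem_nbs.1 hwS
    have := dg_pos.2 ⟨s, hs, hsw.symm⟩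
    omega
  obtain ⟨W, hW, hWc, hwW⟩ := exists_comp (G := G) (U := E.erase v₀) (v := w) (by grind)
  have hWE : ∀ v ∈ W, v ∈ E ∧ v ≠ v₀ := fun v hv => by have := hW.1 hv; grind
  have hWcl : ClosedIn G (Finset.univ \ (insert v₀ (S ∪ T))) W := by
    refine ⟨fun v hv => ?_, fun a ha c hc hac => ?_⟩
    · have := hWE v hv
      have := hE.1 this.1
      grind
    · have h1 := hE.2 a (hWE a ha).1 c (by grind) hac
      exact hW.2 a ha c (by grind) hac
  have hWd := closedIn_disjoint hWcl
  have hWd' := Finset.disjoint_left.1 hWd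
  by_cases hWT : ∃ v ∈ nbs G T, v ∈ W
  · have hsys : KSys G W (nbs G S) (nbs G T) (max (k - S.card) 1) := by
      refine h.toBase.ear_sys hWcl hWc (h.good v₀ ⟨x₀, fun hs => hWd' (by grind) hs, by grind⟩
        (fun hs => hWd' (by grind) hs) ?_) ⟨w, hwS, hwW⟩ hWT ?_
      · intro v hv y hy hyv hvy
        have h1 := hWcl.2 v hv y
        simp only [Finset.mem_union, mem_nbs]
        have := hvy.symm
        grind
      · intro hk2 v hv
        have hvE := (hWE v hv).1
        have h0 := dg_insert (G := G) hv₀H v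
        have h1 := dg_union_le (G := G) S T v
        have h3 := hB.degS v (hvT v hvE)
        have h4 := hB.degT v (hvS v hvE)
        have h5 := dg_eq_zero_of_notMem (G := G) (K := S) (v := v)
        have h6 := dg_eq_zero_of_notMem (G := G) (K := T) (v := v)
        have h7 := hB.dg_zero (v := v)
        have h8 : G.Adj v v₀ → dg G T v ≠ S.card := fun ha hb =>
            hnb v v₀ (hvS v hvE) (hvS v₀ hv₀) hb hv₀T ha
        by_cases h9 : v ∈ nbs G S <;> by_cases h10 : v ∈ nbs G T <;> by_cases h11 : G.Adj v v₀ <;>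
          simp only [h9, h10, h11, if_true, if_false, not_true, not_false_eq_true,
            forall_const] at * <;>
          omega
    refine (hsys.ear_ap (e := 2) (N := S.card + 1) (s := 1) (by omega) hWd (by omega) (by omega)
      le_rfl fun x hx t ht j hj => bip_cross_extra hB.disj hB.adj hx ht hv₀H hj h2 hTc
        (by omega)).mono (by omega)
  · push Not at hWT
    obtain ⟨u, huW, hu⟩ := hEc.exists_nbr hv₀ hW ⟨w, hwW⟩
    have hsys : KSys G W (nbs G S) (nbs G {v₀}) (k - S.card + 1) := by
      refine h.toBase.ear_sys hWcl hWc (h.toBase.good ⟨x₀, fun hs => hWd' (by grind) hs⟩ ?_)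
        ⟨w, hwS, hwW⟩ ⟨u, by simpa using hu, huW⟩ ?_
      · intro v hv y hy hvy
        have h1 := hWcl.2 v hv y
        have h2 := hWT v
        simp only [Finset.mem_union, mem_nbs] at h2 ⊢
        have := hvy.symm
        grind
      · intro hk2 v hv
        have hvE := (hWE v hv).1
        have h0 := dg_insert (G := G) hv₀H v
        have h1 := dg_union_le (G := G) S T v
        have h3 := hB.degS v (hvT v hvE)
        have h5 := dg_eq_zero_of_notMem (G := G) (K := S) (v := v)
        have h6 := dg_eq_zero_of_notMem (G := G) (K := T) (v := v) (fun hs => hWT v hs hv)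
        simp only [mem_nbs_singleton, G.adj_comm v₀ v]
        by_cases h9 : v ∈ nbs G S <;> by_cases h11 : G.Adj v v₀ <;>
          simp only [h9, h11, if_true, if_false, not_true, not_false_eq_true,
            forall_const] at * <;>
          omega
    refine (hsys.ear_ap (e := 2) (N := S.card) (s := 2) (by omega) hWd (by omega) (by omega)
      (by omega) fun x hx t ht j hj => ?_).mono (by omega)
    obtain rfl := Finset.mem_singleton.1 ht
    obtain ⟨τ, hτ, hvτ⟩ := dg_pos.1 (show 0 < dg G T t by omega)
    have := (bip_cross hB.disj hB.adj hx hτ hj (by omega)).snoc (c := t)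
      (W := insert t (S ∪ T)) hv₀H hvτ.symm subset_rfl
    rwa [show 2 + 2 * j = 1 + 2 * j + 1 by omega]

theorem Base.sided_sys (h : Base G k) {t₁ : V} {k' : ℕ} (hdST : ∀ s ∈ S, s ∉ T)
    (hS : S.Nonempty)
    (hE : ClosedIn G (Finset.univ \ (S ∪ T)) E) (hEc : ConnOn G E)
    (hES : ∀ v ∈ E, dg G S v = 0) (ht₁ : t₁ ∈ T) (hEt : ∃ v ∈ nbs G {t₁}, v ∈ E)
    (hdeg : 2 ≤ k' → ∀ v ∈ E, k' + 1 + dg G T v ≤ k + min 1 (dg G T v)) :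
    KSys G E (nbs G {t₁}) (nbs G (T.erase t₁)) k' := by
  have hd' := Finset.disjoint_left.1 (closedIn_disjoint hE)
  have hnS : ∀ v ∈ E, ∀ s ∈ S, ¬G.Adj v s := by
    intro v hv s hs hvs
    have := dg_pos.2 ⟨s, hs, hvs⟩
    have := hES v hv
    omega
  obtain ⟨y, hy, hyE⟩ := h.exists_attached hE hEc.1 (u := t₁) (by grind) (by
    obtain ⟨s, hs⟩ := hS
    have := hdST s hs
    exact ⟨s, by grind, by grind⟩)
  refine h.ear_sys hE hEc (h.good ⟨t₁, fun hs => hd' (by grind) hs⟩ ?_) hEt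
    ⟨y, ?_, hyE⟩ ?_
  · intro v hv y hy hvy
    have h1 := hE.2 v hv y
    have h2 := hnS v hv y
    simp only [Finset.mem_union, mem_nbs]
    have := hvy.symm
    grind
  · rw [mem_nbs] at hy ⊢
    obtain ⟨a, ha, hay⟩ := hy
    have := hnS y hyE a
    have := hay.symm
    exact ⟨a, by grind, hay⟩
  · intro hk2 v hv
    have h1 := dg_union_le (G := G) S T v
    have h2 := hES v hv
    have h3 := hdeg hk2 v hv
    have h5 := dg_erase (G := G) ht₁ v
    have h6 := dg_eq_zero_of_notMem (G := G) (K := T.erase t₁) (v := v)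
    simp only [mem_nbs_singleton, G.adj_comm t₁ v]
    by_cases h7 : v ∈ nbs G (T.erase t₁) <;> by_cases h8 : G.Adj v t₁ <;>
      simp only [h7, h8, if_true, if_false, not_true, not_false_eq_true, forall_const] at * <;>
      omega

theorem MaxBip.one_sided (hB : MaxBip G S T) (h : Base3 G k) (hs : S.card ≤ k)
    (hnb : ∀ u v, u ∉ S → v ∉ S → dg G T u = S.card → dg G T v = S.card → ¬G.Adj u v)
    (hE : ClosedIn G (Finset.univ \ (S ∪ T)) E) (hEc : ConnOn G E)
    (hES : ∀ v ∈ E, dg G S v = 0) (hET : ∃ v ∈ nbs G T, v ∈ E) (hT : S.card + 1 ≤ T.card)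
    (hcase : S.card = k ∨ (∀ v ∈ E, dg G T v ≠ S.card) ∨ S.card + 2 ≤ T.card) :
    AP (HasCycleLen G) k := by
  have hd := closedIn_disjoint hE
  have hd' := Finset.disjoint_left.1 hd
  have h2 := hB.two
  have hvS : ∀ v ∈ E, v ∉ S := fun v hv hs => hd' (by grind) hv
  have hvT : ∀ v ∈ E, v ∉ T := fun v hv hs => hd' (by grind) hv
  have hnS : ∀ v ∈ E, ∀ s ∈ S, ¬G.Adj v s := by
    intro v hv s hs hvs
    have := dg_pos.2 ⟨s, hs, hvs⟩
    have := hES v hv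
    omega
  obtain ⟨x₀, hx₀⟩ := Finset.card_pos.1 (show 0 < S.card by omega)
  by_cases hbig : S.card = k ∨ ∀ v ∈ E, dg G T v ≠ S.card
  · obtain ⟨v, hvT', hvE⟩ := hET
    obtain ⟨t₁, ht₁, ht₁v⟩ := mem_nbs.1 hvT'
    have hsys := h.toBase.sided_sys (k' := k - S.card + 1) hB.disj ⟨x₀, hx₀⟩ hE hEc hES ht₁
      ⟨v, by simpa using ht₁v, hvE⟩ (by
        intro hk2 v hv
        have h4 := hB.degT v (hvS v hv)
        have h8 := fun hs : ∀ v ∈ E, dg G T v ≠ S.card => hs v hv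
        by_cases h9 : dg G T v = S.card
        · exact absurd h9 (h8 (hbig.resolve_left (by omega)))
        · omega)
    refine (hsys.ear_ap (e := 2) (N := S.card) (s := 2) (by omega) hd (by omega) (by omega)
      (by omega) fun x hx t ht j hj => ?_).mono (by omega)
    obtain rfl := Finset.mem_singleton.1 hx
    exact bip_same hB.disj hB.adj ht₁ (by grind) (by grind) hj (by omega)
  · push Not at hbig
    obtain ⟨hsk, v₀, hv₀, hv₀T⟩ := hbig
    have hT2 : S.card + 2 ≤ T.card := by
      rcases hcase with hc | hc | hc
      · exact absurd hc hsk
      · exact absurd hv₀T (hc v₀ hv₀)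
      · exact hc
    have hv₀H : v₀ ∉ S ∪ T := by have := hvS v₀ hv₀; have := hvT v₀ hv₀; grind
    obtain ⟨w, hw, hvw⟩ : ∃ w ∈ E, G.Adj v₀ w := by
      have h1 := h.deg v₀
      have h3 := dg_le_of_closedIn_sdiff (G := G) hE hv₀
      have h4 := dg_union_le (G := G) S T v₀
      have h5 := hES v₀ hv₀
      exact dg_pos.1 (by omega)
    obtain ⟨W, hW, hWc, hwW⟩ := exists_comp (G := G) (U := E.erase v₀) (v := w)
      (by have := hvw.ne; grind)
    have hWE : ∀ v ∈ W, v ∈ E ∧ v ≠ v₀ := fun v hv => by have := hW.1 hv; grind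
    have hWcl : ClosedIn G (Finset.univ \ (insert v₀ (S ∪ T))) W := by
      refine ⟨fun v hv => ?_, fun a ha c hc hac => ?_⟩
      · have := hWE v hv
        have := hE.1 this.1
        grind
      · have h1 := hE.2 a (hWE a ha).1 c (by grind) hac
        exact hW.2 a ha c (by grind) hac
    have hWd := closedIn_disjoint hWcl
    have hWd' := Finset.disjoint_left.1 hWd
    have hxT := hB.disj x₀ hx₀
    by_cases hatt : ∃ t₁ ∈ T, ¬G.Adj v₀ t₁ ∧ ∃ v ∈ W, G.Adj t₁ v
    · obtain ⟨t₁, ht₁, hvt₁, u, huW, hu⟩ := hatt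
      obtain ⟨y, hy, hyW⟩ := h.exists_attached₂ hWcl hWc.1 (u := t₁) (q := v₀) (by grind) (by grind)
        ⟨x₀, by grind, by grind, by grind⟩
      have hsys : KSys G W (nbs G {t₁}) (nbs G (T.erase t₁)) (max (k - S.card) 1) := by
        refine h.toBase.ear_sys hWcl hWc (h.good v₀ ⟨x₀, fun hs => hWd' (by grind) hs, by grind⟩
          (fun hs => hWd' (by grind) hs) ?_) ⟨u, by simpa using hu, huW⟩ ⟨y, ?_, hyW⟩ ?_
        · intro v hv y hy hyv hvy
          have h1 := hWcl.2 v hv y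
          have h2 := hnS v (hWE v hv).1 y
          simp only [Finset.mem_union, mem_nbs]
          have := hvy.symm
          grind
        · rw [mem_nbs] at hy ⊢
          obtain ⟨a, ha, hay⟩ := hy
          have := hnS y (hWE y hyW).1 a
          have := hay.symm
          exact ⟨a, by grind, hay⟩
        · intro hk2 v hv
          have hvE := (hWE v hv).1
          have h0 := dg_insert (G := G) hv₀H v
          have h1 := dg_union_le (G := G) S T v
          have h3 := hES v hvE
          have h4 := hB.degT v (hvS v hvE)
          have h5 := dg_erase (G := G) ht₁ v
          have h6 := dg_eq_zero_of_notMem (G := G) (K := T.erase t₁) (v := v)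
          have h8 : G.Adj v v₀ → dg G T v ≠ S.card := fun ha hb =>
            hnb v v₀ (hvS v hvE) (hvS v₀ hv₀) hb hv₀T ha
          simp only [mem_nbs_singleton, G.adj_comm t₁ v]
          by_cases h9 : v ∈ nbs G (T.erase t₁) <;> by_cases h10 : G.Adj v t₁ <;>
            by_cases h11 : G.Adj v v₀ <;>
            simp only [h9, h10, h11, if_true, if_false, not_true, not_false_eq_true,
              forall_const] at * <;>
            omega
      refine (hsys.ear_ap (e := 2) (N := S.card + 1) (s := 2) (by omega) hWd (by omega) (by omega)
        (by omega) fun x hx t ht j hj => ?_).mono (by omega)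
      obtain rfl := Finset.mem_singleton.1 hx
      exact bip_same_extra hB.disj hB.adj ht₁ (by grind) (by grind) hv₀H hvt₁ hj h2 hT2 (by omega)
    · push Not at hatt
      have hA : ∀ t, t ∈ T.filter (G.Adj v₀) ↔ t ∈ T ∧ G.Adj v₀ t := by simp
      obtain ⟨y, hy, hyW⟩ := h.exists_attached hWcl hWc.1 (u := v₀) (by grind) ⟨x₀, by grind, by grind⟩
      have hsys : KSys G W (nbs G {v₀}) (nbs G (T.filter (G.Adj v₀))) (max (k - S.card) 1) := by
        refine h.toBase.ear_sys hWcl hWc (h.toBase.good ⟨x₀, fun hs => hWd' (by grind) hs⟩ ?_)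
          ⟨w, by simpa using hvw, hwW⟩ ⟨y, ?_, hyW⟩ ?_
        · intro v hv y hy hvy
          have h1 := hWcl.2 v hv y
          have h2 := hnS v (hWE v hv).1 y
          have h3 := hatt y
          simp only [Finset.mem_union, mem_nbs]
          have := hvy.symm
          grind
        · rw [mem_nbs] at hy ⊢
          obtain ⟨a, ha, hay⟩ := hy
          have := hnS y (hWE y hyW).1 a
          have := hatt a
          have := hay.symm
          exact ⟨a, by grind, hay⟩
        · intro hk2 v hv
          have hvE := (hWE v hv).1
          have h0 := dg_insert (G := G) hv₀H v
          have h1 := dg_union_le (G := G) S T v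
          have h3 := hES v hvE
          have h4 := hB.degT v (hvS v hvE)
          have h6 : v ∉ nbs G (T.filter (G.Adj v₀)) → dg G T v = 0 := by
            intro hv'
            by_contra h0
            obtain ⟨t, ht, hvt⟩ := dg_pos.1 (Nat.pos_of_ne_zero h0)
            have := hatt t ht
            refine hv' (mem_nbs.2 ⟨t, ?_, hvt.symm⟩)
            rw [hA]
            exact ⟨ht, by_contra fun hs => this hs v hv hvt.symm⟩
          simp only [mem_nbs_singleton, G.adj_comm v₀ v]
          by_cases h9 : v ∈ nbs G (T.filter (G.Adj v₀)) <;> by_cases h11 : G.Adj v v₀ <;>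
            simp only [h9, h11, if_true, if_false, not_true, not_false_eq_true,
              forall_const] at * <;>
            omega
      refine (hsys.ear_ap (e := 2) (N := S.card + 1) (s := 1) (by omega) hWd (by omega) (by omega)
        (by omega) fun x hx t ht j hj => ?_).mono (by omega)
      obtain rfl := Finset.mem_singleton.1 hx
      rw [hA] at ht
      rcases j with _ | j
      · exact .cons' (.nil (Finset.mem_singleton_self t)) (by simpa using ht.2.ne) ht.2 (by grind)
      · obtain ⟨τ, hτ, hτt, hvτ⟩ := dg_two (show 2 ≤ dg G T x by omega) t
        have := (bip_same hB.disj hB.adj hτ ht.1 hτt (j := j) (by omega) (by omega)).cons' (a := x)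
          (W := insert x (S ∪ T)) hv₀H hvτ subset_rfl
        convert this using 1
        omega

end BipEars

section BipMain

variable {S T E E' : Finset V}

theorem KSys.combine {k₁ k₂ : ℕ} {t₁ x₁ : V} (hd : ∀ s ∈ S, s ∉ T)
    (hadj : ∀ s ∈ S, ∀ t ∈ T, G.Adj s t) (hST : S.card ≤ T.card) (hS : 2 ≤ S.card)
    (hE : ClosedIn G (Finset.univ \ (S ∪ T)) E) (hE' : ClosedIn G (Finset.univ \ (S ∪ T)) E')
    (hEE : Disjoint E E') (ht₁ : t₁ ∈ T) (hx₁ : x₁ ∈ S)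
    (hs : KSys G E (nbs G {t₁}) (nbs G (T.erase t₁)) k₁)
    (hs' : KSys G E' (nbs G {x₁}) (nbs G (S.erase x₁)) k₂) (hk₁ : 1 ≤ k₁) (hk₂ : 1 ≤ k₂) :
    AP (HasCycleLen G) (S.card - 1 + k₂ - 1 + k₁ - 1) := by
  have hd₁ := Finset.disjoint_left.1 (closedIn_disjoint hE)
  have hd₂ := Finset.disjoint_left.1 (closedIn_disjoint hE')
  have hd₃ := Finset.disjoint_left.1 hEE
  refine AP.add (L := fun m => ∃ n j, j + 1 < S.card ∧ Len G E' (nbs G {x₁}) (nbs G (S.erase x₁)) n ∧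
    m = n + 2 * j) (s := 6) ?_ hs.ap (by omega) hk₁ ?_
  · refine AP.add (L := fun m => ∃ j, j + 1 < S.card ∧ m = 2 * j) (s := 0)
      ⟨0, 2, by omega, fun i hi => ⟨i, by omega, by omega⟩⟩ hs'.ap (by omega) hk₂ ?_
    rintro _ n ⟨j, hj, rfl⟩ hn
    exact ⟨n, j, hj, hn, by omega⟩
  · rintro _ m ⟨n, j, hj, ⟨x', hx', y', hy', hp'⟩, rfl⟩ ⟨x, hx, y, hy, hp⟩
    rw [mem_nbs_singleton] at hx hx'
    obtain ⟨t₂, ht₂, hty⟩ := mem_nbs.1 hy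
    obtain ⟨x₂, hx₂, hxy⟩ := mem_nbs.1 hy'
    have hc := Finset.card_erase_of_mem ht₁
    have hc' := Finset.card_erase_of_mem hx₁
    have h1 := bip_cross (G := G) (S := S.erase x₁) (T := T.erase t₁) (x := x₂) (t := t₂) (j := j)
      (fun s hs => by have := hd s; grind) (fun a ha b hb => hadj a (by grind) b (by grind)) hx₂ ht₂
      (by omega) (by omega)
    have hx₁E : x₁ ∉ E' := hd₂ (by grind)
    have hx₁E' : x₁ ∉ E := hd₁ (by grind)
    have ht₁E : t₁ ∉ E := hd₁ (by grind)
    have ht₁E' : t₁ ∉ E' := hd₂ (by grind)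
    have h2 := (hp'.cons' hx₁E hx' (W := insert x₁ E') subset_rfl).join h1 (by
      rw [Finset.disjoint_left]
      intro v hv hv'
      have := hd x₁ hx₁
      have := hd₂ (a := v)
      grind) hxy.symm
    have h3 := hp.symm.snoc ht₁E hx.symm (W := insert t₁ E) subset_rfl
    have := h2.hasCycleLen' h3 (by
      rw [Finset.disjoint_left]
      intro v hv hv'
      have := hd x₁ hx₁
      have := fun hs => hd t₁ hs ht₁
      have := hd₁ (a := v)
      have := hd₃ (a := v)
      grind) hty (hadj x₁ hx₁ t₁ ht₁).symm (by omega)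
    convert this using 1
    omega

theorem bipartite_iso (hS : S.card = k) (hadj : ∀ s ∈ S, ∀ t, t ∉ S → G.Adj s t)
    (hSS : ∀ a ∈ S, ∀ b ∈ S, ¬G.Adj a b) (hTT : ∀ a, a ∉ S → ∀ b, b ∉ S → ¬G.Adj a b) :
    Nonempty (G ≃g completeBipartiteGraph (Fin k) (Fin (Fintype.card V - k))) := by
  have e₁ : Fin k ≃ {v // v ∈ S} := (Fintype.equivFinOfCardEq (by simpa using hS)).symm
  have e₂ : Fin (Fintype.card V - k) ≃ {v // ¬v ∈ S} :=
    (Fintype.equivFinOfCardEq (by rw [Fintype.card_subtype_compl]; simp [hS])).symm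
  refine ⟨(⟨(Equiv.sumCongr e₁ e₂).trans (Equiv.sumCompl (· ∈ S)), fun {a b} => ?_⟩ :
    completeBipartiteGraph (Fin k) (Fin (Fintype.card V - k)) ≃g G).symm⟩
  rcases a with a | a <;> rcases b with b | b
  · simpa using hSS _ (e₁ a).2 _ (e₁ b).2
  · simpa using hadj _ (e₁ a).2 _ (e₂ b).2
  · simpa using (hadj _ (e₁ b).2 _ (e₂ a).2).symm
  · simpa using hTT _ (e₂ a).2 _ (e₂ b).2

theorem MaxBip.main (hB : MaxBip G S T) (h : Base3 G k) (ho : Odd k)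
    (hnb : ∀ u v, u ∉ S → v ∉ S → dg G T u = S.card → dg G T v = S.card → ¬G.Adj u v) :
    EvenRes G k ∨
      Nonempty (G ≃g completeBipartiteGraph (Fin k) (Fin (Fintype.card V - k))) := by
  have hk := h.hk
  have h2 := hB.two
  have hle := hB.le
  obtain ⟨x₀, hx₀⟩ := Finset.card_pos.1 (show 0 < S.card by omega)
  obtain ⟨t₀, ht₀⟩ := Finset.card_pos.1 (show 0 < T.card by omega)
  rcases Nat.lt_or_ge k S.card with hks | hs
  · left
    refine AP.evenRes ho ⟨4, 2, by omega, fun i hi => ?_⟩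
    have := (bip_cross hB.disj hB.adj hx₀ ht₀ (j := i + 1) (by omega) (by omega)).hasCycleLen
      (hB.adj x₀ hx₀ t₀ ht₀).symm (by omega)
    convert this using 1
    omega
  by_cases hTout : ∃ v, v ∉ S ∧ 0 < dg G T v
  swap
  · push Not at hTout
    have hTS : ∀ t ∈ T, ∀ w, G.Adj t w → w ∈ S := by
      intro t ht w htw
      by_contra hw
      have := hTout w hw
      have := dg_pos.2 ⟨t, ht, htw.symm⟩
      omega
    have hsk : S.card = k := by
      have h1 := h.deg t₀
      have h3 : dg G Finset.univ t₀ ≤ S.card := Finset.card_le_card fun w hw =>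
        hTS t₀ ht₀ w (by grind)
      omega
    by_cases hSout : ∃ v, v ∉ S ∪ T
    · left
      obtain ⟨v, hv⟩ := hSout
      obtain ⟨E, hE, hEc, hvE⟩ := exists_comp (G := G) (U := Finset.univ \ (S ∪ T)) (v := v)
        (by grind)
      have hd' := Finset.disjoint_left.1 (closedIn_disjoint hE)
      refine h.toBase.ear_lemma ho (P := S) (Q := T) (fun t ht s hs => (hB.adj s hs t ht).symm)
        hsk (by omega) hE hEc (fun v hv => ?_) fun v hv => ?_
      · have := hTout v (fun hs => hd' (by grind) hv)
        omega
      · have := hB.degS v (fun hs => hd' (by grind) hv)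
        omega
    · right
      push Not at hSout
      refine bipartite_iso hsk (fun s hs t ht => hB.adj s hs t (by have := hSout t; grind))
        (fun a ha b hb hab => ?_) fun a ha b hb hab => ?_
      · have := hB.dg_S ha
        have := dg_pos.2 ⟨b, hb, hab⟩
        omega
      · have := hTS a (by have := hSout a; grind) b hab
        contradiction
  left
  obtain ⟨v, hvS, hv⟩ := hTout
  obtain ⟨t₁, ht₁, hvt₁⟩ := dg_pos.1 hv
  have hvT : v ∉ T := fun hs => by have := hB.dg_T hs; omega
  obtain ⟨E, hE, hEc, hvE⟩ := exists_comp (G := G) (U := Finset.univ \ (S ∪ T)) (v := v)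
    (by grind)
  have hvET : ∃ v ∈ nbs G T, v ∈ E := ⟨v, mem_nbs.2 ⟨t₁, ht₁, hvt₁.symm⟩, hvE⟩
  by_cases hES : ∃ v ∈ nbs G S, v ∈ E
  · exact (hB.two_sided h hs hnb hE hEc hES hvET).evenRes ho
  replace hES : ∀ v ∈ E, dg G S v = 0 := fun v hv =>
    dg_eq_zero_of_notMem fun hs => hES ⟨v, hs, hv⟩
  have hd := closedIn_disjoint hE
  have hd' := Finset.disjoint_left.1 hd
  by_cases hcase : S.card + 1 ≤ T.card ∧
      (S.card = k ∨ (∀ v ∈ E, dg G T v ≠ S.card) ∨ S.card + 2 ≤ T.card)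
  · exact (hB.one_sided h hs hnb hE hEc hES hvET hcase.1 hcase.2).evenRes ho
  have hT : T.card ≤ S.card + 1 := by
    by_contra! hcon
    exact hcase ⟨by omega, by omega⟩
  have hT' : T.card = S.card + 1 → S.card < k := by
    intro hs'
    by_contra! hcon
    exact hcase ⟨by omega, by omega⟩
  have hdT : ∀ v ∈ E, dg G T v ≤ S.card := fun v hv => hB.degT v fun hs => hd' (by grind) hv
  have hdT' : T.card = S.card → ∀ v ∈ E, dg G T v + 1 ≤ S.card := by
    intro hTS v hv
    have h1 := hB.big v (fun hs => hd' (by grind) hv)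
    have h2 := hdT v hv
    omega
  by_cases hTk : T.card = k
  · refine h.toBase.ear_lemma ho (P := T) (Q := S) hB.adj
      hTk (by omega) (by rwa [Finset.union_comm]) hEc hES fun v hv => ?_
    have h1 := hdT v hv
    have h2 := fun hs => hdT' hs v hv
    omega
  obtain ⟨w, hw, hxw⟩ : ∃ w ∉ S ∪ T, G.Adj x₀ w := by
    by_contra! hcon
    have h1 := h.deg x₀
    have h3 : dg G Finset.univ x₀ ≤ dg G S x₀ + dg G T x₀ :=
      (Finset.card_le_card fun w hw => by have := hcon w; grind).trans
        (dg_union_le (G := G) S T x₀)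
    have := hB.dg_S hx₀
    have := dg_le_card (G := G) T x₀
    omega
  obtain ⟨E', hE', hEc', hwE'⟩ := exists_comp (G := G) (U := Finset.univ \ (S ∪ T)) (v := w)
    (by grind)
  have hwES : w ∈ nbs G S := mem_nbs.2 ⟨x₀, hx₀, hxw⟩
  by_cases hET : ∃ v ∈ nbs G T, v ∈ E'
  · exact (hB.two_sided h hs hnb hE' hEc' ⟨w, hwES, hwE'⟩ hET).evenRes ho
  replace hET : ∀ v ∈ E', dg G T v = 0 := fun v hv =>
    dg_eq_zero_of_notMem fun hs => hET ⟨v, hs, hv⟩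
  have hEE : Disjoint E E' := by
    rw [Finset.disjoint_left]
    intro u hu hu'
    have h1 : E ∩ E' = E := hEc.2 _ ⟨Finset.inter_subset_left, fun a ha b hb hab => by
      have := hE'.2 a (by grind) b (hE.1 hb) hab
      grind⟩ ⟨u, by grind⟩
    have h3 := hET v (by grind)
    omega
  have hd2 := Finset.disjoint_left.1 (closedIn_disjoint hE')
  have hsys' := h.toBase.sided_sys (k' := k - S.card + 1) (S := T) (T := S) (E := E') (t₁ := x₀)
    (fun t ht hs => hB.disj t hs ht) ⟨t₀, ht₀⟩ (by rwa [Finset.union_comm]) hEc' hET hx₀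
    ⟨w, by simpa using hxw, hwE'⟩ (by
      intro _ v hv
      have := hB.degS v (fun hs => hd2 (by grind) hv)
      omega)
  obtain ⟨k₁, hk₁, hk₁', hk₁T⟩ : ∃ k₁, 1 ≤ k₁ ∧
      k ≤ S.card - 1 + (k - S.card + 1) - 1 + k₁ - 1 ∧
      ∀ v ∈ E, k₁ + 1 + dg G T v ≤ k + min 1 (dg G T v) := by
    by_cases hTS : T.card = S.card
    · refine ⟨k - S.card + 1, by omega, by omega, fun v hv => ?_⟩
      have := hdT' hTS v hv
      omega
    · refine ⟨k - S.card, by omega, by omega, fun v hv => ?_⟩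
      have := hdT v hv
      omega
  have hsys := h.toBase.sided_sys (k' := k₁) hB.disj ⟨x₀, hx₀⟩ hE hEc hES ht₁
    ⟨v, by simpa using hvt₁.symm, hvE⟩ (fun _ => hk₁T)
  exact ((KSys.combine hB.disj hB.adj hle h2 hE hE' hEE ht₁ hx₀ hsys hsys' hk₁
    (by omega)).mono hk₁').evenRes ho

end BipMain

section AdjacentBig

variable {S T E : Finset V}

theorem PathIn.of_list : ∀ (l : List V) (a : V), (a :: l).Nodup → (a :: l).IsChain G.Adj →
    PathIn G (a :: l).toFinset a ((a :: l).getLast (by simp)) l.length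
  | [], a, _, _ => .nil (by simp)
  | b :: l, a, hn, hc => by
    have := PathIn.of_list l b (List.nodup_cons.1 hn).2 (List.isChain_cons_cons.1 hc).2
    rw [List.getLast_cons (by simp)]
    exact this.cons' (W := (a :: b :: l).toFinset) (by simpa using (List.nodup_cons.1 hn).1)
      (List.isChain_cons_cons.1 hc).1 (by intro x; simp)

theorem hasCycleLen_of_list (l : List V) (a : V) (hn : (a :: l).Nodup)
    (hc : (a :: l).IsChain G.Adj) (hl : G.Adj ((a :: l).getLast (by simp)) a) (h2 : 2 ≤ l.length) :
    HasCycleLen G (l.length + 1) :=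
  (PathIn.of_list l a hn hc).hasCycleLen hl h2

theorem MaxBip.adjacent_big_consec (hB : MaxBip G S T) {v₀ v₁ : V} (h₀ : v₀ ∉ S) (h₁ : v₁ ∉ S)
    (hv₀ : dg G T v₀ = S.card) (hv₁ : dg G T v₁ = S.card) (hv : G.Adj v₀ v₁) :
    Consec (HasCycleLen G) 5 ∧ (3 ≤ S.card → Consec (HasCycleLen G) 7) := by
  have h2 := hB.two
  obtain ⟨x, hx, y, hy, hxy⟩ := Finset.one_lt_card.1 (show 1 < S.card by omega)
  obtain ⟨a, ha, hva⟩ := dg_pos.1 (show 0 < dg G T v₀ by omega)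
  obtain ⟨a', ha', haa, hva'⟩ := dg_two (show 2 ≤ dg G T v₀ by omega) a
  obtain ⟨b, hb, hvb⟩ := dg_pos.1 (show 0 < dg G T v₁ by omega)
  obtain ⟨b', hb', hbb, hvb'⟩ := dg_two (show 2 ≤ dg G T v₁ by omega) b
  have hdis : ∀ t, G.Adj v₀ t → ¬G.Adj v₁ t := fun t h h' => hB.tri v₀ v₁ t hv h' h
  have hST := hB.disj
  have hadj := hB.adj
  have hadj' := fun s hs t ht => (hB.adj s hs t ht).symm
  have hT : ∀ v, dg G T v = S.card → v ∉ T := fun v hv hvT => by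
    have := hB.dg_T hvT
    omega
  have h₀T := hT v₀ hv₀
  have h₁T := hT v₁ hv₁
  have hne := hv.ne
  have e1 := hva.symm
  have e2 := hva'.symm
  have e3 := hvb.symm
  have e4 := hvb'.symm
  have e5 := hv.symm
  have c4 := hasCycleLen_of_list (G := G) [x, b, y] a (by
    simp only [List.nodup_cons, List.mem_cons, List.not_mem_nil, or_false, not_or,
      not_false_eq_true, List.nodup_nil, and_true]
    and_intros <;> grind) (by
    simp only [List.isChain_cons_cons, List.isChain_singleton, and_true]
    and_intros <;> solve_by_elim) (by simp; grind) (by simp)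
  have c5 := hasCycleLen_of_list (G := G) [v₀, v₁, b, x] a (by
    simp only [List.nodup_cons, List.mem_cons, List.not_mem_nil, or_false, not_or,
      not_false_eq_true, List.nodup_nil, and_true]
    and_intros <;> grind) (by
    simp only [List.isChain_cons_cons, List.isChain_singleton, and_true]
    and_intros <;> solve_by_elim) (by simp; grind) (by simp)
  have c6 := hasCycleLen_of_list (G := G) [v₀, a', x, b, y] a (by
    simp only [List.nodup_cons, List.mem_cons, List.not_mem_nil, or_false, not_or,
      not_false_eq_true, List.nodup_nil, and_true]
    and_intros <;> grind) (by
    simp only [List.isChain_cons_cons, List.isChain_singleton, and_true]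
    and_intros <;> solve_by_elim) (by simp; grind) (by simp)
  have c7 := hasCycleLen_of_list (G := G) [v₀, v₁, b, x, a', y] a (by
    simp only [List.nodup_cons, List.mem_cons, List.not_mem_nil, or_false, not_or,
      not_false_eq_true, List.nodup_nil, and_true]
    and_intros <;> grind) (by
    simp only [List.isChain_cons_cons, List.isChain_singleton, and_true]
    and_intros <;> solve_by_elim) (by simp; grind) (by simp)
  have c8 := hasCycleLen_of_list (G := G) [v₀, a', x, b, v₁, b', y] a (by
    simp only [List.nodup_cons, List.mem_cons, List.not_mem_nil, or_false, not_or,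
      not_false_eq_true, List.nodup_nil, and_true]
    and_intros <;> grind) (by
    simp only [List.isChain_cons_cons, List.isChain_singleton, and_true]
    and_intros <;> solve_by_elim) (by simp; grind) (by simp)
  refine ⟨⟨4, fun i hi => by interval_cases i <;> assumption⟩, fun h3 => ?_⟩
  obtain ⟨z, hz, hzx, hzy⟩ : ∃ z ∈ S, z ≠ x ∧ z ≠ y := by
    by_contra! hcon
    have : S.card ≤ ({x, y} : Finset V).card := Finset.card_le_card fun z hz => by
      have := hcon z hz
      grind
    rw [Finset.card_pair hxy] at this
    omega
  obtain ⟨a₂, ha₂, haa', haa₂, hva₂⟩ : ∃ z ∈ T, z ≠ a ∧ z ≠ a' ∧ G.Adj v₀ z := by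
    by_contra! hcon
    have : dg G T v₀ ≤ ({a, a'} : Finset V).card := Finset.card_le_card fun z hz => by
      have := hcon z
      grind
    rw [Finset.card_pair haa.symm] at this
    omega
  have e6 := hva₂.symm
  have c9 := hasCycleLen_of_list (G := G) [v₀, v₁, b, x, a', y, b', z] a (by
    simp only [List.nodup_cons, List.mem_cons, List.not_mem_nil, or_false, not_or,
      not_false_eq_true, List.nodup_nil, and_true]
    and_intros <;> grind) (by
    simp only [List.isChain_cons_cons, List.isChain_singleton, and_true]
    and_intros <;> solve_by_elim) (by simp; grind) (by simp)
  have c10 := hasCycleLen_of_list (G := G) [v₀, a', x, b, v₁, b', y, a₂, z] a (by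
    simp only [List.nodup_cons, List.mem_cons, List.not_mem_nil, or_false, not_or,
      not_false_eq_true, List.nodup_nil, and_true]
    and_intros <;> grind) (by
    simp only [List.isChain_cons_cons, List.isChain_singleton, and_true]
    and_intros <;> solve_by_elim) (by simp; grind) (by simp)
  exact ⟨4, fun i hi => by interval_cases i <;> assumption⟩

end AdjacentBig

section AdjacentBigSeven

variable {S T : Finset V}

theorem PathIn.of_list' {H : Finset V} {b : V} {n : ℕ} (l : List V) (a : V) (hn : (a :: l).Nodup)
    (hc : (a :: l).IsChain G.Adj) (hb : (a :: l).getLast (by simp) = b) (hl : l.length = n)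
    (hH : ∀ v ∈ a :: l, v ∈ H) : PathIn G H a b n := by
  subst hb hl
  exact (PathIn.of_list l a hn hc).mono fun v hv => hH v (by simpa using hv)

theorem exists_ne₃ (hT : 4 ≤ T.card) (p q r : V) : ∃ t ∈ T, t ≠ p ∧ t ≠ q ∧ t ≠ r := by
  by_contra! hcon
  have h1 : T.card ≤ ({p, q, r} : Finset V).card := Finset.card_le_card fun z hz => by
    have := hcon z hz
    grind
  have := Finset.card_le_three (a := p) (b := q) (c := r)
  omega

theorem adjacent_big_inner_T {v₀ v₁ a a' b b' x y t : V} (hST : Disjoint S T)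
    (hadj : ∀ s ∈ S, ∀ t ∈ T, G.Adj s t) (hx : x ∈ S) (hy : y ∈ S) (hxy : x ≠ y)
    (h₀ : v₀ ∉ S ∪ T) (h₁ : v₁ ∉ S ∪ T) (hv : G.Adj v₀ v₁) (ha : a ∈ T) (ha' : a' ∈ T)
    (hb : b ∈ T) (hb' : b' ∈ T) (haa : a' ≠ a) (hbb : b' ≠ b) (hab : a ≠ b) (hab' : a ≠ b')
    (hab2 : a' ≠ b) (hab3 : a' ≠ b') (hva : G.Adj v₀ a) (hva' : G.Adj v₀ a') (hvb : G.Adj v₁ b)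
    (hvb' : G.Adj v₁ b') (ht : t ∈ T) (hta : t ≠ a) :
    ∀ j < 4, PathIn G (S ∪ T ∪ {v₀, v₁}) a t (4 + j) := by
  have hadj' := fun s hs t ht => (hadj s hs t ht).symm
  have hne := hv.ne
  have hd := Finset.disjoint_left.1 hST
  have e1 := hva.symm
  have e2 := hva'.symm
  have e3 := hvb.symm
  have e4 := hvb'.symm
  have hT : 4 ≤ T.card := by
    have : ({a, a', b, b'} : Finset V) ⊆ T := by grind
    refine le_trans (le_of_eq ?_) (Finset.card_le_card this)
    rw [Finset.card_insert_of_notMem (by grind), Finset.card_insert_of_notMem (by grind),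
      Finset.card_pair hbb.symm]
  obtain ⟨β, hβ, hvβ, hβt, hβa⟩ : ∃ β ∈ T, G.Adj v₁ β ∧ β ≠ t ∧ β ≠ a := by
    by_cases h : b = t
    · exact ⟨b', hb', hvb', by grind⟩
    · exact ⟨b, hb, hvb, by grind⟩
  have e5 := hvβ.symm
  obtain ⟨τ, hτ, hτ1, hτ2, hτ3⟩ := exists_ne₃ hT a β t
  obtain ⟨σ, hσ, hσ1, hσ2, hσ3⟩ := exists_ne₃ hT a a' t
  intro j hj
  obtain rfl | rfl | rfl | rfl : j = 0 ∨ j = 1 ∨ j = 2 ∨ j = 3 := by omega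
  · refine PathIn.of_list' [x, τ, y, t] a ?_ ?_ (by simp) (by simp) (by simp; grind)
    · simp only [List.nodup_cons, List.mem_cons, List.not_mem_nil, or_false, not_or,
        not_false_eq_true, List.nodup_nil, and_true]
      and_intros <;> grind
    · simp only [List.isChain_cons_cons, List.isChain_singleton, and_true]
      and_intros <;> solve_by_elim
  · refine PathIn.of_list' [v₀, v₁, β, x, t] a ?_ ?_ (by simp) (by simp) (by simp; grind)
    · simp only [List.nodup_cons, List.mem_cons, List.not_mem_nil, or_false, not_or,
        not_false_eq_true, List.nodup_nil, and_true]
      and_intros <;> grind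
    · simp only [List.isChain_cons_cons, List.isChain_singleton, and_true]
      and_intros <;> solve_by_elim
  · by_cases hta' : t = a'
    · subst hta'
      refine PathIn.of_list' [x, b, v₁, b', y, t] a ?_ ?_ (by simp) (by simp) (by simp; grind)
      · simp only [List.nodup_cons, List.mem_cons, List.not_mem_nil, or_false, not_or,
          not_false_eq_true, List.nodup_nil, and_true]
        and_intros <;> grind
      · simp only [List.isChain_cons_cons, List.isChain_singleton, and_true]
        and_intros <;> solve_by_elim
    · refine PathIn.of_list' [v₀, a', x, σ, y, t] a ?_ ?_ (by simp) (by simp) (by simp; grind)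
      · simp only [List.nodup_cons, List.mem_cons, List.not_mem_nil, or_false, not_or,
          not_false_eq_true, List.nodup_nil, and_true]
        and_intros <;> grind
      · simp only [List.isChain_cons_cons, List.isChain_singleton, and_true]
        and_intros <;> solve_by_elim
  · refine PathIn.of_list' [v₀, v₁, β, x, τ, y, t] a ?_ ?_ (by simp) (by simp) (by simp; grind)
    · simp only [List.nodup_cons, List.mem_cons, List.not_mem_nil, or_false, not_or,
        not_false_eq_true, List.nodup_nil, and_true]
      and_intros <;> grind
    · simp only [List.isChain_cons_cons, List.isChain_singleton, and_true]
      and_intros <;> solve_by_elim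

theorem adjacent_big_inner_S {v₀ v₁ a a' b b' x y z : V} (hST : Disjoint S T)
    (hadj : ∀ s ∈ S, ∀ t ∈ T, G.Adj s t) (hx : x ∈ S) (hy : y ∈ S) (hxy : x ≠ y)
    (h₀ : v₀ ∉ S ∪ T) (h₁ : v₁ ∉ S ∪ T) (hv : G.Adj v₀ v₁) (ha : a ∈ T) (ha' : a' ∈ T)
    (hb : b ∈ T) (hb' : b' ∈ T) (haa : a' ≠ a) (hbb : b' ≠ b) (hab : a ≠ b) (hab' : a ≠ b')
    (hab2 : a' ≠ b) (hva : G.Adj v₀ a) (hva' : G.Adj v₀ a') (hvb : G.Adj v₁ b)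
    (hvb' : G.Adj v₁ b') (hz : z ∈ S ∪ {v₀, v₁}) :
    ∀ j < 3, PathIn G (S ∪ T ∪ {v₀, v₁}) a z (3 + j) := by
  have hadj' := fun s hs t ht => (hadj s hs t ht).symm
  have hne := hv.ne
  have hd := Finset.disjoint_left.1 hST
  have e0 := hv.symm
  have e1 := hva.symm
  have e2 := hva'.symm
  have e3 := hvb.symm
  have e4 := hvb'.symm
  have key : ∀ l : List V, (a :: l).Nodup → (a :: l).IsChain G.Adj →
      (a :: l).getLast (by simp) = z → (∀ v ∈ a :: l, v ∈ S ∪ T ∪ {v₀, v₁}) →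
      PathIn G (S ∪ T ∪ {v₀, v₁}) a z l.length := fun l h1 h2 h3 h4 =>
    PathIn.of_list' l a h1 h2 h3 rfl h4
  intro j hj
  have hzc : z ∈ S ∨ z = v₀ ∨ z = v₁ := by grind
  rcases hzc with hz | rfl | rfl
  · obtain ⟨w, hw, hwz⟩ : ∃ w ∈ S, w ≠ z := by
      by_cases h : x = z
      · exact ⟨y, by grind⟩
      · exact ⟨x, by grind⟩
    obtain rfl | rfl | rfl : j = 0 ∨ j = 1 ∨ j = 2 := by omega
    on_goal 1 => refine key [w, b, z] ?_ ?_ (by simp) (by simp; grind)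
    on_goal 3 => refine key [v₀, v₁, b, z] ?_ ?_ (by simp) (by simp; grind)
    on_goal 5 => refine key [v₀, a', w, b, z] ?_ ?_ (by simp) (by simp; grind)
    all_goals
      simp only [List.nodup_cons, List.mem_cons, List.not_mem_nil, or_false, not_or,
        not_false_eq_true, List.nodup_nil, and_true, List.isChain_cons_cons,
        List.isChain_singleton]
      and_intros <;> first | assumption | (apply hadj <;> assumption) | (apply hadj' <;> assumption) | grind
  · obtain rfl | rfl | rfl : j = 0 ∨ j = 1 ∨ j = 2 := by omega
    on_goal 1 => refine key [x, a', z] ?_ ?_ (by simp) (by simp; grind)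
    on_goal 3 => refine key [x, b, v₁, z] ?_ ?_ (by simp) (by simp; grind)
    on_goal 5 => refine key [x, b, y, a', z] ?_ ?_ (by simp) (by simp; grind)
    all_goals
      simp only [List.nodup_cons, List.mem_cons, List.not_mem_nil, or_false, not_or,
        not_false_eq_true, List.nodup_nil, and_true, List.isChain_cons_cons,
        List.isChain_singleton]
      and_intros <;> first | assumption | (apply hadj <;> assumption) | (apply hadj' <;> assumption) | grind
  · obtain rfl | rfl | rfl : j = 0 ∨ j = 1 ∨ j = 2 := by omega
    on_goal 1 => refine key [x, b, z] ?_ ?_ (by simp) (by simp; grind)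
    on_goal 3 => refine key [x, a', v₀, z] ?_ ?_ (by simp) (by simp; grind)
    on_goal 5 => refine key [x, b, y, b', z] ?_ ?_ (by simp) (by simp; grind)
    all_goals
      simp only [List.nodup_cons, List.mem_cons, List.not_mem_nil, or_false, not_or,
        not_false_eq_true, List.nodup_nil, and_true, List.isChain_cons_cons,
        List.isChain_singleton]
      and_intros <;> first | assumption | (apply hadj <;> assumption) | (apply hadj' <;> assumption) | grind

/-- A part missing some attachments, hanging off a single vertex, still gives rooted paths. -/
theorem KSys.tail {E D X W : Finset V} {d w : V} {k' : ℕ} (h : KSys G D (nbs G {d}) X k')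
    (hE : ConnOn G E) (hd : d ∈ E) (hD : ClosedIn G (E.erase d) D) (hw : w ∈ E) (hwD : w ∉ D)
    (hwW : w ∈ W) : AP (Len G E W X) k' := by
  obtain ⟨m, hm⟩ := (hE.sdiff hd hD).exists_path (a := d) (b := w)
    (by have := hD.1; grind) (by grind)
  refine AP.symm (h.ap.symm.imp (s := m + 1) fun n hn => ?_)
  exact hn.tail hm (hD.1.trans (Finset.erase_subset _ _)) hwW

theorem Base.adjacent_big_ap (h : Base G 7) {H E T Z : Finset V} {a w : V}
    (hE : ClosedIn G (Finset.univ \ H) E) (hc : ConnOn G E) (hH : H = T ∪ Z) (ha : a ∈ T)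
    (hZ : Z.Nonempty) (haZ : a ∉ Z) (hw : G.Adj a w) (hwE : w ∈ E)
    (hdT : ∀ v ∈ E, dg G T v ≤ 2) (hdZ : ∀ v ∈ E, dg G Z v ≤ 2)
    (hdTZ : ∀ v ∈ E, 0 < dg G T v → dg G Z v ≤ 1) :
    KSys G E (nbs G {a}) (nbs G (T.erase a)) 4 ∨ AP (Len G E (nbs G {a}) (nbs G Z)) 5 := by
  have hd := Finset.disjoint_left.1 (closedIn_disjoint hE)
  have hdg : ∀ v, dg G H v ≤ dg G T v + dg G Z v := fun v => hH ▸ dg_union_le T Z v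
  have haH : a ∈ H := by grind
  have hb : ∀ v ∈ E, ∀ w, w ∉ E → G.Adj v w → w ∈ H := fun v hv w hw hvw => by
    have := hE.2 v hv w
    grind
  have hZpos : ∀ v, v ∉ nbs G Z → dg G Z v = 0 := fun v hv => dg_eq_zero_of_notMem hv
  have hTa := fun v => dg_erase (G := G) ha v
  have hTpos : ∀ v, v ∉ nbs G (T.erase a) → dg G (T.erase a) v = 0 :=
    fun v hv => dg_eq_zero_of_notMem hv
  by_cases hat : ∃ v ∈ nbs G (T.erase a), v ∈ E
  · by_cases hg : Good G E (nbs G {a} ∪ nbs G (T.erase a)) ∅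
    · left
      refine h.ear_sys hE hc hg ⟨w, mem_nbs_singleton.2 hw, hwE⟩ hat fun _ v hv => ?_
      have h1 := hdT v hv
      have h2 := hdZ v hv
      have h3 := hdTZ v hv
      have h4 := hdg v
      have h5 := hTa v
      have h6 := hTpos v
      simp only [mem_nbs_singleton, G.adj_comm a v]
      by_cases h9 : v ∈ nbs G (T.erase a) <;> by_cases h10 : G.Adj v a <;>
        simp only [h9, h10, if_true, if_false, not_true, not_false_eq_true, forall_const] at * <;>
        omega
    · right
      unfold Good at hg
      push Not at hg
      obtain ⟨d, hdE, D', hD', ⟨v, hv⟩, -, hDW'⟩ := hg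
      obtain ⟨D, hD, hDc, hvD⟩ := exists_comp hv
      have hDD := hD.1
      replace hD := hD'.trans hD
      have hDW : ∀ v ∈ D, v ∉ nbs G T := by
        intro v hv hvT
        have h2 := hDW' v (hDD hv)
        simp only [Finset.mem_union, mem_nbs, not_or] at h2 hvT
        grind
      have hDE : D ⊆ E := hD.1.trans (Finset.erase_subset _ _)
      have hDcl : ClosedIn G (Finset.univ \ insert d H) D :=
        ⟨fun x hx => by have := hD.1 hx; have := hd (a := x); grind, fun a ha b hb hab => by
          have := hE.2 a (hDE ha) b (by grind) hab
          exact hD.2 a ha b (by grind) hab⟩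
      obtain ⟨u, huD, hdu⟩ := hc.exists_nbr hdE hD hDc.1
      obtain ⟨x, hx, hxD⟩ := h.exists_attached hDcl hDc.1 (u := d) (by grind) ⟨a, by grind, by grind⟩
      have hTD : ∀ v ∈ D, ∀ t ∈ T, ¬G.Adj v t := fun v hv t ht hvt =>
        hDW v hv (mem_nbs.2 ⟨t, ht, hvt.symm⟩)
      have hsys : KSys G D (nbs G {d}) (nbs G Z) 5 := by
        refine h.ear_sys hDcl hDc (h.good ⟨d, fun hs => by have := hD.1 hs; grind⟩ ?_)
          ⟨u, mem_nbs_singleton.2 hdu, huD⟩ ⟨x, ?_, hxD⟩ ?_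
        · intro v hv y hy hvy
          have h1 := hDcl.2 v hv y
          have h2 := hTD v hv y
          have := hvy.symm
          simp only [Finset.mem_union, mem_nbs]
          grind
        · obtain ⟨y, hy, hyx⟩ := mem_nbs.1 hx
          have h2 := hTD x hxD y
          have := hyx.symm
          exact mem_nbs.2 ⟨y, by grind, hyx⟩
        · intro _ v hv
          have h1 : dg G T v = 0 := dg_eq_zero fun t ht => hTD v hv t ht
          have h2 := hdZ v (hDE hv)
          have h4 := hdg v
          have h5 := dg_insert (G := G) (fun hs => hd hs hdE) v
          have h6 := hZpos v
          simp only [mem_nbs_singleton, G.adj_comm d v]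
          by_cases h9 : v ∈ nbs G Z <;> by_cases h10 : G.Adj v d <;>
            simp only [h9, h10, if_true, if_false, not_true, not_false_eq_true, forall_const] at * <;>
            omega
      exact hsys.tail hc hdE hD hwE (fun hs => hTD w hs a ha hw.symm) (mem_nbs_singleton.2 hw)
  · right
    push Not at hat
    refine KSys.ap ?_
    obtain ⟨x, hx, hxE⟩ := h.exists_attached hE hc.1 haH
      (by obtain ⟨z, hz⟩ := hZ; exact ⟨z, by grind⟩)
    have hTE : ∀ v ∈ E, ∀ t ∈ T, t ≠ a → ¬G.Adj v t := fun v hv t ht hta hvt =>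
      hat v (mem_nbs.2 ⟨t, by grind, hvt.symm⟩) hv
    refine h.ear_sys hE hc (h.good ⟨a, fun hs => hd haH hs⟩ ?_)
      ⟨w, mem_nbs_singleton.2 hw, hwE⟩ ⟨x, ?_, hxE⟩ ?_
    · intro v hv y hy hvy
      have h1 := hb v hv y hy hvy
      have h2 := hTE v hv y
      have := hvy.symm
      simp only [Finset.mem_union, mem_nbs]
      grind
    · obtain ⟨y, hy, hyx⟩ := mem_nbs.1 hx
      have h2 := hTE x hxE y
      have := hyx.symm
      exact mem_nbs.2 ⟨y, by grind, hyx⟩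
    · intro _ v hv
      have h1 : dg G (T.erase a) v = 0 := hTpos v fun hs => hat v hs hv
      have h2 := hdZ v hv
      have h3 := hdTZ v hv
      have h4 := hdg v
      have h5 := hTa v
      have h6 := hZpos v
      simp only [mem_nbs_singleton, G.adj_comm a v]
      by_cases h9 : v ∈ nbs G Z <;> by_cases h10 : G.Adj v a <;>
        simp only [h9, h10, if_true, if_false, not_true, not_false_eq_true, forall_const] at * <;>
        omega

theorem MaxBip.adjacent_big_seven (hB : MaxBip G S T) (h : Base G 7) (hS : S.card = 2) {v₀ v₁ : V}
    (h₀ : v₀ ∉ S) (h₁ : v₁ ∉ S) (hv₀ : dg G T v₀ = S.card) (hv₁ : dg G T v₁ = S.card)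
    (hv : G.Adj v₀ v₁) : EvenRes G 7 := by
  obtain ⟨x, hx, y, hy, hxy⟩ := Finset.one_lt_card.1 (show 1 < S.card by omega)
  obtain ⟨a, ha, hva⟩ := dg_pos.1 (show 0 < dg G T v₀ by omega)
  obtain ⟨a', ha', haa, hva'⟩ := dg_two (show 2 ≤ dg G T v₀ by omega) a
  obtain ⟨b, hb, hvb⟩ := dg_pos.1 (show 0 < dg G T v₁ by omega)
  obtain ⟨b', hb', hbb, hvb'⟩ := dg_two (show 2 ≤ dg G T v₁ by omega) b
  have hdis : ∀ t, G.Adj v₀ t → ¬G.Adj v₁ t := fun t h h' => hB.tri v₀ v₁ t hv h' h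
  have hT : ∀ v, dg G T v = S.card → v ∉ T := fun v hv hvT => by
    have := hB.dg_T hvT
    omega
  have h₀T := hT v₀ hv₀
  have h₁T := hT v₁ hv₁
  have hST : Disjoint S T := Finset.disjoint_left.2 fun s hs => hB.disj s hs
  have hab : a ≠ b := fun h => hdis a hva (h ▸ hvb)
  have hab' : a ≠ b' := fun h => hdis a hva (h ▸ hvb')
  have hab2 : a' ≠ b := fun h => hdis a' hva' (h ▸ hvb)
  have hab3 : a' ≠ b' := fun h => hdis a' hva' (h ▸ hvb')
  have hpair : ∀ v, dg G {v₀, v₁} v ≤ 1 := fun v => by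
    by_contra! hcon
    have h1 := (dg_eq_card (G := G) (K := {v₀, v₁}) (v := v)).1
      (le_antisymm (dg_le_card _ _) (by rw [Finset.card_pair hv.ne]; omega))
    exact hB.tri v v₀ v₁ (h1 v₀ (by simp)) hv (h1 v₁ (by simp))
  obtain ⟨w, hw, haw⟩ : ∃ w ∈ Finset.univ \ (S ∪ T ∪ {v₀, v₁}), G.Adj a w := by
    refine (dg_pos (G := G)).1 ?_
    have h1 := h.deg a
    have h2 := dg_le_add_sdiff (G := G) Finset.univ (S ∪ T ∪ {v₀, v₁}) a
    have h3 := dg_union_le (G := G) (S ∪ T) {v₀, v₁} a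
    have h4 := dg_union_le (G := G) S T a
    have h5 := dg_le_card (G := G) S a
    have h6 := hB.dg_T ha
    have h7 := hpair a
    omega
  obtain ⟨E, hE, hEc, hwE⟩ := exists_comp (G := G) hw
  have hd := closedIn_disjoint hE
  have hd' := Finset.disjoint_left.1 hd
  have hZ : ∀ v, dg G (S ∪ {v₀, v₁}) v ≤ dg G S v + 1 := fun v => by
    have := dg_union_le (G := G) S {v₀, v₁} v
    have := hpair v
    omega
  have hvS : ∀ v ∈ E, v ∉ S := fun v hv hs => hd' (by grind) hv
  have hvT : ∀ v ∈ E, v ∉ T := fun v hv hs => hd' (by grind) hv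
  rcases h.adjacent_big_ap (T := T) (Z := S ∪ {v₀, v₁}) (a := a) hE hEc (by grind) ha
    ⟨x, by grind⟩ (by have := hB.disj a; grind) haw hwE
    (fun v hv => by have := hB.degT v (hvS v hv); omega)
    (fun v hv => by have := hB.degS v (hvT v hv); have := hZ v; omega)
    (fun v hv h0 => by have := hB.dg_zero h0; have := hZ v; omega) with hsys | hap
  · refine (hsys.ear_consec (N := 4) (s := 4) hd (by omega) (by omega) (by omega)
      ?_).evenRes (by omega)
    intro a₀ ha₀ t ht j hj
    obtain rfl := Finset.mem_singleton.1 ha₀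
    exact adjacent_big_inner_T hST hB.adj hx hy hxy (by grind) (by grind) hv ha ha' hb hb' haa hbb
      hab hab' hab2 hab3 hva hva' hvb hvb' (by grind) (by grind) j hj
  · refine Consec.evenRes (by omega) (Consec.add (a := 3) (b := 5) (s := 2)
      (L := fun m => ∃ j < 3, m = 3 + j) ⟨3, fun i hi => ⟨i, hi, rfl⟩⟩ hap (by omega) (by omega) ?_)
    rintro _ n ⟨j, hj, rfl⟩ hn
    refine hn.ear hd (fun a₀ ha₀ z hz => ?_) (by omega)
    obtain rfl := Finset.mem_singleton.1 ha₀
    exact adjacent_big_inner_S hST hB.adj hx hy hxy (by grind) (by grind) hv ha ha' hb hb' haa hbb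
      hab hab' hab2 hva hva' hvb hvb' hz j hj

end AdjacentBigSeven

section Cycles

/-- A periodic enumeration of a cycle of length `g`. -/
structure Cyc (G : SimpleGraph V) (f : ℕ → V) (g : ℕ) : Prop where
  three : 3 ≤ g
  per : Function.Periodic f g
  adj : ∀ i, G.Adj (f i) (f (i + 1))
  inj : ∀ i < g, ∀ j < g, f i = f j → i = j

/-- The vertices of a cycle. -/
def rim (f : ℕ → V) (g : ℕ) : Finset V := (Finset.range g).image f

variable {f : ℕ → V} {g : ℕ}

theorem mem_rim {v : V} : v ∈ rim f g ↔ ∃ i < g, f i = v := by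
  simp [rim]

namespace Cyc

theorem eq_iff (h : Cyc G f g) {i j : ℕ} : f i = f j ↔ i % g = j % g := by
  have := h.three
  rw [← h.per.map_mod_nat i, ← h.per.map_mod_nat j]
  exact ⟨h.inj _ (Nat.mod_lt _ (by omega)) _ (Nat.mod_lt _ (by omega)), fun h => by rw [h]⟩

theorem mem (h : Cyc G f g) (i : ℕ) : f i ∈ rim f g := by
  have := h.three
  exact mem_rim.2 ⟨i % g, Nat.mod_lt _ (by omega), h.per.map_mod_nat i⟩

theorem ne (h : Cyc G f g) {i j : ℕ} (hij : i < j) (hj : j < i + g) : f i ≠ f j := by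
  rw [ne_eq, h.eq_iff]
  intro he
  have h1 := (Nat.modEq_iff_dvd' hij.le).1 he
  have := Nat.le_of_dvd (by omega) h1
  omega

theorem shift (h : Cyc G f g) (s : ℕ) : Cyc G (fun i => f (s + i)) g where
  three := h.three
  per i := by
    change f (s + (i + g)) = f (s + i)
    rw [← add_assoc]
    exact h.per _
  adj i := h.adj (s + i)
  inj i hi j hj hij := by
    by_contra hne
    rcases Nat.lt_or_gt_of_ne hne with hlt | hlt
    · exact h.ne (i := s + i) (j := s + j) (by omega) (by omega) hij
    · exact h.ne (i := s + j) (j := s + i) (by omega) (by omega) hij.symm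

theorem rim_shift (h : Cyc G f g) (s : ℕ) : rim (fun i => f (s + i)) g = rim f g := by
  have h3 := h.three
  ext v
  refine ⟨fun hv => ?_, fun hv => ?_⟩
  · obtain ⟨i, -, rfl⟩ := mem_rim.1 hv
    exact h.mem _
  · obtain ⟨i, hi, rfl⟩ := mem_rim.1 hv
    have hs : s % g < g := Nat.mod_lt _ (by omega)
    have := (h.shift s).mem (i + g - s % g)
    convert this using 1
    rw [h.eq_iff]
    have h1 := Nat.div_add_mod s g
    rw [show s + (i + g - s % g) = i + g * (s / g + 1) by rw [mul_add]; omega]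
    simp

/-- The arc of length `n` starting at position `i`. -/
theorem seg (h : Cyc G f g) (i n : ℕ) (hn : n < g) :
    PathIn G ((Finset.Icc i (i + n)).image f) (f i) (f (i + n)) n := by
  induction n with
  | zero => exact .nil (by simp)
  | succ n ih =>
    refine (ih (by omega)).snoc (c := f (i + (n + 1))) ?_ (h.adj (i + n)) ?_
    · simp only [Finset.mem_image, Finset.mem_Icc, not_exists, not_and]
      intro t ht
      exact h.ne (by omega) (by omega)
    · intro x hx
      simp only [Finset.mem_insert, Finset.mem_image, Finset.mem_Icc] at hx ⊢
      rcases hx with rfl | ⟨t, ht, rfl⟩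
      · exact ⟨_, by omega, rfl⟩
      · exact ⟨t, by omega, rfl⟩

theorem arc (h : Cyc G f g) (i n : ℕ) (hn : n < g) : PathIn G (rim f g) (f i) (f (i + n)) n :=
  (h.seg i n hn).mono fun x hx => by
    obtain ⟨t, -, rfl⟩ := Finset.mem_image.1 hx
    exact h.mem t

theorem arc' (h : Cyc G f g) (i n : ℕ) (h0 : 0 < n) (hn : n < g) :
    PathIn G (rim f g) (f i) (f (i + n)) (g - n) := by
  have := (h.arc (i + n) (g - n) (by omega)).symm
  rwa [show i + n + (g - n) = i + g by omega, h.per i] at this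

end Cyc

theorem PathIn.exists_fun {U : Finset V} {a b : V} {n : ℕ} (h : PathIn G U a b n) :
    ∃ p : ℕ → V, p 0 = a ∧ p n = b ∧ (∀ i < n, G.Adj (p i) (p (i + 1))) ∧ (∀ i ≤ n, p i ∈ U) ∧
      ∀ i ≤ n, ∀ j ≤ n, p i = p j → i = j := by
  induction h with
  | @nil U a ha => exact ⟨fun _ => a, rfl, rfl, by simp, fun _ _ => ha, by grind⟩
  | @cons U a c b n ha hac _ ih =>
    obtain ⟨p, h0, hn, hadj, hU, hinj⟩ := ih
    refine ⟨fun i => if i = 0 then a else p (i - 1), by simp, by simpa using hn, fun i hi => ?_,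
      fun i hi => ?_, fun i hi j hj => ?_⟩
    · by_cases h : i = 0
      · simpa [h, h0] using hac
      · have := hadj (i - 1) (by omega)
        rw [show i - 1 + 1 = i by omega] at this
        simpa [h] using this
    · by_cases h : i = 0
      · simpa [h] using ha
      · have := hU (i - 1) (by omega)
        simp only [h, if_false]
        grind
    · have h1 := hU (i - 1)
      have h2 := hU (j - 1)
      have h3 := hinj (i - 1)
      have h4 := h3 (by omega) (j - 1) (by omega)
      by_cases hi0 : i = 0 <;> by_cases hj0 : j = 0 <;> simp only [hi0, hj0, if_true, if_false]
      · simp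
      · intro h; have := h2 (by omega); grind
      · intro h; have := h1 (by omega); grind
      · intro h; have := h4 h; omega

theorem exists_cyc_of_fun {n : ℕ} (p : ℕ → V) (hn : 2 ≤ n)
    (hadj : ∀ i < n, G.Adj (p i) (p (i + 1))) (hinj : ∀ i ≤ n, ∀ j ≤ n, p i = p j → i = j)
    (hc : G.Adj (p n) (p 0)) : Cyc G (fun i => p (i % (n + 1))) (n + 1) where
  three := by omega
  per i := by simp
  adj i := by
    have h1 : i % (n + 1) < n + 1 := Nat.mod_lt _ (by omega)
    rcases Nat.lt_or_ge (i % (n + 1)) n with h | h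
    · have h2 : (i + 1) % (n + 1) = i % (n + 1) + 1 := by
        rw [Nat.add_mod, Nat.mod_eq_of_lt (a := 1) (by omega)]
        exact Nat.mod_eq_of_lt (by omega)
      rw [h2]
      exact hadj _ h
    · have h3 : i % (n + 1) = n := by omega
      have h2 : (i + 1) % (n + 1) = 0 := by
        rw [Nat.add_mod, h3, Nat.mod_eq_of_lt (a := 1) (by omega), Nat.mod_self]
      rw [h2, h3]
      exact hc
  inj i hi j hj h := by
    rw [Nat.mod_eq_of_lt hi, Nat.mod_eq_of_lt hj] at h
    exact hinj i (by omega) j (by omega) h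

theorem PathIn.exists_cyc {U : Finset V} {a b : V} {n : ℕ} (h : PathIn G U a b n)
    (hab : G.Adj b a) (hn : 2 ≤ n) : ∃ f, Cyc G f (n + 1) ∧ ∀ i, f i ∈ U := by
  obtain ⟨p, h0, h1, hadj, hU, hinj⟩ := h.exists_fun
  refine ⟨_, exists_cyc_of_fun p hn hadj hinj (by rwa [h0, h1]), fun i => hU _ ?_⟩
  have : i % (n + 1) < n + 1 := Nat.mod_lt _ (by omega)
  omega

theorem HasCycleLen.exists_cyc {n : ℕ} (h : HasCycleLen G n) : ∃ f, Cyc G f n := by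
  obtain ⟨v, c, hc, rfl⟩ := h
  have h3 := hc.three_le_length
  have hlast : c.getVert c.length = c.getVert 0 := by simp
  have hinj := hc.getVert_injOn'
  have h := exists_cyc_of_fun (G := G) (n := c.length - 1) c.getVert (by omega)
    (fun i hi => c.adj_getVert_succ (by omega))
    (fun i hi j hj h => hinj (by simpa using hi) (by simpa using hj) h) (by
      have := c.adj_getVert_succ (i := c.length - 1) (by omega)
      rwa [show c.length - 1 + 1 = c.length by omega, hlast] at this)
  rw [show c.length - 1 + 1 = c.length by omega] at h
  exact ⟨_, h⟩

end Cycles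

section NonSeparating

variable {f : ℕ → V} {g : ℕ} {F : Finset V} {P : ℕ → Prop}

theorem ConnOn.insert (h : ConnOn G F) {a x : V} (hx : x ∈ F) (hax : G.Adj a x) :
    ConnOn G (insert a F) := by
  refine ⟨⟨a, by simp⟩, fun D hD hne => ?_⟩
  have h1 := hD.1
  have h2 := hD.2 a
  have h3 := hD.2 x
  have h4 := hax.symm
  by_cases hDF : (D ∩ F).Nonempty
  · have h5 := h.2 (D ∩ F) ⟨Finset.inter_subset_right, fun u hu w hw huw => by
      have := hD.2 u (by grind) w (by grind) huw
      grind⟩ hDF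
    have h6 : x ∈ D := by
      have : x ∈ D ∩ F := by rw [h5]; exact hx
      grind
    have : F ⊆ D := fun y hy => by
      have : y ∈ D ∩ F := by rw [h5]; exact hy
      grind
    grind
  · obtain ⟨d, hd⟩ := hne
    exfalso
    refine hDF ⟨x, ?_⟩
    have : d ∉ F := fun hs => hDF ⟨d, by grind⟩
    grind

/-- A cycle of admissible length together with a largest connected set avoiding it. -/
structure NSys (G : SimpleGraph V) (P : ℕ → Prop) (f : ℕ → V) (g : ℕ) (F : Finset V) : Prop where
  cyc : Cyc G f g
  len : P g
  conn : ConnOn G F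
  disj : ∀ i, f i ∉ F
  max : ∀ f' g' F', Cyc G f' g' → P g' → ConnOn G F' → (∀ i, f' i ∉ F') → F'.card ≤ F.card

theorem Cyc.link (h : Cyc G f g) {j l : ℕ} {U : Finset V} (hj : 2 ≤ j) (hjg : j < g)
    (hU : PathIn G U (f 0) (f j) l) (hl : 1 ≤ l) (hUf : ∀ i, f i ∈ U → f i = f 0 ∨ f i = f j) :
    ∃ f', Cyc G f' (l + j) ∧ ∀ i, f' i ∈ U ∨ ∃ t, 0 < t ∧ t < j ∧ f' i = f t := by
  have h1 := (h.seg 1 (j - 2) (by omega)).symm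
  have h2 := h.adj (j - 1)
  rw [show j - 1 + 1 = j by omega] at h2
  rw [show 1 + (j - 2) = j - 1 by omega] at h1
  have h3 := hU.join h1 ?_ h2.symm
  · obtain ⟨f', hf', hm⟩ := h3.exists_cyc (h.adj 0).symm (by omega)
    refine ⟨f', by convert hf' using 1; omega, fun i => ?_⟩
    have := hm i
    simp only [Finset.mem_union, Finset.mem_image, Finset.mem_Icc] at this
    rcases this with hs | ⟨t, ht, hs⟩
    · exact .inl hs
    · exact .inr ⟨t, by omega, by omega, hs.symm⟩
  · rw [Finset.disjoint_left]
    intro x hx hx'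
    obtain ⟨t, ht, rfl⟩ := Finset.mem_image.1 hx'
    rw [Finset.mem_Icc] at ht
    rcases hUf t hx with hs | hs
    · exact h.ne (i := 0) (j := t) (by omega) (by omega) hs.symm
    · exact h.ne (i := t) (j := j) (by omega) (by omega) hs

namespace NSys

theorem shift (h : NSys G P f g F) (s : ℕ) : NSys G P (fun i => f (s + i)) g F where
  cyc := h.cyc.shift s
  len := h.len
  conn := h.conn
  disj _ := h.disj _
  max := h.max

theorem miss (h : NSys G P f g F) {f' : ℕ → V} {g' : ℕ} {a x : V} (hc : Cyc G f' g') (hP : P g')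
    (ha : a ∉ F) (hx : x ∈ F) (hax : G.Adj a x) (hF : ∀ i, f' i ∉ F) (hfa : ∀ i, f' i ≠ a) :
    False := by
  have := h.max f' g' (insert a F) hc hP (h.conn.insert hx hax) fun i => by
    have := hF i; have := hfa i; grind
  rw [Finset.card_insert_of_notMem ha] at this
  omega

theorem link_half (h : NSys G P f g F) {j l s t : ℕ} {U : Finset V} (hs : 0 < s) (hsj : s < j)
    (hjt : j < t) (htg : t < g) (ht : ∃ x ∈ F, G.Adj (f t) x) (hU : PathIn G U (f 0) (f j) l)
    (hl : 1 ≤ l) (hUf : ∀ i, f i ∈ U → f i = f 0 ∨ f i = f j) (hUF : Disjoint U F) :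
    ¬P (l + j) := by
  intro hP
  obtain ⟨f', hf', hm⟩ := h.cyc.link (by omega) (by omega) hU hl hUf
  obtain ⟨x, hx, htx⟩ := ht
  refine h.miss hf' hP (h.disj t) hx htx (fun i hi => ?_) fun i hi => ?_
  · rcases hm i with h1 | ⟨t', -, -, h1⟩
    · exact Finset.disjoint_left.1 hUF h1 hi
    · exact h.disj t' (h1 ▸ hi)
  · have h0 := hm i
    rw [hi] at h0
    rcases h0 with h1 | ⟨t', h2, h3, h1⟩
    · rcases hUf t h1 with h1 | h1
      · exact h.cyc.ne (i := 0) (j := t) (by omega) (by omega) h1.symm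
      · exact h.cyc.ne (i := j) (j := t) (by omega) (by omega) h1.symm
    · exact h.cyc.ne (i := t') (j := t) (by omega) (by omega) h1.symm

theorem no_link (h : NSys G P f g F) (hP : SplitClosed P)
    {i j l s t : ℕ} {U : Finset V} (hs : i < s) (hsj : s < j)
    (hjt : j < t) (htg : t < i + g) (hsF : ∃ x ∈ F, G.Adj (f s) x) (ht : ∃ x ∈ F, G.Adj (f t) x)
    (hU : PathIn G U (f i) (f j) l) (hl : 1 ≤ l)
    (hUf : ∀ u, f u ∈ U → f u = f i ∨ f u = f j) (hUF : Disjoint U F) : False := by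
  have hper := h.cyc.per
  rcases hP g (j - i) l (by omega) h.len with h1 | h1
  · refine (h.shift i).link_half (j := j - i) (s := s - i) (t := t - i) (U := U) (l := l) (by omega)
      (by omega) (by omega) (by omega) ?_ ?_ hl ?_ hUF h1
    · rwa [show i + (t - i) = t by omega]
    · rwa [show i + (j - i) = j by omega, add_zero]
    · rw [show i + (j - i) = j by omega, add_zero]
      exact fun u => hUf _
  · refine (h.shift j).link_half (j := g - (j - i)) (s := t - j) (t := s + g - j) (U := U) (l := l)
      (by omega) (by omega) (by omega) (by omega) ?_ ?_ hl ?_ hUF h1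
    · rw [show j + (s + g - j) = s + g by omega, hper]
      exact hsF
    · rw [show j + (g - (j - i)) = i + g by omega, hper]
      exact hU.symm
    · rw [show j + (g - (j - i)) = i + g by omega, hper]
      exact fun u hu => (hUf _ hu).symm

theorem closed (h : NSys G P f g F) {a x : V} (ha : a ∉ rim f g) (hx : x ∈ F) (hax : G.Adj a x) :
    a ∈ F := by
  by_contra haF
  exact h.miss h.cyc h.len haF hx hax h.disj fun i hi => ha (hi ▸ h.cyc.mem i)

theorem attached_succ (h : NSys G P f g F)
    (hP : SplitClosed P) (hB : Base3 G k)
    (h0 : ∃ x ∈ F, G.Adj (f 0) x) : ∃ x ∈ F, G.Adj (f 1) x := by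
  classical
  by_contra h1
  have h3 := h.cyc.three
  have hex : ∃ s, 0 < s ∧ ∃ x ∈ F, G.Adj (f s) x :=
    ⟨g, by omega, by have := h.cyc.per 0; rw [zero_add] at this; rwa [this]⟩
  obtain ⟨s, ⟨hs0, hs⟩, hmin⟩ : ∃ s, (0 < s ∧ ∃ x ∈ F, G.Adj (f s) x) ∧
      ∀ t, 0 < t → t < s → ¬∃ x ∈ F, G.Adj (f t) x :=
    ⟨Nat.find hex, Nat.find_spec hex, fun t h1 h2 h3 => Nat.find_min hex h2 ⟨h1, h3⟩⟩
  have hs1 : s ≠ 1 := fun h => h1 (h ▸ hs)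
  have hclosed : ∀ a x, x ∈ F → G.Adj a x → a ∉ F → ∃ i < g, f i = a := fun a x hx hax ha => by
    by_contra hcon
    exact ha (h.closed (fun hr => hcon (mem_rim.1 hr)) hx hax)
  have hsg : s < g := by
    by_contra! hcon
    have := (hB.conn_erase (f 0)).2 F ⟨fun x hx => by have := h.disj 0; grind,
      fun a ha b hb hab => by
        by_contra hbF
        obtain ⟨i, hi, rfl⟩ := hclosed b a ha hab.symm hbF
        refine hmin i ?_ (by omega) ⟨a, ha, hab.symm⟩
        rcases Nat.eq_zero_or_pos i with rfl | hi
        · simp at hb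
        · exact hi⟩ h.conn.1
    refine h.disj 1 (this ▸ ?_)
    have := h.cyc.adj 0
    have := this.ne
    simp only [zero_add] at this
    grind
  set R := Finset.univ \ (rim f g ∪ F) with hR
  have hRf : ∀ i, f i ∉ R := fun i => by have := h.cyc.mem i; grind
  have hlink : ∀ i j, 0 < i → i < s → s < j → j < g → ∀ U l, PathIn G U (f i) (f j) l → 1 ≤ l →
      U ⊆ insert (f i) (insert (f j) R) → False := by
    intro i j h1 h2 h3 h4 U l hU hl hUs
    refine h.no_link hP (s := s) (t := g) h2 h3 h4 (by omega) hs ?_ hU hl (fun u hu => ?_) ?_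
    · have := h.cyc.per 0; rw [zero_add] at this; rwa [this]
    · have := hUs hu
      have := hRf u
      grind
    · rw [Finset.disjoint_left]
      intro x hx hxF
      have := hUs hx
      have := h.disj i
      have := h.disj j
      grind
  let Q : V → Prop := fun v => ∃ i, 0 < i ∧ i < s ∧ (v = f i ∨ v ∈ R ∧ ∃ y, G.Adj (f i) y ∧
    ∃ n, PathIn G R y v n)
  have hmem : ∀ b, b ≠ f 0 → b ≠ f s → b ∉ F → b ∉ R → (∀ j, s < j → j < g → b ≠ f j) → Q b := by
    intro b hb0 hbs hbF hbR hbj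
    obtain ⟨j, hj, rfl⟩ := mem_rim.1 (show b ∈ rim f g by grind)
    refine ⟨j, ?_, ?_, .inl rfl⟩
    · rcases Nat.eq_zero_or_pos j with rfl | hj
      · exact absurd rfl hb0
      · exact hj
    · by_contra! hsj
      rcases hsj.lt_or_eq with hlt | heq
      · exact hbj j hlt hj rfl
      · exact hbs (heq ▸ rfl)
  have := (hB.conn_erase₂ (f 0) (f s)).2 (((Finset.univ.erase (f 0)).erase (f s)).filter Q)
    ⟨Finset.filter_subset _ _, fun a ha b hb hab => ?_⟩ ?_
  · obtain ⟨x, hx⟩ := h.conn.1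
    have hxQ : x ∈ ((Finset.univ.erase (f 0)).erase (f s)).filter Q := by
      rw [this]
      have := h.disj 0
      have := h.disj s
      grind
    obtain ⟨i, h1, h2, rfl | ⟨h3, -⟩⟩ := (Finset.mem_filter.1 hxQ).2
    · exact h.disj i hx
    · grind
  · rw [Finset.mem_filter] at ha ⊢
    refine ⟨hb, ?_⟩
    simp only [Finset.mem_erase, Finset.mem_univ, and_true] at hb
    obtain ⟨-, i, hi0, his, rfl | ⟨haR, y, hy, n, hp⟩⟩ := ha
    · have hbF : b ∉ F := fun hs => hmin i hi0 his ⟨b, hs, hab⟩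
      by_cases hbR : b ∈ R
      · exact ⟨i, hi0, his, .inr ⟨hbR, b, hab, 0, .nil hbR⟩⟩
      · refine hmem b hb.2 hb.1 hbF hbR fun j hj hjg hbj => ?_
        subst hbj
        exact hlink i j hi0 his hj hjg {f i, f j} 1
          (.cons (by simp) hab (.nil (by have := hab.ne; grind))) le_rfl (by grind)
    · have hbF : b ∉ F := fun hs => by have := h.closed (a := a) (by grind) hs hab; grind
      by_cases hbR : b ∈ R
      · obtain ⟨m, hm⟩ := hp.extend hbR hab
        exact ⟨i, hi0, his, .inr ⟨hbR, y, hy, m, hm⟩⟩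
      · refine hmem b hb.2 hb.1 hbF hbR fun j hj hjg hbj => ?_
        subst hbj
        refine hlink i j hi0 his hj hjg (insert (f i) (insert (f j) R)) (n + 1 + 1)
          ((hp.cons' (W := insert (f i) R) (hRf i) hy subset_rfl).snoc ?_ hab (by grind))
          (by omega) subset_rfl
        have := h.cyc.ne (i := i) (j := j) (by omega) (by omega)
        have := hRf j
        grind
  · refine ⟨f 1, Finset.mem_filter.2 ⟨?_, 1, by omega, by omega, .inl rfl⟩⟩
    have := h.cyc.ne (i := 0) (j := 1) (by omega) (by omega)
    have := h.cyc.ne (i := 1) (j := s) (by omega) (by omega)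
    grind

theorem attached (h : NSys G P f g F)
    (hP : SplitClosed P) (hB : Base3 G k) :
    ∀ i, ∃ x ∈ F, G.Adj (f i) x := by
  obtain ⟨x, hx, y, -, hy, hxy⟩ := hB.conn.exists_adj (Finset.subset_univ F) h.conn.1
    ⟨f 0, by simp, h.disj 0⟩
  have hr : y ∈ rim f g := by_contra fun hr => hy (h.closed hr hx hxy.symm)
  obtain ⟨i₀, hi₀, rfl⟩ := mem_rim.1 hr
  have key : ∀ n, ∃ x ∈ F, G.Adj (f (i₀ + n)) x := by
    intro n
    induction n with
    | zero => exact ⟨x, hx, hxy.symm⟩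
    | succ n ih => exact (h.shift (i₀ + n)).attached_succ hP hB ih
  intro i
  have := key (g * i₀ + i - i₀)
  have h3 := h.cyc.three
  have h4 : i₀ ≤ g * i₀ := Nat.le_mul_of_pos_left _ (by omega)
  rwa [show i₀ + (g * i₀ + i - i₀) = i + i₀ * g by rw [mul_comm i₀]; omega,
    show f (i + i₀ * g) = f i from h.cyc.per.nat_mul i₀ i] at this

theorem link_adj (h : NSys G P f g F)
    (hP : SplitClosed P) (hB : Base3 G k)
    {i j l : ℕ} {U : Finset V} (hij : i < j) (hj : j < i + g) (hU : PathIn G U (f i) (f j) l)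
    (hl : 1 ≤ l) (hUf : ∀ u, f u ∈ U → f u = f i ∨ f u = f j) (hUF : Disjoint U F) :
    j = i + 1 ∨ j + 1 = i + g := by
  by_contra! hcon
  exact h.no_link hP (s := i + 1) (t := j + 1) (by omega) (by omega) (by omega) (by omega)
    (h.attached hP hB _) (h.attached hP hB _) hU hl hUf hUF

theorem induced (h : NSys G P f g F)
    (hP : SplitClosed P) (hB : Base3 G k)
    {i j : ℕ} (hij : i < j) (hj : j < i + g) (ha : G.Adj (f i) (f j)) :
    j = i + 1 ∨ j + 1 = i + g := by
  refine h.link_adj hP hB hij hj (U := {f i, f j}) (l := 1)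
    (.cons (by simp) ha (.nil (by have := ha.ne; grind))) le_rfl (by simp) ?_
  rw [Finset.disjoint_left]
  have := h.disj i
  have := h.disj j
  grind

theorem spans (h : NSys G P f g F)
    (hP : SplitClosed P) (hB : Base3 G k) (hg : 4 ≤ g) (v : V) :
    v ∈ F ∨ v ∈ rim f g := by
  by_contra hcon
  obtain ⟨D, hD, hDc, hvD⟩ := exists_comp (G := G) (U := Finset.univ \ (rim f g ∪ F)) (v := v)
    (by grind)
  have hDR : ∀ x ∈ D, x ∉ rim f g ∧ x ∉ F := fun x hx => by have := hD.1 hx; grind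
  have hDcl : ClosedIn G (Finset.univ \ rim f g) D := ⟨fun x hx => by have := hDR x hx; grind,
    fun a ha b hb hab => hD.2 a ha b (by
      have : b ∉ F := fun hbF => (hDR a ha).2 (h.closed (hDR a ha).1 hbF hab)
      grind) hab⟩
  have hlink : ∀ i j, i < j → j < i + g → (∃ x ∈ D, G.Adj (f i) x) → (∃ x ∈ D, G.Adj (f j) x) →
      j = i + 1 ∨ j + 1 = i + g := by
    rintro i j hij hj ⟨x, hx, hix⟩ ⟨y, hy, hjy⟩
    obtain ⟨n, hn⟩ := hDc.exists_path hx hy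
    have hi : f i ∉ D := fun hs => (hDR _ hs).1 (h.cyc.mem i)
    have hj' : f j ∉ D := fun hs => (hDR _ hs).1 (h.cyc.mem j)
    have hne := h.cyc.ne hij hj
    refine h.link_adj hP hB hij hj (U := insert (f i) (insert (f j) D))
      ((hn.cons' (W := insert (f i) D) hi hix subset_rfl).snoc (by grind) hjy.symm (by grind))
      (by omega) (fun u hu => ?_) ?_
    · have : f u ∉ D := fun hs => (hDR _ hs).1 (h.cyc.mem u)
      grind
    · rw [Finset.disjoint_left]
      intro a ha haF
      have := h.disj i
      have := h.disj j
      have := hDR a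
      grind
  obtain ⟨x, hx, hxD⟩ := hB.exists_attached hDcl hDc.1 (h.cyc.mem 0)
    ⟨f 1, h.cyc.mem 1, (h.cyc.ne (by omega) (by omega)).symm⟩
  obtain ⟨p, hp, hpx⟩ := mem_nbs.1 hx
  obtain ⟨i, hi, rfl⟩ := mem_rim.1 (Finset.mem_of_mem_erase hp)
  replace hlink := fun a b => hlink (i + a) (i + b)
  have hatt : ∀ b, 0 < b → b < g → ∃ c, 0 < c ∧ c < g ∧ c ≠ b ∧ ∃ x ∈ D, G.Adj (f (i + c)) x := by
    intro b hb hbg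
    obtain ⟨w, hw, hw0, hwb⟩ : ∃ w ∈ rim f g, w ≠ f i ∧ w ≠ f (i + b) := by
      by_cases hb1 : b = 1
      · subst hb1
        exact ⟨f (i + 2), h.cyc.mem _, (h.cyc.ne (by omega) (by omega)).symm,
          (h.cyc.ne (by omega) (by omega)).symm⟩
      · exact ⟨f (i + 1), h.cyc.mem _, (h.cyc.ne (by omega) (by omega)).symm,
          h.cyc.ne (by omega) (by omega)⟩
    obtain ⟨x, hx, hxD⟩ := hB.exists_attached₂ hDcl hDc.1 (h.cyc.mem i) (h.cyc.mem (i + b))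
      ⟨w, hw, hw0, hwb⟩
    obtain ⟨p, hp, hpx⟩ := mem_nbs.1 hx
    simp only [Finset.mem_erase] at hp
    obtain ⟨h1, h2, hp⟩ := hp
    rw [← h.cyc.rim_shift i] at hp
    obtain ⟨c, hc, rfl⟩ := mem_rim.1 hp
    refine ⟨c, ?_, hc, fun hcb => h1 (hcb ▸ rfl), x, hxD, hpx⟩
    rcases Nat.eq_zero_or_pos c with rfl | hc0
    · exact absurd rfl h2
    · exact hc0
  have hi0 : ∃ x ∈ D, G.Adj (f (i + 0)) x := ⟨x, hxD, hpx⟩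
  obtain ⟨c, hc0, hcg, hc1, hc⟩ := hatt 1 (by omega) (by omega)
  have h1 := hlink 0 c (by omega) (by omega) hi0 hc
  obtain ⟨c', hc0', hcg', hc1', hc'⟩ := hatt (g - 1) (by omega) (by omega)
  have h2 := hlink 0 c' (by omega) (by omega) hi0 hc'
  have h3 := hlink c' c (by omega) (by omega) hc' hc
  omega

end NSys

end NonSeparating

section Leaf

variable {f : ℕ → V} {g : ℕ} {F D A : Finset V} {P : ℕ → Prop} {c v : V}

theorem ConnOn.union_attached (h : ConnOn G F) (hA : ∀ a ∈ A, ∃ x ∈ F, G.Adj a x) :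
    ConnOn G (F ∪ A) := by
  induction A using Finset.induction_on with
  | empty => simpa using h
  | insert a A _ ih =>
    obtain ⟨x, hx, hax⟩ := hA a (by simp)
    rw [Finset.union_insert]
    exact (ih fun b hb => hA b (by simp [hb])).insert (Finset.mem_union_left _ hx) hax

/-- `D` is an end block of `F` with its cut vertex `c` removed. -/
structure Leaf (G : SimpleGraph V) (F D : Finset V) (c : V) : Prop where
  mem : c ∈ F
  closed : ClosedIn G (F.erase c) D
  conn : ConnOn G D
  min : ∀ e ∈ D, ∀ E ⊆ D, E.Nonempty → ¬ClosedIn G (F.erase e) E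

theorem exists_leaf (hc : c ∈ F) (hD : ClosedIn G (F.erase c) D) (hne : D.Nonempty) :
    ∃ c' D', D' ⊆ D ∧ Leaf G F D' c' := by
  induction hn : D.card using Nat.strong_induction_on generalizing D c with
  | _ n ih =>
    by_cases hmin : ∃ e ∈ D, ∃ E ⊆ D, E.Nonempty ∧ ClosedIn G (F.erase e) E
    · obtain ⟨e, he, E, hED, hE, hEc⟩ := hmin
      have heE : e ∉ E := fun hs => by simpa using hEc.1 hs
      have heF : e ∈ F := Finset.mem_of_mem_erase (hD.1 he)
      obtain ⟨c', D', h1, h2⟩ := ih E.card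
        (by rw [← hn]; exact Finset.card_lt_card ⟨hED, fun hs => heE (hs he)⟩) heF hEc hE rfl
      exact ⟨c', D', h1.trans hED, h2⟩
    · push Not at hmin
      obtain ⟨y, hy⟩ := hne
      obtain ⟨C, hC, hCc, -⟩ := exists_comp (G := G) hy
      exact ⟨c, C, hC.1, hc, hD.trans hC, hCc, fun e he E hE => hmin e (hC.1 he) E (hE.trans hC.1)⟩

namespace Leaf

theorem notMem (h : Leaf G F D c) : c ∉ D := fun hs => by simpa using h.closed.1 hs

theorem subset (h : Leaf G F D c) : D ⊆ F := h.closed.1.trans (Finset.erase_subset _ _)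

theorem good (h : Leaf G F D c) : Good G D (nbs G {c}) ∅ := by
  intro e he E hE hne _
  by_contra! hcon
  have hEs := hE.1
  refine h.min e he E (hE.1.trans (Finset.erase_subset _ _)) hne ⟨fun x hx => ?_,
    fun a ha b hb hab => ?_⟩
  · have := hEs hx
    have := h.subset (Finset.mem_of_mem_erase this)
    grind
  · have haD := hEs ha
    have hbc : b ≠ c := by
      rintro rfl
      exact hcon a ha (mem_nbs_singleton.2 hab.symm)
    have := h.closed.2 a (by grind) b (by grind) hab
    exact hE.2 a ha b (by grind) hab

theorem noncut (h : Leaf G F D c) (hF : ConnOn G F) (hv : v ∈ D) : ConnOn G (F.erase v) := by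
  have hcD := h.notMem
  have hU := hF.sdiff h.mem h.closed
  refine ⟨⟨c, by have := h.mem; grind⟩, fun E hE hne => ?_⟩
  have key : ∀ E, ClosedIn G (F.erase v) E → E.Nonempty → c ∈ E := by
    intro E hE hne
    by_contra hcE
    have hEs := hE.1
    by_cases hED : E ⊆ D
    · exact h.min v hv E hED hne hE
    · have h1 := hU.2 (E \ D) ⟨fun x hx => by have := @hEs x; grind, fun a ha b hb hab => by
        have := hE.2 a (by grind) b (by grind) hab
        grind⟩ (by rwa [Finset.sdiff_nonempty])
      have : c ∈ E \ D := by
        rw [h1]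
        have := h.mem
        grind
      grind
  have h1 := key E hE hne
  by_contra hcon
  have h2 := key _ hE.sdiff (by
    rw [Finset.sdiff_nonempty]
    exact fun hs => hcon (hE.1.antisymm hs))
  grind

end Leaf

theorem exists_two_leaves (hF : ConnOn G F) (hc : c ∈ F) (hcut : ¬ConnOn G (F.erase c))
    (hne : (F.erase c).Nonempty) : ∃ c₁ D₁ c₂ D₂, Leaf G F D₁ c₁ ∧ Leaf G F D₂ c₂ ∧
      Disjoint D₁ D₂ ∧ c₁ ∉ D₂ ∧ c₂ ∉ D₁ ∧ ConnOn G ((F \ D₁) \ D₂) := by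
  obtain ⟨M, N, hM, hMc, hN, hNc, hMN⟩ := exists_two_comps hne hcut
  obtain ⟨c₁, D₁, hD₁, h₁⟩ := exists_leaf hc hM hMc.1
  have hcl := h₁.closed.sdiff
  obtain ⟨n, hn⟩ := hNc.1
  have hnN := hN.1 hn
  have hMs := hM.1
  rw [Finset.disjoint_left] at hMN
  obtain ⟨c₂, D₂, hD₂, h₂⟩ := exists_leaf h₁.mem hcl (by
    by_cases hc₁ : c₁ = c
    · exact ⟨n, by grind⟩
    · exact ⟨c, by have := @hMs c; grind⟩)
  have hdis : Disjoint D₁ D₂ := by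
    rw [Finset.disjoint_left]
    intro x hx hx'
    have := hD₂ hx'
    grind
  have hc₁ : c₁ ∉ D₂ := fun hs => by have := hD₂ hs; grind
  have hc₂ : c₂ ∉ D₁ := fun hs => by
    have := (h₁.noncut hF hs).2 D₂ h₂.closed h₂.conn.1
    refine hc₁ (this ▸ ?_)
    have := h₁.mem
    have := h₁.notMem
    grind
  refine ⟨c₁, D₁, c₂, D₂, h₁, h₂, hdis, hc₁, hc₂, ?_⟩
  refine (hF.sdiff h₁.mem h₁.closed).sdiff (c := c₂) ?_ ⟨fun x hx => ?_, fun a ha b hb hab => ?_⟩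
  · have := h₂.mem; grind
  · have := h₂.closed.1 hx
    rw [Finset.disjoint_left] at hdis
    grind
  · exact h₂.closed.2 a ha b (by grind) hab

end Leaf

section NonSeparating

variable {f : ℕ → V} {g : ℕ} {F : Finset V} {P : ℕ → Prop} {v : V}

theorem Cyc.succ_pred (h : Cyc G f g) {i j : ℕ} (hj : j + 1 = i + g) :
    G.Adj (f i) (f j) := by
  have := h.adj j
  rw [hj, h.per] at this
  exact this.symm

/-- Positions of a cycle other than `i`, written as `i < j < i + g`. -/
theorem Cyc.exists_pos (h : Cyc G f g) (i : ℕ) {x : V} (hx : x ∈ rim f g) (hne : x ≠ f i) :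
    ∃ j, i < j ∧ j < i + g ∧ f j = x := by
  rw [← h.rim_shift i] at hx
  obtain ⟨t, ht, rfl⟩ := mem_rim.1 hx
  refine ⟨i + t, ?_, by omega, rfl⟩
  rcases Nat.eq_zero_or_pos t with rfl | ht0
  · exact absurd rfl hne
  · omega

theorem Cyc.dg_rim_le (h : Cyc G f g) (i : ℕ)
    (hind : ∀ j, i < j → j < i + g → G.Adj (f i) (f j) → j = i + 1 ∨ j + 1 = i + g) :
    dg G (rim f g) (f i) ≤ 2 := by
  have h3 := h.three
  have hs : (rim f g).filter (G.Adj (f i)) ⊆ {f (i + 1), f (i + (g - 1))} := by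
    intro x hx
    rw [Finset.mem_filter] at hx
    obtain ⟨j, h1, h2, rfl⟩ := h.exists_pos i hx.1 hx.2.ne'
    rcases hind j h1 h2 hx.2 with rfl | h4
    · simp
    · rw [show i + (g - 1) = j by omega]
      simp
  exact (Finset.card_le_card hs).trans Finset.card_le_two

theorem exists_nSys (hP : SplitClosed P) (hB : Base G k)
    (h0 : ∃ f g, Cyc G f g ∧ P g) : ∃ f g F, NSys G P f g F := by
  classical
  obtain ⟨g, ⟨f, hf, hPg⟩, hmin⟩ : ∃ g, (∃ f, Cyc G f g ∧ P g) ∧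
      ∀ g' f', Cyc G f' g' → P g' → g ≤ g' := by
    have hex : ∃ g f, Cyc G f g ∧ P g := by
      obtain ⟨f, g, h⟩ := h0
      exact ⟨g, f, h⟩
    exact ⟨Nat.find hex, Nat.find_spec hex, fun g' f' h1 h2 => Nat.find_min' hex ⟨f', h1, h2⟩⟩
  have hne : ∃ v, v ∉ rim f g := by
    by_contra! hall
    have h1 := hf.dg_rim_le 0 fun j hj hjg ha => by
      by_contra! hcon
      have hne := ha.ne
      rcases hP g j 1 (by omega) hPg with h1 | h1
      · obtain ⟨f', hf', -⟩ := hf.link (j := j) (l := 1) (U := {f 0, f j}) (by omega) (by omega)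
          (.cons (by simp) ha (.nil (by grind))) le_rfl (by simp)
        have := hmin _ _ hf' h1
        omega
      · have h2 : f (j + (g - j)) = f 0 := by
          rw [show j + (g - j) = 0 + g by omega, hf.per]
        obtain ⟨f', hf', -⟩ := (hf.shift j).link (j := g - j) (l := 1) (U := {f j, f 0}) (by omega)
          (by omega) (by rw [h2]; exact .cons (by simp) ha.symm (.nil (by grind))) le_rfl
          (by rw [h2]; simp)
        have := hmin _ _ hf' h1
        omega
    rw [show rim f g = Finset.univ from Finset.eq_univ_iff_forall.2 hall] at h1
    have := hB.deg (f 0)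
    have := hB.hk
    omega
  obtain ⟨w, hw⟩ := hne
  let Q : ℕ → Prop := fun n => ∃ f g F, Cyc G f g ∧ P g ∧ ConnOn G F ∧ (∀ i, f i ∉ F) ∧ F.card = n
  have hQ : Q 1 := ⟨f, g, {w}, hf, hPg, ⟨by simp, fun D hD ⟨x, hx⟩ => by
    have := hD.1; have := hD.1 hx; grind⟩, fun i hi => hw (by
      rw [Finset.mem_singleton] at hi
      exact hi ▸ hf.mem i), by simp⟩
  have hb : 1 ≤ Fintype.card V := by have := hB.card; omega
  obtain ⟨f, g, F, h1, h2, h3, h4, h5⟩ := Nat.findGreatest_spec hb hQ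
  refine ⟨f, g, F, h1, h2, h3, h4, fun f' g' F' h1' h2' h3' h4' => ?_⟩
  rw [h5]
  exact Nat.le_findGreatest (Finset.card_le_univ _) ⟨f', g', F', h1', h2', h3', h4', rfl⟩

theorem split_true : SplitClosed fun _ => True :=
  fun _ _ _ _ _ => .inl trivial

theorem odd_split : SplitClosed Odd := by
  intro g a l ha hg
  rcases Nat.even_or_odd (l + a) with h | h
  · right
    rcases h with ⟨m, hm⟩
    rcases hg with ⟨r, hr⟩
    exact ⟨m + r - a, by omega⟩
  · exact .inl h

namespace NSys

theorem dg_F (h : NSys G P f g F)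
    (hP : SplitClosed P) (hB : Base3 G k) (hg : 4 ≤ g)
    (i : ℕ) : k ≤ dg G F (f i) + 2 := by
  have h1 := h.cyc.dg_rim_le i fun j h1 h2 h3 => h.induced hP hB h1 h2 h3
  have h2 := dg_union_le (G := G) F (rim f g) (f i)
  rw [show F ∪ rim f g = Finset.univ from Finset.eq_univ_iff_forall.2 fun v =>
    Finset.mem_union.2 (h.spans hP hB hg v)] at h2
  have := hB.deg (f i)
  omega

theorem short (h : NSys G P f g F)
    (hP : SplitClosed P) (hB : Base3 G k) (hg : 4 ≤ g)
    (hv : v ∈ F) (hcon : ConnOn G (F.erase v)) {j : ℕ} (hj : 2 ≤ j) (hjg : j < g)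
    (h0 : G.Adj v (f 0)) (h1 : G.Adj v (f j)) (hPj : P (j + 2)) : g ≤ j + 2 := by
  have hvf : ∀ i, f i ≠ v := fun i hi => h.disj i (hi ▸ hv)
  have hne := h.cyc.ne (i := 0) (j := j) (by omega) (by omega)
  obtain ⟨f', hf', hm⟩ := h.cyc.link (l := 2) (U := {f 0, v, f j}) hj hjg
    (.cons (by simp) h0.symm (.cons (by have := hvf 0; grind) h1
      (.nil (by have := hvf j; grind)))) (by omega) (fun i hi => by have := hvf i; grind)
  have hA := hcon.union_attached (A := (Finset.Ioo j g).image f) fun a ha => by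
    obtain ⟨i, -, rfl⟩ := Finset.mem_image.1 ha
    have h1 := h.dg_F hP hB hg i
    have h2 := hB.hk
    have h3 := dg_union_le (G := G) (F.erase v) {v} (f i)
    rw [show F.erase v ∪ {v} = F by grind] at h3
    have h4 : dg G {v} (f i) ≤ 1 := (dg_le_card ..).trans (by simp)
    exact (dg_pos (G := G)).1 (by omega)
  have := h.max f' (2 + j) _ hf' (by rwa [add_comm]) hA fun i hi => by
    rw [Finset.mem_union, Finset.mem_image] at hi
    rcases hm i with h2 | ⟨t, ht0, htj, ht⟩
    · rcases hi with hi | ⟨s, hs, hsi⟩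
      · have := h.disj 0; have := h.disj j; grind
      · rw [Finset.mem_Ioo] at hs
        rw [← hsi] at h2
        simp only [Finset.mem_insert, Finset.mem_singleton] at h2
        rcases h2 with h2 | h2 | h2
        · exact h.cyc.ne (i := 0) (j := s) (by omega) (by omega) h2.symm
        · exact hvf _ h2
        · exact h.cyc.ne (i := j) (j := s) (by omega) (by omega) h2.symm
    · rcases hi with hi | ⟨s, hs, hsi⟩
      · exact h.disj t (by rw [← ht]; exact Finset.mem_of_mem_erase hi)
      · rw [Finset.mem_Ioo] at hs
        exact h.cyc.ne (i := t) (j := s) (by omega) (by omega) (by rw [hsi, ht])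
  rw [Finset.card_union_of_disjoint, Finset.card_erase_of_mem hv, Finset.card_image_of_injOn,
    Nat.card_Ioo] at this
  · have : 0 < F.card := Finset.card_pos.2 ⟨v, hv⟩
    omega
  · intro a ha b hb hab
    rw [Finset.coe_Ioo, Set.mem_Ioo] at ha hb
    exact h.cyc.inj a (by omega) b (by omega) hab
  · rw [Finset.disjoint_left]
    intro x hx hx'
    obtain ⟨t, -, rfl⟩ := Finset.mem_image.1 hx'
    exact h.disj t (Finset.mem_of_mem_erase hx)

/-- A vertex whose deletion keeps the rest of the system connected has close neighbours on the
cycle. -/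
theorem short_all (h : NSys G P f g F)
    (hP : SplitClosed P) (hB : Base3 G k) (hg : 4 ≤ g)
    (htri : TriFree G)
    (hv : v ∈ F) (hcon : ConnOn G (F.erase v)) {i j : ℕ} (hij : i < j) (hj : j < i + g)
    (h0 : G.Adj v (f i)) (h1 : G.Adj v (f j)) :
    i + 2 ≤ j ∧ j + 2 ≤ i + g ∧ (P (j - i + 2) → g ≤ j - i + 2) ∧
      (P (g - (j - i) + 2) → j ≤ i + 2) := by
  have h2 : i + 2 ≤ j := by
    by_contra! hcon
    have : j = i + 1 := by omega
    subst this
    exact htri _ _ _ h0 (h.cyc.adj i) h1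
  have h3 : j + 2 ≤ i + g := by
    by_contra! hcon
    exact htri _ _ _ h0 (h.cyc.succ_pred (by omega)) h1
  refine ⟨h2, h3, fun hp => ?_, fun hp => ?_⟩
  · refine (h.shift i).short hP hB hg hv hcon (j := j - i) (by omega) (by omega) h0 ?_ hp
    rwa [show i + (j - i) = j by omega]
  · have := (h.shift j).short hP hB hg hv hcon (j := g - (j - i)) (by omega) (by omega) h1 ?_ hp
    · omega
    · rwa [show j + (g - (j - i)) = i + g by omega, h.cyc.per]

theorem dg_rim_le_one (h : NSys G (fun _ => True) f g F) (hB : Base3 G k) (hg : 5 ≤ g)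
    (htri : TriFree G)
    (hv : v ∈ F) (hcon : ConnOn G (F.erase v)) : dg G (rim f g) v ≤ 1 := by
  refine Finset.card_le_one.2 fun a ha b hb => ?_
  rw [Finset.mem_filter] at ha hb
  by_contra hab
  obtain ⟨i, -, rfl⟩ := mem_rim.1 ha.1
  obtain ⟨j, h1, h2, rfl⟩ := h.cyc.exists_pos i hb.1 (Ne.symm hab)
  have := h.short_all split_true hB (by omega) htri hv hcon h1 h2 ha.2 hb.2
  simp only [forall_const] at this
  omega

theorem odd_dist (h : NSys G Odd f g F) (hB : Base3 G k) (hg : 5 ≤ g)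
    (htri : TriFree G)
    (hv : v ∈ F) (hcon : ConnOn G (F.erase v)) {i j : ℕ} (hij : i < j) (hj : j < i + g)
    (h0 : G.Adj v (f i)) (h1 : G.Adj v (f j)) : j = i + 2 ∨ j + 2 = i + g := by
  obtain ⟨h2, h3, h4, h5⟩ := h.short_all odd_split hB (by omega) htri hv hcon hij hj h0 h1
  have hg' := h.len
  by_cases ho : Odd (j - i)
  · have := h4 (by rcases ho with ⟨m, hm⟩; exact ⟨m + 1, by omega⟩)
    omega
  · have := h5 (by
      rw [Nat.not_odd_iff_even] at ho
      rcases ho with ⟨m, hm⟩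
      rcases hg' with ⟨r, hr⟩
      exact ⟨r - m + 1, by omega⟩)
    omega

theorem dg_rim_le_two (h : NSys G Odd f g F) (hB : Base3 G k) (hg : 5 ≤ g)
    (htri : TriFree G)
    (hv : v ∈ F) (hcon : ConnOn G (F.erase v)) : dg G (rim f g) v ≤ 2 := by
  by_contra! hlt
  obtain ⟨a, b, c, ha, hb, hc, hab, hac, hbc⟩ := Finset.two_lt_card_iff.1 hlt
  rw [Finset.mem_filter] at ha hb hc
  obtain ⟨i, -, rfl⟩ := mem_rim.1 ha.1
  obtain ⟨j, h1, h2, rfl⟩ := h.cyc.exists_pos i hb.1 (Ne.symm hab)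
  obtain ⟨l, h3, h4, rfl⟩ := h.cyc.exists_pos i hc.1 (Ne.symm hac)
  have h5 := h.odd_dist hB hg htri hv hcon h1 h2 ha.2 hb.2
  have h6 := h.odd_dist hB hg htri hv hcon h3 h4 ha.2 hc.2
  have hjl : j ≠ l := fun hs => hbc (hs ▸ rfl)
  obtain ⟨r, hr⟩ := h.len
  rcases lt_or_gt_of_ne hjl with h7 | h7
  · have := h.odd_dist hB hg htri hv hcon h7 (by omega) hb.2 hc.2
    omega
  · have := h.odd_dist hB hg htri hv hcon h7 (by omega) hc.2 hb.2
    omega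

end NSys

variable {f : ℕ → V} {g r : ℕ} {F D : Finset V} {P : ℕ → Prop} {v c : V}

/-- A cycle `C` together with a connected set `F` covering all other vertices, such that
vertices of `F` that are not cut vertices of `F` have at most `r` neighbours on `C`. -/
structure CSys (G : SimpleGraph V) [DecidableRel G.Adj] (k r : ℕ) (f : ℕ → V) (g : ℕ)
    (F : Finset V) : Prop extends Base3 G k where
  cyc : Cyc G f g
  conn' : ConnOn G F
  disj : ∀ i, f i ∉ F
  spans : ∀ v, v ∈ F ∨ v ∈ rim f g
  dg_F : ∀ i, k ≤ dg G F (f i) + 2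
  dg_rim : ∀ v ∈ F, ConnOn G (F.erase v) → dg G (rim f g) v ≤ r

namespace CSys

theorem dg_F_add (h : CSys G k r f g F) (hv : v ∈ F) (hF : ConnOn G (F.erase v)) :
    k ≤ dg G F v + r := by
  have h2 := dg_union_le (G := G) F (rim f g) v
  rw [show F ∪ rim f g = Finset.univ from Finset.eq_univ_iff_forall.2 fun v =>
    Finset.mem_union.2 (h.spans v)] at h2
  have := h.deg v
  have := h.dg_rim v hv hF
  omega

theorem cycle (h : CSys G k r f g F) {i j n : ℕ} (hij : i < j) (hj : j < i + g)
    (hl : Len G F (nbs G {f i}) (nbs G {f j}) n) :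
    HasCycleLen G (j - i + n + 2) ∧ HasCycleLen G (g - (j - i) + n + 2) := by
  have hd : Disjoint (rim f g) F := by
    rw [Finset.disjoint_left]
    intro x hx
    obtain ⟨t, -, rfl⟩ := mem_rim.1 hx
    exact h.disj t
  have h1 := h.cyc.arc i (j - i) (by omega)
  have h2 := h.cyc.arc' i (j - i) (by omega) (by omega)
  rw [show i + (j - i) = j by omega] at h1 h2
  refine ⟨hl.ear hd ?_ (by omega), hl.ear hd ?_ (by omega)⟩
  · simpa using h1
  · simpa using h2

theorem leaf_nbr (h : CSys G k r f g F) (hD : Leaf G F D c) (t : ℕ) :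
    ∃ i, f i ≠ f t ∧ ∃ x ∈ D, G.Adj (f i) x := by
  by_contra! hcon
  have h3 := h.cyc.three
  have hi := h.cyc.ne (i := t) (j := t + 1) (by omega) (by omega)
  have := (h.conn_erase₂ (f t) c).2 D ⟨fun x hx => ?_, fun a ha b hb hab => ?_⟩ hD.conn.1
  · have h1 : f (t + 1) ∈ D := by
      rw [this]
      have := h.disj (t + 1)
      have := hD.mem
      grind
    exact h.disj _ (hD.subset h1)
  · have := hD.notMem
    have := h.disj t
    have := hD.subset hx
    grind
  · rcases h.spans b with hbF | hbr
    · exact hD.closed.2 a ha b (by grind) hab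
    · obtain ⟨j, -, rfl⟩ := mem_rim.1 hbr
      exact absurd hab.symm (hcon j (by grind) a ha)

theorem leaf_sys (h : CSys G k r f g F) (hD : Leaf G F D c) {i : ℕ}
    (hi : ∃ x ∈ D, G.Adj (f i) x) : KSys G D (nbs G {f i}) (nbs G {c}) (k - 1 - r) where
  conn := hD.conn
  hX := by
    obtain ⟨x, hx, hix⟩ := hi
    exact ⟨x, mem_nbs_singleton.2 hix, hx⟩
  hY := by
    obtain ⟨x, hx, hix⟩ := h.conn'.exists_nbr hD.mem hD.closed hD.conn.1
    exact ⟨x, mem_nbs_singleton.2 hix, hx⟩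
  good := hD.good.mono Finset.subset_union_right subset_rfl
  deg _ v hv := by
    have h1 := h.dg_F_add (hD.subset hv) (hD.noncut h.conn' hv)
    have h2 := dg_le_of_closedIn hD.closed hv
    unfold dgp
    omega

theorem two_leaves (h : CSys G k r f g F) (hr : r + 2 ≤ k) (hc : c ∈ F)
    (hcut : ¬ConnOn G (F.erase c)) : ∃ i j, i < j ∧ j < i + g ∧
      AP (Len G F (nbs G {f i}) (nbs G {f j})) (2 * (k - 1 - r) - 1) := by
  obtain ⟨c₁, D₁, c₂, D₂, h₁, h₂, hdis, hc₁, hc₂, hU⟩ := exists_two_leaves h.conn' hc hcut (by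
    by_contra hne
    have h1 : dg G F (f 0) ≤ F.card := dg_le_card ..
    rw [Finset.not_nonempty_iff_eq_empty] at hne
    have h2 := Finset.card_erase_of_mem hc
    rw [hne, Finset.card_empty] at h2
    have := h.dg_F 0
    have := h.hk
    omega)
  obtain ⟨i, -, hi⟩ := h.leaf_nbr h₁ 0
  obtain ⟨j, hij, hj⟩ := h.leaf_nbr h₂ i
  obtain ⟨j', h1, h2, h3⟩ := h.cyc.exists_pos i (h.cyc.mem j) hij
  rw [← h3] at hj
  refine ⟨i, j', h1, h2, ?_⟩
  have hs₁ := (h.leaf_sys h₁ hi).ap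
  have hs₂ := (h.leaf_sys h₂ hj).ap
  obtain ⟨m, hm⟩ := hU.exists_path (a := c₁) (b := c₂) (by
    have := h₁.mem; have := h₁.notMem; grind) (by have := h₂.mem; have := h₂.notMem; grind)
  have key := hs₁.add (s := m + 2) (M := Len G F (nbs G {f i}) (nbs G {f j'})) hs₂ (by omega)
    (by omega) ?_
  · convert key using 1
    omega
  rintro n n' ⟨x, hx, y, hy, hp⟩ ⟨x', hx', y', hy', hp'⟩
  refine ⟨x, hx, x', hx', ?_⟩
  have h4 := (hp.join hm ?_ (mem_nbs_singleton.1 hy).symm).join hp'.symm ?_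
    (mem_nbs_singleton.1 hy')
  · rw [show n + n' + (m + 2) = n + m + 1 + n' + 1 by omega]
    refine h4.mono ?_
    have := h₁.subset
    have := h₂.subset
    intro z hz
    grind
  · rw [Finset.disjoint_left]
    grind
  · rw [Finset.disjoint_left] at hdis ⊢
    grind

theorem sys (h : CSys G k r f g F) (h2 : ∀ v ∈ F, ConnOn G (F.erase v)) (i j : ℕ) :
    KSys G F (nbs G {f i}) (nbs G {f j}) (k - 1 - r) := by
  have hatt : ∀ i, ∀ c, ∃ x ∈ F.erase c, G.Adj (f i) x := fun i c => by
    have h1 := h.dg_F i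
    have h3 := h.hk
    have h4 := dg_union_le (G := G) (F.erase c) {c} (f i)
    have h5 : dg G F (f i) ≤ dg G (F.erase c ∪ {c}) (f i) := dg_mono (by grind) _
    have h6 : dg G {c} (f i) ≤ 1 := (dg_le_card ..).trans (by simp)
    exact (dg_pos (G := G)).1 (by omega)
  refine ⟨h.conn', ?_, ?_, fun c hc D hD hne _ => ?_, fun _ v hv => ?_⟩
  · obtain ⟨x, hx, hix⟩ := hatt i (f i)
    exact ⟨x, mem_nbs_singleton.2 hix, Finset.mem_of_mem_erase hx⟩
  · obtain ⟨x, hx, hix⟩ := hatt j (f i)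
    exact ⟨x, mem_nbs_singleton.2 hix, Finset.mem_of_mem_erase hx⟩
  · obtain ⟨x, hx, hix⟩ := hatt i c
    rw [(h2 c hc).2 D hD hne]
    exact ⟨x, hx, Finset.mem_union_left _ (mem_nbs_singleton.2 hix)⟩
  · have h1 := h.dg_F_add hv (h2 v hv)
    unfold dgp
    omega

theorem evenRes_odd (h : CSys G k r f g F) (ho : Odd k) (hr : 2 * r + 3 ≤ k) (hc : c ∈ F)
    (hcut : ¬ConnOn G (F.erase c)) : EvenRes G k := by
  obtain ⟨i, j, h1, h2, h3⟩ := h.two_leaves (by omega) hc hcut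
  have h4 : AP (HasCycleLen G) (2 * (k - 1 - r) - 1) := h3.imp (s := j - i + 2) fun n hn => by
    have := (h.cycle h1 h2 hn).1
    rwa [show n + (j - i + 2) = j - i + n + 2 by omega]
  exact AP.evenRes ho (h4.mono (by omega))

theorem exists_shift (h : CSys G k r f g F) (hg : Odd g) {i j : ℕ} (hij : i < j)
    (hj : j < i + g) (p : ℕ) : ∃ q, Even (q + p) ∧
      ∀ n, Len G F (nbs G {f i}) (nbs G {f j}) n → HasCycleLen G (q + n) := by
  rcases Nat.even_or_odd (j - i + p) with he | he
  · refine ⟨j - i + 2, ?_, fun n hn => ?_⟩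
    · rcases he with ⟨m, hm⟩
      exact ⟨m + 1, by omega⟩
    · have := (h.cycle hij hj hn).1
      rwa [show j - i + 2 + n = j - i + n + 2 by omega]
  · refine ⟨g - (j - i) + 2, ?_, fun n hn => ?_⟩
    · rcases he with ⟨m, hm⟩
      rcases hg with ⟨t, ht⟩
      exact ⟨t + 1 + p - m, by omega⟩
    · have := (h.cycle hij hj hn).2
      rwa [show g - (j - i) + 2 + n = g - (j - i) + n + 2 by omega]

/-- An arithmetic progression of lengths outside an odd cycle gives all even residues. -/
theorem evenRes_even (h : CSys G k r f g F) (hk : Even k) (hg : Odd g) {i j : ℕ} (hij : i < j)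
    (hj : j < i + g) (hA : AP (Len G F (nbs G {f i}) (nbs G {f j})) (k - 1)) : EvenRes G k := by
  obtain ⟨p, d, hd, hA⟩ := hA
  have h4 := h.hk
  obtain ⟨q, hq, hq'⟩ := h.exists_shift hg hij hj p
  obtain ⟨m, hm⟩ := hk
  refine evenRes_of_even (m := m) (by omega) ⟨m, hm⟩ (by omega) hq fun s hs => ?_
  rcases hd with rfl | rfl
  · have := hq' _ (hA (2 * s) (by omega))
    rwa [show q + p + 2 * s = q + (p + 1 * (2 * s)) by omega]
  · have := hq' _ (hA s (by omega))
    rwa [show q + p + 2 * s = q + (p + 2 * s) by omega]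

theorem evenRes_leaves (h : CSys G k r f g F) (hg : Odd g) (hr : 2 * r + 3 ≤ k + 1) (hc : c ∈ F)
    (hk : Even k) (hcut : ¬ConnOn G (F.erase c)) : EvenRes G k := by
  obtain ⟨i, j, h1, h2, h3⟩ := h.two_leaves (by omega) hc hcut
  exact h.evenRes_even hk hg h1 h2 (h3.mono (by omega))

/-- Cycle lengths from two systems of lengths, one for each arc of the cycle. -/
theorem cycle_of_arcs (h : CSys G k r f g F) {a b n : ℕ} (ha : 0 < a) (hb : 0 < b) (hab : a + b = g)
    (hl : Len G F (nbs G {f 0}) (nbs G {f a}) n) :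
    HasCycleLen G (a + 2 + n) ∧ HasCycleLen G (b + 2 + n) := by
  have := h.cycle (i := 0) (j := a) ha (by omega) hl
  rw [show g - (a - 0) = b by omega] at this
  rwa [show a + 2 + n = a - 0 + n + 2 by omega, show b + 2 + n = b + n + 2 by omega]

theorem evenRes_block_odd (h : CSys G k r f g F) (ho : Odd k) (h2 : ∀ v ∈ F, ConnOn G (F.erase v))
    (hr : r = 1 ∧ 7 ≤ k ∧ 5 ≤ g ∨ r = 2 ∧ 9 ≤ k ∧ 5 ≤ g ∧ Odd g) : EvenRes G k := by
  obtain ⟨a, e, ha, he, hag⟩ : ∃ a e, 0 < a ∧ (e = 3 ∨ e = 4 ∧ r = 1) ∧ a + (a + e) = g := by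
    rcases Nat.even_or_odd g with ⟨m, hm⟩ | ⟨m, hm⟩
    · have : ¬Odd g := Nat.not_odd_iff_even.2 ⟨m, hm⟩
      exact ⟨m - 2, 4, by omega, .inr ⟨rfl, by tauto⟩, by omega⟩
    · exact ⟨m - 1, 3, by omega, .inl rfl, by omega⟩
  obtain ⟨p, d, hd, hA⟩ := (h.sys h2 0 a).ap
  have hA' := fun n hn => h.cycle_of_arcs (a := a) (b := a + e) (by omega) (by omega)
    (by omega) (hA n hn)
  rcases hd with rfl | rfl
  · refine Consec.evenRes (by omega) ⟨a + 2 + p, fun i hi => ?_⟩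
    by_cases hik : i < k - 1 - r
    · have := (hA' i (by omega)).1
      rwa [show a + 2 + p + i = a + 2 + (p + 1 * i) by omega]
    · have := (hA' (i - e) (by omega)).2
      rwa [show a + 2 + p + i = a + e + 2 + (p + 1 * (i - e)) by omega]
  · intro l _
    obtain ⟨j, hj, hjl⟩ := exists_modEq_of_odd ho (a + 2 + p : ℕ) l
    by_cases hjk : j < k - 1 - r
    · exact ⟨_, (hA' j hjk).1, by push_cast at hjl ⊢; convert hjl using 1; ring⟩
    rcases he with rfl | ⟨rfl, rfl⟩
    · obtain ⟨m, hm⟩ := ho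
      obtain ⟨t, rfl⟩ : ∃ t, j = t + (m + 2) := ⟨j - (m + 2), by omega⟩
      refine ⟨_, (hA' t (by omega)).2, Int.ModEq.trans ?_ hjl⟩
      refine Int.modEq_iff_dvd.2 ⟨1, ?_⟩
      subst hm
      push_cast
      ring
    · obtain ⟨t, rfl⟩ : ∃ t, j = t + 2 := ⟨j - 2, by omega⟩
      refine ⟨_, (hA' t (by omega)).2, ?_⟩
      convert hjl using 1
      push_cast
      ring

theorem evenRes_block_even (h : CSys G k 2 f g F) (hk : Even k) (h6 : 6 ≤ k) (hg : Odd g)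
    (hg5 : 5 ≤ g) (h2 : ∀ v ∈ F, ConnOn G (F.erase v)) : EvenRes G k := by
  obtain ⟨m, rfl⟩ : ∃ m, g = 2 * m + 1 := hg
  obtain ⟨p, d, hd, hA⟩ := (h.sys h2 0 (m - 1)).ap
  have hA' := fun n hn => h.cycle_of_arcs (a := m - 1) (b := m + 2) (by omega) (by omega)
    (by omega) (hA n hn)
  rcases hd with rfl | rfl
  · refine Consec.evenRes (by omega) ⟨m - 1 + 2 + p, fun i hi => ?_⟩
    by_cases hik : i < k - 3
    · have := (hA' i (by omega)).1
      rwa [show m - 1 + 2 + p + i = m - 1 + 2 + (p + 1 * i) by omega]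
    · have := (hA' (i - 3) (by omega)).2
      rwa [show m - 1 + 2 + p + i = m + 2 + 2 + (p + 1 * (i - 3)) by omega]
  · obtain ⟨q, hq, hq'⟩ := h.exists_shift ⟨m, rfl⟩ (i := 0) (j := m - 1) (by omega) (by omega) p
    obtain ⟨t, ht⟩ := hk
    refine evenRes_of_even (m := t) (by omega) ⟨t, ht⟩ (by omega) hq fun s hs => ?_
    have := hq' _ (hA s (by omega))
    rwa [show q + p + 2 * s = q + (p + 2 * s) by omega]

end CSys

variable {f : ℕ → V} {g : ℕ}

theorem Cyc.hasCycleLen (h : Cyc G f g) : HasCycleLen G g := by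
  have h3 := h.three
  have h1 := h.arc' 0 1 (by omega) (by omega)
  have := h1.hasCycleLen (h.adj 0).symm (by omega)
  rwa [show g - 1 + 1 = g by omega] at this

theorem Cyc.four_le (h : Cyc G f g) (htri : TriFree G) :
    4 ≤ g := by
  have h3 := h.three
  by_contra! hcon
  refine htri _ _ _ (h.adj 0) (h.adj 1) (h.adj 2 |>.symm |> fun h' => ?_)
  have := h.per 0
  rw [show 0 + g = 3 by omega] at this
  rw [show 2 + 1 = 3 by rfl, this] at h'
  exact h'

theorem Base.exists_cyc (h : Base G k) : ∃ f g, Cyc G f g := by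
  obtain ⟨x, -⟩ := h.conn.1
  have h4 := h.hk
  have h1 := h.deg x
  obtain ⟨a, -, -, ha⟩ := dg_two (G := G) (U := Finset.univ) (v := x) (by omega) x
  obtain ⟨b, -, hab, hb⟩ := dg_two (G := G) (U := Finset.univ) (v := x) (by omega) a
  obtain ⟨n, hn⟩ := (h.conn_erase x).exists_path (a := a) (b := b)
    (by have := ha.ne; grind) (by have := hb.ne; grind)
  obtain ⟨f, hf, -⟩ := (hn.cons' (W := Finset.univ) (by simp) ha (by simp)).exists_cyc hb.symm (by
    cases hn
    · exact absurd rfl hab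
    · omega)
  exact ⟨f, _, hf⟩

theorem Base3.exists_cSys_one (h : Base3 G k)
    (htri : TriFree G) (h4 : ¬HasCycleLen G 4) :
    ∃ f g F, CSys G k 1 f g F ∧ NSys G (fun _ => True) f g F ∧ 5 ≤ g := by
  obtain ⟨f₀, g₀, h₀⟩ := h.toBase.exists_cyc
  obtain ⟨f, g, F, hN⟩ := exists_nSys (P := fun _ => True) split_true h.toBase
    ⟨f₀, g₀, h₀, trivial⟩
  have hg : 5 ≤ g := by
    have := hN.cyc.four_le htri
    by_contra! hcon
    obtain rfl : g = 4 := by omega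
    exact h4 hN.cyc.hasCycleLen
  exact ⟨f, g, F, ⟨h, hN.cyc, hN.conn, hN.disj, hN.spans split_true h (by omega),
    hN.dg_F split_true h (by omega), fun v hv hc => hN.dg_rim_le_one h hg htri hv hc⟩, hN, hg⟩

theorem Base3.exists_cSys_two (h : Base3 G k)
    (htri : TriFree G) {n : ℕ} (hn : HasCycleLen G n)
    (ho : Odd n) :
    ∃ f g F, CSys G k 2 f g F ∧ NSys G Odd f g F ∧ 5 ≤ g := by
  obtain ⟨f₀, h₀⟩ := hn.exists_cyc
  obtain ⟨f, g, F, hN⟩ := exists_nSys (P := Odd) odd_split h.toBase ⟨f₀, n, h₀, ho⟩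
  have hg : 5 ≤ g := by
    have := hN.cyc.four_le htri
    obtain ⟨m, hm⟩ := hN.len
    omega
  exact ⟨f, g, F, ⟨h, hN.cyc, hN.conn, hN.disj, hN.spans odd_split h (by omega),
    hN.dg_F odd_split h (by omega), fun v hv hc => hN.dg_rim_le_two h hg htri hv hc⟩, hN, hg⟩

theorem Base3.girth_five (h : Base3 G k) (ho : Odd k) (hk : 7 ≤ k)
    (htri : TriFree G) (h4 : ¬HasCycleLen G 4) : EvenRes G k := by
  obtain ⟨f, g, F, hC, -, hg⟩ := h.exists_cSys_one htri h4
  by_cases h2 : ∀ v ∈ F, ConnOn G (F.erase v)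
  · exact hC.evenRes_block_odd ho h2 (.inl ⟨rfl, hk, hg⟩)
  · push Not at h2
    obtain ⟨c, hc, hcut⟩ := h2
    exact hC.evenRes_odd ho (by omega) hc hcut

theorem Base3.nonbipartite_odd (h : Base3 G k) (ho : Odd k) (hk : 9 ≤ k)
    (htri : TriFree G) {n : ℕ} (hn : HasCycleLen G n)
    (hno : Odd n) : EvenRes G k := by
  obtain ⟨f, g, F, hC, hN, hg⟩ := h.exists_cSys_two htri hn hno
  by_cases h2 : ∀ v ∈ F, ConnOn G (F.erase v)
  · exact hC.evenRes_block_odd ho h2 (.inr ⟨rfl, hk, hg, hN.len⟩)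
  · push Not at h2
    obtain ⟨c, hc, hcut⟩ := h2
    exact hC.evenRes_odd ho (by omega) hc hcut

theorem Base3.nonbipartite_even (h : Base3 G k) (he : Even k) (hk : 6 ≤ k)
    (htri : TriFree G) {n : ℕ} (hn : HasCycleLen G n)
    (hno : Odd n) : EvenRes G k := by
  obtain ⟨f, g, F, hC, hN, hg⟩ := h.exists_cSys_two htri hn hno
  by_cases h2 : ∀ v ∈ F, ConnOn G (F.erase v)
  · exact hC.evenRes_block_even he hk hN.len hg h2
  · push Not at h2
    obtain ⟨c, hc, hcut⟩ := h2
    exact hC.evenRes_leaves hN.len (by omega) hc he hcut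

end NonSeparating

section FourCycleFour

variable {S T E : Finset V}

theorem ClosedIn.mem_of_path {U W D : Finset V} {a b : V} {n : ℕ} (h : ClosedIn G W D)
    (hp : PathIn G U a b n) (hU : U ⊆ W) (ha : a ∈ D) : b ∈ D := by
  induction hp with
  | nil => exact ha
  | cons ha' hac hp ih =>
    exact ih ((Finset.erase_subset _ _).trans hU)
      (h.2 _ ha _ (hU ((Finset.erase_subset _ _) hp.left_mem)) hac)

theorem evenRes_four {p : ℕ} (hp : Even p) (h : HasCycleLen G p) (h' : HasCycleLen G (p + 2)) :
    EvenRes G 4 :=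
  evenRes_of_even (m := 2) (by omega) (by decide) (by omega) hp fun i hi => by
    interval_cases i
    · exact h
    · exact h'

theorem cross_ear (hST : ∀ s ∈ S, ∀ t ∈ T, G.Adj s t) (hS : 2 ≤ S.card) (hT : 2 ≤ T.card)
    (hE : Disjoint (S ∪ T) E) {s t : V} (hs : s ∈ S) (ht : t ∈ T) {n : ℕ}
    (h : Len G E (nbs G {s}) (nbs G {t}) n) (hn : Odd n) : EvenRes G 4 := by
  have hc : ∀ j < 2, HasCycleLen G (1 + 2 * j + n + 2) := fun j hj => h.ear hE (by
    simp only [Finset.mem_singleton]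
    rintro _ rfl _ rfl
    exact bip_cross (fun s hs ht => (hST s hs s ht).ne rfl) hST hs ht (by omega) (by omega)) (by omega)
  refine evenRes_four (p := n + 3) (by obtain ⟨m, rfl⟩ := hn; exact ⟨m + 2, by omega⟩) ?_ ?_
  · convert hc 0 (by omega) using 1; omega
  · convert hc 1 (by omega) using 1; omega

theorem cross_spider (hST : ∀ s ∈ S, ∀ t ∈ T, G.Adj s t) (hS : 2 ≤ S.card) (hT : 2 ≤ T.card)
    (hE : Disjoint (S ∪ T) E) (hc : ConnOn G E) {s t t' : V} (hs : s ∈ S) (ht : t ∈ T) (ht' : t' ∈ T)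
    {n : ℕ} (h : Len G E (nbs G {t}) (nbs G {t'}) n) (hn : Odd n) (hsE : ∃ v ∈ nbs G {s}, v ∈ E) :
    EvenRes G 4 := by
  obtain ⟨x, hx, y, hy, hp⟩ := h
  obtain ⟨z, hz, m, i, j, hij, h1, h2⟩ := hc.spider hp hsE
  rcases Nat.even_or_odd (m + i) with he | ho
  · refine cross_ear hST hS hT hE hs ht' ⟨z, hz, y, hy, h2⟩ ?_
    obtain ⟨q, hq⟩ := hn
    obtain ⟨r, hr⟩ := he
    exact ⟨m + q - r, by omega⟩
  · exact cross_ear hST hS hT hE hs ht ⟨z, hz, x, hx, h1⟩ ho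

theorem same_ear (hST : ∀ s ∈ S, ∀ t ∈ T, G.Adj s t) (hS : 2 ≤ S.card) (hT : 3 ≤ T.card)
    (hE : Disjoint (S ∪ T) E) {t t' : V} (ht : t ∈ T) (ht' : t' ∈ T) (htt : t ≠ t') {n : ℕ}
    (h : Len G E (nbs G {t}) (nbs G {t'}) n) (hn : Even n) : EvenRes G 4 := by
  have hc : ∀ j < 2, HasCycleLen G (2 + 2 * j + n + 2) := fun j hj => h.ear hE (by
    simp only [Finset.mem_singleton]
    rintro _ rfl _ rfl
    exact bip_same (fun s hs ht => (hST s hs s ht).ne rfl) hST ht ht' htt (by omega) (by omega))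
    (by omega)
  refine evenRes_four (p := n + 4) (by obtain ⟨m, rfl⟩ := hn; exact ⟨m + 2, by omega⟩) ?_ ?_
  · convert hc 0 (by omega) using 1; omega
  · convert hc 1 (by omega) using 1; omega

theorem MaxBip.four_of_three (hB : MaxBip G S T) (h : Base3 G 4) (hT : 3 ≤ T.card) :
    EvenRes G 4 := by
  have h2 := hB.two
  have hST := hB.adj
  have hdis := hB.disj
  have hTT : ∀ t ∈ T, ∀ t' ∈ T, ¬G.Adj t t' := fun t ht t' ht' htt => by
    have := hB.dg_T ht
    have := dg_pos.2 ⟨t', ht', htt⟩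
    omega
  by_cases hS : 3 ≤ S.card
  · obtain ⟨s, hs⟩ := Finset.card_pos.1 (show 0 < S.card by omega)
    obtain ⟨t, ht⟩ := Finset.card_pos.1 (show 0 < T.card by omega)
    have hc : ∀ j < 2, HasCycleLen G (1 + 2 * (j + 1) + 1) := fun j hj =>
      (bip_cross hdis hST hs ht (by omega) (by omega)).hasCycleLen (hST s hs t ht).symm (by omega)
    exact evenRes_four (p := 4) (by decide) (hc 0 (by omega)) (hc 1 (by omega))
  obtain ⟨a, c, hac, rfl⟩ := Finset.card_eq_two.1 (show S.card = 2 by omega)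
  obtain ⟨t, ht, t₂, ht₂, htt⟩ := Finset.one_lt_card.1 (show 1 < T.card by omega)
  by_cases hex : ∃ E, ClosedIn G (Finset.univ \ ({a, c} ∪ T)) E ∧ ConnOn G E ∧
      (∃ v ∈ nbs G {t}, v ∈ E) ∧ ∃ t' ∈ T, t ≠ t' ∧ ∃ v ∈ nbs G {t'}, v ∈ E
  · obtain ⟨E, hE, hEc, ⟨x, hx, hxE⟩, t', ht', htt', y, hy, hyE⟩ := hex
    have hd := closedIn_disjoint hE
    obtain ⟨n, hn⟩ := hEc.exists_path hxE hyE
    by_cases hne : Even n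
    · exact same_ear hST h2 hT hd ht ht' htt' ⟨x, hx, y, hy, hn⟩ hne
    rw [Nat.not_even_iff_odd] at hne
    obtain ⟨z, hz, hzE⟩ := h.exists_attached₂ hE hEc.1 (u := t) (q := t') (by grind) (by grind)
      ⟨a, by grind, by grind, by grind⟩
    obtain ⟨q, hq, hqz⟩ := mem_nbs.1 hz
    have hqz' : ∃ v ∈ nbs G {q}, v ∈ E := ⟨z, (mem_nbs_singleton (G := G)).2 hqz, hzE⟩
    by_cases hqS : q ∈ ({a, c} : Finset V)
    · exact cross_spider hST h2 (by omega) hd hEc hqS ht ht' ⟨x, hx, y, hy, hn⟩ hne hqz'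
    obtain ⟨w, hw, m, i, j, hij, h1, h2'⟩ := hEc.spider hn hqz'
    rcases Nat.even_or_odd (m + i) with he | ho
    · exact same_ear hST h2 hT hd (t := q) (t' := t) (by grind) ht (by grind) ⟨w, hw, x, hx, h1⟩ he
    · refine same_ear hST h2 hT hd (t := q) (t' := t') (by grind) ht' (by grind)
        ⟨w, hw, y, hy, h2'⟩ ?_
      obtain ⟨p, hp⟩ := hne
      obtain ⟨r, hr⟩ := ho
      exact ⟨m + p - r, by omega⟩
  · push Not at hex
    classical
    have hcl : ClosedIn G ((Finset.univ.erase a).erase c) (insert t ((Finset.univ \ ({a, c} ∪ T)).filter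
        fun v => ∃ x, G.Adj t x ∧ ∃ n, PathIn G (Finset.univ \ ({a, c} ∪ T)) x v n)) := by
      refine ⟨fun x hx => by grind, fun v hv b hb hvb => ?_⟩
      rw [Finset.mem_insert, Finset.mem_filter] at hv ⊢
      rcases hv with rfl | ⟨hvF, x, hx, n, hn⟩
      · have := hTT v ht b
        have hbF : b ∈ Finset.univ \ ({a, c} ∪ T) := by grind
        exact .inr ⟨hbF, b, hvb, 0, .nil hbF⟩
      · by_cases hbT : b ∈ T
        · left
          by_contra hbt
          obtain ⟨E, hE, hEc, hxE⟩ := exists_comp (G := G) hn.left_mem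
          exact hex E hE hEc ⟨x, (mem_nbs_singleton (G := G)).2 hx, hxE⟩ b hbT (Ne.symm hbt) v
            ((mem_nbs_singleton (G := G)).2 hvb.symm) (hE.mem_of_path hn subset_rfl hxE)
        · have hbF : b ∈ Finset.univ \ ({a, c} ∪ T) := by grind
          obtain ⟨m, hm⟩ := hn.extend hbF hvb
          exact .inr ⟨hbF, x, hx, m, hm⟩
    have := (h.conn_erase₂ a c).2 _ hcl ⟨t, by simp⟩
    have ht2 : t₂ ∈ (Finset.univ.erase a).erase c := by have := hdis a; have := hdis c; grind
    rw [← this] at ht2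
    grind

theorem Base3.four_two (h : Base3 G 4) (hST : ∀ s ∈ S, ∀ t ∈ T, G.Adj s t) (hS : S.card = 2)
    (hT : T.card = 2) (hdg : ∀ v, v ∉ S → v ∉ T → dg G (S ∪ T) v ≤ 1)
    (hE : ClosedIn G (Finset.univ \ (S ∪ T)) E) (hc : ConnOn G E)
    (hSE : ∀ s ∈ S, ∃ v ∈ nbs G {s}, v ∈ E) (hTE : ∃ t ∈ T, ∃ v ∈ nbs G {t}, v ∈ E) :
    EvenRes G 4 := by
  have hTS : ∀ t ∈ T, ∀ s ∈ S, G.Adj t s := fun t ht s hs => (hST s hs t ht).symm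
  have hdis : ∀ s ∈ S, s ∉ T := fun s hs ht => (hST s hs s ht).ne rfl
  have hd := closedIn_disjoint hE
  have hd' := Finset.disjoint_left.1 hd
  have key : ∀ P Q D : Finset V, (∀ s ∈ P, ∀ t ∈ Q, G.Adj s t) → P ∪ Q = S ∪ T → P.card = 2 →
      Q.card = 2 → (∃ t ∈ Q, ∃ v ∈ nbs G {t}, v ∈ E) → D ⊆ E → ∀ x ∈ P, ∀ y ∈ P, x ≠ y →
      KSys G D (nbs G {x}) (nbs G {y}) 2 → EvenRes G 4 := by
    intro P Q D hPQ hU hP hQ ⟨q, hq, hqE⟩ hDE x hx y hy hxy hK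
    have hQP : ∀ t ∈ Q, ∀ s ∈ P, G.Adj t s := fun t ht s hs => (hPQ s hs t ht).symm
    by_cases hodd : ∃ n, Len G D (nbs G {x}) (nbs G {y}) n ∧ Odd n
    · obtain ⟨n, ⟨u, hu, v, hv, hp⟩, hn⟩ := hodd
      exact cross_spider hQP hQ.ge hP.ge (by rwa [Finset.union_comm, hU]) hc hq hx hy
        ⟨u, hu, v, hv, hp.mono hDE⟩ hn hqE
    push Not at hodd
    obtain ⟨p, d, hd1, hL⟩ := hK.ap
    have h0 := hL 0 (by omega)
    have h1 := hL 1 (by omega)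
    have he0 := Nat.not_odd_iff_even.1 (hodd _ h0)
    have he1 := Nat.not_odd_iff_even.1 (hodd _ h1)
    obtain rfl : d = 2 := by
      obtain ⟨a, ha⟩ := he0
      obtain ⟨b, hb⟩ := he1
      omega
    have hin : ∀ a ∈ ({x} : Finset V), ∀ b ∈ ({y} : Finset V), PathIn G (Q ∪ P) a b 2 := by
      simp only [Finset.mem_singleton]
      rintro _ rfl _ rfl
      exact bip_same (j := 0) (fun s hs ht => (hQP s hs s ht).ne rfl) hQP hx hy hxy (by omega)
        (by omega)
    have hd2 : Disjoint (Q ∪ P) D := by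
      rw [Finset.union_comm, hU]
      exact hd.mono_right hDE
    refine evenRes_four (p := p + 4) (he0.add (by decide)) ?_ ?_
    · convert h0.ear hd2 hin (by omega) using 1; omega
    · convert h1.ear hd2 hin (by omega) using 1; omega
  obtain ⟨a, c, hac, rfl⟩ := Finset.card_eq_two.1 hS
  obtain ⟨b, d, hbd, rfl⟩ := Finset.card_eq_two.1 hT
  have hvH : ∀ v ∈ E, v ∉ ({a, c} : Finset V) ∪ {b, d} := fun v hv hs => hd' hs hv
  by_cases hg : Good G E (nbs G {a} ∪ nbs G {c}) ∅
  · refine key {a, c} {b, d} E hST rfl hS hT hTE subset_rfl a (by simp) c (by simp) hac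
      (h.toBase.ear_sys hE hc hg (hSE a (by simp)) (hSE c (by simp)) fun _ v hv => ?_)
    have := hdg v (by have := hvH v hv; grind) (by have := hvH v hv; grind)
    omega
  unfold Good at hg
  push Not at hg
  obtain ⟨e, he, D', hD', ⟨v, hv⟩, -, hDW'⟩ := hg
  obtain ⟨D, hD, hDc, hvD⟩ := exists_comp (G := G) hv
  have hDD := hD.1
  replace hD := hD'.trans hD
  have hDE : D ⊆ E := hD.1.trans (Finset.erase_subset _ _)
  have hDS : ∀ v ∈ D, ¬G.Adj v a ∧ ¬G.Adj v c := by
    intro v hv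
    have h2 := hDW' v (hDD hv)
    simp only [Finset.mem_union, mem_nbs_singleton, not_or] at h2
    exact ⟨fun h' => h2.1 h'.symm, fun h' => h2.2 h'.symm⟩
  have hN : ∀ v ∈ D, ∀ w, w ∉ D → G.Adj v w → w = e ∨ w = b ∨ w = d := by
    intro v hv w hw hvw
    have h1 := hDS v hv
    have h2 := hE.2 v (hDE hv) w
    have h3 := hD.2 v hv w
    grind
  have hcl : ClosedIn G (Finset.univ \ {e, b, d}) D := by
    refine ⟨fun x hx => ?_, fun x hx y hy hxy => ?_⟩
    · have := hD.1 hx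
      have := hvH x (hDE hx)
      grind
    · by_contra hcon
      have := hN x hx y hcon hxy
      grind
  have heH := hvH e he
  have hat : ∀ u q w, ({e, b, d} : Finset V) = {u, q, w} → u ≠ q → u ≠ w → q ≠ w →
      ∃ v ∈ nbs G {w}, v ∈ D := by
    intro u q w heq h1 h2 h3
    rw [heq] at hcl
    obtain ⟨v, hv, hvD⟩ := h.exists_attached₂ hcl hDc.1 (u := u) (q := q) (by simp) (by simp)
      ⟨w, by simp, h2.symm, h3.symm⟩
    refine ⟨v, ?_, hvD⟩
    rwa [show (({u, q, w} : Finset V).erase u).erase q = {w} by ext x; simp; grind] at hv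
  have heb : e ≠ b := by grind
  have hed : e ≠ d := by grind
  refine key {b, d} {a, c} D hTS (Finset.union_comm _ _) hT hS ⟨a, by simp, hSE a (by simp)⟩ hDE b
    (by simp) d (by simp) hbd ⟨hDc, hat e d b (by rw [Finset.pair_comm]) hed heb hbd.symm,
      hat e b d rfl heb hed hbd, h.good e ⟨a, fun hs => ?_, by grind⟩ (fun hs => ?_) ?_, fun _ v hv => ?_⟩
  · have := hvH a (hDE hs)
    simp at this
  · have := hD.1 hs
    simp at this
  · intro v hv w hw hwe hvw
    have := hN v hv w hw hvw
    have := hvw.symm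
    simp only [Finset.mem_union, mem_nbs_singleton]
    grind
  · have h1 := h.deg v
    have h2 := dg_le_of_closedIn_sdiff hcl hv
    have h3 := dg_insert (G := G) (K := {b, d}) (u := e) (by simp [heb, hed]) v
    have h4 := dg_insert (G := G) (K := {d}) (u := b) (by simp [hbd]) v
    have h5 := dg_insert (G := G) (K := ∅) (u := d) (by simp) v
    have h6 : dg G ∅ v = 0 := by simp [dg]
    unfold dgp
    simp only [mem_nbs_singleton, G.adj_comm b v, G.adj_comm d v]
    rw [LawfulSingleton.insert_empty_eq] at h5
    split_ifs at * <;> omega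

theorem MaxBip.four (hB : MaxBip G S T) (h : Base3 G 4) : EvenRes G 4 := by
  by_cases hT : 3 ≤ T.card
  · exact hB.four_of_three h hT
  have h2 := hB.two
  have hle := hB.le
  have hdg : ∀ v, v ∉ S → v ∉ T → dg G (S ∪ T) v ≤ 1 := by
    intro v hS hT
    have h1 := hB.degT v hS
    have h3 := hB.big v hS
    have h4 := hB.degS v hT
    have h5 := dg_union_le (G := G) S T v
    have h6 := hB.dg_zero (v := v)
    omega
  have hTS : ∀ t ∈ T, ∀ s ∈ S, G.Adj t s := fun t ht s hs => (hB.adj s hs t ht).symm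
  obtain ⟨a, c, hac, rfl⟩ := Finset.card_eq_two.1 (show S.card = 2 by omega)
  obtain ⟨b, d, hbd, rfl⟩ := Finset.card_eq_two.1 (show T.card = 2 by omega)
  have hout : ∃ v, v ∈ Finset.univ \ (({a, c} : Finset V) ∪ {b, d}) := by
    by_contra! hcon
    have h1 := h.toBase.card
    have h3 := Finset.card_le_card (s := Finset.univ) (t := ({a, c} : Finset V) ∪ {b, d}) (by
      intro x _
      have := hcon x
      grind)
    have h4 := Finset.card_union_le ({a, c} : Finset V) {b, d}
    rw [Finset.card_univ] at h3
    omega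
  obtain ⟨v, hv⟩ := hout
  obtain ⟨E, hE, hEc, -⟩ := exists_comp (G := G) hv
  have hat : ∀ u q, u ∈ ({a, c} : Finset V) ∪ {b, d} → q ∈ ({a, c} : Finset V) ∪ {b, d} →
      ∃ w ∈ ({a, c} : Finset V) ∪ {b, d}, w ≠ u ∧ w ≠ q ∧ ∃ v ∈ nbs G {w}, v ∈ E := by
    intro u q hu hq
    have hw : ∃ w ∈ ({a, c} : Finset V) ∪ {b, d}, w ≠ u ∧ w ≠ q := by
      have h1 := hB.disj a (by simp)
      have h3 := hB.disj c (by simp)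
      by_contra! hcon
      have h4 := hcon a (by simp)
      have h5 := hcon b (by simp)
      have h6 := hcon c (by simp)
      simp only [Finset.mem_insert, Finset.mem_singleton, not_or] at h1 h3
      clear hcon hdg hTS hE hv hB h2
      grind
    obtain ⟨v, hv, hvE⟩ := h.exists_attached₂ hE hEc.1 hu hq hw
    obtain ⟨w, hw, hwv⟩ := mem_nbs.1 hv
    exact ⟨w, by grind, by grind, by grind, v, (mem_nbs_singleton (G := G)).2 hwv, hvE⟩
  by_cases hS : ∀ s ∈ ({a, c} : Finset V), ∃ v ∈ nbs G {s}, v ∈ E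
  · obtain ⟨w, hw, hwa, hwc, hwE⟩ := hat a c (by simp) (by simp)
    exact h.four_two hB.adj (by omega) (by omega) hdg hE hEc hS ⟨w, by grind, hwE⟩
  · push Not at hS
    obtain ⟨s, hs, hsE⟩ := hS
    have hall : ∀ t ∈ ({b, d} : Finset V), ∃ v ∈ nbs G {t}, v ∈ E := by
      intro t ht
      by_contra! hcon
      have hst : ∀ w, w ∈ ({a, c} : Finset V) ∪ {b, d} → (∃ v ∈ nbs G {w}, v ∈ E) → w ≠ s ∧ w ≠ t := by
        rintro w - ⟨v, hv, hvE⟩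
        exact ⟨fun h => hsE v (h ▸ hv) hvE, fun h => hcon v (h ▸ hv) hvE⟩
      obtain ⟨s', hs', hss⟩ := Finset.exists_mem_ne (s := {a, c}) (by omega) s
      obtain ⟨t', ht', htt⟩ := Finset.exists_mem_ne (s := {b, d}) (by omega) t
      obtain ⟨w, h1, h2, h3, h4⟩ := hat s' t' (Finset.mem_union_left _ hs') (Finset.mem_union_right _ ht')
      have h5 := hst w h1 h4
      simp only [Finset.mem_union, Finset.mem_insert, Finset.mem_singleton] at h1 hs hs' ht ht'
      clear hat hst hsE hcon h4 hdg hB hTS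
      rcases hs with rfl | rfl <;> rcases ht with rfl | rfl <;> grind
    obtain ⟨w, hw, hwb, hwd, hwE⟩ := hat b d (by simp) (by simp)
    refine h.four_two (S := {b, d}) (T := {a, c}) hTS (by omega) (by omega) (fun v h1 h2 => ?_) (E := E)
      (by rwa [Finset.union_comm]) hEc hall ⟨w, by grind, hwE⟩
    rw [Finset.union_comm]
    exact hdg v h2 h1

end FourCycleFour

section Geodesic

variable {f κ : ℕ → V} {g m s : ℕ} {F H E : Finset V}

/-- Long progressions of lengths through a component, from a prescribed neighbour `x` to some
neighbour in `Y`. -/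
theorem Base.exists_ear_ap (h : Base G k) {Y : Finset V} {x y : V}
    (hE : ClosedIn G (Finset.univ \ H) E) (hc : ConnOn G E)
    (hx : ∃ v ∈ E, G.Adj x v) (hy : ∃ v ∈ E, G.Adj y v) (hyY : y ∈ Y)
    (hdeg : ∀ v ∈ E, dg G H v ≤ 1 + (if v ∈ nbs G {x} then 1 else 0) +
      if v ∈ nbs G {y} then 1 else 0)
    (hleaf : ∀ c D, Leaf G E D c → (∀ v ∈ D, ¬G.Adj x v) → ∃ y ∈ Y, (∃ v ∈ D, G.Adj y v) ∧
      ∀ v ∈ D, dg G H v ≤ 1 + if v ∈ nbs G {y} then 1 else 0) :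
    ∃ y ∈ Y, (∃ v ∈ E, G.Adj y v) ∧ AP (Len G E (nbs G {x}) (nbs G {y})) (k - 2) := by
  have h4 := h.hk
  by_cases hg : Good G E (nbs G {x} ∪ nbs G {y}) ∅
  · refine ⟨y, hyY, hy, (h.ear_sys hE hc hg ?_ ?_ fun _ v hv => ?_).ap⟩
    · obtain ⟨v, hv, hxv⟩ := hx
      exact ⟨v, mem_nbs_singleton.2 hxv, hv⟩
    · obtain ⟨v, hv, hxv⟩ := hy
      exact ⟨v, mem_nbs_singleton.2 hxv, hv⟩
    · have := hdeg v hv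
      omega
  · unfold Good at hg
    push Not at hg
    obtain ⟨d, hd, D₀, hD₀, hne, -, hDW⟩ := hg
    obtain ⟨c, D, hDD, hL⟩ := exists_leaf hd hD₀ hne
    obtain ⟨y', hy', hyD, hdg⟩ := hleaf c D hL fun v hv hxv =>
      hDW v (hDD hv) (Finset.mem_union_left _ (mem_nbs_singleton.2 hxv))
    obtain ⟨w, hw, hxw⟩ := hx
    have hS : KSys G D (nbs G {c}) (nbs G {y'}) (k - 2) := {
      conn := hL.conn
      hX := by
        obtain ⟨v, hv, hcv⟩ := hc.exists_nbr hL.mem hL.closed hL.conn.1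
        exact ⟨v, mem_nbs_singleton.2 hcv, hv⟩
      hY := by
        obtain ⟨v, hv, hcv⟩ := hyD
        exact ⟨v, mem_nbs_singleton.2 hcv, hv⟩
      good := hL.good.mono Finset.subset_union_left subset_rfl
      deg := fun _ v hv => by
        have h1 := h.deg v
        have h2 := dg_le_of_closedIn_sdiff hE (hL.subset hv)
        have h3 := dg_le_of_closedIn hL.closed hv
        have h5 := hdg v hv
        unfold dgp
        omega }
    refine ⟨y', hy', ?_, hS.tail hc hL.mem hL.closed hw (fun hs => ?_)
      (mem_nbs_singleton.2 hxw)⟩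
    · obtain ⟨v, hv, h1⟩ := hyD
      exact ⟨v, hL.subset hv, h1⟩
    · exact hDW w (hDD hs) (Finset.mem_union_left _ (mem_nbs_singleton.2 hxw))

/-- The vertices of the path `κ`. -/
def trace (κ : ℕ → V) (m : ℕ) : Finset V := (Finset.range (m + 1)).image κ

theorem mem_trace {v : V} : v ∈ trace κ m ↔ ∃ i ≤ m, κ i = v := by
  simp [trace]

theorem seg_of_fun (hinj : ∀ i ≤ m, ∀ j ≤ m, κ i = κ j → i = j)
    (hadj : ∀ i < m, G.Adj (κ i) (κ (i + 1))) {i j : ℕ} (hij : i ≤ j) (hj : j ≤ m) :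
    PathIn G ((Finset.Icc i j).image κ) (κ i) (κ j) (j - i) := by
  induction j, hij using Nat.le_induction with
  | base => rw [Nat.sub_self]; exact .nil (by simp)
  | succ j hij ih =>
    rw [show j + 1 - i = j - i + 1 by omega]
    refine (ih (by omega)).snoc (c := κ (j + 1)) ?_ (hadj j (by omega)) ?_
    · simp only [Finset.mem_image, Finset.mem_Icc, not_exists, not_and]
      intro t ht he
      have := hinj t (by omega) (j + 1) hj he
      omega
    · intro x hx
      simp only [Finset.mem_insert, Finset.mem_image, Finset.mem_Icc] at hx ⊢
      rcases hx with rfl | ⟨t, ht, rfl⟩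
      · exact ⟨_, by omega, rfl⟩
      · exact ⟨t, by omega, rfl⟩

theorem seg_trace {i j : ℕ} (hj : j ≤ m) : (Finset.Icc i j).image κ ⊆ trace κ m := fun x hx => by
  obtain ⟨t, ht, rfl⟩ := Finset.mem_image.1 hx
  rw [Finset.mem_Icc] at ht
  exact mem_trace.2 ⟨t, by omega, rfl⟩

/-- A shortest path `κ` outside the cycle `f` joining neighbours of `f 0` and `f s`. -/
structure Geo (G : SimpleGraph V) (f : ℕ → V) (g : ℕ) (F : Finset V) (κ : ℕ → V) (m s : ℕ) :
    Prop where
  pos : 0 < s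
  lt : s < g
  mpos : 1 ≤ m
  inj : ∀ i ≤ m, ∀ j ≤ m, κ i = κ j → i = j
  adj : ∀ i < m, G.Adj (κ i) (κ (i + 1))
  mem : ∀ i ≤ m, κ i ∈ F
  fst : G.Adj (f 0) (κ 0)
  lst : G.Adj (f s) (κ m)
  ind : ∀ i j, i < j → j ≤ m → G.Adj (κ i) (κ j) → j = i + 1
  nadj : ∀ i ≤ m, ∀ j, G.Adj (f j) (κ i) → f j = f 0 ∨ f j = f s
  one : ∀ u ∈ F, u ∉ trace κ m → ∀ i ≤ m, ∀ j ≤ m, G.Adj u (κ i) → G.Adj u (κ j) → i = j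
  mixed : ∀ u ∈ F, u ∉ trace κ m → ∀ i ≤ m, ∀ j, G.Adj u (κ i) → G.Adj (f j) u →
    m = 1 ∨ m = 2 ∧ i = 1

/-- A cycle of length four from four vertices. -/
theorem hasCycleLen_four {a b c d : V} (hab : G.Adj a b) (hbc : G.Adj b c) (hcd : G.Adj c d)
    (hda : G.Adj d a) (hac : a ≠ c) (hbd : b ≠ d) : HasCycleLen G 4 :=
  PathIn.hasCycleLen (U := {a, b, c, d}) (n := 3) (.cons (by simp) hab (.cons
    (by have := hab.ne; grind) hbc (.cons (by have := hbc.ne; grind) hcd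
      (.nil (by have := hcd.ne; have := hda.ne; grind))))) hda (by omega)

theorem geo_of_min (hcyc : Cyc G f g) (htri : TriFree G)
    (h4 : ¬HasCycleLen G 4) (hF : ∀ i, f i ∉ F)
    (hone : ∀ v ∈ F, ∀ i j, G.Adj v (f i) → G.Adj v (f j) → f i = f j)
    (hmin : ∀ i j n, f i ≠ f j → Len G F (nbs G {f i}) (nbs G {f j}) n → m ≤ n)
    (hs : 0 < s) (hsg : s < g) (hl : Len G F (nbs G {f 0}) (nbs G {f s}) m) :
    ∃ κ, Geo G f g F κ m s := by
  obtain ⟨x, hx, y, hy, hp⟩ := hl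
  rw [mem_nbs_singleton] at hx hy
  obtain ⟨κ, rfl, rfl, hadj, hmem, hinj⟩ := hp.exists_fun
  have h0s := hcyc.ne (i := 0) (j := s) hs (by omega)
  have hseg := fun i j hij hj => seg_of_fun (i := i) (j := j) hinj hadj hij hj
  have hsub : ∀ i j, j ≤ m → (Finset.Icc i j).image κ ⊆ F := fun i j hj x hx => by
    obtain ⟨t, ht, rfl⟩ := mem_trace.1 (seg_trace hj hx)
    exact hmem t ht
  have hL0 : ∀ i ≤ m, ∀ j, G.Adj (f j) (κ i) → f j ≠ f 0 → m ≤ i := fun i hi j hj hne => by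
    refine hmin 0 j i hne.symm ⟨κ 0, mem_nbs_singleton.2 hx, κ i, mem_nbs_singleton.2 hj, ?_⟩
    simpa using (hseg 0 i (by omega) hi).mono (hsub 0 i hi)
  have hu0 : ∀ u ∈ F, u ∉ trace κ m → ∀ i ≤ m, G.Adj u (κ i) →
      PathIn G (insert u ((Finset.Icc 0 i).image κ)) (κ 0) u (i + 1) := fun u hu huK i hi hui => by
    simpa using (hseg 0 i (by omega) hi).snoc (c := u) (fun hs => huK (seg_trace hi hs)) hui.symm
      subset_rfl
  have hu1 : ∀ u ∈ F, u ∉ trace κ m → ∀ i ≤ m, G.Adj u (κ i) →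
      PathIn G (insert u ((Finset.Icc i m).image κ)) u (κ m) (m - i + 1) :=
    fun u hu huK i hi hui =>
      (hseg i m hi le_rfl).cons' (fun hs => huK (seg_trace le_rfl hs)) hui subset_rfl
  have hK : ∀ i ≤ m, κ i ∈ trace κ m := fun i hi => mem_trace.2 ⟨i, hi, rfl⟩
  have hmpos : 1 ≤ m := by
    by_contra! hm
    obtain rfl : m = 0 := by omega
    exact h0s (hone _ (hmem 0 le_rfl) _ _ hx.symm hy.symm)
  have hfκ : ∀ i ≤ m, ∀ j, κ i ≠ f j := fun i hi j he => hF j (he ▸ hmem i hi)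
  refine ⟨κ, hs, hsg, hmpos, hinj, hadj, hmem, hx, hy, fun i j hij hj ha => ?_,
    fun i hi j hj => ?_, fun u hu huK => ?_, fun u hu huK i hi j hui hju => ?_⟩
  · have h1 := (hseg 0 i (by omega) (by omega)).join (hseg j m hj le_rfl)
      (Finset.disjoint_left.2 fun z hz hz' => by
        obtain ⟨t, ht, rfl⟩ := Finset.mem_image.1 hz
        obtain ⟨t', ht', h⟩ := Finset.mem_image.1 hz'
        rw [Finset.mem_Icc] at ht ht'
        have := hinj _ (by omega) _ (by omega) h
        omega) ha
    have := hmin 0 s _ h0s ⟨κ 0, mem_nbs_singleton.2 hx, κ m, mem_nbs_singleton.2 hy,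
      h1.mono (Finset.union_subset (hsub _ _ (by omega)) (hsub _ _ le_rfl))⟩
    omega
  · by_cases h : f j = f 0
    · exact .inl h
    · have := hL0 i hi j hj h
      obtain rfl : i = m := by omega
      exact .inr (hone _ (hmem i hi) _ _ hj.symm hy.symm)
  · have key : ∀ i j, i < j → j ≤ m → G.Adj u (κ i) → G.Adj u (κ j) → False := by
      intro i j hij hj hi' hj'
      have h1 := hmin 0 s (i + (m - j + 1) + 1) h0s ⟨κ 0, mem_nbs_singleton.2 hx, κ m,
        mem_nbs_singleton.2 hy, ?_⟩
      · obtain rfl | rfl : j = i + 1 ∨ j = i + 1 + 1 := by omega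
        · exact htri _ _ _ hi' (hadj i (by omega)) hj'
        · refine h4 (hasCycleLen_four hi' (hadj i (by omega)) (hadj (i + 1) (by omega)) hj'.symm
            (fun he => huK (he ▸ hK _ (by omega))) fun he => ?_)
          have := hinj _ (by omega) _ (by omega) he
          omega
      · have := (hseg 0 i (by omega) (by omega)).join (hu1 u hu huK j hj hj') ?_ hi'.symm
        · rw [Nat.sub_zero] at this
          refine this.mono (Finset.union_subset (hsub _ _ (by omega))
            (Finset.insert_subset hu (hsub _ _ le_rfl)))
        · rw [Finset.disjoint_left]
          intro z hz hz'
          obtain ⟨t, ht, rfl⟩ := Finset.mem_image.1 hz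
          rw [Finset.mem_Icc] at ht
          rcases Finset.mem_insert.1 hz' with h | h
          · exact huK (h ▸ hK t (by omega))
          · obtain ⟨t', ht', h⟩ := Finset.mem_image.1 h
            rw [Finset.mem_Icc] at ht'
            have := hinj _ (by omega) _ (by omega) h
            omega
    intro i hi j hj hi' hj'
    rcases lt_trichotomy i j with h | h | h
    · exact (key i j h hj hi' hj').elim
    · exact h
    · exact (key j i h hi hj' hi').elim
  · have huf : ∀ j, u ≠ f j := fun j he => hF j (he ▸ hu)
    have h1 : i + 1 < m → f j = f 0 := fun hi1 => by
      by_contra hne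
      have := hmin 0 j (i + 1) (Ne.symm hne) ⟨κ 0, mem_nbs_singleton.2 hx, u,
        mem_nbs_singleton.2 hju, (hu0 u hu huK i hi hui).mono
          (Finset.insert_subset hu (hsub _ _ hi))⟩
      omega
    have h2 : 1 < i → f j = f s := fun hi1 => by
      by_contra hne
      have := hmin j s (m - i + 1) hne ⟨u, mem_nbs_singleton.2 hju, κ m,
        mem_nbs_singleton.2 hy, (hu1 u hu huK i hi hui).mono
          (Finset.insert_subset hu (hsub _ _ le_rfl))⟩
      omega
    have h3 : f j = f 0 → i ≠ 0 ∧ i ≠ 1 := fun hj => by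
      rw [hj] at hju
      refine ⟨fun hi0 => ?_, fun hi1 => ?_⟩ <;> subst i
      · exact htri _ _ _ hju hui hx
      · exact h4 (hasCycleLen_four hju hui (hadj 0 (by omega)).symm hx.symm
          (hfκ 1 hi 0).symm fun he => huK (he ▸ hK 0 (by omega)))
    have h5 : f j = f s → i ≠ m ∧ i + 1 ≠ m := fun hj => by
      rw [hj] at hju
      refine ⟨fun hi0 => ?_, fun hi1 => ?_⟩ <;> subst m
      · exact htri _ _ _ hju hui hy
      · exact h4 (hasCycleLen_four hju hui (hadj i (by omega)) hy.symm
          (hfκ i hi s).symm fun he => huK (he ▸ hK (i + 1) le_rfl))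
    by_cases ha : f j = f 0
    · have h6 : ¬f j = f s := by rw [ha]; exact h0s
      have := h3 ha
      have : ¬1 < i := fun h => h6 (h2 h)
      omega
    · have : ¬i + 1 < m := fun h => ha (h1 h)
      by_cases hb : f j = f s
      · have := h5 hb
        omega
      · have : ¬1 < i := fun h => hb (h2 h)
        omega

end Geodesic

section Theta

variable {f κ : ℕ → V} {g m s r : ℕ} {F H E : Finset V}

theorem CSys.shift (h : CSys G k r f g F) (t : ℕ) : CSys G k r (fun i => f (t + i)) g F where
  __ := h
  cyc := h.cyc.shift t
  disj i := h.disj _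
  spans := by rw [h.cyc.rim_shift]; exact h.spans
  dg_F i := h.dg_F _
  dg_rim := by rw [h.cyc.rim_shift]; exact h.dg_rim

/-- An odd cycle `f` whose complement `F` is 2-connected, with a shortest path `κ` through `F`
between neighbours of different vertices of the cycle. -/
structure Theta (G : SimpleGraph V) [DecidableRel G.Adj] (k : ℕ) (f : ℕ → V) (g : ℕ)
    (F : Finset V) (κ : ℕ → V) (m s : ℕ) : Prop extends CSys G k 1 f g F where
  block : ∀ v ∈ F, ConnOn G (F.erase v)
  geo : Geo G f g F κ m s
  odd : Odd g
  even : Even s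

theorem CSys.exists_theta (h : CSys G k 1 f g F) (h2 : ∀ v ∈ F, ConnOn G (F.erase v))
    (ho : Odd g) (htri : TriFree G) (h4 : ¬HasCycleLen G 4) :
    ∃ f κ m s, Theta G k f g F κ m s := by
  classical
  have hone : ∀ v ∈ F, ∀ i j, G.Adj v (f i) → G.Adj v (f j) → f i = f j :=
    fun v hv i j hi hj => Finset.card_le_one.1 (h.dg_rim v hv (h2 v hv)) _
      (Finset.mem_filter.2 ⟨h.cyc.mem i, hi⟩) _ (Finset.mem_filter.2 ⟨h.cyc.mem j, hj⟩)
  have hex : ∃ n i j, i < j ∧ j < i + g ∧ Len G F (nbs G {f i}) (nbs G {f j}) n := by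
    have h3 := h.cyc.three
    have := (h.sys h2 0 1).ap
    obtain ⟨p, d, -, hp⟩ := this
    have := h.hk
    exact ⟨_, 0, 1, by omega, by omega, hp 0 (by omega)⟩
  obtain ⟨i, j, hij, hj, hl⟩ := Nat.find_spec hex
  have hmin : ∀ a b n, f a ≠ f b → Len G F (nbs G {f a}) (nbs G {f b}) n → Nat.find hex ≤ n := by
    intro a b n hab hn
    obtain ⟨b', h1, h2, h3⟩ := h.cyc.exists_pos a (h.cyc.mem b) hab.symm
    exact Nat.find_min' hex ⟨a, b', h1, h2, by rwa [h3]⟩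
  generalize Nat.find hex = m at hl hmin
  have key : ∀ t s, 0 < s → s < g → Even s → Len G F (nbs G {f t}) (nbs G {f (t + s)}) m →
      ∃ f κ m s, Theta G k f g F κ m s := fun t s h0 hs he hl => by
    obtain ⟨κ, hκ⟩ := geo_of_min (h.cyc.shift t) htri h4 (fun i => h.disj _)
      (fun v hv i j => hone v hv _ _) (fun i j => hmin _ _) h0 hs hl
    exact ⟨_, κ, m, s, h.shift t, h2, hκ, ho, he⟩
  by_cases he : Even (j - i)
  · exact key i (j - i) (by omega) (by omega) he (by rwa [show i + (j - i) = j by omega])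
  · refine key j (i + g - j) (by omega) (by omega) ?_ ?_
    · rw [Nat.not_even_iff_odd] at he
      obtain ⟨a, ha⟩ := he
      obtain ⟨b, hb⟩ := ho
      exact ⟨b - a, by omega⟩
    · rw [show j + (i + g - j) = i + g by omega, h.cyc.per]
      exact hl.symm

namespace Theta

theorem mem_F (h : Theta G k f g F κ m s) (hE : ClosedIn G (Finset.univ \ (rim f g ∪ trace κ m)) E)
    {v : V} (hv : v ∈ E) : v ∈ F ∧ v ∉ rim f g ∧ v ∉ trace κ m := by
  have h1 := hE.1 hv
  have := h.spans v
  grind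

theorem trace_sub (h : Theta G k f g F κ m s) : trace κ m ⊆ F := fun x hx => by
  obtain ⟨i, hi, rfl⟩ := mem_trace.1 hx
  exact h.geo.mem i hi

theorem disj_rim (h : Theta G k f g F κ m s) : Disjoint (rim f g) F := by
  rw [Finset.disjoint_left]
  intro x hx
  obtain ⟨i, -, rfl⟩ := mem_rim.1 hx
  exact h.disj i

/-- The four lengths of cycles obtained from a path between `f x` and `κ i`. -/
theorem cycles (h : Theta G k f g F κ m s) (hd : Disjoint (rim f g ∪ trace κ m) E) {x i n : ℕ}
    (hx : x < g) (hx0 : x ≠ 0) (hxs : x ≠ s) (hi : i ≤ m)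
    (hl : Len G E (nbs G {f x}) (nbs G {κ i}) n) :
    HasCycleLen G (n + 3 + i + x) ∧ HasCycleLen G (n + 3 + i + (g - x)) ∧
    HasCycleLen G (n + 3 + (m - i) + (x - s + (s - x))) ∧
    HasCycleLen G (n + 3 + (m - i) + (g - (x - s + (s - x)))) := by
  have hrt : Disjoint (rim f g) (trace κ m) := h.disj_rim.mono_right h.trace_sub
  have h1 := (seg_of_fun h.geo.inj h.geo.adj (i := 0) (j := i) (by omega) hi).mono (seg_trace hi)
  have h2 := (seg_of_fun h.geo.inj h.geo.adj (i := i) (j := m) hi le_rfl).mono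
    (seg_trace le_rfl)
  have key : ∀ {a b l q}, PathIn G (rim f g) (f x) (f a) l → PathIn G (trace κ m) b (κ i) q →
      G.Adj (f a) b → HasCycleLen G (n + 3 + q + l) := fun ha hb hab => by
    have := hl.ear hd (fun y hy z hz => by
      rw [Finset.mem_singleton.1 hy, Finset.mem_singleton.1 hz]
      exact ha.join hb hrt hab) (by omega)
    convert this using 1
    omega
  rw [Nat.sub_zero] at h1
  have a1 := (h.cyc.arc 0 x hx).symm
  have a2 := (h.cyc.arc' 0 x (by omega) hx).symm
  rw [zero_add] at a1 a2
  refine ⟨key a1 h1 h.geo.fst, key a2 h1 h.geo.fst, ?_⟩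
  have hs := h.geo.lt
  rcases lt_or_gt_of_ne hxs with hlt | hlt
  · have a3 := h.cyc.arc x (s - x) (by omega)
    have a4 := h.cyc.arc' x (s - x) (by omega) (by omega)
    rw [show x + (s - x) = s by omega] at a3 a4
    rw [show x - s + (s - x) = s - x by omega]
    exact ⟨key a3 h2.symm h.geo.lst, key a4 h2.symm h.geo.lst⟩
  · have a3 := (h.cyc.arc s (x - s) (by omega)).symm
    have a4 := (h.cyc.arc' s (x - s) (by omega) (by omega)).symm
    rw [show s + (x - s) = x by omega] at a3 a4
    rw [show x - s + (s - x) = x - s by omega]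
    exact ⟨key a3 h2.symm h.geo.lst, key a4 h2.symm h.geo.lst⟩

theorem ne_ends (h : Theta G k f g F κ m s) {x : ℕ} (hx : x < g) (hx0 : x ≠ 0) (hxs : x ≠ s) :
    f x ≠ f 0 ∧ f x ≠ f s :=
  ⟨fun he => hx0 (h.cyc.inj x hx 0 (by omega) he),
    fun he => hxs (h.cyc.inj x hx s h.geo.lt he)⟩

theorem exists_nbr (h : Theta G k f g F κ m s) {x : ℕ} (hx : x < g) (hx0 : x ≠ 0) (hxs : x ≠ s) :
    ∃ v, v ∈ Finset.univ \ (rim f g ∪ trace κ m) ∧ G.Adj (f x) v := by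
  have h1 := h.dg_F x
  have h2 := h.hk
  obtain ⟨v, hv, hxv⟩ := (dg_pos (G := G) (U := F) (v := f x)).1 (by omega)
  refine ⟨v, ?_, hxv⟩
  have h3 := Finset.disjoint_right.1 h.disj_rim hv
  have h4 : v ∉ trace κ m := fun ht => by
    obtain ⟨i, hi, rfl⟩ := mem_trace.1 ht
    have := h.ne_ends hx hx0 hxs
    have := h.geo.nadj i hi x hxv
    tauto
  simp [h3, h4]

/-- Parts of `F` off the path attach to the path away from any given vertex. -/
theorem attached (h : Theta G k f g F κ m s) {D : Finset V} {c : V} (hDF : D ⊆ F)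
    (hne : D.Nonempty) (hc : c ∈ F) (hcD : c ∉ D) (hDK : Disjoint D (trace κ m))
    (hcl : ∀ a ∈ D, ∀ b ∈ F, G.Adj a b → b ∈ D ∨ b ∈ trace κ m ∨ b = c) :
    ∃ i ≤ m, κ i ≠ c ∧ ∃ v ∈ D, G.Adj (κ i) v := by
  by_contra! hcon
  have := (h.block c hc).2 D ⟨fun x hx => by have := hDF hx; grind, fun a ha b hb hab => ?_⟩ hne
  · obtain ⟨i, hi, hic⟩ : ∃ i ≤ m, κ i ≠ c := by
      by_contra! hall
      have := h.geo.inj 0 (by omega) 1 h.geo.mpos ((hall 0 (by omega)).trans (hall 1 h.geo.mpos).symm)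
      omega
    refine Finset.disjoint_left.1 hDK ?_ (mem_trace.2 ⟨i, hi, rfl⟩)
    rw [this]
    exact Finset.mem_erase.2 ⟨hic, h.geo.mem i hi⟩
  · rw [Finset.mem_erase] at hb
    rcases hcl a ha b hb.2 hab with hb' | hb' | hb'
    · exact hb'
    · obtain ⟨i, hi, rfl⟩ := mem_trace.1 hb'
      exact absurd hab.symm (hcon i hi hb.1 a ha)
    · exact absurd hb' hb.1

theorem comp_attached (h : Theta G k f g F κ m s)
    (hE : ClosedIn G (Finset.univ \ (rim f g ∪ trace κ m)) E) (hne : E.Nonempty) {j : ℕ}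
    (hj : j ≤ m) : ∃ i ≤ m, i ≠ j ∧ ∃ v ∈ E, G.Adj (κ i) v := by
  obtain ⟨i, hi, hij, hv⟩ := h.attached (c := κ j) (fun v hv => (h.mem_F hE hv).1) hne
    (h.geo.mem j hj) (fun hs => (h.mem_F hE hs).2.2 (mem_trace.2 ⟨j, hj, rfl⟩))
    (Finset.disjoint_left.2 fun v hv => (h.mem_F hE hv).2.2) fun a ha b hb hab => by
      have h1 := hE.2 a ha b
      have := Finset.disjoint_right.1 h.disj_rim hb
      grind
  exact ⟨i, hi, fun he => hij (he ▸ rfl), hv⟩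

theorem leaf_attached (h : Theta G k f g F κ m s)
    (hE : ClosedIn G (Finset.univ \ (rim f g ∪ trace κ m)) E) {D : Finset V} {c : V} (hc : c ∈ E)
    (hD : ClosedIn G (E.erase c) D) (hne : D.Nonempty) : ∃ i ≤ m, ∃ v ∈ D, G.Adj (κ i) v := by
  have hDE : D ⊆ E := hD.1.trans (Finset.erase_subset _ _)
  obtain ⟨i, hi, hij, hv⟩ := h.attached (c := c) (fun v hv => (h.mem_F hE (hDE hv)).1) hne
    (h.mem_F hE hc).1 (fun hs => by simpa using hD.1 hs)
    (Finset.disjoint_left.2 fun v hv => (h.mem_F hE (hDE hv)).2.2) fun a ha b hb hab => by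
      have h1 := hE.2 a (hDE ha) b
      have h2 := hD.2 a ha b
      have := Finset.disjoint_right.1 h.disj_rim hb
      grind
  exact ⟨i, hi, hv⟩

theorem dg_trace (h : Theta G k f g F κ m s) {v : V} (hv : v ∈ F) (hvK : v ∉ trace κ m) :
    dg G (trace κ m) v ≤ 1 := by
  refine Finset.card_le_one.2 fun a ha b hb => ?_
  rw [Finset.mem_filter] at ha hb
  obtain ⟨i, hi, rfl⟩ := mem_trace.1 ha.1
  obtain ⟨j, hj, rfl⟩ := mem_trace.1 hb.1
  rw [h.geo.one v hv hvK i hi j hj ha.2 hb.2]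

theorem dg_le_two (h : Theta G k f g F κ m s) {v : V} (hv : v ∈ F) :
    dg G (rim f g ∪ trace κ m) v ≤ 1 + dg G (trace κ m) v :=
  (dg_union_le _ _ v).trans (Nat.add_le_add_right (h.dg_rim v hv (h.block v hv)) _)

/-- If a vertex off the path has two neighbours on the theta graph then the path is short. -/
theorem dg_le_one (h : Theta G k f g F κ m s) {v : V} (hv : v ∈ F) (hvK : v ∉ trace κ m)
    (hm : 2 ≤ m) (h1 : m = 2 → ¬G.Adj (κ 1) v) : dg G (rim f g ∪ trace κ m) v ≤ 1 := by
  have h2 := dg_union_le (G := G) (rim f g) (trace κ m) v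
  have h3 := h.dg_rim v hv (h.block v hv)
  have h4 := h.dg_trace hv hvK
  by_contra! hlt
  obtain ⟨a, ha, hva⟩ := (dg_pos (G := G) (U := rim f g) (v := v)).1 (by omega)
  obtain ⟨b, hb, hvb⟩ := (dg_pos (G := G) (U := trace κ m) (v := v)).1 (by omega)
  obtain ⟨j, -, rfl⟩ := mem_rim.1 ha
  obtain ⟨i, hi, rfl⟩ := mem_trace.1 hb
  rcases h.geo.mixed v hv hvK i hi j hvb hva.symm with h5 | ⟨h5, rfl⟩
  · omega
  · exact h1 h5 hvb.symm

theorem fixed (h : Theta G k f g F κ m s) (hm : 3 ≤ m)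
    (hE : ClosedIn G (Finset.univ \ (rim f g ∪ trace κ m)) E) (hc : ConnOn G E) {x : ℕ}
    (hx : ∃ v ∈ E, G.Adj (f x) v) :
    ∃ i ≤ m, (∃ v ∈ E, G.Adj (κ i) v) ∧ AP (Len G E (nbs G {f x}) (nbs G {κ i})) (k - 2) := by
  obtain ⟨i, hi, -, hv⟩ := h.comp_attached hE hc.1 (j := 0) (by omega)
  have hdg : ∀ v ∈ E, dg G (rim f g ∪ trace κ m) v ≤ 1 := fun v hv =>
    h.dg_le_one (h.mem_F hE hv).1 (h.mem_F hE hv).2.2 (by omega) (by omega)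
  obtain ⟨y, hy, h1, h2⟩ := h.toBase.exists_ear_ap (Y := trace κ m) hE hc hx hv
    (mem_trace.2 ⟨i, hi, rfl⟩) (fun v hv => by have := hdg v hv; omega) fun c D hD _ => by
      obtain ⟨j, hj, hjv⟩ := h.leaf_attached hE hD.mem hD.closed hD.conn.1
      exact ⟨κ j, mem_trace.2 ⟨j, hj, rfl⟩, hjv, fun v hv => by
        have := hdg v (hD.subset hv); omega⟩
  obtain ⟨j, hj, rfl⟩ := mem_trace.1 hy
  exact ⟨j, hj, h1, h2⟩

end Theta

end Theta

section FourGirth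

variable {f κ : ℕ → V} {g m s r : ℕ} {F H E : Finset V}

theorem evenRes_four_of_ne (h : ¬EvenRes G 4) :
    ∃ M, ∀ p, HasCycleLen G p → p % 2 = 0 → p % 4 = M := by
  by_cases hex : ∃ q, HasCycleLen G q ∧ q % 2 = 0
  · obtain ⟨q, hq, hq2⟩ := hex
    refine ⟨q % 4, fun p hp hp2 => ?_⟩
    by_contra hne
    refine h fun l hl => ?_
    obtain ⟨t, ht⟩ := hl
    by_cases hl' : (q : ℤ) ≡ l [ZMOD (4 : ℕ)]
    · exact ⟨q, hq, hl'⟩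
    · refine ⟨p, hp, ?_⟩
      unfold Int.ModEq at *
      omega
  · exact ⟨0, fun p hp hp2 => absurd ⟨p, hp, hp2⟩ hex⟩

namespace Theta

theorem exists_part (h : Theta G k f g F κ m s) {x : ℕ} (hx : x < g) (hx0 : x ≠ 0) (hxs : x ≠ s) :
    ∃ E, ClosedIn G (Finset.univ \ (rim f g ∪ trace κ m)) E ∧ ConnOn G E ∧
      ∃ v ∈ E, G.Adj (f x) v := by
  obtain ⟨v, hv, hxv⟩ := h.exists_nbr hx hx0 hxs
  obtain ⟨E, h1, h2, h3⟩ := exists_comp (G := G) hv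
  exact ⟨E, h1, h2, v, h3, hxv⟩

/-- Lengths of paths ending anywhere on the path of a theta graph. -/
theorem free (h : Theta G k f g F κ m s)
    (hE : ClosedIn G (Finset.univ \ (rim f g ∪ trace κ m)) E) (hc : ConnOn G E) {x : ℕ}
    (hx : ∃ v ∈ E, G.Adj (f x) v) :
    AP (fun n => ∃ i ≤ m, Len G E (nbs G {f x}) (nbs G {κ i}) n) (k - 2) := by
  obtain ⟨i, hi, -, v, hv, hiv⟩ := h.comp_attached hE hc.1 (j := 0) (by omega)
  have hK : KSys G E (nbs G {f x}) (nbs G (trace κ m)) (k - 2) := by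
    refine h.toBase.ear_sys hE hc ?_ ?_ ⟨v, mem_nbs.2 ⟨κ i, mem_trace.2 ⟨i, hi, rfl⟩, hiv⟩, hv⟩ ?_
    · intro c hc D hD hne _
      obtain ⟨j, hj, w, hw, hjw⟩ := h.leaf_attached hE hc hD hne
      exact ⟨w, hw, Finset.mem_union_right _ (mem_nbs.2 ⟨κ j, mem_trace.2 ⟨j, hj, rfl⟩, hjw⟩)⟩
    · obtain ⟨w, hw, hxw⟩ := hx
      exact ⟨w, mem_nbs_singleton.2 hxw, hw⟩
    · intro _ w hw
      have h1 := h.dg_le_two (h.mem_F hE hw).1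
      have h2 := h.dg_trace (h.mem_F hE hw).1 (h.mem_F hE hw).2.2
      have h3 : dg G (trace κ m) w ≤ if w ∈ nbs G (trace κ m) then 1 else 0 := by
        split_ifs with hn
        · exact h2
        · by_contra! hpos
          obtain ⟨u, hu, hwu⟩ := dg_pos.1 hpos
          exact hn (mem_nbs.2 ⟨u, hu, hwu.symm⟩)
      have := h.hk
      omega
  refine AP.mono (AP.imp (s := 0) hK.ap fun n hn => ?_) le_rfl
  obtain ⟨a, ha, b, hb, hp⟩ := hn
  obtain ⟨c, hc, hcb⟩ := mem_nbs.1 hb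
  obtain ⟨j, hj, rfl⟩ := mem_trace.1 hc
  exact ⟨j, hj, a, ha, b, mem_nbs_singleton.2 hcb, hp⟩

theorem exists_len (hc : ConnOn G E) {x i : ℕ} (hx : ∃ v ∈ E, G.Adj (f x) v)
    (hi : ∃ v ∈ E, G.Adj (κ i) v) : ∃ n, Len G E (nbs G {f x}) (nbs G {κ i}) n := by
  obtain ⟨v, hv, hxv⟩ := hx
  obtain ⟨w, hw, hiw⟩ := hi
  obtain ⟨n, hn⟩ := hc.exists_path hv hw
  exact ⟨n, v, mem_nbs_singleton.2 hxv, w, mem_nbs_singleton.2 hiw, hn⟩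

theorem seg_between (h : Theta G k f g F κ m s) {i j : ℕ} (hi : i ≤ m) (hj : j ≤ m) :
    ∃ l, PathIn G (trace κ m) (κ i) (κ j) l := by
  rcases le_total i j with hij | hij
  · exact ⟨_, (seg_of_fun h.geo.inj h.geo.adj hij hj).mono (seg_trace hj)⟩
  · exact ⟨_, ((seg_of_fun h.geo.inj h.geo.adj hij hi).mono (seg_trace hi)).symm⟩

/-- Two disjoint parts attached to the path give many lengths between two vertices of the cycle. -/
theorem two_parts (h : Theta G k f g F κ m s) {E' : Finset V} {x y i j a b : ℕ}
    (hE : ClosedIn G (Finset.univ \ (rim f g ∪ trace κ m)) E)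
    (hE' : ClosedIn G (Finset.univ \ (rim f g ∪ trace κ m)) E') (hd : Disjoint E E')
    (hi : i ≤ m) (hj : j ≤ m) (ha : 1 ≤ a) (hb : 1 ≤ b)
    (h1 : AP (Len G E (nbs G {f x}) (nbs G {κ i})) a)
    (h2 : AP (Len G E' (nbs G {f y}) (nbs G {κ j})) b) :
    AP (Len G F (nbs G {f x}) (nbs G {f y})) (a + b - 1) := by
  obtain ⟨l, hl⟩ := h.seg_between hi hj
  refine h1.add (s := l + 2) h2 ha hb fun n n' hn hn' => ?_
  obtain ⟨u, hu, v, hv, hp⟩ := hn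
  obtain ⟨u', hu', v', hv', hp'⟩ := hn'
  have d1 : Disjoint E (trace κ m) := Finset.disjoint_left.2 fun v hv => (h.mem_F hE hv).2.2
  have d2 : Disjoint (E ∪ trace κ m) E' := Finset.disjoint_union_left.2
    ⟨hd, Finset.disjoint_right.2 fun v hv => (h.mem_F hE' hv).2.2⟩
  have := (hp.join hl d1 (mem_nbs_singleton.1 hv).symm).join hp'.symm d2 (mem_nbs_singleton.1 hv')
  refine ⟨u, hu, u', hu', ?_⟩
  convert this.mono (fun w hw => ?_) using 1
  · omega
  · have h3 := h.trace_sub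
    rcases Finset.mem_union.1 hw with hw | hw
    · rcases Finset.mem_union.1 hw with hw | hw
      · exact (h.mem_F hE hw).1
      · exact h3 hw
    · exact (h.mem_F hE' hw).1

theorem exists_odd_type {e : ℕ} (hg : 5 ≤ g) (he : s = e + e) (hs : 0 < s) :
    ∃ y, y ≠ 0 ∧ y < g ∧ (y < s ∧ (s + 2 * y) % 4 = 2 ∨ s < y ∧ s % 4 = 2) := by
  rcases Nat.mod_two_eq_zero_or_one e with h | h
  · exact ⟨1, by omega, by omega, by omega⟩
  · by_cases h2 : s = 2
    · exact ⟨3, by omega, by omega, by omega⟩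
    · exact ⟨2, by omega, by omega, by omega⟩

theorem four_aux (h : Theta G 4 f g F κ m s) {M : ℕ}
    (hM : ∀ p, HasCycleLen G p → p % 2 = 0 → p % 4 = M)
    (hd : Disjoint (rim f g ∪ trace κ m) E) {x i n : ℕ}
    (hx : x < g) (hx0 : x ≠ 0) (hxs : x ≠ s) (hi : i ≤ m)
    (hl : Len G E (nbs G {f x}) (nbs G {κ i}) n) :
    ((n + 3 + i + x) % 2 = 0 ∧ (n + 3 + i + x) % 4 = M ∧
      (n + 3 + (m - i) + if m % 2 = 0 then x - s + (s - x) else g - (x - s + (s - x))) % 4 = M) ∨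
    ((n + 3 + i + x) % 2 = 1 ∧ (n + 3 + i + (g - x)) % 4 = M ∧
      (n + 3 + (m - i) + if m % 2 = 0 then g - (x - s + (s - x)) else x - s + (s - x)) % 4 = M) := by
  obtain ⟨h1, h2, h3, h4⟩ := h.cycles hd hx hx0 hxs hi hl
  obtain ⟨b, hb⟩ := h.odd
  obtain ⟨e, he⟩ := h.even
  have hsg := h.geo.lt
  rcases Nat.mod_two_eq_zero_or_one (n + 3 + i + x) with hp | hp
  · refine .inl ⟨hp, hM _ h1 hp, ?_⟩
    split_ifs with hm
    · exact hM _ h3 (by omega)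
    · exact hM _ h4 (by omega)
  · refine .inr ⟨hp, hM _ h2 (by omega), ?_⟩
    split_ifs with hm
    · exact hM _ h4 (by omega)
    · exact hM _ h3 (by omega)

theorem four (h : Theta G 4 f g F κ m s) (hg : 5 ≤ g) : EvenRes G 4 := by
  by_contra hn
  obtain ⟨M, hM⟩ := evenRes_four_of_ne hn
  obtain ⟨b, hb⟩ := h.odd
  obtain ⟨e, he⟩ := h.even
  have hs0 := h.geo.pos
  have hsg := h.geo.lt
  have hm1 := h.geo.mpos
  have key : ∀ {E x i n}, ClosedIn G (Finset.univ \ (rim f g ∪ trace κ m)) E → x < g → x ≠ 0 →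
      x ≠ s → i ≤ m → Len G E (nbs G {f x}) (nbs G {κ i}) n → _ := fun hE h1 h2 h3 h4 h5 =>
    h.four_aux hM (closedIn_disjoint hE) h1 h2 h3 h4 h5
  obtain ⟨x, hx0, hxs, hx⟩ : ∃ x, 0 < x ∧ x < s ∧ (s + 2 * x) % 4 = 0 := by
    by_cases h4 : s % 4 = 0
    · exact ⟨2, by omega, by omega, by omega⟩
    · exact ⟨1, by omega, by omega, by omega⟩
  obtain ⟨E, hE, hc, hxE⟩ := h.exists_part (x := x) (by omega) (by omega) (by omega)
  rcases Nat.lt_or_ge m 3 with hm | hm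
  · obtain rfl | rfl : m = 1 ∨ m = 2 := by omega
    · obtain ⟨p, d, hd, hp⟩ := h.free hE hc hxE
      obtain ⟨i, hi, h1⟩ := hp 0 (by omega)
      obtain ⟨j, hj, h2⟩ := hp 1 (by omega)
      have k1 := key hE (by omega) (by omega) (by omega) hi h1
      have k2 := key hE (by omega) (by omega) (by omega) hj h2
      have hi' : i = 0 ∨ i = 1 := by omega
      have hj' : j = 0 ∨ j = 1 := by omega
      rw [show x - s = 0 by omega, if_neg (by omega), if_neg (by omega)] at k1 k2
      rcases hd with rfl | rfl <;> rcases hi' with rfl | rfl <;> rcases hj' with rfl | rfl <;>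
        rcases k1 with k1 | k1 <;> rcases k2 with k2 | k2 <;> omega
    · obtain ⟨i, hi, hi1, hv⟩ := h.comp_attached hE hc.1 (j := 1) (by omega)
      obtain ⟨n, hl⟩ := exists_len hc hxE hv
      have k1 := key hE (by omega) (by omega) (by omega) hi hl
      rw [if_pos (by omega), if_pos (by omega)] at k1
      omega
  · obtain ⟨i, hi, hiE, hA⟩ := h.fixed hm hE hc hxE
    obtain ⟨n, hl⟩ := exists_len hc hxE hiE
    have k1 := key hE (by omega) (by omega) (by omega) hi hl
    by_cases hme : m % 2 = 0
    · rw [if_pos (by omega), if_pos (by omega)] at k1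
      have hi4 : (m + 2 * i) % 4 = 0 := by omega
      clear k1
      obtain ⟨y, hy0, hyg, hy⟩ := exists_odd_type hg he hs0
      have hys : y ≠ s := by omega
      obtain ⟨E', hE', hc', hyE'⟩ := h.exists_part (x := y) hyg hy0 hys
      have hdis : Disjoint E E' := by
        rw [Finset.disjoint_left]
        intro v hv hv'
        have hEE : E' ∩ E = E' := hc'.2 _ ⟨Finset.inter_subset_left, fun a ha b hb hab => by
          rw [Finset.mem_inter] at ha ⊢
          exact ⟨hb, hE.2 a ha.2 b (hE'.1 hb) hab⟩⟩ ⟨v, by simp [hv, hv']⟩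
        obtain ⟨w, hw, hyw⟩ := hyE'
        rw [← hEE] at hw
        obtain ⟨n', hl'⟩ := exists_len hc ⟨w, (Finset.mem_inter.1 hw).2, hyw⟩ hiE
        have k2 := key hE hyg hy0 hys hi hl'
        rw [if_pos (by omega), if_pos (by omega)] at k2
        have h1 : (n' + 3 + i + y) % 4 = (n' + 3 + (m - i) + (y - s + (s - y))) % 4 ∨
            (n' + 3 + i + (g - y)) % 4 =
              (n' + 3 + (m - i) + (g - (y - s + (s - y)))) % 4 := by
          rcases k2 with ⟨-, h1, h2⟩ | ⟨-, h1, h2⟩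
          · exact .inl (h1.trans h2.symm)
          · exact .inr (h1.trans h2.symm)
        clear k2 hx0 hxs hb hs0 hg
        rcases h1 with h1 | h1 <;> rcases hy with h3 | h3 <;> omega
      obtain ⟨j, hj, -, hB⟩ := h.fixed hm hE' hc' hyE'
      have hfin := h.two_parts hE hE' hdis hi hj (by omega) (by omega) hA hB
      rcases lt_or_gt_of_ne (show x ≠ y by omega) with hxy | hxy
      · exact hn (h.evenRes_even (by decide) h.odd hxy (by omega) hfin)
      · exact hn (h.evenRes_even (by decide) h.odd hxy (by omega)
          (AP.mono (AP.imp (s := 0) hfin fun n hn => hn.symm) le_rfl))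
    · obtain ⟨p, d, hd, hp⟩ := hA
      have k2 := key hE (by omega) (by omega) (by omega) hi (hp 0 (by omega))
      have k3 := key hE (by omega) (by omega) (by omega) hi (hp 1 (by omega))
      rw [if_neg (by omega), if_neg (by omega)] at k2 k3
      rcases hd with rfl | rfl <;> rcases k2 with k2 | k2 <;> rcases k3 with k3 | k3 <;> omega

end Theta

theorem Base3.four_girth_five (h : Base3 G 4)
    (htri : TriFree G) {n : ℕ} (hn : HasCycleLen G n)
    (hno : Odd n) (h4 : ¬HasCycleLen G 4) : EvenRes G 4 := by
  obtain ⟨f, g, F, hC, hN, hg⟩ := h.exists_cSys_two htri hn hno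
  have hC1 : CSys G 4 1 f g F := { hC with
    dg_rim := fun v hv hc => by
      refine Finset.card_le_one.2 fun a ha b hb => ?_
      rw [Finset.mem_filter] at ha hb
      by_contra hab
      obtain ⟨i, -, rfl⟩ := mem_rim.1 ha.1
      obtain ⟨j, hij, hj, rfl⟩ := hN.cyc.exists_pos i hb.1 (Ne.symm hab)
      have hd : f i = f (j + 2) ∨ f j = f (i + 2) := by
        rcases hN.odd_dist h hg htri hv hc hij hj ha.2 hb.2 with rfl | h2
        · exact .inr rfl
        · rw [h2]
          exact .inl (hN.cyc.per i).symm
      have main : ∀ i j, f j = f (i + 2) → G.Adj v (f i) → G.Adj v (f j) → False :=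
        fun i j he hi hj => by
          rw [he] at hj
          exact h4 (hasCycleLen_four hi (hN.cyc.adj i) (hN.cyc.adj (i + 1)) hj.symm
            (fun hv' => hN.disj (i + 1) (hv' ▸ hv)) (hN.cyc.ne (by omega) (by omega)))
      rcases hd with hd | hd
      · exact main _ _ hd hb.2 ha.2
      · exact main _ _ hd ha.2 hb.2 }
  by_cases h2 : ∀ v ∈ F, ConnOn G (F.erase v)
  · obtain ⟨f, κ, m, s, hT⟩ := hC1.exists_theta h2 hN.len htri h4
    exact hT.four hg
  · push Not at h2
    obtain ⟨c, hc, hcut⟩ := h2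
    exact hC1.evenRes_leaves hN.len (by omega) hc (by decide) hcut

end FourGirth

section Linking

variable {H E F D : Finset V}

theorem Base3.five_bipartite (h : Base3 G 5) (htri : TriFree G)
    (h4 : ¬HasCycleLen G 4) (hb : ∀ n, HasCycleLen G n → Even n) : EvenRes G 5 := by
  obtain ⟨f, g, F, hC, -, hg⟩ := h.exists_cSys_one htri h4
  by_cases h2 : ∀ v ∈ F, ConnOn G (F.erase v)
  · obtain ⟨b, hgb⟩ := hb g hC.cyc.hasCycleLen
    obtain ⟨p, d, hd, hp⟩ := (hC.sys h2 0 (b - 2)).ap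
    have c0 := hC.cycle (by omega) (by omega) (hp 0 (by omega))
    have c1 := hC.cycle (by omega) (by omega) (hp 1 (by omega))
    have c2 := hC.cycle (by omega) (by omega) (hp 2 (by omega))
    rcases hd with rfl | rfl
    · obtain ⟨x, hx⟩ := hb _ c0.1
      obtain ⟨y, hy⟩ := hb _ c1.1
      omega
    · refine AP.evenRes (by decide) ⟨b + p, 2, .inr rfl, fun i hi => ?_⟩
      interval_cases i
      · convert c0.1 using 1; omega
      · convert c1.1 using 1; omega
      · convert c0.2 using 1; omega
      · convert c1.2 using 1; omega
      · convert c2.2 using 1; omega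
  · push Not at h2
    obtain ⟨c, hc, hcut⟩ := h2
    exact hC.evenRes_odd (by decide) (by omega) hc hcut

theorem PathIn.glue {U W : Finset V} {a b c : V} {n m : ℕ} (h : PathIn G U a b n)
    (h' : PathIn G W b c m) (hUW : ∀ x ∈ U, x ∈ W → x = b) : ∃ l, PathIn G (U ∪ W) a c l := by
  cases h' with
  | nil => exact ⟨n, h.mono Finset.subset_union_left⟩
  | @cons _ _ d _ _ _ hbd h' =>
    refine ⟨_, (h.join h' ?_ hbd).mono (Finset.union_subset_union_right (Finset.erase_subset _ _))⟩
    rw [Finset.disjoint_left]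
    grind

theorem ConnOn.of_reach {B U : Finset V} (h : ConnOn G B) (hB : B ⊆ U)
    (hr : ∀ u ∈ U, ∃ b ∈ B, ∃ n, PathIn G U u b n) : ConnOn G U := by
  refine ⟨h.1.mono hB, fun D hD ⟨d, hd⟩ => hD.1.antisymm fun u hu => ?_⟩
  obtain ⟨b, hb, n, hn⟩ := hr d (hD.1 hd)
  have hbD := hD.mem_of_path hn subset_rfl hd
  have hBD := h.2 (D ∩ B) ⟨Finset.inter_subset_right, fun x hx y hy hxy => by
    rw [Finset.mem_inter] at hx ⊢
    exact ⟨hD.2 x hx.1 y (hB hy) hxy, hy⟩⟩ ⟨b, Finset.mem_inter.2 ⟨hbD, hb⟩⟩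
  obtain ⟨c, hc, m, hm⟩ := hr u hu
  rw [← hBD] at hc
  exact hD.mem_of_path hm.symm subset_rfl (Finset.mem_inter.1 hc).1

/-- Two disjoint paths joining `x` to `z` and `y` to `w`. -/
def Linked (G : SimpleGraph V) (H : Finset V) (x y z w : V) : Prop :=
  ∃ P Q n m, P ⊆ H ∧ Q ⊆ H ∧ Disjoint P Q ∧ PathIn G P x z n ∧ PathIn G Q y w m

theorem PathIn.rest {U : Finset V} {x w : V} {n : ℕ} (h : PathIn G U x w n) :
    ∃ S ⊆ U.erase x, (∃ m, PathIn G (insert x S) x w m) ∧ ∀ r ∈ S, ∃ m, PathIn G S r w m := by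
  cases h with
  | nil => exact ⟨∅, by simp, ⟨0, .nil (by simp)⟩, by simp⟩
  | @cons _ _ c _ _ _ hxc h' =>
    obtain ⟨S, hS, -, -, hp, hr⟩ := h'.exact
    refine ⟨S, hS, ⟨_, hp.cons' (fun hx => by simpa using hS hx) hxc subset_rfl⟩, fun r hr' => ?_⟩
    obtain ⟨_, j, -, -, hj⟩ := hr r hr'
    exact ⟨j, hj⟩

theorem Linked.step {x x' y z w : V} (h : Linked G H x' y z w) (hx : x ∈ H) (hxy : x ≠ y)
    (hxx : G.Adj x x') (hc : ConnOn G (H.erase x)) : Linked G H x y z w ∨ Linked G H x y w z := by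
  obtain ⟨P, Q, n, m, hP, hQ, hd, hp, hq⟩ := h
  obtain ⟨P', hP', -, hzP, hp', hPr⟩ := hp.exact
  obtain ⟨Q', hQ', hyQ, -, hq', hQr⟩ := hq.exact
  have hd' : ∀ v ∈ P', v ∉ Q' := fun v hv hv' => Finset.disjoint_left.1 hd (hP' hv) (hQ' hv')
  have hPH := hP'.trans hP
  have hQH := hQ'.trans hQ
  by_cases hxP : x ∈ P'
  · obtain ⟨_, j, -, -, hj⟩ := hPr x hxP
    exact .inl ⟨P', Q', _, _, hPH, hQH, Finset.disjoint_left.2 hd', hj, hq'⟩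
  have hcons := hp'.cons' hxP hxx subset_rfl
  have hxPH := Finset.insert_subset hx hPH
  by_cases hxQ : x ∈ Q'
  · obtain ⟨_, j, -, -, hj⟩ := hQr x hxQ
    obtain ⟨S, hS, ⟨l, hl⟩, hSr⟩ := hj.rest
    have hSH : S ⊆ H := hS.trans ((Finset.erase_subset _ _).trans hQH)
    obtain ⟨l', hl'⟩ := hc.exists_path (a := z) (b := y)
      (Finset.mem_erase.2 ⟨fun he => hxP (he ▸ hzP), hPH hzP⟩)
      (Finset.mem_erase.2 ⟨hxy.symm, hQH hyQ⟩)
    rcases hl'.escape (P' ∪ S) with ⟨r, hr, hrH, t, ht⟩ | ⟨hz, -⟩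
    · by_cases hrP : r ∈ P'
      · obtain ⟨_, i, -, -, hi⟩ := hPr r hrP
        obtain ⟨q, hq⟩ := ht.symm.glue hi (by grind)
        refine .inr ⟨_, _, _, _, Finset.insert_subset hx hSH, ?_, ?_, hl, hq⟩
        · intro v hv; grind
        · rw [Finset.disjoint_left]; intro v hv; grind
      · have hrS : r ∈ S := by grind
        obtain ⟨i, hi⟩ := hSr r hrS
        obtain ⟨q, hq⟩ := ht.symm.glue hi (by grind)
        refine .inl ⟨_, _, _, _, hxPH, ?_, ?_, hcons, hq⟩
        · intro v hv; grind
        · rw [Finset.disjoint_left]; intro v hv; grind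
    · exact absurd (Finset.mem_union_left _ hzP) hz
  · refine .inl ⟨_, _, _, _, hxPH, hQH, ?_, hcons, hq'⟩
    rw [Finset.disjoint_left]; grind

theorem Linked.of_path {U : Finset V} {x t y z w : V} {n : ℕ} (hp : PathIn G U x t n)
    (hU : U ⊆ H.erase y) (hH : ∀ v ∈ H, ConnOn G (H.erase v))
    (h : Linked G H t y z w ∨ Linked G H t y w z) :
    Linked G H x y z w ∨ Linked G H x y w z := by
  induction hp with
  | nil => exact h
  | @cons U a c b n ha hac _ ih =>
    have haH := Finset.mem_erase.1 (hU ha)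
    rcases ih ((Finset.erase_subset _ _).trans hU) h with h' | h'
    · exact h'.step haH.2 haH.1 hac (hH a haH.2)
    · exact (h'.step haH.2 haH.1 hac (hH a haH.2)).symm

theorem exists_linked (hH : ∀ v ∈ H, ConnOn G (H.erase v)) {x y z w : V} (hx : x ∈ H) (hy : y ∈ H)
    (hz : z ∈ H) (hw : w ∈ H) (hxy : x ≠ y) (hzw : z ≠ w) :
    Linked G H x y z w ∨ Linked G H x y w z := by
  have base : ∀ t u, t ∈ H → u ∈ H → t ≠ u → t ≠ y → Linked G H t y t u := fun t u ht hu htu hty => by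
    obtain ⟨n, hn⟩ := (hH t ht).exists_path (Finset.mem_erase.2 ⟨hty.symm, hy⟩)
      (Finset.mem_erase.2 ⟨htu.symm, hu⟩)
    exact ⟨{t}, _, 0, n, by simpa using ht, Finset.erase_subset _ _, by simp, .nil (by simp), hn⟩
  by_cases hzy : z = y
  · have hwy : w ≠ y := fun h => hzw (hzy.trans h.symm)
    obtain ⟨n, hn⟩ := (hH y hy).exists_path (Finset.mem_erase.2 ⟨hxy, hx⟩)
      (Finset.mem_erase.2 ⟨hwy, hw⟩)
    exact Linked.of_path hn subset_rfl hH (.inr (base w z hw hz hzw.symm hwy))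
  · obtain ⟨n, hn⟩ := (hH y hy).exists_path (Finset.mem_erase.2 ⟨hxy, hx⟩)
      (Finset.mem_erase.2 ⟨hzy, hz⟩)
    exact Linked.of_path hn subset_rfl hH (.inl (base z w hz hw hzw hzy))

theorem AP.linked {E' : Finset V} {x y z w : V} {a b : ℕ} (h1 : AP (Len G E (nbs G {x}) (nbs G {y})) a)
    (h2 : AP (Len G E' (nbs G {z}) (nbs G {w})) b) (ha : 1 ≤ a) (hb : 1 ≤ b) (hE : Disjoint H E)
    (hE' : Disjoint H E') (hEE : Disjoint E E') (hl : Linked G H x y z w) :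
    AP (HasCycleLen G) (a + b - 1) := by
  obtain ⟨P, Q, p, q, hP, hQ, hPQ, hp, hq⟩ := hl
  refine h1.add (s := p + q + 4) h2 ha hb fun n n' hn hn' => ?_
  obtain ⟨u, hu, v, hv, hn⟩ := hn
  rw [Finset.disjoint_left] at *
  have := (hp.symm.join hn (Finset.disjoint_left.2 (by grind)) (mem_nbs_singleton.1 hu)).join hq
    (Finset.disjoint_left.2 (by grind)) (mem_nbs_singleton.1 hv).symm
  have := hn'.ear (H := P ∪ E ∪ Q) (m := p + n + 1 + q + 1) (Finset.disjoint_left.2 (by grind))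
    (fun a ha b hb => by
      rw [Finset.mem_singleton.1 ha, Finset.mem_singleton.1 hb]
      exact this) (by omega)
  convert this using 1
  omega

end Linking

section Complement

variable {H E F D : Finset V}

/-- A 2-connected part `H` to which the other vertices have at most one neighbour, except
perhaps for a further neighbour `w`. -/
structure Tight (G : SimpleGraph V) [DecidableRel G.Adj] (H : Finset V) (w : V) : Prop where
  conn : ConnOn G H
  block : ∀ v ∈ H, ConnOn G (H.erase v)
  mem : w ∈ H
  deg : ∀ v ∉ H, dg G H v ≤ 1 + if G.Adj w v then 1 else 0

namespace Tight

variable {w : V}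

theorem exists_ne (h : Tight G H w) (u : V) : ∃ v ∈ H, v ≠ u := by
  obtain ⟨v, hv⟩ := (h.block w h.mem).1
  rw [Finset.mem_erase] at hv
  by_cases hu : w = u
  · exact ⟨v, hv.2, hu ▸ hv.1⟩
  · exact ⟨w, h.mem, hu⟩

/-- The vertex from which a part outside `H` is approached. -/
theorem exists_entry (h : Tight G H w) (hE : ∀ v ∈ E, v ∉ H) (hx : ∃ x ∈ H, ∃ v ∈ E, G.Adj x v) :
    ∃ x ∈ H, (∃ v ∈ E, G.Adj x v) ∧ ∀ v ∈ E, dg G H v ≤ 1 + if v ∈ nbs G {x} then 1 else 0 := by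
  by_cases hw : ∃ v ∈ E, G.Adj w v
  · refine ⟨w, h.mem, hw, fun v hv => ?_⟩
    simpa only [mem_nbs_singleton] using h.deg v (hE v hv)
  · obtain ⟨x, hx, hv⟩ := hx
    refine ⟨x, hx, hv, fun v hv => ?_⟩
    have := h.deg v (hE v hv)
    rw [if_neg fun hwv => hw ⟨v, hv, hwv⟩] at this
    omega

theorem leaf_attached (h : Tight G H w) (hB : Base G k) {c : V} (hE : ClosedIn G (Finset.univ \ H) E)
    (hc : c ∈ E) (hD : ClosedIn G (E.erase c) D) (hne : D.Nonempty) :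
    ∃ x ∈ H, ∃ v ∈ D, G.Adj x v := by
  by_contra! hcon
  have h1 := hE.1 hc
  have := (hB.conn_erase c).2 D ⟨fun x hx => by have := hD.1 hx; grind, fun a ha b hb hab => ?_⟩ hne
  · have hw : w ∈ D := by
      rw [this]
      have := h.mem
      grind
    have := hE.1 (Finset.mem_of_mem_erase (hD.1 hw))
    have := h.mem
    grind
  · have h2 := hcon b
    have h3 := hE.2 a (Finset.mem_of_mem_erase (hD.1 ha)) b
    have h4 := hD.2 a ha b
    have := hab.symm
    grind

theorem part_ap (h : Tight G H w) (hB : Base G k) (hE : ClosedIn G (Finset.univ \ H) E)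
    (hc : ConnOn G E) :
    ∃ x ∈ H, ∃ y ∈ H, x ≠ y ∧ AP (Len G E (nbs G {x}) (nbs G {y})) (k - 2) := by
  have hEH : ∀ v ∈ E, v ∉ H := fun v hv => (Finset.mem_sdiff.1 (hE.1 hv)).2
  have hatt : ∀ u ∈ H, ∃ y ∈ H.erase u, ∃ v ∈ E, G.Adj y v := fun u hu => by
    obtain ⟨v, hv, hvE⟩ := hB.exists_attached hE hc.1 hu (h.exists_ne u)
    obtain ⟨y, hy, hyv⟩ := mem_nbs.1 hv
    exact ⟨y, hy, v, hvE, hyv⟩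
  obtain ⟨x₀, hx₀, hx₀E⟩ := hatt w h.mem
  obtain ⟨x, hx, hxE, hdx⟩ := h.exists_entry hEH ⟨x₀, Finset.mem_of_mem_erase hx₀, hx₀E⟩
  obtain ⟨y, hy, hyE⟩ := hatt x hx
  obtain ⟨y', hy', -, hA⟩ := hB.exists_ear_ap hE hc hxE hyE hy
    (fun v hv => (hdx v hv).trans (by omega)) fun c D hD hDx => by
      obtain ⟨z, hz, v, hv, hzv⟩ := h.leaf_attached hB hE hD.mem hD.closed hD.conn.1
      refine ⟨z, Finset.mem_erase.2 ⟨?_, hz⟩, ⟨v, hv, hzv⟩, fun u hu => ?_⟩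
      · rintro rfl
        exact hDx v hv hzv
      · have := hdx u (hD.subset hu)
        rw [if_neg fun hn => hDx u hu (mem_nbs_singleton.1 hn)] at this
        omega
  rw [Finset.mem_erase] at hy'
  exact ⟨x, hx, y', hy'.2, hy'.1.symm, hA⟩

/-- The part outside `H` is 2-connected, since otherwise there are five cycle lengths in
progression. -/
theorem compl (h : Tight G H w) (hB : Base G 5) (hne : (Finset.univ \ H).Nonempty) :
    EvenRes G 5 ∨ ConnOn G (Finset.univ \ H) ∧ ∀ c ∈ Finset.univ \ H,
      ConnOn G ((Finset.univ \ H).erase c) := by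
  have h5 : ∀ L : ℕ → Prop, AP L (3 + 3 - 1) → AP L 5 := fun L h => h
  by_cases hF : ConnOn G (Finset.univ \ H)
  swap
  · obtain ⟨M, N, hM, hMc, hN, hNc, hMN⟩ := exists_two_comps hne hF
    obtain ⟨x, hx, y, hy, hxy, hA⟩ := h.part_ap hB hM hMc
    obtain ⟨z, hz, t, ht, hzt, hA'⟩ := h.part_ap hB hN hNc
    have d1 := closedIn_disjoint hM
    have d2 := closedIn_disjoint hN
    refine .inl (AP.evenRes (by decide) (h5 _ ?_))
    rcases exists_linked h.block hx hy hz ht hxy hzt with hl | hl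
    · exact hA.linked hA' (by omega) (by omega) d1 d2 hMN hl
    · exact hA.linked (AP.mono (AP.imp (s := 0) hA' fun n hn => hn.symm) le_rfl) (by omega)
        (by omega) d1 d2 hMN hl
  by_cases h2 : ∀ c ∈ Finset.univ \ H, ConnOn G ((Finset.univ \ H).erase c)
  · exact .inr ⟨hF, h2⟩
  push Not at h2
  obtain ⟨c, hc, hcut⟩ := h2
  obtain ⟨c₁, D₁, c₂, D₂, h₁, h₂, hdis, hc₁, hc₂, hU⟩ := exists_two_leaves hF hc hcut (by
    have h6 := hB.deg c
    have h7 := h.deg c (Finset.mem_sdiff.1 hc).2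
    have h8 := dg_le_add_sdiff (G := G) Finset.univ H c
    have h9 : 0 < dg G (Finset.univ \ H) c := by split_ifs at h7 <;> omega
    obtain ⟨u, hu, hcu⟩ := dg_pos.1 h9
    exact ⟨u, Finset.mem_erase.2 ⟨hcu.ne', hu⟩⟩)
  have hclU : ClosedIn G (Finset.univ \ H) (Finset.univ \ H) := ⟨subset_rfl, fun _ _ b hb _ => hb⟩
  have leaf : ∀ {c D}, Leaf G (Finset.univ \ H) D c → ∃ x ∈ H,
      AP (Len G D (nbs G {x}) (nbs G {c})) 3 := fun {c D} hD => by
    have hDH : ∀ v ∈ D, v ∉ H := fun v hv => (Finset.mem_sdiff.1 (hD.subset hv)).2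
    obtain ⟨x, hx, ⟨v, hv, hxv⟩, hdx⟩ := h.exists_entry hDH
      (h.leaf_attached hB hclU hD.mem hD.closed hD.conn.1)
    obtain ⟨u, hu, hcu⟩ := hF.exists_nbr hD.mem hD.closed hD.conn.1
    refine ⟨x, hx, (hB.ear_sys (H := insert c H) ?_ hD.conn
      (hD.good.mono Finset.subset_union_right subset_rfl) ⟨v, mem_nbs_singleton.2 hxv, hv⟩
      ⟨u, mem_nbs_singleton.2 hcu, hu⟩ fun _ v hv => ?_).ap⟩
    · rw [show Finset.univ \ insert c H = (Finset.univ \ H).erase c by ext; simp]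
      exact hD.closed
    · have h1 := hdx v hv
      rw [dg_insert (Finset.mem_sdiff.1 hD.mem).2]
      simp only [mem_nbs_singleton, G.adj_comm c v] at *
      omega
  obtain ⟨x, hx, hA⟩ := leaf h₁
  obtain ⟨y, hy, hA'⟩ := leaf h₂
  obtain ⟨m, hm⟩ := hU.exists_path (a := c₁) (b := c₂) (by
    have := h₁.mem; have := h₁.notMem; grind) (by have := h₂.mem; have := h₂.notMem; grind)
  obtain ⟨l, hl⟩ := h.conn.exists_path hx hy
  refine .inl (AP.evenRes (by decide) (h5 _ (hA.add (s := m + 2 + (l + 2)) hA' (by omega) (by omega)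
    fun n n' hn hn' => ?_)))
  obtain ⟨a, ha, b, hb, hp⟩ := hn
  obtain ⟨a', ha', b', hb', hp'⟩ := hn'
  have e1 := h₁.subset
  have e2 := h₂.subset
  rw [Finset.disjoint_left] at hdis
  have h4 := ((hp.join hm (Finset.disjoint_left.2 (by grind)) (mem_nbs_singleton.1 hb).symm).join
    hp'.symm (Finset.disjoint_left.2 (by grind)) (mem_nbs_singleton.1 hb')).mono
      (W := Finset.univ \ H) (fun z hz => by grind)
  have := h4.hasCycleLen' hl.symm (Finset.disjoint_left.2 (by grind)) (mem_nbs_singleton.1 ha').symm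
    (mem_nbs_singleton.1 ha) (by omega)
  convert this using 1
  omega

end Tight

end Complement

section FiveOdd

variable {f κ : ℕ → V} {g m s : ℕ} {F H E U : Finset V}

set_option maxRecDepth 100000 in
theorem zmod_five_cover : ∀ a b c r d : ZMod 5, (d = 1 ∨ d = 2) → a ≠ b → a ≠ c → b ≠ c →
    ∃ j : Fin 3, r = d * (j.val : ZMod 5) + a ∨ r = d * (j.val : ZMod 5) + b ∨
      r = d * (j.val : ZMod 5) + c := by
  decide

/-- Three lengths modulo five, together with a progression of three lengths, give every residue. -/
theorem evenRes_five {L : ℕ → Prop} (hA : AP L 3) {a b c : ℕ} (hab : a % 5 ≠ b % 5)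
    (hac : a % 5 ≠ c % 5) (hbc : b % 5 ≠ c % 5)
    (h : ∀ n, L n → HasCycleLen G (n + a) ∧ HasCycleLen G (n + b) ∧ HasCycleLen G (n + c)) :
    EvenRes G 5 := by
  intro l _
  obtain ⟨p, d, hd, hp⟩ := hA
  have hz : ∀ x y : ℕ, x % 5 ≠ y % 5 → (x : ZMod 5) ≠ y := fun x y hxy he =>
    hxy ((ZMod.natCast_eq_natCast_iff' x y 5).1 he)
  obtain ⟨j, hj⟩ := zmod_five_cover a b c ((l : ZMod 5) - p) d
    (by rcases hd with rfl | rfl <;> simp) (hz _ _ hab) (hz _ _ hac) (hz _ _ hbc)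
  obtain ⟨h1, h2, h3⟩ := h _ (hp j.val j.isLt)
  have fin : ∀ t : ℕ, (l : ZMod 5) - p = d * (j.val : ZMod 5) + t → HasCycleLen G (p + d * j + t) →
      HasCycleLenMod G 5 l := fun t ht hc => ⟨_, hc, by
    rw [← ZMod.intCast_eq_intCast_iff]
    push_cast
    linear_combination -ht⟩
  rcases hj with hj | hj | hj
  · exact fin a hj h1
  · exact fin b hj h2
  · exact fin c hj h3

theorem ConnOn.of_paths {u : V} (hu : u ∈ U) (h : ∀ v ∈ U, ∃ n, PathIn G U u v n) : ConnOn G U :=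
  ConnOn.of_reach (B := {u}) ⟨by simp, fun D hD hne => by
      obtain ⟨d, hd⟩ := hne
      have := hD.1
      grind⟩ (by simpa using hu)
    fun v hv => ⟨u, by simp, (h v hv).imp fun _ hn => hn.symm⟩

theorem Cyc.conn (h : Cyc G f g) : ConnOn G (rim f g) :=
  .of_paths (h.mem 0) fun v hv => by
    obtain ⟨i, hi, rfl⟩ := mem_rim.1 hv
    have := h.arc 0 i hi
    rw [zero_add] at this
    exact ⟨_, this⟩

theorem Cyc.block (h : Cyc G f g) {v : V} (hv : v ∈ rim f g) : ConnOn G ((rim f g).erase v) := by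
  obtain ⟨i, -, rfl⟩ := mem_rim.1 hv
  have h3 := h.three
  refine .of_paths (u := f (i + 1)) (Finset.mem_erase.2
    ⟨(h.ne (by omega) (by omega)).symm, h.mem _⟩) fun v hv => ?_
  rw [Finset.mem_erase] at hv
  obtain ⟨j, h1, h2, rfl⟩ := h.exists_pos i hv.2 hv.1
  have := h.seg (i + 1) (j - (i + 1)) (by omega)
  rw [show i + 1 + (j - (i + 1)) = j by omega] at this
  refine ⟨_, this.mono fun x hx => ?_⟩
  obtain ⟨t, ht, rfl⟩ := Finset.mem_image.1 hx
  rw [Finset.mem_Icc] at ht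
  exact Finset.mem_erase.2 ⟨(h.ne (by omega) (by omega)).symm, h.mem _⟩

/-- A shortest odd cycle is induced. -/
theorem Cyc.dg_rim_le_of_shortest (h : Cyc G f g) (ho : Odd g)
    (hmin : ∀ n, Odd n → HasCycleLen G n → g ≤ n) (i : ℕ) : dg G (rim f g) (f i) ≤ 2 := by
  refine h.dg_rim_le i fun j h1 h2 ha => ?_
  by_contra! hcon
  have e1 := (h.arc i (j - i) (by omega))
  have e2 := (h.arc' i (j - i) (by omega) (by omega))
  rw [show i + (j - i) = j by omega] at e1 e2
  obtain ⟨b, hb⟩ := ho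
  have h3 := fun h => hmin _ h (e1.hasCycleLen ha.symm (by omega))
  have h4 := fun h => hmin _ h (e2.hasCycleLen ha.symm (by omega))
  rcases Nat.even_or_odd (j - i) with ⟨c, hc⟩ | ⟨c, hc⟩
  · have := h3 ⟨c, by omega⟩
    omega
  · have := h4 ⟨b - c, by omega⟩
    omega

theorem Cyc.dg_rim_le_one_of_shortest (h : Cyc G f g) (ho : Odd g)
    (hmin : ∀ n, Odd n → HasCycleLen G n → g ≤ n) (h4 : ¬HasCycleLen G 4) {v : V}
    (hv : v ∉ rim f g) : dg G (rim f g) v ≤ 1 := by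
  refine Finset.card_le_one.2 fun a ha b hb => ?_
  rw [Finset.mem_filter] at ha hb
  by_contra hab
  obtain ⟨i, -, rfl⟩ := mem_rim.1 ha.1
  obtain ⟨j, h1, h2, rfl⟩ := h.exists_pos i hb.1 (Ne.symm hab)
  have main : ∀ i, G.Adj v (f i) → G.Adj v (f (i + 2)) → f i ≠ f (i + 2) → False :=
    fun i hi hj hne => h4 (hasCycleLen_four hi (h.adj i) (h.adj (i + 1)) hj.symm
      (fun hv' => hv (hv' ▸ h.mem _)) hne)
  have e1 := (h.arc i (j - i) (by omega))
  have e2 := (h.arc' i (j - i) (by omega) (by omega))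
  rw [show i + (j - i) = j by omega] at e1 e2
  obtain ⟨b, hb'⟩ := ho
  have cyc : ∀ {n}, PathIn G (rim f g) (f i) (f j) n → Odd n → g ≤ n + 2 := fun {n} hp ⟨c, hc⟩ =>
    hmin _ ⟨c + 1, by omega⟩ ((hp.cons' hv ha.2 subset_rfl).hasCycleLen hb.2.symm (by omega))
  rcases Nat.even_or_odd (j - i) with ⟨c, hc⟩ | ho'
  · have := cyc e2 ⟨b - c, by omega⟩
    obtain rfl : j = i + 2 := by omega
    exact main i ha.2 hb.2 hab
  · have := cyc e1 ho'
    have hi : f i = f (j + 2) := by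
      rw [← h.per i]
      congr 1
      obtain ⟨c, hc⟩ := ho'
      omega
    rw [hi] at ha hab
    exact main j hb.2 ha.2 (Ne.symm hab)

namespace Theta

/-- Paths from the path of a theta graph to its cycle. -/
theorem to_rim (h : Theta G k f g F κ m s) {v : V} {i : ℕ} (hi : i ≤ m)
    (hv : (f 0 ≠ v ∧ ∀ j ≤ i, κ j ≠ v) ∨ f s ≠ v ∧ ∀ j, i ≤ j → j ≤ m → κ j ≠ v) :
    ∃ b ∈ (rim f g).erase v, ∃ n, PathIn G ((rim f g ∪ trace κ m).erase v) (κ i) b n := by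
  have hd := Finset.disjoint_left.1 (h.disj_rim.mono_right h.trace_sub)
  rcases hv with ⟨h0, hv⟩ | ⟨h0, hv⟩
  · refine ⟨f 0, Finset.mem_erase.2 ⟨h0, h.cyc.mem 0⟩, _,
      (seg_of_fun h.geo.inj h.geo.adj (Nat.zero_le i) hi).symm.snoc
        (fun hs => hd (h.cyc.mem 0) (seg_trace hi hs)) h.geo.fst.symm
        (Finset.insert_subset (by simp [h0, h.cyc.mem 0]) fun x hx => ?_)⟩
    have := seg_trace hi hx
    grind
  · refine ⟨f s, Finset.mem_erase.2 ⟨h0, h.cyc.mem s⟩, _,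
      (seg_of_fun h.geo.inj h.geo.adj hi le_rfl).snoc
        (fun hs => hd (h.cyc.mem s) (seg_trace le_rfl hs)) h.geo.lst.symm
        (Finset.insert_subset (by simp [h0, h.cyc.mem s]) fun x hx => ?_)⟩
    have := seg_trace le_rfl hx
    grind

theorem union_block (h : Theta G k f g F κ m s) {v : V} (hv : v ∈ rim f g ∪ trace κ m) :
    ConnOn G ((rim f g ∪ trace κ m).erase v) := by
  have hd := Finset.disjoint_left.1 (h.disj_rim.mono_right h.trace_sub)
  have h0s := h.cyc.ne (i := 0) (j := s) h.geo.pos (by have := h.geo.lt; omega)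
  have hB : ConnOn G ((rim f g).erase v) := by
    by_cases hr : v ∈ rim f g
    · exact h.cyc.block hr
    · rw [Finset.erase_eq_of_notMem hr]
      exact h.cyc.conn
  refine hB.of_reach (Finset.erase_subset_erase _ Finset.subset_union_left) fun u hu => ?_
  rw [Finset.mem_erase, Finset.mem_union] at hu
  rcases hu.2 with hr | hr
  · exact ⟨u, Finset.mem_erase.2 ⟨hu.1, hr⟩, 0, .nil (by simp [hu.1, hr])⟩
  obtain ⟨i, hi, rfl⟩ := mem_trace.1 hr
  have hK : ∀ j ≤ m, κ j ∉ rim f g := fun j hj hs => hd hs (mem_trace.2 ⟨j, hj, rfl⟩)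
  refine h.to_rim hi ?_
  by_cases hr : v ∈ rim f g
  · have hne : ∀ j ≤ m, κ j ≠ v := fun j hj he => hK j hj (he ▸ hr)
    by_cases h0 : f 0 = v
    · exact .inr ⟨h0 ▸ h0s.symm, fun j _ hj => hne j hj⟩
    · exact .inl ⟨h0, fun j hj => hne j (by omega)⟩
  · obtain ⟨c, hc, rfl⟩ := mem_trace.1 ((Finset.mem_union.1 hv).resolve_left hr)
    have hf : ∀ j, f j ≠ κ c := fun j he => hr (he ▸ h.cyc.mem j)
    rcases Nat.lt_or_ge i c with hic | hic
    · exact .inl ⟨hf 0, fun j hj he => by have := h.geo.inj j (by omega) c hc he; omega⟩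
    · refine .inr ⟨hf s, fun j hj hjm he => hu.1 ?_⟩
      have := h.geo.inj j hjm c hc he
      rw [show i = c by omega]

theorem tight (h : Theta G k f g F κ m s) (hm : 2 ≤ m) :
    Tight G (rim f g ∪ trace κ m) (κ 1) where
  conn := by
    have h0 : κ 0 ∈ trace κ m := mem_trace.2 ⟨0, by omega, rfl⟩
    have := (h.union_block (Finset.mem_union_right _ h0)).union_attached (A := {κ 0}) fun a ha => by
      rw [Finset.mem_singleton.1 ha]
      refine ⟨f 0, Finset.mem_erase.2 ⟨fun he => h.disj 0 (he ▸ h.geo.mem 0 (by omega)), ?_⟩,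
        h.geo.fst.symm⟩
      exact Finset.mem_union_left _ (h.cyc.mem 0)
    rwa [Finset.union_comm, ← Finset.insert_eq, Finset.insert_erase
      (Finset.mem_union_right _ h0)] at this
  block _ := h.union_block
  mem := Finset.mem_union_right _ (mem_trace.2 ⟨1, by omega, rfl⟩)
  deg v hv := by
    rw [Finset.mem_union, not_or] at hv
    have hF := (h.spans v).resolve_right hv.1
    split_ifs with h1
    · have := h.dg_le_two hF
      have := h.dg_trace hF hv.2
      omega
    · exact h.dg_le_one hF hv.2 hm fun _ => h1

theorem two_le_dg (h : Theta G 5 f g F κ m s) {x : ℕ} (hx : x < g) (hx0 : x ≠ 0) (hxs : x ≠ s) :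
    2 ≤ dg G (Finset.univ \ (rim f g ∪ trace κ m)) (f x) := by
  have h1 := h.dg_F x
  have h2 : dg G F (f x) ≤ dg G (Finset.univ \ (rim f g ∪ trace κ m)) (f x) :=
    Finset.card_le_card fun v hv => by
      rw [Finset.mem_filter] at hv ⊢
      have h3 := Finset.disjoint_right.1 h.disj_rim hv.1
      refine ⟨?_, hv.2⟩
      have h4 : v ∉ trace κ m := fun ht => by
        obtain ⟨i, hi, rfl⟩ := mem_trace.1 ht
        have := h.ne_ends hx hx0 hxs
        have := h.geo.nadj i hi x hv.2
        tauto
      simp [h3, h4]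
  omega

theorem exists_nbr_trace (h : Theta G 5 f g F κ m s) {i : ℕ} (hi : i ≤ m) :
    ∃ v ∈ Finset.univ \ (rim f g ∪ trace κ m), G.Adj (κ i) v := by
  have h1 := h.deg (κ i)
  have h2 := h.dg_rim _ (h.geo.mem i hi) (h.block _ (h.geo.mem i hi))
  have h3 : dg G (trace κ m) (κ i) ≤ 2 := by
    refine (Finset.card_le_card (t := {κ (i - 1), κ (i + 1)}) fun v hv => ?_).trans
      Finset.card_le_two
    rw [Finset.mem_filter] at hv
    obtain ⟨j, hj, rfl⟩ := mem_trace.1 hv.1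
    rcases lt_trichotomy i j with hij | rfl | hij
    · simp [h.geo.ind i j hij hj hv.2]
    · exact absurd hv.2 (G.loopless.irrefl _)
    · simp [h.geo.ind j i hij hi hv.2.symm]
  have h4 := dg_le_add_sdiff (G := G) Finset.univ (rim f g ∪ trace κ m) (κ i)
  have h5 := dg_union_le (G := G) (rim f g) (trace κ m) (κ i)
  exact dg_pos.1 (by omega)

theorem ap_of_block (h : Theta G 5 f g F κ m s) (hm : 2 ≤ m)
    (hU : ConnOn G (Finset.univ \ (rim f g ∪ trace κ m)))
    (h2 : ∀ c ∈ Finset.univ \ (rim f g ∪ trace κ m),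
      ConnOn G ((Finset.univ \ (rim f g ∪ trace κ m)).erase c)) {x i : ℕ} (hx : x < g)
    (hx0 : x ≠ 0) (hxs : x ≠ s) (hi : i ≤ m) (hi1 : m = 2 → i = 1) :
    AP (Len G (Finset.univ \ (rim f g ∪ trace κ m)) (nbs G {f x}) (nbs G {κ i})) 3 := by
  have hE : ClosedIn G (Finset.univ \ (rim f g ∪ trace κ m))
    (Finset.univ \ (rim f g ∪ trace κ m)) := ⟨subset_rfl, fun _ _ b hb _ => hb⟩
  have h3 := h.two_le_dg hx hx0 hxs
  have hdg : ∀ v ∈ Finset.univ \ (rim f g ∪ trace κ m), dg G (rim f g ∪ trace κ m) v ≤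
      1 + (if v ∈ nbs G {f x} then 1 else 0) + if v ∈ nbs G {κ i} then 1 else 0 := fun v hv => by
    obtain ⟨h4, -, h5⟩ := h.mem_F hE hv
    by_cases h6 : m = 2 → ¬G.Adj (κ 1) v
    · have := h.dg_le_one h4 h5 hm h6
      omega
    · push Not at h6
      have h7 := h.dg_le_two h4
      have h8 := h.dg_trace h4 h5
      rw [hi1 h6.1, if_pos (mem_nbs_singleton.2 h6.2) (c := _ ∈ nbs G {κ 1})]
      omega
  obtain ⟨y, hy, -, hA⟩ := h.toBase.exists_ear_ap (Y := {κ i}) hE hU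
    (by obtain ⟨v, hv⟩ := h.exists_nbr hx hx0 hxs; exact ⟨v, hv⟩) (h.exists_nbr_trace hi)
    (Finset.mem_singleton_self _) hdg fun c D hD hDx => by
      exfalso
      have h4 := (h2 c hD.mem).2 D hD.closed hD.conn.1
      refine absurd (h3.trans (Finset.card_le_one.2 fun a ha b hb => ?_)) (by decide)
      rw [Finset.mem_filter] at ha hb
      have h6 : ∀ a ∈ Finset.univ \ (rim f g ∪ trace κ m), G.Adj (f x) a → a = c :=
        fun a ha hxa => by
          by_contra hac
          exact hDx a (h4 ▸ Finset.mem_erase.2 ⟨hac, ha⟩) hxa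
      rw [h6 a ha.1 ha.2, h6 b hb.1 hb.2]
  rwa [Finset.mem_singleton.1 hy] at hA

/-- The two further cycles of a theta graph. -/
theorem arcs (h : Theta G k f g F κ m s) :
    HasCycleLen G (s + m + 2) ∧ HasCycleLen G (g - s + m + 2) := by
  have hd := h.disj_rim.mono_right h.trace_sub
  have h1 := (seg_of_fun h.geo.inj h.geo.adj (Nat.zero_le m) le_rfl).mono (seg_trace le_rfl)
  have hs := h.geo.pos
  have := h.geo.mpos
  have a1 := h.cyc.arc 0 s h.geo.lt
  have a2 := h.cyc.arc' 0 s hs h.geo.lt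
  rw [zero_add] at a1 a2
  exact ⟨a1.hasCycleLen' h1.symm hd h.geo.lst h.geo.fst.symm (by omega),
    a2.hasCycleLen' h1.symm hd h.geo.lst h.geo.fst.symm (by omega)⟩

theorem five_of_block (h : Theta G 5 f g F κ m s) (hm : 2 ≤ m)
    (hU : ConnOn G (Finset.univ \ (rim f g ∪ trace κ m)))
    (h2 : ∀ c ∈ Finset.univ \ (rim f g ∪ trace κ m),
      ConnOn G ((Finset.univ \ (rim f g ∪ trace κ m)).erase c)) {x i a b c d : ℕ} (hx : x < g)
    (hx0 : x ≠ 0) (hxs : x ≠ s) (hi : i ≤ m) (hi1 : m = 2 → i = 1) (ha : i + x = a)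
    (hb : i + (g - x) = b) (hc : m - i + (x - s + (s - x)) = c)
    (hd : m - i + (g - (x - s + (s - x))) = d)
    (hr : a % 5 ≠ b % 5 ∧ (a % 5 ≠ c % 5 ∧ b % 5 ≠ c % 5 ∨ a % 5 ≠ d % 5 ∧ b % 5 ≠ d % 5) ∨
      c % 5 ≠ d % 5 ∧ (a % 5 ≠ c % 5 ∧ a % 5 ≠ d % 5 ∨ b % 5 ≠ c % 5 ∧ b % 5 ≠ d % 5)) :
    EvenRes G 5 := by
  have hA := h.ap_of_block hm hU h2 hx hx0 hxs hi hi1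
  have key : ∀ n, Len G (Finset.univ \ (rim f g ∪ trace κ m)) (nbs G {f x}) (nbs G {κ i}) n →
      HasCycleLen G (n + (3 + a)) ∧ HasCycleLen G (n + (3 + b)) ∧ HasCycleLen G (n + (3 + c)) ∧
        HasCycleLen G (n + (3 + d)) := fun n hn => by
    have := h.cycles Finset.disjoint_sdiff hx hx0 hxs hi hn
    simp only [add_assoc, ha, hb, hc, hd] at this
    exact this
  clear ha hb hc hd
  rcases hr with ⟨h1, ⟨h3, h4⟩ | ⟨h3, h4⟩⟩ | ⟨h1, ⟨h3, h4⟩ | ⟨h3, h4⟩⟩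
  · exact evenRes_five hA (a := 3 + a) (b := 3 + b) (c := 3 + c) (by omega) (by omega) (by omega)
      fun n hn => by have := key n hn; tauto
  · exact evenRes_five hA (a := 3 + a) (b := 3 + b) (c := 3 + d) (by omega) (by omega) (by omega)
      fun n hn => by have := key n hn; tauto
  · exact evenRes_five hA (a := 3 + a) (b := 3 + c) (c := 3 + d) (by omega) (by omega) (by omega)
      fun n hn => by have := key n hn; tauto
  · exact evenRes_five hA (a := 3 + b) (b := 3 + c) (c := 3 + d) (by omega) (by omega) (by omega)
      fun n hn => by have := key n hn; tauto

theorem exists_good_position (hg : 5 ≤ g) (ho : g % 2 = 1) (he : s % 2 = 0) (hs : 0 < s)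
    (hsg : s < g) : ∃ x, x < g ∧ x ≠ 0 ∧ x ≠ s ∧ x % 5 ≠ (g - x) % 5 ∧
      (x - s + (s - x)) % 5 ≠ (g - (x - s + (s - x))) % 5 := by
  by_cases h2 : s = 2
  · subst h2
    by_cases h5 : g = 5
    · exact ⟨1, by omega⟩
    by_contra! hcon
    have h3 := hcon 3 (by omega) (by omega) (by omega)
    have h4 := hcon 4 (by omega) (by omega) (by omega)
    have h6 := hcon 5 (by omega) (by omega) (by omega)
    clear hcon
    omega
  · by_contra! hcon
    have h3 := hcon 1 (by omega) (by omega) (by omega)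
    have h4 := hcon 2 (by omega) (by omega) (by omega)
    have h6 := hcon 3 (by omega) (by omega) (by omega)
    clear hcon
    obtain ⟨t, rfl⟩ := Nat.exists_eq_add_of_le (show 4 ≤ s by omega)
    obtain ⟨w, rfl⟩ := Nat.exists_eq_add_of_le hsg.le
    rw [show 1 - (4 + t) + (4 + t - 1) = t + 3 by omega,
      show 4 + t + w - (t + 3) = w + 1 by omega, show 4 + t + w - 1 = t + w + 3 by omega] at h3
    rw [show 2 - (4 + t) + (4 + t - 2) = t + 2 by omega,
      show 4 + t + w - (t + 2) = w + 2 by omega, show 4 + t + w - 2 = t + w + 2 by omega] at h4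
    rw [show 3 - (4 + t) + (4 + t - 3) = t + 1 by omega,
      show 4 + t + w - (t + 1) = w + 3 by omega, show 4 + t + w - 3 = t + w + 1 by omega] at h6
    clear hg ho he hs hsg h2
    omega

theorem five (h : Theta G 5 f g F κ m s) (hg : 5 ≤ g) (h4 : ¬HasCycleLen G 4)
    (hmin : ∀ n, Odd n → HasCycleLen G n → g ≤ n) : EvenRes G 5 := by
  obtain ⟨b, hb⟩ := h.odd
  obtain ⟨e, he⟩ := h.even
  obtain ⟨c1, c2⟩ := h.arcs
  have hs0 := h.geo.pos
  have hsg := h.geo.lt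
  have hm1 := h.geo.mpos
  rcases Nat.lt_or_ge m 2 with hm | hm
  · obtain rfl : m = 1 := by omega
    have h3 := hmin _ ⟨e + 1, by omega⟩ c1
    by_cases hs1 : s + 1 = g
    · refine absurd c2 ?_
      rwa [show g - s + 1 + 2 = 4 by omega]
    obtain rfl : g = s + 3 := by omega
    obtain ⟨E, hE, hc, hxE⟩ := h.exists_part (x := e) (by omega) (by omega) (by omega)
    refine evenRes_five (h.free hE hc hxE) (a := e + 3) (b := e + 4) (c := e + 6) (by omega)
      (by omega) (by omega) fun n ⟨i, hi, hn⟩ => ?_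
    have := h.cycles (closedIn_disjoint hE) (by omega) (by omega) (by omega) hi hn
    rw [show e - s + (s - e) = e by omega, show s + 3 - e = e + 3 by omega] at this
    obtain rfl | rfl : i = 0 ∨ i = 1 := by omega
    all_goals
      obtain ⟨k1, k2, k3, k4⟩ := this
      refine ⟨?_, ?_, ?_⟩
    · convert k1 using 1; omega
    · convert k3 using 1; omega
    · convert k2 using 1; omega
    · convert k3 using 1; omega
    · convert k1 using 1; omega
    · convert k4 using 1; omega
  rcases (h.tight hm).compl h.toBase (by
    obtain ⟨v, hv, -⟩ := h.exists_nbr_trace hm1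
    exact ⟨v, hv⟩) with h1 | ⟨hU, h2⟩
  · exact h1
  by_cases hm2 : m = 2
  · subst hm2
    have h3 := hmin _ ⟨b - e + 2, by omega⟩ c2
    have hgo : g % 5 = 0 ∨ g % 5 = 1 ∨ g % 5 = 2 ∨ g % 5 = 3 ∨ g % 5 = 4 := by omega
    have fin : ∀ x, x < g → x ≠ 0 → x ≠ s → _ → EvenRes G 5 := fun x h3 h4 h5 =>
      h.five_of_block hm hU h2 h3 h4 h5 (i := 1) (by omega) (fun _ => rfl) rfl rfl rfl rfl
    clear h4 h2 hU c1 c2 hmin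
    obtain rfl | rfl : s = 2 ∨ s = 4 := by omega
    · by_cases hg1 : g % 5 = 4
      · exact fin 4 (by omega) (by omega) (by omega) (by omega)
      · exact fin 3 (by omega) (by omega) (by omega) (by omega)
    · by_cases hg1 : g % 5 = 4
      · exact fin 5 (by omega) (by omega) (by omega) (by omega)
      · exact fin 1 (by omega) (by omega) (by omega) (by omega)
  · obtain ⟨x, hx, hx0, hxs, h5, h6⟩ :=
      exists_good_position hg (by omega) (by omega) hs0 hsg
    obtain ⟨i, hi, him⟩ : ∃ i ≤ 2, 2 * i % 5 ≠ m % 5 := by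
      by_cases hm' : m % 5 = 2
      · exact ⟨2, by omega⟩
      · exact ⟨1, by omega⟩
    have hv : x - s + (s - x) ≤ g := by omega
    refine h.five_of_block hm hU h2 hx hx0 hxs (i := i) (by omega) (by omega) rfl rfl rfl rfl
      (.inl ⟨by omega, ?_⟩)
    have h7 : (i + x + (i + (g - x))) % 5 ≠
        (m - i + (x - s + (s - x)) + (m - i + (g - (x - s + (s - x))))) % 5 := by
      rw [show i + x + (i + (g - x)) = 2 * i + g by omega,
        show m - i + (x - s + (s - x)) + (m - i + (g - (x - s + (s - x)))) =
          2 * (m - i) + g by omega]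
      obtain ⟨j, rfl⟩ := Nat.exists_eq_add_of_le (show i ≤ m by omega)
      rw [show i + j - i = j by omega]
      omega
    have h8 : (m - i + (x - s + (s - x))) % 5 ≠ (m - i + (g - (x - s + (s - x)))) % 5 := by
      omega
    generalize i + x = a at *
    generalize i + (g - x) = b at *
    generalize m - i + (x - s + (s - x)) = c at *
    generalize m - i + (g - (x - s + (s - x))) = d at *
    clear hb he hs0 hsg hm1 hm hm2 hx hx0 hxs h5 h6 him hi hv hg
    by_contra! hcon
    by_cases hac : a % 5 = c % 5 <;> by_cases had : a % 5 = d % 5 <;> omega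

end Theta

/-- Graphs of odd girth at least five without four-cycles, for `k = 5`. -/
theorem Base3.five_nonbipartite (h : Base3 G 5)
    (htri : TriFree G) (h4 : ¬HasCycleLen G 4) {n : ℕ}
    (hn : HasCycleLen G n) (hno : Odd n) : EvenRes G 5 := by
  classical
  have hex : ∃ g, Odd g ∧ HasCycleLen G g := ⟨n, hno, hn⟩
  obtain ⟨ho, hl⟩ := Nat.find_spec hex
  have hmin : ∀ n, Odd n → HasCycleLen G n → Nat.find hex ≤ n := fun n h1 h2 =>
    Nat.find_min' hex ⟨h1, h2⟩
  generalize Nat.find hex = g at ho hl hmin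
  obtain ⟨f, hf⟩ := hl.exists_cyc
  have hg := hf.four_le htri
  have hdF : ∀ i, 5 ≤ dg G (Finset.univ \ rim f g) (f i) + 2 := fun i => by
    have := h.deg (f i)
    have := hf.dg_rim_le_of_shortest ho hmin i
    have := dg_le_add_sdiff (G := G) Finset.univ (rim f g) (f i)
    omega
  have hdR := fun v hv => hf.dg_rim_le_one_of_shortest ho hmin h4 (v := v) hv
  have hT : Tight G (rim f g) (f 0) := ⟨hf.conn, fun v hv => hf.block hv, hf.mem 0, fun v hv => by
    have := hdR v hv
    omega⟩
  rcases hT.compl h.toBase (by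
    obtain ⟨v, hv, -⟩ := (dg_pos (G := G) (U := Finset.univ \ rim f g) (v := f 0)).1
      (by have := hdF 0; omega)
    exact ⟨v, hv⟩) with h1 | ⟨hU, h2⟩
  · exact h1
  have hC : CSys G 5 1 f g (Finset.univ \ rim f g) := ⟨h, hf, hU, fun i hi => by
    have := hf.mem i
    grind, fun v => by grind, hdF, fun v hv _ => hdR v (Finset.mem_sdiff.1 hv).2⟩
  obtain ⟨f, κ, m, s, hΘ⟩ := hC.exists_theta h2 ho htri h4
  exact hΘ.five (by obtain ⟨b, hb⟩ := ho; omega) h4 hmin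

end FiveOdd

section Assembly

theorem ConnOn.of_induce {S U : Finset V} (h : (G.induce ((↑S : Set V)ᶜ)).Connected)
    (hU : ∀ v, v ∈ U ↔ v ∉ S) : ConnOn G U := by
  refine ⟨?_, fun D hD hne => ?_⟩
  · obtain ⟨v, hv⟩ := h.nonempty
    exact ⟨v, (hU v).2 (by simpa using hv)⟩
  · obtain ⟨d, hd⟩ := hne
    have key : ∀ a b : ((↑S : Set V)ᶜ : Set V), (G.induce ((↑S : Set V)ᶜ)).Walk a b →
        a.1 ∈ D → b.1 ∈ D := by
      intro a b p
      induction p with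
      | nil => exact id
      | @cons a c b hac _ ih =>
        exact fun ha => ih (hD.2 _ ha _ ((hU _).2 (fun hc => c.2 hc)) (by simpa using hac))
    refine Finset.Subset.antisymm hD.1 fun u hu => ?_
    obtain ⟨p⟩ := h.preconnected ⟨d, by simpa using (hU d).1 (hD.1 hd)⟩
      ⟨u, by simpa using (hU u).1 hu⟩
    exact key _ _ p hd

theorem Base.of_kConnected (hk : 4 ≤ k) (h2 : KConnected G 2) (hδ : ∀ v : V, k ≤ G.degree v) :
    Base G k where
  hk := hk
  deg v := by
    have := hδ v
    rwa [← G.card_neighborFinset_eq_degree, neighborFinset_eq_filter] at this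
  conn := .of_induce (S := ∅) (h2.2 ∅ (by simp)) (by simp)
  conn_erase c := .of_induce (S := {c}) (h2.2 {c} (by simp)) (by simp)

theorem exists_maxBip_of_four (htri : TriFree G)
    (h4 : HasCycleLen G 4) : ∃ S T, MaxBip G S T := by
  obtain ⟨f, hf⟩ := h4.exists_cyc
  have e : f 4 = f 0 := hf.per 0
  have a0 := hf.adj 0
  have a1 := hf.adj 1
  have a2 := hf.adj 2
  have a3 := hf.adj 3
  simp only [zero_add, Nat.reduceAdd, e] at a0 a1 a2 a3
  have n02 : f 0 ≠ f 2 := hf.ne (by decide) (by decide)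
  have n13 : f 1 ≠ f 3 := hf.ne (by decide) (by decide)
  refine exists_maxBip htri (S₀ := {f 0, f 2}) (T₀ := {f 1, f 3}) ?_ (Finset.card_pair n02).ge
    (Finset.card_pair n13).ge
  have := a0.symm; have := a1.symm; have := a2.symm; have := a3.symm
  simp only [Finset.mem_insert, Finset.mem_singleton]
  rintro s (rfl | rfl) t (rfl | rfl) <;> assumption

theorem Base3.even_case (h : Base3 G k) (he : Even k)
    (htri : TriFree G) : EvenRes G k := by
  by_cases hb : ∀ n, HasCycleLen G n → Even n
  · exact h.bipartite he hb
  push Not at hb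
  obtain ⟨n, hn, hno⟩ := hb
  rw [Nat.not_even_iff_odd] at hno
  have := h.hk
  obtain hk | rfl : 6 ≤ k ∨ k = 4 := by obtain ⟨m, rfl⟩ := he; omega
  · exact h.nonbipartite_even he hk htri hn hno
  by_cases h4 : HasCycleLen G 4
  · obtain ⟨S, T, hB⟩ := exists_maxBip_of_four htri h4
    exact hB.four h
  · exact h.four_girth_five htri hn hno h4

theorem MaxBip.adjacent_big {S T : Finset V} (hB : MaxBip G S T) (h : Base3 G k) (ho : Odd k)
    {u v : V} (hu : u ∉ S) (hv : v ∉ S) (hu' : dg G T u = S.card) (hv' : dg G T v = S.card)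
    (huv : G.Adj u v) : EvenRes G k := by
  obtain ⟨h5, h7⟩ := hB.adjacent_big_consec hu hv hu' hv' huv
  have := h.hk
  obtain rfl | rfl | hk : k = 5 ∨ k = 7 ∨ 9 ≤ k := by obtain ⟨m, rfl⟩ := ho; omega
  · exact h5.evenRes (by norm_num)
  · by_cases h3 : 3 ≤ S.card
    · exact (h7 h3).evenRes (by norm_num)
    · have := hB.two
      exact hB.adjacent_big_seven h.toBase (by omega) hu hv hu' hv' huv
  · obtain ⟨p, hp⟩ := h5
    obtain hpo | hpo := p.even_or_odd
    · exact h.nonbipartite_odd ho hk hB.tri (hp 1 (by norm_num)) hpo.add_one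
    · exact h.nonbipartite_odd ho hk hB.tri (hp 0 (by norm_num)) hpo

theorem Base3.odd_case (h : Base3 G k) (ho : Odd k)
    (htri : TriFree G) :
    EvenRes G k ∨
      Nonempty (G ≃g completeBipartiteGraph (Fin k) (Fin (Fintype.card V - k))) := by
  by_cases h4 : HasCycleLen G 4
  · obtain ⟨S, T, hB⟩ := exists_maxBip_of_four htri h4
    by_cases hnb : ∀ u v, u ∉ S → v ∉ S → dg G T u = S.card → dg G T v = S.card → ¬G.Adj u v
    · exact hB.main h ho hnb
    · push Not at hnb
      obtain ⟨u, v, hu, hv, hu', hv', huv⟩ := hnb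
      exact .inl (hB.adjacent_big h ho hu hv hu' hv' huv)
  left
  have := h.hk
  obtain rfl | hk : k = 5 ∨ 7 ≤ k := by obtain ⟨m, rfl⟩ := ho; omega
  · by_cases hb : ∀ n, HasCycleLen G n → Even n
    · exact h.five_bipartite htri h4 hb
    push Not at hb
    obtain ⟨n, hn, hno⟩ := hb
    exact h.five_nonbipartite htri h4 hn (Nat.not_even_iff_odd.1 hno)
  · exact h.girth_five ho hk htri h4

end Assembly

end Main

/-- Every 2-connected graph with minimum degree at least `k ≥ 4`
contains an `(ℓ mod k)`-cycle for every even `ℓ`, unless it is `K_{k+1}` or `K_{k,n-k}`. -/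
theorem stmt1 {V : Type*} [Fintype V] [DecidableEq V] (G : SimpleGraph V)
    [DecidableRel G.Adj] (k : ℕ) (hk : 4 ≤ k)
    (h2 : KConnected G 2) (hδ : ∀ v : V, k ≤ G.degree v) :
    (∀ l : ℤ, Even l → HasCycleLenMod G k l) ∨
      Nonempty (G ≃g (⊤ : SimpleGraph (Fin (k + 1)))) ∨
      Nonempty (G ≃g completeBipartiteGraph (Fin k) (Fin (Fintype.card V - k))) := by
  have hbase := Base.of_kConnected hk h2 hδ
  by_cases hc : ∀ c d, ConnOn G ((Finset.univ.erase c).erase d)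
  · have h : Base3 G k := ⟨hbase, hc⟩
    by_cases htri : TriFree G
    · obtain he | ho := k.even_or_odd
      · exact .inl (h.even_case he htri)
      · exact (h.odd_case ho htri).imp_right .inr
    · simp only [TriFree] at htri
      push Not at htri
      obtain ⟨a, b, c, hab, hbc, hac⟩ := htri
      exact (h.triangle hab hbc hac).imp_right .inl
  · push Not at hc
    obtain ⟨c, d, hn⟩ := hc
    exact .inl (hbase.two_cut hn)
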